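/- There exists a McNaughton homeomorphism S of [0,1]² that fixes the boundary of the unit square pointwise and is ergodic with respect to Lebesgue measure on [0,1]². -/

import Mathlib

/-- The unit cube `[0,1]^n` inside `Fin n → ℝ`. -/
def unitCube (n : ℕ) : Set (Fin n → ℝ) := Set.univ.pi fun _ => Set.Icc (0:ℝ) 1

/-- A McNaughton function in `n` variables: a continuous function
`[0,1]^n → [0,1]` which, at every point of the cube, agrees with one of
finitely many affine polynomials with integer coefficients. -/
def IsMcNaughtonFn {n : ℕ} (f : (Fin n → ℝ) → ℝ) : Prop :=
  ContinuousOn f (unitCube n) ∧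
  Set.MapsTo f (unitCube n) (Set.Icc (0:ℝ) 1) ∧
  ∃ (m : ℕ) (a : Fin m → Fin n → ℤ) (b : Fin m → ℤ),
    ∀ x ∈ unitCube n, ∃ j : Fin m,
      f x = (∑ i : Fin n, (a j i : ℝ) * x i) + (b j : ℝ)

/-- A McNaughton mapping of `[0,1]^n`: each coordinate is a McNaughton
function. -/
def IsMcNaughtonMap {n : ℕ} (S : (Fin n → ℝ) → (Fin n → ℝ)) : Prop :=
  ∀ i : Fin n, IsMcNaughtonFn (fun x => S x i)

/-- A McNaughton homeomorphism of `[0,1]^n`: a McNaughton mapping which is a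
bijection of the cube onto itself whose inverse is also a McNaughton mapping. -/
def IsMcNaughtonHomeo {n : ℕ} (S : (Fin n → ℝ) → (Fin n → ℝ)) : Prop :=
  IsMcNaughtonMap S ∧ ∃ T : (Fin n → ℝ) → (Fin n → ℝ), IsMcNaughtonMap T ∧
    (∀ x ∈ unitCube n, T (S x) = x) ∧ (∀ x ∈ unitCube n, S (T x) = x)

/-- `p ∈ [0,1]^n` has `d` as a denominator: `d > 0` and `d • p ∈ ℤ^n`. -/
def IsDenom {n : ℕ} (p : Fin n → ℝ) (d : ℕ) : Prop :=
  0 < d ∧ ∀ i : Fin n, ∃ z : ℤ, (d : ℝ) * p i = (z : ℝ)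

/-- The denominator of a point: the least positive integer `d` with
`d • p ∈ ℤ^n` (junk value `0` if there is none). -/
noncomputable def den {n : ℕ} (p : Fin n → ℝ) : ℕ := sInf {d | IsDenom p d}

open MeasureTheory

/-- An affine self-map of the plane with integer coefficients. -/
structure IntAffine where
  a : ℤ
  b : ℤ
  c : ℤ
  d : ℤ
  e : ℤ
  f : ℤ

namespace IntAffine

/-- The linear part. -/
def lin (A : IntAffine) : ℝ × ℝ →ₗ[ℝ] ℝ × ℝ where
  toFun p := (A.a * p.1 + A.b * p.2, A.c * p.1 + A.d * p.2)
  map_add' p q := by ext <;> simp <;> ring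
  map_smul' r p := by ext <;> simp <;> ring

/-- The action on points. -/
def act (A : IntAffine) (p : ℝ × ℝ) : ℝ × ℝ :=
  (A.a * p.1 + A.b * p.2 + A.e, A.c * p.1 + A.d * p.2 + A.f)

/-- The determinant of the linear part. -/
def det (A : IntAffine) : ℤ := A.a * A.d - A.b * A.c

/-- Composition. -/
def comp (B A : IntAffine) : IntAffine where
  a := B.a * A.a + B.b * A.c
  b := B.a * A.b + B.b * A.d
  c := B.c * A.a + B.d * A.c
  d := B.c * A.b + B.d * A.d
  e := B.a * A.e + B.b * A.f + B.e
  f := B.c * A.e + B.d * A.f + B.f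

lemma comp_act (B A : IntAffine) (p : ℝ × ℝ) : (B.comp A).act p = B.act (A.act p) := by
  ext <;> simp [act, comp] <;> ring

lemma comp_det (B A : IntAffine) : (B.comp A).det = B.det * A.det := by
  simp [det, comp]; ring

lemma act_eq (A : IntAffine) (p : ℝ × ℝ) : A.act p = A.lin p + ((A.e : ℝ), (A.f : ℝ)) := by
  ext <;> simp [act, lin]

lemma act_sub (A : IntAffine) (p q : ℝ × ℝ) : A.act q - A.act p = A.lin (q - p) := by
  simp [act_eq]

lemma continuous_act (A : IntAffine) : Continuous A.act := by
  unfold act; fun_prop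

lemma lin_det (A : IntAffine) : LinearMap.det A.lin = (A.det : ℝ) := by
  rw [← LinearMap.det_toMatrix (Module.Basis.finTwoProd ℝ), Matrix.det_fin_two]
  simp [LinearMap.toMatrix_apply, lin, det]

lemma volume_image_act (A : IntAffine) (h : |A.det| = 1) (s : Set (ℝ × ℝ)) :
    volume (A.act '' s) = volume s := by
  have : A.act '' s = (fun x => x + ((A.e : ℝ), (A.f : ℝ))) '' (A.lin '' s) := by
    rw [Set.image_image]; exact Set.image_congr fun p _ => A.act_eq p
  rw [this, Set.image_add_right, measure_preimage_add_right,
    Measure.addHaar_image_linearMap, lin_det, ← Int.cast_abs, h]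
  simp

end IntAffine

/-- Continuous maps of the plane given piecewise by finitely many unimodular integer affine maps. -/
def IsPL (f : ℝ × ℝ → ℝ × ℝ) : Prop :=
  Continuous f ∧ ∃ s : Set IntAffine, s.Finite ∧ (∀ A ∈ s, |A.det| = 1) ∧
    ∀ p, ∃ A ∈ s, f p = A.act p

lemma IsPL.comp {f g : ℝ × ℝ → ℝ × ℝ} (hg : IsPL g) (hf : IsPL f) : IsPL (g ∘ f) := by
  obtain ⟨cf, s, hs, ds, ps⟩ := hf
  obtain ⟨cg, t, ht, dt, pt⟩ := hg
  refine ⟨cg.comp cf, Set.image2 IntAffine.comp t s, ht.image2 _ hs, ?_, fun p => ?_⟩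
  · rintro _ ⟨B, hB, A, hA, rfl⟩
    rw [IntAffine.comp_det, abs_mul, ds A hA, dt B hB, one_mul]
  · obtain ⟨A, hA, h1⟩ := ps p
    obtain ⟨B, hB, h2⟩ := pt (f p)
    exact ⟨_, ⟨B, hB, A, hA, rfl⟩, by rw [Function.comp, h2, h1, IntAffine.comp_act]⟩

/-- Every piecewise affine map is Lipschitz. -/
lemma IsPL.exists_lipschitz {f : ℝ × ℝ → ℝ × ℝ} (hf : IsPL f) :
    ∃ L : NNReal, 1 ≤ L ∧ LipschitzWith L f := by
  obtain ⟨cf, s, hs, -, ps⟩ := hf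
  obtain ⟨M, hM⟩ : ∃ M : ℝ, ∀ A ∈ s, ‖A.lin.toContinuousLinearMap‖ ≤ M := by
    obtain ⟨M, hM⟩ := (hs.image fun A => ‖A.lin.toContinuousLinearMap‖).bddAbove
    exact ⟨M, fun A hA => hM ⟨A, hA, rfl⟩⟩
  let L : NNReal := ⟨max M 0 + 1, by positivity⟩
  have hL1 : (1 : ℝ) ≤ L := le_add_of_nonneg_left (le_max_right _ _)
  have hLM : M < L := (le_max_left M 0).trans_lt (lt_add_one _)
  refine ⟨L, by exact_mod_cast hL1, LipschitzWith.of_dist_le_mul fun p q => ?_⟩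
  rw [dist_comm, dist_comm p, dist_eq_norm, dist_eq_norm]
  rcases eq_or_ne q p with rfl | hpq
  · simp
  have hn : 0 < ‖q - p‖ := norm_pos_iff.2 (sub_ne_zero.2 hpq)
  let c : ℝ → ℝ × ℝ := fun t => p + t • (q - p)
  have hc : Continuous c := by fun_prop
  have hclosed : ∀ A ∈ s, IsClosed {t | f (c t) = A.act (c t)} := fun A _ =>
    isClosed_eq (cf.comp hc) (A.continuous_act.comp hc)
  have key := image_norm_le_of_liminf_right_slope_norm_lt_deriv_boundary
    (f := fun t => f (c t) - f p) (a := 0) (b := 1) (f' := fun _ => M * ‖q - p‖)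
    (B := fun t => L * ‖q - p‖ * t) (B' := fun _ => L * ‖q - p‖)
    (by fun_prop) ?_ (by simp [c]) (by fun_prop)
    (fun x _ => by simpa using ((hasDerivAt_id x).const_mul (L * ‖q - p‖)).hasDerivWithinAt)
    (fun x _ _ => by gcongr)
  · have := key (x := 1) (by simp)
    simpa [c] using this
  · intro x hx r hr
    obtain ⟨A, hA, hfr⟩ : ∃ A ∈ s, ∃ᶠ z in nhdsWithin x (Set.Ioi x), f (c z) = A.act (c z) := by
      by_contra! hcon
      have := (Filter.eventually_all_finite hs).2 hcon
      obtain ⟨z, hz⟩ := this.exists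
      obtain ⟨A, hA, h⟩ := ps (c z)
      exact hz A hA h
    have hxA : f (c x) = A.act (c x) :=
      (hclosed A hA).mem_of_frequently_of_tendsto hfr
        (tendsto_nhdsWithin_of_tendsto_nhds Filter.tendsto_id)
    refine (hfr.and_eventually self_mem_nhdsWithin).mono fun z ⟨hz, hzx⟩ => lt_of_le_of_lt ?_ hr
    have hzx' : 0 < z - x := sub_pos.2 hzx
    rw [slope_def_field, div_le_iff₀ hzx']
    have h1 : (f (c z) - f p) - (f (c x) - f p) = A.lin ((z - x) • (q - p)) := by
      rw [sub_sub_sub_cancel_right, hz, hxA, A.act_sub]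
      congr 1
      simp only [c]
      rw [add_sub_add_left_eq_sub, ← sub_smul]
    calc _ ≤ ‖(f (c z) - f p) - (f (c x) - f p)‖ := norm_sub_norm_le _ _
      _ ≤ ‖A.lin.toContinuousLinearMap‖ * ‖(z - x) • (q - p)‖ := by
        rw [h1]; exact A.lin.toContinuousLinearMap.le_opNorm _
      _ ≤ M * ‖(z - x) • (q - p)‖ := by gcongr; exact hM A hA
      _ = _ := by rw [norm_smul, Real.norm_of_nonneg hzx'.le]; ring

/-- A bijective unimodular piecewise affine map preserves the Lebesgue measure. -/
lemma IsPL.measurePreserving {f g : ℝ × ℝ → ℝ × ℝ} (hf : IsPL f)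
    (hgc : Continuous g) (hgf : Function.LeftInverse g f) (hfg : Function.RightInverse g f) :
    MeasurePreserving f volume volume := by
  obtain ⟨cf, s, hs, ds, ps⟩ := hf
  refine ⟨cf.measurable, Measure.ext fun E hE => ?_⟩
  rw [Measure.map_apply cf.measurable hE]
  have := hs.to_subtype
  have := Fintype.ofFinite s
  let K : s → Set (ℝ × ℝ) := fun A => {p | f p = A.1.act p}
  have hK : ∀ A, MeasurableSet (K A) := fun A =>
    (isClosed_eq cf A.1.continuous_act).measurableSet
  obtain ⟨e⟩ : Nonempty (s ≃ Fin (Fintype.card s)) := ⟨Fintype.equivFin s⟩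
  let D : Fin (Fintype.card s) → Set (ℝ × ℝ) := disjointed fun i => K (e.symm i)
  have hDK : ∀ i, D i ⊆ K (e.symm i) := fun i => disjointed_subset _ i
  have hDm : ∀ i, MeasurableSet (D i) := fun i =>
    disjointedRec (f := fun i => K (e.symm i)) (fun _ _ ht => ht.diff (hK _)) (hK _)
  have hDU : ⋃ i, D i = Set.univ := by
    rw [iUnion_disjointed]
    refine Set.eq_univ_of_forall fun p => ?_
    obtain ⟨A, hA, h⟩ := ps p
    exact Set.mem_iUnion.2 ⟨e ⟨A, hA⟩, by simpa [K] using h⟩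
  have hDd : Pairwise (Function.onFun Disjoint D) := disjoint_disjointed _
  have hpre : ∀ t, f '' t = g ⁻¹' t := fun t => by
    rw [Set.image_eq_preimage_of_inverse hgf hfg]
  have hE1 : f ⁻¹' E = ⋃ i, f ⁻¹' E ∩ D i := by rw [← Set.inter_iUnion, hDU, Set.inter_univ]
  have hE2 : E = ⋃ i, f '' (f ⁻¹' E ∩ D i) := by
    rw [← Set.image_iUnion, ← hE1, Set.image_preimage_eq _ hfg.surjective]
  have hm : ∀ i, MeasurableSet (f ⁻¹' E ∩ D i) := fun i => (cf.measurable hE).inter (hDm i)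
  have hd : Pairwise (Function.onFun Disjoint fun i => f ⁻¹' E ∩ D i) := fun i j hij =>
    (hDd hij).mono Set.inter_subset_right Set.inter_subset_right
  conv_lhs => rw [hE1]
  conv_rhs => rw [hE2]
  rw [measure_iUnion hd hm, measure_iUnion]
  · refine tsum_congr fun i => ?_
    rw [← IntAffine.volume_image_act (e.symm i).1 (ds _ (e.symm i).2)]
    exact congrArg _ (Set.image_congr fun p hp => (hDK i hp.2).symm)
  · exact fun i j hij => (Set.disjoint_image_iff hgf.injective).2 (hd hij)
  · intro i
    rw [hpre]
    exact hgc.measurable (hm i)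

/-- The open unit square. -/
def openSquare : Set (ℝ × ℝ) := Set.Ioo 0 1 ×ˢ Set.Ioo 0 1

lemma volume_openSquare : volume openSquare = 1 := by
  rw [openSquare, Measure.volume_eq_prod, Measure.prod_prod]; simp

lemma measurableSet_openSquare : MeasurableSet openSquare :=
  measurableSet_Ioo.prod measurableSet_Ioo

/-- `f` is affine with linear part `A` on the ball of radius `r` about `p`. -/
def AffineOnBall (f : ℝ × ℝ → ℝ × ℝ) (p : ℝ × ℝ) (A : ℝ × ℝ →ₗ[ℝ] ℝ × ℝ) (r : ℝ) : Prop :=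
  ∀ q, ‖q - p‖ < r → f q = f p + A (q - p)

/-- `D` is the derivative of the piecewise affine map `f`, and the set of points of the unit square
at which the radius of affinity is less than `ε` has area `O(ε)`. -/
def HasMargin (f : ℝ × ℝ → ℝ × ℝ) (D : ℝ × ℝ → (ℝ × ℝ →ₗ[ℝ] ℝ × ℝ)) (m : ℝ × ℝ → ℝ) : Prop :=
  Continuous m ∧ (∀ p, AffineOnBall f p (D p) (m p)) ∧
    ∃ C : ℝ, ∀ ε > 0, volume {p ∈ openSquare | m p < ε} ≤ ENNReal.ofReal (C * ε)

lemma AffineOnBall.comp {f g : ℝ × ℝ → ℝ × ℝ} {p A B r s} {K : NNReal}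
    (hg : AffineOnBall g (f p) B s) (hf : AffineOnBall f p A r) (hK : LipschitzWith K f)
    (hK1 : 1 ≤ K) : AffineOnBall (g ∘ f) p (B ∘ₗ A) (min r (s / K)) := by
  intro q hq
  have hK0 : (0 : ℝ) < K := zero_lt_one.trans_le (by exact_mod_cast hK1)
  have h1 := hf q (hq.trans_le (min_le_left _ _))
  have h2 : ‖f q - f p‖ < s := by
    have := hK.dist_le_mul q p
    rw [dist_eq_norm, dist_eq_norm] at this
    have h3 := hq.trans_le (min_le_right _ _)
    rw [lt_div_iff₀' hK0] at h3
    exact this.trans_lt h3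
  simp only [Function.comp, LinearMap.comp_apply]
  rw [hg _ h2]
  congr 2
  rw [h1]; simp

lemma volume_sep_min_lt {m m' : ℝ × ℝ → ℝ} {C C' : ℝ}
    (h : ∀ ε > 0, volume {p ∈ openSquare | m p < ε} ≤ ENNReal.ofReal (C * ε))
    (h' : ∀ ε > 0, volume {p ∈ openSquare | m' p < ε} ≤ ENNReal.ofReal (C' * ε)) :
    ∀ ε > 0, volume {p ∈ openSquare | min (m p) (m' p) < ε} ≤
      ENNReal.ofReal ((max C 0 + max C' 0) * ε) := by
  intro ε hε
  have : {p ∈ openSquare | min (m p) (m' p) < ε} ⊆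
      {p ∈ openSquare | m p < ε} ∪ {p ∈ openSquare | m' p < ε} := by
    rintro p ⟨hp, h⟩
    rcases min_lt_iff.1 h with h | h
    · exact Or.inl ⟨hp, h⟩
    · exact Or.inr ⟨hp, h⟩
  refine (measure_mono this).trans ((measure_union_le _ _).trans ?_)
  rw [add_mul, ENNReal.ofReal_add (by positivity) (by positivity)]
  refine add_le_add ((h ε hε).trans (ENNReal.ofReal_le_ofReal ?_))
    ((h' ε hε).trans (ENNReal.ofReal_le_ofReal ?_))
  · gcongr; exact le_max_left _ _
  · gcongr; exact le_max_left _ _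

lemma HasMargin.comp {f g : ℝ × ℝ → ℝ × ℝ} {D D' m m'} (hg : HasMargin g D' m')
    (hf : HasMargin f D m) {K : NNReal} (hK : LipschitzWith K f) (hK1 : 1 ≤ K)
    (hfm : MeasurePreserving f volume volume) (hX : f ⁻¹' openSquare = openSquare) :
    HasMargin (g ∘ f) (fun p => D' (f p) ∘ₗ D p) (fun p => min (m p) (m' (f p) / K)) := by
  have hK0 : (0 : ℝ) < K := zero_lt_one.trans_le (by exact_mod_cast hK1)
  obtain ⟨hmc, hf, C, hC⟩ := hf
  obtain ⟨hmc', hg, C', hC'⟩ := hg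
  refine ⟨hmc.min ((hmc'.comp hK.continuous).div_const _), fun p => (hg _).comp (hf p) hK hK1, _,
    volume_sep_min_lt hC (m' := fun p => m' (f p) / K) (C' := C' * K) fun ε hε => ?_⟩
  have : {p ∈ openSquare | m' (f p) / K < ε} = f ⁻¹' {p ∈ openSquare | m' p < ε * K} := by
    ext p
    have : p ∈ openSquare ↔ f p ∈ openSquare := by rw [← Set.mem_preimage, hX]
    simp [this, div_lt_iff₀ hK0]
  have hmeas : MeasurableSet {p ∈ openSquare | m' p < ε * K} :=
    measurableSet_openSquare.inter (hmc'.measurable measurableSet_Iio)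
  rw [this, hfm.measure_preimage hmeas.nullMeasurableSet]
  refine (hC' _ (by positivity)).trans (le_of_eq ?_)
  congr 1; ring

/-- The value at `p` of the affine form with coefficients `l`. -/
def lineEval (l : ℤ × ℤ × ℤ) (p : ℝ × ℝ) : ℝ := l.1 * p.1 + l.2.1 * p.2 + l.2.2

lemma continuous_lineEval (l : ℤ × ℤ × ℤ) : Continuous (lineEval l) := by
  change Continuous fun p : ℝ × ℝ => (l.1 * p.1 + l.2.1 * p.2 + l.2.2 : ℝ)
  fun_prop

lemma volume_strip_le {l : ℤ × ℤ × ℤ} (hl : l.1 ≠ 0 ∨ l.2.1 ≠ 0) {ε : ℝ} (hε : 0 < ε) :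
    volume {p ∈ openSquare | |lineEval l p| < ε} ≤ ENNReal.ofReal (2 * ε) := by
  have hm : MeasurableSet {p ∈ openSquare | |lineEval l p| < ε} := by
    exact measurableSet_openSquare.inter
      (measurableSet_lt (continuous_lineEval l).abs.measurable measurable_const)
  have key : ∀ (a : ℤ) (c : ℝ), a ≠ 0 →
      volume {x : ℝ | |a * x + c| < ε} ≤ ENNReal.ofReal (2 * ε) := by
    intro a c ha
    have ha' : (1 : ℝ) ≤ |(a : ℝ)| := by exact_mod_cast Int.one_le_abs ha
    have ha0 : (a : ℝ) ≠ 0 := by exact_mod_cast ha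
    have : {x : ℝ | |a * x + c| < ε} ⊆ Metric.ball (-c / a) ε := by
      intro x hx
      rw [Metric.mem_ball, Real.dist_eq]
      have h1 : a * x + c = a * (x - -c / a) := by field_simp; ring
      rw [Set.mem_ofPred_eq, h1, abs_mul] at hx
      nlinarith [abs_nonneg (x - -c / a)]
    refine (measure_mono this).trans ?_
    rw [Real.volume_ball]
  have fin : ∀ {g : ℝ → ENNReal}, (∀ y, g y ≤ (Set.Ioo (0:ℝ) 1).indicator
      (fun _ => ENNReal.ofReal (2 * ε)) y) → ∫⁻ y, g y ≤ ENNReal.ofReal (2 * ε) := by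
    intro g hg
    refine (lintegral_mono hg).trans ?_
    rw [lintegral_indicator measurableSet_Ioo]; simp
  rw [Measure.volume_eq_prod]
  rcases hl with hl | hl
  · rw [Measure.prod_apply_symm hm]
    refine fin fun y => ?_
    by_cases hy : y ∈ Set.Ioo (0:ℝ) 1
    · rw [Set.indicator_of_mem hy]
      refine (measure_mono ?_).trans (key l.1 (l.2.1 * y + l.2.2) hl)
      rintro x ⟨-, hx⟩
      simpa [lineEval, add_assoc] using hx
    · rw [Set.indicator_of_notMem hy, nonpos_iff_eq_zero]
      refine measure_mono_null (t := ∅) ?_ measure_empty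
      rintro x ⟨hx, -⟩
      exact hy hx.2
  · rw [Measure.prod_apply hm]
    refine fin fun y => ?_
    by_cases hy : y ∈ Set.Ioo (0:ℝ) 1
    · rw [Set.indicator_of_mem hy]
      refine (measure_mono ?_).trans (key l.2.1 (l.1 * y + l.2.2) hl)
      rintro x ⟨-, hx⟩
      have : lineEval l (y, x) = l.2.1 * x + (l.1 * y + l.2.2) := by simp [lineEval]; ring
      rw [this] at hx
      exact hx
    · rw [Set.indicator_of_notMem hy, nonpos_iff_eq_zero]
      refine measure_mono_null (t := ∅) ?_ measure_empty
      rintro x ⟨hx, -⟩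
      exact hy hx.1

/-- A lower bound for the distance to finitely many lines. -/
noncomputable def lineMargin : List (ℤ × ℤ × ℤ) → ℝ × ℝ → ℝ
  | [], _ => 1
  | l :: L, p => min (|lineEval l p| / 16) (lineMargin L p)

lemma continuous_lineMargin (L : List (ℤ × ℤ × ℤ)) : Continuous (lineMargin L) := by
  induction L with
  | nil => exact continuous_const
  | cons l L ih =>
    exact ((continuous_lineEval l).abs.div_const _).min ih

lemma lineMargin_le {L : List (ℤ × ℤ × ℤ)} {l} (h : l ∈ L) (p) :
    lineMargin L p ≤ |lineEval l p| / 16 := by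
  induction L with
  | nil => simp at h
  | cons l' L ih =>
    rcases List.mem_cons.1 h with rfl | h
    · exact min_le_left _ _
    · exact (min_le_right _ _).trans (ih h)

lemma lineMargin_pos {L : List (ℤ × ℤ × ℤ)} {p} (h : ∀ l ∈ L, lineEval l p ≠ 0) :
    0 < lineMargin L p := by
  induction L with
  | nil => exact one_pos
  | cons l L ih =>
    have := abs_pos.2 (h l (by simp))
    exact lt_min (by positivity) (ih fun l hl => h l (by simp [hl]))

lemma volume_lineMargin_lt {L : List (ℤ × ℤ × ℤ)} (h : ∀ l ∈ L, l.1 ≠ 0 ∨ l.2.1 ≠ 0) :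
    ∃ C : ℝ, ∀ ε > 0, volume {p ∈ openSquare | lineMargin L p < ε} ≤ ENNReal.ofReal (C * ε) := by
  induction L with
  | nil =>
    refine ⟨1, fun ε hε => ?_⟩
    by_cases h1 : 1 < ε
    · refine (measure_mono (Set.sep_subset _ _)).trans ?_
      rw [volume_openSquare]
      simpa using h1.le
    · simp [lineMargin, h1]
  | cons l L ih =>
    obtain ⟨C, hC⟩ := ih fun l hl => h l (by simp [hl])
    refine ⟨_, volume_sep_min_lt (m := fun p => |lineEval l p| / 16) (C := 32)
      (fun ε hε => ?_) hC⟩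
    have := volume_strip_le (h l (by simp)) (ε := 16 * ε) (by positivity)
    simp only [div_lt_iff₀ (show (0 : ℝ) < 16 by norm_num), mul_comm ε]
    refine this.trans (le_of_eq ?_)
    congr 1; ring

/-- Near `p`, the sign of an affine form with small coefficients is constant. -/
lemma lineEval_sign {L : List (ℤ × ℤ × ℤ)} {l} (h : l ∈ L) (hc : |l.1| + |l.2.1| ≤ 16)
    {p q : ℝ × ℝ} (hq : ‖q - p‖ < lineMargin L p) :
    (0 < lineEval l q ↔ 0 < lineEval l p) ∧ lineEval l q ≠ 0 ∧ lineEval l p ≠ 0 := by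
  have h1 := hq.trans_le (lineMargin_le h p)
  have h2 : |lineEval l q - lineEval l p| < |lineEval l p| := by
    have h3 : lineEval l q - lineEval l p = l.1 * (q - p).1 + l.2.1 * (q - p).2 := by
      simp [lineEval]; ring
    have h4 : |(l.1 : ℝ)| + |(l.2.1 : ℝ)| ≤ 16 := by exact_mod_cast hc
    have h5 : |(q - p).1| ≤ ‖q - p‖ := le_max_left _ _
    have h6 : |(q - p).2| ≤ ‖q - p‖ := le_max_right _ _
    have h7 : |lineEval l q - lineEval l p| ≤ |(l.1 : ℝ)| * |(q - p).1| + |(l.2.1 : ℝ)| * |(q - p).2| := by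
      rw [h3, ← abs_mul, ← abs_mul]; exact abs_add_le _ _
    have h8 : |(l.1 : ℝ)| * |(q - p).1| + |(l.2.1 : ℝ)| * |(q - p).2| ≤ 16 * ‖q - p‖ := by
      have := mul_le_mul_of_nonneg_left h5 (abs_nonneg (l.1 : ℝ))
      have := mul_le_mul_of_nonneg_left h6 (abs_nonneg (l.2.1 : ℝ))
      have := mul_le_mul_of_nonneg_right h4 (norm_nonneg (q - p))
      linarith
    linarith
  have h9 := abs_lt.1 h2
  rcases lt_trichotomy (lineEval l p) 0 with h0 | h0 | h0
  · rw [abs_of_neg h0] at h9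
    refine ⟨⟨fun _ => by linarith, fun _ => by linarith⟩, by linarith, h0.ne⟩
  · rw [h0] at h2
    simp at h2
    exact absurd h2 (not_lt.2 (abs_nonneg _))
  · rw [abs_of_pos h0] at h9
    refine ⟨⟨fun _ => by linarith, fun _ => by linarith⟩, by linarith, h0.ne'⟩

/-- The closed convex cell cut out by the nonnegativity of finitely many affine forms. -/
def cell (L : List (ℤ × ℤ × ℤ)) : Set (ℝ × ℝ) := {p | ∀ l ∈ L, 0 ≤ lineEval l p}

lemma isClosed_cell (L : List (ℤ × ℤ × ℤ)) : IsClosed (cell L) := by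
  have : cell L = ⋂ l ∈ L, {p | 0 ≤ lineEval l p} := by ext; simp [cell]
  rw [this]
  exact isClosed_biInter fun l _ => isClosed_le continuous_const (continuous_lineEval l)

lemma mem_cell_nil (p) : p ∈ cell [] ↔ True := by simp [cell]

lemma mem_cell_cons (l L p) : p ∈ cell (l :: L) ↔ 0 ≤ lineEval l p ∧ p ∈ cell L := by simp [cell]

/-- A table of cells with an affine map on each of them. -/
abbrev PLTable := List (List (ℤ × ℤ × ℤ) × IntAffine)

namespace PLTable

open Classical in
/-- The affine map attached to the first cell containing the point. -/
noncomputable def sel : PLTable → ℝ × ℝ → IntAffine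
  | [], _ => ⟨1, 0, 0, 1, 0, 0⟩
  | (L, A) :: tb, p => if p ∈ cell L then A else sel tb p

/-- The piecewise affine map described by a table. -/
noncomputable def map (tb : PLTable) (p : ℝ × ℝ) : ℝ × ℝ := (sel tb p).act p

/-- All the affine forms in a table. -/
def lines (tb : PLTable) : List (ℤ × ℤ × ℤ) := tb.flatMap Prod.fst

/-- The affine maps agree on the intersection of two cells. -/
def Compat (a b : List (ℤ × ℤ × ℤ) × IntAffine) : Prop :=
  ∀ p, p ∈ cell a.1 → p ∈ cell b.1 → a.2.act p = b.2.act p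

lemma map_eq {tb : PLTable} (h : tb.Pairwise Compat) {L A} (hL : (L, A) ∈ tb) {p}
    (hp : p ∈ cell L) : map tb p = A.act p := by
  induction tb with
  | nil => simp at hL
  | cons a tb ih =>
    obtain ⟨L', A'⟩ := a
    rw [List.pairwise_cons] at h
    by_cases hp' : p ∈ cell L'
    · have h1 : map ((L', A') :: tb) p = A'.act p := by simp [map, sel, hp']
      rw [h1]
      rcases List.mem_cons.1 hL with h2 | h2
      · rw [(Prod.mk.inj h2).2]
      · exact h.1 _ h2 p hp' hp
    · have h1 : map ((L', A') :: tb) p = map tb p := by simp [map, sel, hp']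
      rw [h1]
      rcases List.mem_cons.1 hL with h2 | h2
      · rw [(Prod.mk.inj h2).1] at hp; exact absurd hp hp'
      · exact ih h.2 h2

lemma exists_map_eq {tb : PLTable} (h : tb.Pairwise Compat)
    (hc : ∀ p, ∃ a ∈ tb, p ∈ cell a.1) (p) : ∃ a ∈ tb, p ∈ cell a.1 ∧ map tb p = a.2.act p := by
  obtain ⟨⟨L, A⟩, ha, hp⟩ := hc p
  exact ⟨_, ha, hp, map_eq h ha hp⟩

lemma isPL {tb : PLTable} (h : tb.Pairwise Compat) (hc : ∀ p, ∃ a ∈ tb, p ∈ cell a.1)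
    (hd : ∀ a ∈ tb, |a.2.det| = 1) : IsPL (map tb) := by
  refine ⟨?_, {A | ∃ a ∈ tb, a.2 = A}, ?_, ?_, fun p => ?_⟩
  · have : Finite {a // a ∈ tb} := (List.finite_toSet tb).to_subtype
    refine (locallyFinite_of_finite fun a : {a // a ∈ tb} => cell a.1.1).continuous ?_
      (fun a => isClosed_cell _) fun a => ?_
    · refine Set.eq_univ_of_forall fun p => ?_
      obtain ⟨a, ha, hp⟩ := hc p
      exact Set.mem_iUnion.2 ⟨⟨a, ha⟩, hp⟩
    · exact a.1.2.continuous_act.continuousOn.congr fun p hp => map_eq h a.2 hp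
  · exact ((List.finite_toSet tb).image Prod.snd).subset fun A ⟨a, ha, hA⟩ => ⟨a, ha, hA⟩
  · rintro _ ⟨a, ha, rfl⟩; exact hd a ha
  · obtain ⟨a, ha, -, h⟩ := exists_map_eq h hc p
    exact ⟨_, ⟨a, ha, rfl⟩, h⟩

lemma sel_congr {tb : PLTable} {p q : ℝ × ℝ}
    (h : ∀ l ∈ lines tb, (0 ≤ lineEval l q ↔ 0 ≤ lineEval l p)) : sel tb q = sel tb p := by
  induction tb with
  | nil => rfl
  | cons a tb ih =>
    obtain ⟨L, A⟩ := a
    have h1 : q ∈ cell L ↔ p ∈ cell L :=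
      forall₂_congr fun l hl => h l (by simp [lines, hl])
    have h2 := ih fun l hl => h l (by
      rw [lines, List.flatMap_cons, List.mem_append]; exact Or.inr hl)
    by_cases hq : q ∈ cell L
    · simp [sel, hq, h1.1 hq]
    · simp [sel, hq, mt h1.2 hq, h2]

lemma affineOnBall {tb : PLTable} (h : ∀ l ∈ lines tb, |l.1| + |l.2.1| ≤ 16) (p) :
    AffineOnBall (map tb) p (sel tb p).lin (lineMargin (lines tb) p) := by
  intro q hq
  have : sel tb q = sel tb p := sel_congr fun l hl => by
    obtain ⟨h1, h2, h3⟩ := lineEval_sign hl (h l hl) hq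
    rw [le_iff_lt_or_eq, le_iff_lt_or_eq, h1]
    simp [h2.symm, h3.symm]
  rw [map, map, this, ← IntAffine.act_sub]
  abel

end PLTable

section Recurrence

variable {α : Type*} [MeasurableSpace α] {μ : Measure α} {S T : α → α} {B : Set α}

lemma ae_forall_iterate (hS : MeasurePreserving S μ μ) {P : α → Prop} (h : ∀ᵐ p ∂μ, P p) :
    ∀ᵐ p ∂μ, ∀ n, P (S^[n] p) :=
  ae_all_iff.2 fun n => (hS.iterate n).quasiMeasurePreserving.ae h

lemma ae_forall_exists_visit (hS : MeasurePreserving S μ μ) (h : ∀ᵐ p ∂μ, ∃ n, S^[n] p ∈ B) :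
    ∀ᵐ p ∂μ, ∀ N, ∃ n, N ≤ n ∧ S^[n] p ∈ B := by
  filter_upwards [ae_forall_iterate hS h] with p hp N
  obtain ⟨n, hn⟩ := hp N
  exact ⟨n + N, by omega, by rwa [Function.iterate_add_apply]⟩

lemma ae_exists_visit_backward [IsFiniteMeasure μ] (hS : MeasurePreserving S μ μ)
    (hT : MeasurePreserving T μ μ) (hTS : Function.LeftInverse T S)
    (hB : MeasurableSet B) (h : ∀ᵐ p ∂μ, ∃ n, S^[n] p ∈ B) :
    ∀ᵐ p ∂μ, ∃ n, T^[n] p ∈ B := by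
  set V : Set α := {p | ∀ n, T^[n] p ∉ B}
  have hV : MeasurableSet V := by
    have : V = ⋂ n, (T^[n]) ⁻¹' Bᶜ := by ext; simp [V]
    rw [this]
    exact MeasurableSet.iInter fun n => (hT.measurable.iterate n) hB.compl
  have h1 : S ⁻¹' V ⊆ V := by
    intro p hp n
    have := hp (n + 1)
    rwa [Function.iterate_succ_apply, hTS p] at this
  have h2 : S ⁻¹' V =ᵐ[μ] V :=
    ae_eq_of_subset_of_measure_ge h1 (hS.measure_preimage hV.nullMeasurableSet).ge
      (hS.measurable hV).nullMeasurableSet (measure_ne_top _ _)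
  have h3 : ∀ᵐ p ∂μ, p ∈ V → S p ∈ V := by
    filter_upwards [h2] with p hp hpV
    have : (S ⁻¹' V) p := by rw [hp]; exact hpV
    exact this
  have h4 : ∀ᵐ p ∂μ, p ∈ V → ∀ n, S^[n] p ∈ V := by
    filter_upwards [ae_forall_iterate hS h3] with p hp hpV n
    induction n with
    | zero => exact hpV
    | succ n ih => rw [Function.iterate_succ_apply']; exact hp n ih
  filter_upwards [h4, h] with p h4 ⟨n, hn⟩
  by_contra hcon
  push Not at hcon
  exact h4 hcon n 0 hn

/-- Along almost every backward orbit the visits to `B` have ratio of consecutive times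
close to one. -/
lemma ae_visit_gap [IsFiniteMeasure μ] (hS : MeasurePreserving S μ μ)
    (hT : MeasurePreserving T μ μ) (hST : Function.RightInverse T S)
    (hTS : Function.LeftInverse T S)
    (hB : MeasurableSet B) (h : ∀ᵐ p ∂μ, ∃ n, S^[n] p ∈ B) :
    ∀ᵐ p ∂μ, ∃ N, ∀ n ≥ N, ∃ j, j ≤ n ∧ 7 * (n + 1) ≤ 8 * j ∧ T^[j] p ∈ B := by
  set H : ℕ → Set α := fun m => {y | S^[m] y ∈ B ∧ ∀ i < m, S^[i] y ∉ B}
  have hH : ∀ m, MeasurableSet (H m) := fun m => by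
    have : H m = (S^[m]) ⁻¹' B ∩ ⋂ i, ⋂ (_ : i < m), (S^[i]) ⁻¹' Bᶜ := by ext; simp [H]
    rw [this]
    exact ((hS.measurable.iterate m) hB).inter
      (MeasurableSet.iInter fun i => MeasurableSet.iInter fun _ =>
        (hS.measurable.iterate i) hB.compl)
  have hd : Pairwise (Function.onFun Disjoint H) := by
    intro m n hmn
    refine Set.disjoint_left.2 fun y hm hn => ?_
    rcases lt_or_gt_of_ne hmn with h' | h'
    · exact hn.2 m h' hm.1
    · exact hm.2 n h' hn.1
  have hsum : ∑' m, μ (H m) ≠ ⊤ := by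
    rw [← measure_iUnion hd hH]; exact measure_ne_top _ _
  have hsum8 : ∑' j : ℕ, μ (H (j / 8)) ≠ ⊤ := by
    have e : ∑' j : ℕ, μ (H (j / 8)) = ∑' x : ℕ × Fin 8, μ (H x.1) := by
      rw [← (Nat.divModEquiv 8).tsum_eq]
      rfl
    rw [e, ENNReal.tsum_prod (f := fun m (_ : Fin 8) => μ (H m))]
    simp only [tsum_fintype, Finset.sum_const, Finset.card_univ, Fintype.card_fin, nsmul_eq_mul]
    rw [ENNReal.tsum_mul_left]
    exact ENNReal.mul_ne_top (by simp) hsum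
  have hBC : ∀ᵐ p ∂μ, ∀ᶠ j : ℕ in Filter.atTop, T^[j + j / 8] p ∉ H (j / 8) := by
    refine ae_eventually_notMem (s := fun j => (T^[j + j / 8]) ⁻¹' H (j / 8)) ?_
    convert hsum8 using 3 with j
    exact (hT.iterate _).measure_preimage (hH _).nullMeasurableSet
  have hvis := ae_forall_exists_visit hT (ae_exists_visit_backward hS hT hTS hB h)
  filter_upwards [hBC, hvis] with p hp hv
  obtain ⟨N, hN⟩ := Filter.eventually_atTop.1 hp
  obtain ⟨j₀, hj₀, hj₀B⟩ := hv (max N 64)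
  refine ⟨j₀, fun n hn => ?_⟩
  classical
  set P : ℕ → Prop := fun j => T^[j] p ∈ B
  set j := Nat.findGreatest P n
  have hPj : P j := Nat.findGreatest_spec hn hj₀B
  have hj₀j : j₀ ≤ j := Nat.le_findGreatest hn hj₀B
  have hjn : j ≤ n := Nat.findGreatest_le n
  refine ⟨j, hjn, ?_, hPj⟩
  by_contra hcon
  refine hN j (by omega) ⟨?_, fun i hi => ?_⟩
  · rw [add_comm, Function.iterate_add_apply]
    rw [(hST.iterate (j/8))]
    exact hPj
  · have : j + j / 8 = i + (j + j / 8 - i) := by omega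
    rw [this, Function.iterate_add_apply, hST.iterate i]
    exact Nat.findGreatest_is_greatest (P := P) (n := n) (k := j + j / 8 - i) (by omega) (by omega)

end Recurrence

/-- Points of a conull set whose orbits approach each other at rate `1/n` are not separated by a
given invariant set. -/
lemma exists_hopf_set {μ : Measure (ℝ × ℝ)} [IsFiniteMeasure μ] {T : ℝ × ℝ → ℝ × ℝ}
    (hT : MeasurePreserving T μ μ) {E : Set (ℝ × ℝ)} (hE : MeasurableSet E) (hinv : T ⁻¹' E = E) :
    ∃ H : Set (ℝ × ℝ), (∀ᵐ p ∂μ, p ∈ H) ∧ ∀ z ∈ H, ∀ z' ∈ H,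
      (∃ C : ℝ, ∀ n : ℕ, dist (T^[n] z) (T^[n] z') ≤ C / (n + 1)) → (z ∈ E ↔ z' ∈ E) := by
  set u : ℝ × ℝ → ℝ := E.indicator 1
  have hu : MemLp u 1 μ := memLp_indicator_const 1 hE 1 (Or.inr (measure_ne_top _ _))
  have hiter : ∀ n z, u (T^[n] z) = u z := fun n z => by
    have : T^[n] z ∈ E ↔ z ∈ E := by
      induction n with
      | zero => rfl
      | succ n ih =>
        rw [Function.iterate_succ_apply', ← ih]
        exact Set.ext_iff.1 hinv _
    by_cases h : z ∈ E
    · simp [u, h, this.2 h]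
    · simp [u, h, mt this.1 h]
  have hg : ∀ k : ℕ, ∃ g : ℝ × ℝ → ℝ, HasCompactSupport g ∧
      eLpNorm (u - g) 1 μ ≤ ENNReal.ofReal (4⁻¹ ^ k) ∧ Continuous g ∧ MemLp g 1 μ := fun k =>
    hu.exists_hasCompactSupport_eLpNorm_sub_le ENNReal.one_ne_top
      (by rw [Ne, ENNReal.ofReal_eq_zero, not_le]; positivity)
  choose g hgc hgn hgcont hgm using hg
  have hn : ∀ k : ℕ, ∃ n : ℕ, ∀ x y, dist x y ≤ k / ((n : ℝ) + 1) → |g k x - g k y| < 1 / 4 := by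
    intro k
    obtain ⟨δ, hδ, h⟩ := Metric.uniformContinuous_iff.1
      ((hgc k).uniformContinuous_of_continuous (hgcont k)) (1 / 4) (by norm_num)
    obtain ⟨n, hn⟩ := exists_nat_gt (k / δ)
    refine ⟨n, fun x y hxy => h (hxy.trans_lt ?_)⟩
    rw [div_lt_iff₀ hδ] at hn
    rw [div_lt_iff₀ (by positivity)]
    nlinarith
  choose n hn using hn
  set B : ℕ → Set (ℝ × ℝ) := fun k => {x | 1 / 4 ≤ |u (T^[n k] x) - g k (T^[n k] x)|}
  have hB : ∀ k, μ (B k) ≤ 4 * ENNReal.ofReal (4⁻¹ ^ k) := by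
    intro k
    set B' : Set (ℝ × ℝ) := {x | (1 / 4 : ENNReal) ≤ ‖(u - g k) x‖ₑ}
    have hB' : B k = T^[n k] ⁻¹' B' := by
      ext x
      simp only [B, B', Set.mem_ofPred_eq, Set.mem_preimage, Pi.sub_apply, Real.enorm_eq_ofReal_abs]
      rw [ENNReal.le_ofReal_iff_toReal_le (by simp) (abs_nonneg _)]
      simp
    have hm : AEStronglyMeasurable (u - g k) μ := hu.1.sub (hgm k).1
    have hms : MeasurableSet B' := by
      have : Measurable (u - g k) :=
        (measurable_one.indicator hE).sub (hgcont k).measurable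
      exact measurableSet_le measurable_const this.enorm
    rw [hB', (hT.iterate (n k)).measure_preimage hms.nullMeasurableSet]
    have := mul_meas_ge_le_lintegral₀ (μ := μ) (hm.enorm) (1 / 4)
    rw [← eLpNorm_one_eq_lintegral_enorm] at this
    calc μ B' = 4 * (1 / 4 * μ B') := by
          rw [← mul_assoc, one_div, ENNReal.mul_inv_cancel (by simp) (by simp), one_mul]
      _ ≤ _ := by gcongr; exact this.trans (hgn k)
  have hsum : ∑' k, μ (B k) ≠ ⊤ := by
    refine ne_top_of_le_ne_top ?_ (ENNReal.tsum_le_tsum hB)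
    rw [ENNReal.tsum_mul_left, ← ENNReal.ofReal_tsum_of_nonneg (fun k => by positivity)
      (summable_geometric_of_lt_one (by norm_num) (by norm_num))]
    exact ENNReal.mul_ne_top (by simp) ENNReal.ofReal_ne_top
  refine ⟨{x | ∀ᶠ k in Filter.atTop, x ∉ B k}, ae_eventually_notMem hsum, ?_⟩
  rintro z hz z' hz' ⟨C, hC⟩
  obtain ⟨k, ⟨h1, h2⟩, h3⟩ := ((Filter.Eventually.and hz hz').and
    (Filter.eventually_ge_atTop ⌈C⌉₊)).exists
  have h4 := hn k _ _ ((hC (n k)).trans (by gcongr; exact Nat.ceil_le.1 h3))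
  simp only [B, Set.mem_ofPred_eq, not_le, hiter] at h1 h2
  have h5 : |u z - u z'| < 3 / 4 := by
    rw [abs_lt] at *
    constructor <;> linarith
  by_cases ha : z ∈ E <;> by_cases hb : z' ∈ E <;>
    simp [u, ha, hb] at h5 ⊢ <;> norm_num at h5

/-- A Lipschitz correspondence maps Hausdorff null sets to Hausdorff null sets. -/
lemma hausdorffMeasure_null_of_rel {X Y : Type*} [MetricSpace X] [MeasurableSpace X] [BorelSpace X]
    [MetricSpace Y] [MeasurableSpace Y] [BorelSpace Y] {R : X → Y → Prop} {K d : ℝ} (hd : 0 ≤ d)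
    (hR : ∀ x y x' y', R x y → R x' y' → dist y y' ≤ K * dist x x')
    {s : Set X} {t : Set Y} (hs : μH[d] s = 0) (ht : ∀ y ∈ t, ∃ x ∈ s, R x y) : μH[d] t = 0 := by
  classical
  rcases isEmpty_or_nonempty Y with h | ⟨⟨y₀⟩⟩
  · rw [Set.eq_empty_of_isEmpty t]; exact measure_empty
  set f : X → Y := fun x => if h : ∃ y, R x y then h.choose else y₀
  have hf : ∀ x y, R x y → R x (f x) := fun x y h => by
    have h' : ∃ y, R x y := ⟨y, h⟩
    simp only [f, dif_pos h']
    exact h'.choose_spec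
  set s' : Set X := {x ∈ s | ∃ y, R x y}
  have hL : LipschitzOnWith K.toNNReal f s' := by
    refine LipschitzOnWith.of_dist_le_mul fun x hx x' hx' => ?_
    obtain ⟨-, y, hy⟩ := hx
    obtain ⟨-, y', hy'⟩ := hx'
    refine (hR _ _ _ _ (hf _ _ hy) (hf _ _ hy')).trans ?_
    gcongr
    exact Real.le_coe_toNNReal K
  have hsub : t ⊆ f '' s' := by
    intro y hy
    obtain ⟨x, hx, hxy⟩ := ht y hy
    refine ⟨x, ⟨hx, y, hxy⟩, ?_⟩
    have := hR _ _ _ _ (hf x y hxy) hxy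
    rw [dist_self, mul_zero] at this
    exact dist_le_zero.1 this
  refine measure_mono_null hsub (nonpos_iff_eq_zero.1 ?_)
  refine (hL.hausdorffMeasure_image_le hd).trans ?_
  rw [measure_mono_null (Set.sep_subset _ _) hs, mul_zero]

section Strip

/-- A family of lines `w = y + (x - a) s`, indexed by their height `y` over `a` and their slope `s`,
which are uniformly separated over `[a, b]`. -/
def Separated (a b η : ℝ) (R : ℝ → ℝ → Prop) : Prop :=
  ∀ y s y' s', R y s → R y' s' → |s| ≤ 1 ∧ ∀ x ∈ Set.Icc a b,
    η * |s - s'| ≤ |(y - y') + (x - a) * (s - s')|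

variable {a b η : ℝ} {R : ℝ → ℝ → Prop}

/-- The parametrization of the lines. -/
def IsLinePoint (a b : ℝ) (R : ℝ → ℝ → Prop) (z q : ℝ × ℝ) : Prop :=
  z.2 ∈ Set.Icc a b ∧ q.1 = z.2 ∧ ∃ s, R z.1 s ∧ q.2 = z.1 + (z.2 - a) * s

lemma Separated.dist_le (hR : Separated a b η R) (hη : 0 < η) {z q z' q' : ℝ × ℝ}
    (h : IsLinePoint a b R z q) (h' : IsLinePoint a b R z' q') :
    dist q q' ≤ (2 + (b - a) / η) * dist z z' := by
  obtain ⟨hx, h1, s, hs, h2⟩ := h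
  obtain ⟨hx', h1', s', hs', h2'⟩ := h'
  obtain ⟨hs1, h3⟩ := hR _ _ _ _ hs hs'
  have h4 := h3 a ⟨le_rfl, hx.1.trans hx.2⟩
  rw [sub_self, zero_mul, add_zero] at h4
  have hd1 : |z.1 - z'.1| ≤ dist z z' := by rw [Prod.dist_eq]; exact le_max_left _ _
  have hd2 : |z.2 - z'.2| ≤ dist z z' := by rw [Prod.dist_eq]; exact le_max_right _ _
  have hba : 0 ≤ (b - a) / η := div_nonneg (by linarith [hx.1, hx.2]) hη.le
  have hd0 : 0 ≤ dist z z' := dist_nonneg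
  rw [Prod.dist_eq]
  refine max_le ?_ ?_
  · rw [h1, h1', Real.dist_eq]; nlinarith
  · rw [Real.dist_eq, h2, h2']
    have e : z.1 + (z.2 - a) * s - (z'.1 + (z'.2 - a) * s') =
      (z.1 - z'.1) + (z.2 - z'.2) * s + (z'.2 - a) * (s - s') := by ring
    have h5 : |s - s'| ≤ dist z z' / η := by
      rw [le_div_iff₀ hη]; linarith
    have h6 : |(z'.2 - a) * (s - s')| ≤ (b - a) * (dist z z' / η) := by
      rw [abs_mul]
      refine mul_le_mul ?_ h5 (abs_nonneg _) (by linarith [hx.1, hx.2])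
      rw [abs_of_nonneg (by linarith [hx'.1])]; linarith [hx'.2]
    have h7 : |(z.2 - z'.2) * s| ≤ dist z z' * 1 := by
      rw [abs_mul]; exact mul_le_mul hd2 hs1 (abs_nonneg _) hd0
    rw [e]
    refine (abs_add_three _ _ _).trans ?_
    have : (2 + (b - a) / η) * dist z z' =
      dist z z' + dist z z' * 1 + (b - a) * (dist z z' / η) := by ring
    linarith

lemma Separated.dist_le_inv (hR : Separated a b η R) (hη : 0 < η) {z q z' q' : ℝ × ℝ}
    (h : IsLinePoint a b R z q) (h' : IsLinePoint a b R z' q') :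
    dist z z' ≤ (2 * (1 + (b - a) / η)) * dist q q' := by
  obtain ⟨hx, h1, s, hs, h2⟩ := h
  obtain ⟨hx', h1', s', hs', h2'⟩ := h'
  obtain ⟨hs1, h3⟩ := hR _ _ _ _ hs hs'
  obtain ⟨hs1', -⟩ := hR _ _ _ _ hs' hs
  have h4 := h3 z.2 hx
  have hd1 : |q.1 - q'.1| ≤ dist q q' := by rw [Prod.dist_eq]; exact le_max_left _ _
  have hd2 : |q.2 - q'.2| ≤ dist q q' := by rw [Prod.dist_eq]; exact le_max_right _ _
  have hba : 0 ≤ (b - a) / η := div_nonneg (by linarith [hx.1, hx.2]) hη.le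
  have hd0 : 0 ≤ dist q q' := dist_nonneg
  have hdd : |(z.1 - z'.1) + (z.2 - a) * (s - s')| ≤ 2 * dist q q' := by
    have e : (z.1 - z'.1) + (z.2 - a) * (s - s') = (q.2 - q'.2) + (q'.1 - q.1) * s' := by
      rw [h2, h2', h1, h1']; ring
    have : |(q'.1 - q.1) * s'| ≤ dist q q' * 1 := by
      rw [abs_mul, abs_sub_comm]; exact mul_le_mul hd1 hs1' (abs_nonneg _) hd0
    rw [e]
    refine (abs_add_le _ _).trans ?_
    linarith
  rw [Prod.dist_eq]
  refine max_le ?_ ?_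
  · rw [Real.dist_eq]
    have h5 : |s - s'| ≤ 2 * dist q q' / η := by
      rw [le_div_iff₀ hη]; linarith
    have h6 : |(z.2 - a) * (s - s')| ≤ (b - a) * (2 * dist q q' / η) := by
      rw [abs_mul]
      refine mul_le_mul ?_ h5 (abs_nonneg _) (by linarith [hx.1, hx.2])
      rw [abs_of_nonneg (by linarith [hx.1])]; linarith [hx.2]
    have e : z.1 - z'.1 = ((z.1 - z'.1) + (z.2 - a) * (s - s')) - (z.2 - a) * (s - s') := by ring
    rw [e]
    refine (abs_sub _ _).trans ?_
    have : (2 * (1 + (b - a) / η)) * dist q q' =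
      2 * dist q q' + (b - a) * (2 * dist q q' / η) := by ring
    linarith
  · rw [Real.dist_eq, ← h1, ← h1']
    refine hd1.trans ?_
    nlinarith

lemma volume_eq_hausdorff_real (s : Set ℝ) : volume s = μH[1] s := by
  rw [hausdorffMeasure_real]

lemma volume_eq_hausdorff_prod (s : Set (ℝ × ℝ)) : volume s = μH[2] s := by
  rw [hausdorffMeasure_prod_real]

/-- A null set of heights gives a null set of points on the lines. -/
lemma Separated.volume_lines_null (hR : Separated a b η R) (hη : 0 < η) {Y : Set ℝ}
    (hY : volume Y = 0) : volume {q | ∃ z : ℝ × ℝ, z.1 ∈ Y ∧ IsLinePoint a b R z q} = 0 := by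
  rw [volume_eq_hausdorff_prod]
  refine hausdorffMeasure_null_of_rel (s := Y ×ˢ Set.Icc a b) (by norm_num)
    (fun z q z' q' => hR.dist_le hη) ?_ ?_
  · rw [← volume_eq_hausdorff_prod, Measure.volume_eq_prod, Measure.prod_prod, hY, zero_mul]
  · rintro q ⟨z, hz, hzq⟩
    exact ⟨z, ⟨hz, hzq.1⟩, hzq⟩

lemma Separated.volume_hit_null (hR : Separated a b η R) (hη : 0 < η) {Z : Set (ℝ × ℝ)}
    (hZ : μH[1] Z = 0) : volume {q | ∃ z, IsLinePoint a b R z q ∧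
      ∃ x, ∃ q' ∈ Z, IsLinePoint a b R (z.1, x) q'} = 0 := by
  refine measure_mono_null ?_ (hR.volume_lines_null hη
    (Y := {y | ∃ q' ∈ Z, ∃ x, IsLinePoint a b R (y, x) q'}) ?_)
  · rintro q ⟨z, hz, x, q', hq', h⟩
    exact ⟨z, ⟨q', hq', x, h⟩, hz⟩
  · rw [volume_eq_hausdorff_real]
    refine hausdorffMeasure_null_of_rel (s := Z)
      (R := fun q y => ∃ x, IsLinePoint a b R (y, x) q) (K := 2 * (1 + (b - a) / η)) zero_le_one ?_ hZ fun y hy => hy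
    rintro q y q' y' ⟨x, h⟩ ⟨x', h'⟩
    refine le_trans ?_ (hR.dist_le_inv hη h h')
    rw [Prod.dist_eq]; exact le_max_left _ _

lemma Separated.volume_not_ae_null (hR : Separated a b η R) (hη : 0 < η) {N : Set (ℝ × ℝ)}
    (hN : volume N = 0) : volume {q | ∃ z, IsLinePoint a b R z q ∧
      volume {x | ∃ q' ∈ N, IsLinePoint a b R (z.1, x) q'} ≠ 0} = 0 := by
  have h1 : volume {z | ∃ q' ∈ N, IsLinePoint a b R z q'} = 0 := by
    rw [volume_eq_hausdorff_prod] at hN ⊢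
    exact hausdorffMeasure_null_of_rel (R := fun q z => IsLinePoint a b R z q) (by norm_num)
      (fun q z q' z' => hR.dist_le_inv hη) hN fun y hy => hy
  have h2 := Measure.measure_ae_null_of_prod_null (μ := (volume : Measure ℝ))
    (ν := (volume : Measure ℝ)) h1
  refine measure_mono_null ?_ (hR.volume_lines_null hη (ae_iff.1 h2))
  rintro q ⟨z, hz, h⟩
  exact ⟨z, h, hz⟩

end Strip

/-- A family of segments `{p + t v}`, stable under passing to subsegments, such that segments with
the same midpoint are parallel. -/
structure IsSegmentFamily (𝓛 : ℝ × ℝ → ℝ × ℝ → Prop) : Prop where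
  ne_zero : ∀ {p v}, 𝓛 p v → v ≠ 0
  sub : ∀ {p v} {t r : ℝ}, 𝓛 p v → 0 < r → |t| + r ≤ 1 → 𝓛 (p + t • v) (r • v)
  parallel : ∀ {p v v'}, 𝓛 p v → 𝓛 p v' → v.1 * v'.2 = v.2 * v'.1

namespace IsSegmentFamily

variable {𝓛 : ℝ × ℝ → ℝ × ℝ → Prop}

/-- The segments of slope at most one crossing a given vertical strip. -/
def InStrip (𝓛 : ℝ × ℝ → ℝ × ℝ → Prop) (A a b B : ℝ) (p v : ℝ × ℝ) : Prop :=
  𝓛 p v ∧ |v.2| ≤ |v.1| ∧ p.1 - 3 / 4 * |v.1| ≤ A ∧ B ≤ p.1 + 3 / 4 * |v.1| ∧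
    a ≤ p.1 - 1 / 2 * |v.1| ∧ p.1 + 1 / 2 * |v.1| ≤ b

/-- Heights and slopes of the segments crossing a strip. -/
def stripRel (𝓛 : ℝ × ℝ → ℝ × ℝ → Prop) (A a b B : ℝ) (y s : ℝ) : Prop :=
  ∃ p v, InStrip 𝓛 A a b B p v ∧ y = p.2 + (a - p.1) * (v.2 / v.1) ∧ s = v.2 / v.1

lemma fst_ne_zero (h : IsSegmentFamily 𝓛) {p v} (hv : 𝓛 p v) (h1 : |v.2| ≤ |v.1|) :
    v.1 ≠ 0 := by
  intro h0
  rw [h0, abs_zero] at h1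
  exact h.ne_zero hv (Prod.ext h0 (abs_nonpos_iff.1 h1))

lemma point_mem (h : IsSegmentFamily 𝓛) {p v x} (hv : 𝓛 p v) (h1 : |v.2| ≤ |v.1|)
    (hx : |x - p.1| ≤ 3 / 4 * |v.1|) :
    𝓛 (x, p.2 + (x - p.1) * (v.2 / v.1)) ((1 / 4 : ℝ) • v) := by
  have h0 := h.fst_ne_zero hv h1
  have h2 : |(x - p.1) / v.1| ≤ 3 / 4 := by
    rw [abs_div, div_le_iff₀ (abs_pos.2 h0)]; exact hx
  convert h.sub hv (t := (x - p.1) / v.1) (r := 1 / 4) (by norm_num) (by linarith) using 1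
  ext
  · simp [div_mul_cancel₀ _ h0]
  · simp only [Prod.snd_add, Prod.smul_snd, smul_eq_mul]; ring

lemma separated (h : IsSegmentFamily 𝓛) {A a b B : ℝ} :
    Separated a b (min (a - A) (B - b)) (stripRel 𝓛 A a b B) := by
  rintro y s y' s' ⟨p, v, ⟨hv, h1, h2, h3, h4, h5⟩, rfl, rfl⟩
    ⟨p', v', ⟨hv', h1', h2', h3', h4', h5'⟩, rfl, rfl⟩
  have h0 := h.fst_ne_zero hv h1
  have h0' := h.fst_ne_zero hv' h1'
  refine ⟨?_, fun x hx => ?_⟩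
  · rw [abs_div, div_le_one (abs_pos.2 h0)]; exact h1
  by_contra! hcon
  set s := v.2 / v.1
  set s' := v'.2 / v'.1
  set d := p.2 + (a - p.1) * s - (p'.2 + (a - p'.1) * s') + (x - a) * (s - s') with hd
  have hss : s - s' ≠ 0 := by
    intro h; rw [h, abs_zero, mul_zero] at hcon; exact absurd hcon (not_lt.2 (abs_nonneg _))
  set x₀ := x - d / (s - s') with hx₀
  have hx1 : |d / (s - s')| < min (a - A) (B - b) := by
    rw [abs_div, div_lt_iff₀ (abs_pos.2 hss)]; exact hcon
  have hxa := hx1.trans_le (min_le_left _ _)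
  have hxb := hx1.trans_le (min_le_right _ _)
  rw [abs_lt] at hxa hxb
  have hA : A ≤ x₀ := by linarith [hx.1]
  have hB : x₀ ≤ B := by linarith [hx.2]
  have e : p.2 + (x₀ - p.1) * s = p'.2 + (x₀ - p'.1) * s' := by
    have : d / (s - s') * (s - s') = d := div_mul_cancel₀ _ hss
    rw [hx₀]
    linear_combination -this + hd
  have k := h.point_mem hv h1 (x := x₀) (by rw [abs_le]; constructor <;> linarith)
  have k' := h.point_mem hv' h1' (x := x₀) (by rw [abs_le]; constructor <;> linarith)
  change 𝓛 (x₀, p.2 + (x₀ - p.1) * s) _ at k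
  rw [e] at k
  have := h.parallel k k'
  simp only [Prod.smul_fst, Prod.smul_snd, smul_eq_mul] at this
  apply hss
  rw [sub_eq_zero, div_eq_div_iff h0 h0']
  linarith

lemma exists_inStrip (h : IsSegmentFamily 𝓛) {p v} (hv : 𝓛 p v) (h1 : |v.2| ≤ |v.1|) :
    ∃ A a b B : ℚ, (A : ℝ) < a ∧ (b : ℝ) < B ∧ InStrip 𝓛 A a b B p v := by
  have h0 := abs_pos.2 (h.fst_ne_zero hv h1)
  obtain ⟨A, hA⟩ := exists_rat_btwn (show p.1 - 3 / 4 * |v.1| < p.1 - 5 / 8 * |v.1| by linarith)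
  obtain ⟨a, ha⟩ := exists_rat_btwn (show p.1 - 5 / 8 * |v.1| < p.1 - 1 / 2 * |v.1| by linarith)
  obtain ⟨b, hb⟩ := exists_rat_btwn (show p.1 + 1 / 2 * |v.1| < p.1 + 5 / 8 * |v.1| by linarith)
  obtain ⟨B, hB⟩ := exists_rat_btwn (show p.1 + 5 / 8 * |v.1| < p.1 + 3 / 4 * |v.1| by linarith)
  exact ⟨A, a, b, B, by linarith, by linarith, hv, h1, hA.1.le, hB.2.le, ha.2.le, hb.1.le⟩

lemma InStrip.isLinePoint {A a b B : ℝ} {p v} (h : InStrip 𝓛 A a b B p v)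
    (h0 : v.1 ≠ 0) {t : ℝ} (ht : |t| ≤ 1 / 2) :
    IsLinePoint a b (stripRel 𝓛 A a b B) (p.2 + (a - p.1) * (v.2 / v.1), p.1 + t * v.1)
      (p + t • v) := by
  have ⟨_, _, _, _, h4, h5⟩ := h
  have : |t * v.1| ≤ 1 / 2 * |v.1| := by rw [abs_mul]; gcongr
  rw [abs_le] at this
  refine ⟨⟨by linarith, by linarith⟩, by simp, v.2 / v.1, ⟨p, v, h, rfl, rfl⟩, ?_⟩
  simp only [Prod.snd_add, Prod.smul_snd, smul_eq_mul]
  field_simp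
  ring

lemma ae_not_hit_of_slope (h : IsSegmentFamily 𝓛) {Z : Set (ℝ × ℝ)} (hZ : μH[1] Z = 0) :
    ∀ᵐ q : ℝ × ℝ, ∀ v, 𝓛 q v → |v.2| ≤ |v.1| → ∀ t : ℝ, |t| ≤ 1 / 2 → q + t • v ∉ Z := by
  have key : ∀ A a b B : ℚ, ∀ᵐ q : ℝ × ℝ, (A : ℝ) < a → (b : ℝ) < B → ∀ v,
      InStrip 𝓛 A a b B q v → ∀ t : ℝ, |t| ≤ 1 / 2 → q + t • v ∉ Z := by
    intro A a b B
    by_cases hc : (A : ℝ) < a ∧ (b : ℝ) < B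
    · refine measure_mono_null ?_ ((h.separated (A := A) (a := a) (b := b) (B := B)).volume_hit_null
        (lt_min (sub_pos.2 hc.1) (sub_pos.2 hc.2)) hZ)
      intro q hq
      simp only [Set.mem_compl_iff, Set.mem_ofPred_eq] at hq
      push Not at hq
      obtain ⟨-, -, v, hv, t, ht, hm⟩ := hq
      have h0 := h.fst_ne_zero hv.1 hv.2.1
      have := hv.isLinePoint h0 (t := 0) (by norm_num)
      rw [zero_smul, add_zero] at this
      exact ⟨_, this, _, _, hm, hv.isLinePoint h0 ht⟩
    · filter_upwards with q h1 h2
      exact absurd ⟨h1, h2⟩ hc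
  simp only [← ae_all_iff] at key
  filter_upwards [key] with q hq v hv h1
  obtain ⟨A, a, b, B, h2, h3, h4⟩ := h.exists_inStrip hv h1
  exact hq A a b B h2 h3 v h4

lemma ae_null_of_slope (h : IsSegmentFamily 𝓛) {N : Set (ℝ × ℝ)} (hN : volume N = 0) :
    ∀ᵐ q : ℝ × ℝ, ∀ v, 𝓛 q v → |v.2| ≤ |v.1| →
      volume {t : ℝ | |t| ≤ 1 / 2 ∧ q + t • v ∈ N} = 0 := by
  have key : ∀ A a b B : ℚ, ∀ᵐ q : ℝ × ℝ, (A : ℝ) < a → (b : ℝ) < B → ∀ v,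
      InStrip 𝓛 A a b B q v → volume {t : ℝ | |t| ≤ 1 / 2 ∧ q + t • v ∈ N} = 0 := by
    intro A a b B
    by_cases hc : (A : ℝ) < a ∧ (b : ℝ) < B
    · refine measure_mono_null ?_ ((h.separated (A := A) (a := a) (b := b)
        (B := B)).volume_not_ae_null (lt_min (sub_pos.2 hc.1) (sub_pos.2 hc.2)) hN)
      intro q hq
      simp only [Set.mem_compl_iff, Set.mem_ofPred_eq] at hq
      push Not at hq
      obtain ⟨-, -, v, hv, hm⟩ := hq
      have h0 := h.fst_ne_zero hv.1 hv.2.1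
      have := hv.isLinePoint h0 (t := 0) (by norm_num)
      rw [zero_smul, add_zero] at this
      refine ⟨_, this, fun h1 => hm ?_⟩
      have h2 : volume ((fun t : ℝ => v.1 * t + q.1) ⁻¹'
          {x | ∃ q' ∈ N, IsLinePoint a b (stripRel 𝓛 A a b B)
            (q.2 + (a - q.1) * (v.2 / v.1), x) q'}) = 0 := by
        have e : (fun t : ℝ => v.1 * t + q.1) = (fun t => t + q.1) ∘ (fun t => v.1 * t) := rfl
        rw [e, Set.preimage_comp, Real.volume_preimage_mul_left h0, measure_preimage_add_right, h1,
          mul_zero]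
      refine measure_mono_null ?_ h2
      rintro t ⟨ht, hm⟩
      refine ⟨_, hm, ?_⟩
      have := hv.isLinePoint h0 ht
      rwa [add_comm q.1, mul_comm t] at this
    · filter_upwards with q h1 h2
      exact absurd ⟨h1, h2⟩ hc
  simp only [← ae_all_iff] at key
  filter_upwards [key] with q hq v hv h1
  obtain ⟨A, a, b, B, h2, h3, h4⟩ := h.exists_inStrip hv h1
  exact hq A a b B h2 h3 v h4

lemma swap (h : IsSegmentFamily 𝓛) : IsSegmentFamily fun p v => 𝓛 p.swap v.swap where
  ne_zero hp h0 := h.ne_zero hp (by rw [h0]; rfl)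
  sub hp hr ht := by simpa using h.sub hp hr ht
  parallel hp hp' := by simpa using (h.parallel hp hp').symm

lemma ae_swap {P : ℝ × ℝ → Prop} (h : ∀ᵐ q : ℝ × ℝ, P q) : ∀ᵐ q : ℝ × ℝ, P q.swap :=
  (Measure.measurePreserving_swap (μ := (volume : Measure ℝ))
    (ν := (volume : Measure ℝ))).quasiMeasurePreserving.ae h

/-- A set of zero length is avoided by the half segments at almost every point. -/
lemma ae_not_hit (h : IsSegmentFamily 𝓛) {Z : Set (ℝ × ℝ)} (hZ : μH[1] Z = 0) :
    ∀ᵐ q : ℝ × ℝ, ∀ v, 𝓛 q v → ∀ t : ℝ, |t| ≤ 1 / 2 → q + t • v ∉ Z := by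
  have hZ' : μH[1] (Prod.swap ⁻¹' Z) = 0 := by
    refine hausdorffMeasure_null_of_rel (R := fun q q' : ℝ × ℝ => q = q'.swap) (K := 1)
      zero_le_one ?_ hZ fun q hq => ⟨_, hq, rfl⟩
    rintro _ q _ q' rfl rfl
    simp [Prod.dist_eq, max_comm]
  filter_upwards [h.ae_not_hit_of_slope hZ, ae_swap (h.swap.ae_not_hit_of_slope hZ')]
    with q h1 h2 v hv t ht
  rcases le_total |v.2| |v.1| with hs | hs
  · exact h1 v hv hs t ht
  · exact h2 v.swap (by simpa using hv) (by simpa using hs) t ht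

/-- A set of zero area meets the half segments at almost every point in zero length. -/
lemma ae_null (h : IsSegmentFamily 𝓛) {N : Set (ℝ × ℝ)} (hN : volume N = 0) :
    ∀ᵐ q : ℝ × ℝ, ∀ v, 𝓛 q v → volume {t : ℝ | |t| ≤ 1 / 2 ∧ q + t • v ∈ N} = 0 := by
  have hN' : volume (Prod.swap ⁻¹' N) = 0 := by
    have : ∀ᵐ q : ℝ × ℝ, q ∉ N := by rw [ae_iff]; simpa using hN
    have h1 : volume {a : ℝ × ℝ | a.swap ∈ N} = 0 := by simpa [ae_iff] using ae_swap this
    exact h1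
  filter_upwards [h.ae_null_of_slope hN, ae_swap (h.swap.ae_null_of_slope hN')]
    with q h1 h2 v hv
  rcases le_total |v.2| |v.1| with hs | hs
  · exact h1 v hv hs
  · exact h2 v.swap (by simpa using hv) (by simpa using hs)

end IsSegmentFamily

/-- The segment `{p + t v}`, `|t| ≤ 1`, is contracted by the iterates of `T`, each of which is
affine near it. -/
def IsLeaf (T : ℝ × ℝ → ℝ × ℝ) (p v : ℝ × ℝ) : Prop :=
  v ≠ 0 ∧ ∃ (A : ℕ → ℝ × ℝ →ₗ[ℝ] ℝ × ℝ) (C : ℝ), (∀ n, |LinearMap.det (A n)| = 1) ∧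
    (∀ n : ℕ, ‖A n v‖ ≤ C / (n + 1)) ∧
    ∀ n : ℕ, ∀ t : ℝ, |t| ≤ 1 → ∃ r > 0, AffineOnBall (T^[n]) (p + t • v) (A n) r

lemma AffineOnBall.unique {f : ℝ × ℝ → ℝ × ℝ} {p A B r s} (hr : 0 < r) (hs : 0 < s)
    (h : AffineOnBall f p A r) (h' : AffineOnBall f p B s) : A = B := by
  refine LinearMap.ext fun w => ?_
  obtain ⟨ε, hε, h1⟩ : ∃ ε : ℝ, 0 < ε ∧ ε * ‖w‖ < min r s := by
    have : 0 < min r s := lt_min hr hs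
    refine ⟨min r s / (‖w‖ + 1), by positivity, ?_⟩
    rw [div_mul_eq_mul_div, div_lt_iff₀ (by positivity)]
    nlinarith [norm_nonneg w]
  have h2 : ‖p + ε • w - p‖ < min r s := by
    rw [add_sub_cancel_left, norm_smul, Real.norm_of_nonneg hε.le]; exact h1
  have h3 := (h _ (h2.trans_le (min_le_left _ _))).symm.trans (h' _ (h2.trans_le (min_le_right _ _)))
  rw [add_right_inj, add_sub_cancel_left, map_smul, map_smul] at h3
  exact smul_right_injective _ hε.ne' h3

/-- The determinant of two vectors. -/
def cross (v w : ℝ × ℝ) : ℝ := v.1 * w.2 - v.2 * w.1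

lemma cross_map (A : ℝ × ℝ →ₗ[ℝ] ℝ × ℝ) (v w : ℝ × ℝ) :
    cross (A v) (A w) = LinearMap.det A * cross v w := by
  have e : ∀ u : ℝ × ℝ, A u = u.1 • A (1, 0) + u.2 • A (0, 1) := fun u => by
    rw [← map_smul, ← map_smul, ← map_add]; simp
  rw [← LinearMap.det_toMatrix (Module.Basis.finTwoProd ℝ), Matrix.det_fin_two]
  simp only [LinearMap.toMatrix_apply, Module.Basis.finTwoProd_zero, Module.Basis.finTwoProd_one,
    Module.Basis.coe_finTwoProd_repr, Matrix.cons_val_zero, Matrix.cons_val_one]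
  rw [e v, e w]
  simp [cross]
  ring

lemma abs_cross_le (v w : ℝ × ℝ) : |cross v w| ≤ 2 * (‖v‖ * ‖w‖) := by
  have h : ∀ u : ℝ × ℝ, |u.1| ≤ ‖u‖ ∧ |u.2| ≤ ‖u‖ := fun u => ⟨norm_fst_le u, norm_snd_le u⟩
  rw [cross]
  refine (abs_sub _ _).trans ?_
  rw [abs_mul, abs_mul]
  have h1 := mul_le_mul (h v).1 (h w).2 (abs_nonneg _) (norm_nonneg _)
  have h2 := mul_le_mul (h v).2 (h w).1 (abs_nonneg _) (norm_nonneg _)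
  linarith

lemma isSegmentFamily_isLeaf (T : ℝ × ℝ → ℝ × ℝ) : IsSegmentFamily (IsLeaf T) where
  ne_zero h := h.1
  sub := by
    rintro p v t r ⟨h0, A, C, hd, hA, hT⟩ hr ht
    refine ⟨smul_ne_zero hr.ne' h0, A, C, hd, fun n => ?_, fun n s hs => ?_⟩
    · rw [map_smul, norm_smul, Real.norm_of_nonneg hr.le]
      have h1 : r ≤ 1 := by linarith [abs_nonneg t]
      exact (mul_le_of_le_one_left (norm_nonneg _) h1).trans (hA n)
    · have h1 : |t + s * r| ≤ 1 := by
        refine (abs_add_le _ _).trans ?_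
        rw [abs_mul, abs_of_pos hr]
        nlinarith
      obtain ⟨ρ, hρ, h⟩ := hT n _ h1
      refine ⟨ρ, hρ, ?_⟩
      convert h using 1
      module
  parallel := by
    rintro p v v' ⟨h0, A, C, hd, hA, hT⟩ ⟨h0', A', C', hd', hA', hT'⟩
    have hAA : ∀ n, A n = A' n := fun n => by
      obtain ⟨r, hr, h⟩ := hT n 0 (by norm_num)
      obtain ⟨r', hr', h'⟩ := hT' n 0 (by norm_num)
      rw [zero_smul, add_zero] at h h'
      exact h.unique hr hr' h'
    have h1 : ∀ n : ℕ, |cross v v'| ≤ 2 * (C * (1 / ((n : ℝ) + 1)) * (C' * (1 / ((n : ℝ) + 1)))) := by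
      intro n
      have h2 := abs_cross_le (A n v) (A n v')
      rw [cross_map, abs_mul, hd, one_mul] at h2
      refine h2.trans ?_
      have h3 := hA n
      have h4 := hA' n
      rw [← hAA] at h4
      rw [div_eq_mul_one_div] at h3 h4
      gcongr
      exact (norm_nonneg _).trans h3
    have h2 : Filter.Tendsto (fun n : ℕ => 2 * (C * (1 / ((n : ℝ) + 1)) * (C' * (1 / ((n : ℝ) + 1)))))
        Filter.atTop (nhds 0) := by
      have := tendsto_one_div_add_atTop_nhds_zero_nat (𝕜 := ℝ)
      have := ((this.const_mul C).mul (this.const_mul C')).const_mul 2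
      simpa using this
    have h3 : |cross v v'| ≤ 0 := ge_of_tendsto' h2 h1
    have h4 := abs_nonpos_iff.1 h3
    rw [cross] at h4
    linarith

namespace IsLeaf

variable {T : ℝ × ℝ → ℝ × ℝ} {p v : ℝ × ℝ}

lemma exists_dist_le (h : IsLeaf T p v) : ∃ C : ℝ, ∀ t s : ℝ, |t| ≤ 1 → |s| ≤ 1 → ∀ n : ℕ,
    dist (T^[n] (p + t • v)) (T^[n] (p + s • v)) ≤ C / (n + 1) := by
  obtain ⟨h0, A, C, hd, hA, hT⟩ := h
  refine ⟨2 * C, fun t s ht hs n => ?_⟩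
  have hder : ∀ x ∈ Set.Icc (-1 : ℝ) 1, HasDerivWithinAt (fun t : ℝ => T^[n] (p + t • v))
      (A n v) (Set.Icc (-1) 1) x := by
    intro x hx
    obtain ⟨r, hr, hr'⟩ := hT n x (abs_le.2 hx)
    have h1 : HasDerivAt (fun t : ℝ => T^[n] (p + x • v) + (t - x) • A n v) (A n v) x := by
      simpa using (((hasDerivAt_id x).sub_const x).smul_const (A n v)).const_add
        (T^[n] (p + x • v))
    refine (h1.congr_of_eventuallyEq ?_).hasDerivWithinAt
    have hc : Continuous fun t : ℝ => ‖p + t • v - (p + x • v)‖ := by fun_prop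
    have : ∀ᶠ t in nhds x, ‖p + t • v - (p + x • v)‖ < r :=
      hc.continuousAt.eventually_lt continuousAt_const (by simpa using hr)
    filter_upwards [this] with t ht
    rw [hr' _ ht, ← map_smul]
    congr 2
    module
  have := (convex_Icc (-1 : ℝ) 1).norm_image_sub_le_of_norm_hasDerivWithin_le hder
    (fun x _ => hA n) (abs_le.1 hs) (abs_le.1 ht)
  rw [dist_eq_norm]
  refine this.trans ?_
  have h2 : ‖t - s‖ ≤ 2 := by
    rw [Real.norm_eq_abs]; exact (abs_sub _ _).trans (by linarith)
  have h3 := (norm_nonneg _).trans (hA n)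
  have : 2 * C / ((n : ℝ) + 1) = C / (n + 1) * 2 := by ring
  rw [this]
  gcongr

end IsLeaf

/-- The product of the derivatives along an orbit. -/
noncomputable def iterDeriv (T : ℝ × ℝ → ℝ × ℝ) (D : ℝ × ℝ → (ℝ × ℝ →ₗ[ℝ] ℝ × ℝ)) (p : ℝ × ℝ) :
    ℕ → (ℝ × ℝ →ₗ[ℝ] ℝ × ℝ)
  | 0 => LinearMap.id
  | n + 1 => D (T^[n] p) ∘ₗ iterDeriv T D p n

/-- Cones which are contracted by the derivative `D` of `T`, the energy `e` being halved and
controlling the norm `N` at each visit to `B`. -/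
structure IsConeSystem (T : ℝ × ℝ → ℝ × ℝ) (D : ℝ × ℝ → (ℝ × ℝ →ₗ[ℝ] ℝ × ℝ)) (Γ : Set (ℝ × ℝ))
    (K : ℝ × ℝ → ℝ × ℝ → Prop) (e N : ℝ × ℝ → ℝ × ℝ → ℝ) (B : Set (ℝ × ℝ)) (C : ℝ) : Prop where
  pos : 0 ≤ C
  det : ∀ y ∈ Γ, |LinearMap.det (D y)| = 1
  closed : ∀ p, IsClosed {w | K p w}
  smul : ∀ {p w} (r : ℝ), K p w → K p (r • w)
  nonempty : ∀ p, ∃ w, w ≠ 0 ∧ K p w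
  norm_le : ∀ p w, K p w → ‖w‖ ≤ C * N p w
  cone : ∀ y ∈ Γ, ∀ w, K (T y) (D y w) → K y w
  energy : ∀ y ∈ Γ, ∀ w, K (T y) (D y w) → e (T y) (D y w) ≤ e y w
  energy_visit : ∀ y ∈ Γ, ∀ w, K (T y) (D y w) → T y ∈ B → 2 * e (T y) (D y w) ≤ e y w
  size : ∀ y ∈ Γ, ∀ w, K (T y) (D y w) → T y ∉ B → N (T y) (D y w) ≤ N y w
  size_visit : ∀ y ∈ Γ, ∀ w, K (T y) (D y w) → T y ∈ B → N (T y) (D y w) ≤ C * e y w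

namespace IsConeSystem

variable {T : ℝ × ℝ → ℝ × ℝ} {D : ℝ × ℝ → (ℝ × ℝ →ₗ[ℝ] ℝ × ℝ)} {Γ : Set (ℝ × ℝ)}
  {K : ℝ × ℝ → ℝ × ℝ → Prop} {e N : ℝ × ℝ → ℝ × ℝ → ℝ} {B : Set (ℝ × ℝ)} {C : ℝ} {p v : ℝ × ℝ}

lemma det_iterDeriv (h : IsConeSystem T D Γ K e N B C) (hp : ∀ n, T^[n] p ∈ Γ) (n : ℕ) :
    |LinearMap.det (iterDeriv T D p n)| = 1 := by
  induction n with
  | zero => simp [iterDeriv]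
  | succ n ih => rw [iterDeriv, LinearMap.det_comp, abs_mul, h.det _ (hp n), ih, one_mul]

lemma exists_direction (h : IsConeSystem T D Γ K e N B C) (hp : ∀ n, T^[n] p ∈ Γ) :
    ∃ v, v ≠ 0 ∧ ∀ n, K (T^[n] p) (iterDeriv T D p n v) := by
  have h1 : ∀ n, ∃ v : ℝ × ℝ, v ∈ Metric.sphere (0 : ℝ × ℝ) 1 ∧
      ∀ k ≤ n, K (T^[k] p) (iterDeriv T D p k v) := by
    intro n
    obtain ⟨w, hw, hK⟩ := h.nonempty (T^[n] p)
    have hdet : LinearMap.det (iterDeriv T D p n) ≠ 0 := by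
      intro h0
      have := h.det_iterDeriv hp n
      rw [h0, abs_zero] at this
      exact zero_ne_one this
    set E := LinearEquiv.ofIsUnitDet (f := iterDeriv T D p n)
      (v := Module.Basis.finTwoProd ℝ) (v' := Module.Basis.finTwoProd ℝ)
      (by rw [LinearMap.det_toMatrix]; exact isUnit_iff_ne_zero.2 hdet)
    have hE : ∀ u, E u = iterDeriv T D p n u := fun u => rfl
    set u := E.symm w
    have hu : iterDeriv T D p n u = w := by rw [← hE]; exact E.apply_symm_apply w
    have hu0 : u ≠ 0 := by
      intro h0; rw [h0, map_zero] at hu; exact hw hu.symm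
    refine ⟨‖u‖⁻¹ • u, by simp [norm_smul, hu0], fun k hk => ?_⟩
    induction hk using Nat.decreasingInduction with
    | self => rw [map_smul, hu]; exact h.smul _ hK
    | of_succ k hk ih =>
      rw [Function.iterate_succ_apply'] at ih
      exact h.cone _ (hp k) _ ih
  choose v hv hKv using h1
  obtain ⟨v₀, hv₀, φ, hφ, hlim⟩ := (isCompact_sphere (0 : ℝ × ℝ) 1).tendsto_subseq hv
  refine ⟨v₀, by rintro rfl; simp at hv₀, fun n => ?_⟩
  have hc : Continuous (iterDeriv T D p n) := LinearMap.continuous_of_finiteDimensional _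
  refine (h.closed (T^[n] p)).mem_of_tendsto ((hc.tendsto v₀).comp hlim) ?_
  filter_upwards [Filter.eventually_ge_atTop n] with k hk
  exact hKv _ n (hk.trans hφ.le_apply)

lemma energy_antitone (h : IsConeSystem T D Γ K e N B C) (hp : ∀ n, T^[n] p ∈ Γ)
    (hv : ∀ n, K (T^[n] p) (iterDeriv T D p n v)) :
    Antitone fun n => e (T^[n] p) (iterDeriv T D p n v) := by
  refine antitone_nat_of_succ_le fun n => ?_
  have := hv (n + 1)
  rw [Function.iterate_succ_apply'] at this ⊢
  exact h.energy _ (hp n) _ this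

lemma size_le (h : IsConeSystem T D Γ K e N B C) (hp : ∀ n, T^[n] p ∈ Γ)
    (hv : ∀ n, K (T^[n] p) (iterDeriv T D p n v)) {j n : ℕ} (hj : T^[j + 1] p ∈ B) (hn : j + 1 ≤ n) :
    N (T^[n] p) (iterDeriv T D p n v) ≤ C * e (T^[j] p) (iterDeriv T D p j v) := by
  induction n, hn using Nat.le_induction with
  | base =>
    have := hv (j + 1)
    rw [Function.iterate_succ_apply'] at this hj ⊢
    exact h.size_visit _ (hp j) _ this hj
  | succ n hn ih =>
    have h1 := hv (n + 1)
    rw [Function.iterate_succ_apply'] at h1 ⊢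
    by_cases hB : T (T^[n] p) ∈ B
    · refine (h.size_visit _ (hp n) _ h1 hB).trans ?_
      exact mul_le_mul_of_nonneg_left (h.energy_antitone hp hv (by omega)) h.pos
    · exact (h.size _ (hp n) _ h1 hB).trans ih

lemma energy_pos (h : IsConeSystem T D Γ K e N B C) (hp : ∀ n, T^[n] p ∈ Γ)
    (hv : ∀ n, K (T^[n] p) (iterDeriv T D p n v)) (hv0 : v ≠ 0) {i j : ℕ} (hij : i ≤ j)
    (hj : T^[j + 1] p ∈ B) : 0 < e (T^[i] p) (iterDeriv T D p i v) := by
  by_contra! hcon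
  have h1 := h.size_le hp hv hj le_rfl
  have h2 : e (T^[j] p) (iterDeriv T D p j v) ≤ e (T^[i] p) (iterDeriv T D p i v) :=
    h.energy_antitone hp hv hij
  have h3 := h.norm_le (T^[j + 1] p) (iterDeriv T D p (j + 1) v) (hv _)
  have h4 : C * e (T^[j] p) (iterDeriv T D p j v) ≤ 0 :=
    mul_nonpos_of_nonneg_of_nonpos h.pos (h2.trans hcon)
  have h5 : ‖iterDeriv T D p (j + 1) v‖ ≤ 0 :=
    h3.trans (mul_nonpos_of_nonneg_of_nonpos h.pos (h1.trans h4))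
  have hdet : LinearMap.det (iterDeriv T D p (j + 1)) ≠ 0 := by
    intro h0
    have := h.det_iterDeriv hp (j + 1)
    rw [h0, abs_zero] at this
    exact zero_ne_one this
  have h6 := norm_le_zero_iff.1 h5
  have h7 : Function.Injective (iterDeriv T D p (j + 1)) :=
    (LinearMap.equivOfDetNeZero _ hdet).injective
  exact hv0 (h7 (h6.trans (map_zero _).symm))

lemma exists_norm_le (h : IsConeSystem T D Γ K e N B C) (hp : ∀ n, T^[n] p ∈ Γ)
    (hv : ∀ n, K (T^[n] p) (iterDeriv T D p n v)) (he : 0 < e p v)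
    (hgap : ∃ M, ∀ n ≥ M, ∃ j, j ≤ n ∧ 7 * (n + 1) ≤ 8 * j ∧ T^[j] p ∈ B) :
    ∃ C' : ℝ, ∀ n : ℕ, ‖iterDeriv T D p n v‖ ≤ C' / ((n : ℝ) + 1) ^ 5 := by
  obtain ⟨M, hM⟩ := hgap
  set E : ℕ → ℝ := fun n => e (T^[n] p) (iterDeriv T D p n v)
  have hE : Antitone E := h.energy_antitone hp hv
  have hE2 : ∀ j, T^[j + 1] p ∈ B → 2 * E (j + 1) ≤ E j := fun j hj => by
    have := hv (j + 1)
    simp only [E]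
    rw [Function.iterate_succ_apply'] at this hj ⊢
    exact h.energy_visit _ (hp j) _ this hj
  have hpow : ∀ n j : ℕ, 7 * (n + 1) ≤ 8 * (j + 1) → ((n : ℝ) + 1) ^ 5 ≤ 2 * ((j : ℝ) + 1) ^ 5 := by
    intro n j hnj
    have : (7 : ℝ) * (n + 1) ≤ 8 * (j + 1) := by exact_mod_cast hnj
    have h1 : (n : ℝ) + 1 ≤ 8 / 7 * (j + 1) := by linarith
    calc ((n : ℝ) + 1) ^ 5 ≤ (8 / 7 * (j + 1)) ^ 5 := by gcongr
      _ = (8 / 7) ^ 5 * ((j : ℝ) + 1) ^ 5 := by ring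
      _ ≤ _ := by gcongr; norm_num
  have hstep : ∀ n ≥ M, ∃ j, j + 1 ≤ n ∧ 7 * (n + 1) ≤ 8 * (j + 1) ∧ T^[j + 1] p ∈ B := by
    intro n hn
    obtain ⟨j, h1, h2, h3⟩ := hM n hn
    obtain ⟨j, rfl⟩ : ∃ i, j = i + 1 := ⟨j - 1, by omega⟩
    exact ⟨j, h1, h2, h3⟩
  set C1 := e p v * ((M : ℝ) + 1) ^ 5
  have hC1 : 0 ≤ C1 := by positivity
  have hEn : ∀ n : ℕ, E n ≤ C1 / ((n : ℝ) + 1) ^ 5 := by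
    intro n
    induction n using Nat.strong_induction_on with
    | _ n ih =>
    rcases lt_or_ge n M with hn | hn
    · rw [le_div_iff₀ (by positivity)]
      have h1 : E n ≤ e p v := hE (Nat.zero_le n)
      have h2 : (n : ℝ) + 1 ≤ M + 1 := by gcongr
      exact mul_le_mul h1 (pow_le_pow_left₀ (by positivity) h2 5) (by positivity) he.le
    · obtain ⟨j, h1, h2, h3⟩ := hstep n hn
      have h4 := ih j (by omega)
      have h5 := hE2 j h3
      have h6 : E n ≤ E (j + 1) := hE h1
      have h7 := hpow n j h2
      rw [le_div_iff₀ (by positivity)] at h4 ⊢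
      rcases le_or_gt (E n) 0 with h8 | h8
      · exact (mul_nonpos_of_nonpos_of_nonneg h8 (by positivity)).trans hC1
      · calc E n * ((n : ℝ) + 1) ^ 5 ≤ E n * (2 * ((j : ℝ) + 1) ^ 5) := by gcongr
          _ = (2 * E n) * ((j : ℝ) + 1) ^ 5 := by ring
          _ ≤ E j * ((j : ℝ) + 1) ^ 5 := by gcongr; linarith
          _ ≤ C1 := h4
  have hfin : ∃ C2 : ℝ, 0 ≤ C2 ∧ ∀ n < M, ‖iterDeriv T D p n v‖ ≤ C2 := by
    refine ⟨∑ n ∈ Finset.range M, ‖iterDeriv T D p n v‖,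
      Finset.sum_nonneg fun _ _ => norm_nonneg _, fun n hn => ?_⟩
    exact Finset.single_le_sum (f := fun n => ‖iterDeriv T D p n v‖) (fun _ _ => norm_nonneg _)
      (Finset.mem_range.2 hn)
  obtain ⟨C2, hC2, hfin⟩ := hfin
  refine ⟨max (C2 * ((M : ℝ) + 1) ^ 5) (C * (C * (2 * C1))), fun n => ?_⟩
  rw [le_div_iff₀ (by positivity)]
  rcases lt_or_ge n M with hn | hn
  · refine le_max_of_le_left ?_
    have h2 : (n : ℝ) ≤ M := by exact_mod_cast hn.le
    have := hfin n hn
    gcongr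
  · refine le_max_of_le_right ?_
    obtain ⟨j, h1, h2, h3⟩ := hstep n hn
    have h4 := h.size_le hp hv h3 h1
    have h5 := h.norm_le (T^[n] p) (iterDeriv T D p n v) (hv n)
    have h6 := hEn j
    have h7 := hpow n j h2
    have h8 : ‖iterDeriv T D p n v‖ ≤ C * (C * (C1 / ((j : ℝ) + 1) ^ 5)) :=
      h5.trans (mul_le_mul_of_nonneg_left (h4.trans (mul_le_mul_of_nonneg_left h6 h.pos)) h.pos)
    have hC := h.pos
    calc _ ≤ C * (C * (C1 / ((j : ℝ) + 1) ^ 5)) * (2 * ((j : ℝ) + 1) ^ 5) := by gcongr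
      _ = _ := by field_simp

end IsConeSystem

lemma ae_exists_margin {T : ℝ × ℝ → ℝ × ℝ} {D : ℝ × ℝ → (ℝ × ℝ →ₗ[ℝ] ℝ × ℝ)} {m : ℝ × ℝ → ℝ}
    (hm : HasMargin T D m)
    (hT : MeasurePreserving T (volume.restrict openSquare) (volume.restrict openSquare)) :
    ∀ᵐ p ∂(volume.restrict openSquare), ∃ c > 0, ∀ n : ℕ, c / ((n : ℝ) + 1) ^ 2 ≤ m (T^[n] p) := by
  obtain ⟨hc, -, C, hC⟩ := hm
  have hμ : ∀ ε > 0, (volume.restrict openSquare) {p | m p < ε} ≤ ENNReal.ofReal (C * ε) := by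
    intro ε hε
    rw [Measure.restrict_apply' measurableSet_openSquare, Set.inter_comm]
    exact hC ε hε
  have hpos : ∀ᵐ p ∂(volume.restrict openSquare), 0 < m p := by
    rw [ae_iff]
    refine le_antisymm ?_ zero_le
    have h1 : Filter.Tendsto (fun n : ℕ => ENNReal.ofReal (C * (1 / ((n : ℝ) + 1))))
        Filter.atTop (nhds 0) := by
      rw [← ENNReal.ofReal_zero]
      refine ENNReal.tendsto_ofReal ?_
      simpa using (tendsto_one_div_add_atTop_nhds_zero_nat (𝕜 := ℝ)).const_mul C
    refine ge_of_tendsto' h1 fun n => (measure_mono fun p hp => ?_).trans (hμ _ (by positivity))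
    simp only [Set.mem_ofPred_eq, not_lt] at hp ⊢
    exact hp.trans_lt (by positivity)
  have hbc : ∀ᵐ p ∂(volume.restrict openSquare), ∀ᶠ n : ℕ in Filter.atTop,
      ¬ m (T^[n] p) < 1 / ((n : ℝ) + 1) ^ 2 := by
    refine ae_eventually_notMem (s := fun n : ℕ => {p | m (T^[n] p) < 1 / ((n : ℝ) + 1) ^ 2}) ?_
    have h1 : ∀ n : ℕ, (volume.restrict openSquare) {p | m (T^[n] p) < 1 / ((n : ℝ) + 1) ^ 2} ≤
        ENNReal.ofReal (C * (1 / ((n : ℝ) + 1) ^ 2)) := by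
      intro n
      refine le_trans (le_of_eq ?_) (hμ (1 / ((n : ℝ) + 1) ^ 2) (by positivity))
      exact (hT.iterate n).measure_preimage
        (isOpen_lt hc continuous_const).measurableSet.nullMeasurableSet
    refine ne_top_of_le_ne_top ?_ (ENNReal.tsum_le_tsum h1)
    refine Summable.tsum_ofReal_ne_top ?_
    refine Summable.mul_left C ?_
    have := (summable_nat_add_iff 1).2 (Real.summable_one_div_nat_pow.2 one_lt_two)
    simpa using this
  filter_upwards [hbc, ae_forall_iterate hT hpos] with p hp hp'
  obtain ⟨M, hM⟩ := Filter.eventually_atTop.1 hp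
  have hfin : ∃ c > 0, ∀ n < M, c ≤ m (T^[n] p) := by
    clear hM
    induction M with
    | zero => exact ⟨1, one_pos, by simp⟩
    | succ M ih =>
      obtain ⟨c, hc, h⟩ := ih
      refine ⟨min c (m (T^[M] p)), lt_min hc (hp' M), fun n hn => ?_⟩
      rcases Nat.lt_succ_iff_lt_or_eq.1 hn with h1 | rfl
      · exact (min_le_left _ _).trans (h n h1)
      · exact min_le_right _ _
  obtain ⟨c, hc, h⟩ := hfin
  refine ⟨min c 1, lt_min hc one_pos, fun n => ?_⟩
  rcases lt_or_ge n M with hn | hn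
  · refine le_trans ?_ (h n hn)
    refine (div_le_self (le_min hc.le zero_le_one) ?_).trans (min_le_left _ _)
    exact one_le_pow₀ (by linarith [(n.cast_nonneg : (0 : ℝ) ≤ n)])
  · refine le_trans ?_ (not_lt.1 (hM n hn))
    gcongr
    exact min_le_right _ _

/-- The iterates of `T` are affine as long as the orbit stays inside the margins. -/
lemma exists_affineOnBall_iterate {T : ℝ × ℝ → ℝ × ℝ} {D : ℝ × ℝ → (ℝ × ℝ →ₗ[ℝ] ℝ × ℝ)}
    {m : ℝ × ℝ → ℝ} (hm : ∀ p, AffineOnBall T p (D p) (m p)) {p w : ℝ × ℝ} :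
    ∀ n : ℕ, (∀ k < n, ‖iterDeriv T D p k w‖ < m (T^[k] p)) →
      ∃ r > 0, AffineOnBall (T^[n]) (p + w) (iterDeriv T D p n) r := by
  have key : ∀ n q, (∀ k < n, ‖iterDeriv T D p k (q - p)‖ < m (T^[k] p)) →
      T^[n] q = T^[n] p + iterDeriv T D p n (q - p) := by
    intro n q
    induction n with
    | zero => intro _; simp [iterDeriv]
    | succ n ih =>
      intro h
      have h1 := ih fun k hk => h k (hk.trans n.lt_succ_self)
      rw [Function.iterate_succ_apply', Function.iterate_succ_apply', h1,
        hm (T^[n] p) _ (by rw [add_sub_cancel_left]; exact h n n.lt_succ_self),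
        add_sub_cancel_left]
      rfl
  intro n h
  have hopen : IsOpen (⋂ k ∈ Finset.range n, {q | ‖iterDeriv T D p k (q - p)‖ < m (T^[k] p)}) := by
    refine isOpen_biInter_finset fun k _ => isOpen_lt ?_ continuous_const
    have := LinearMap.continuous_of_finiteDimensional (iterDeriv T D p k)
    fun_prop
  have hmem : p + w ∈ ⋂ k ∈ Finset.range n, {q | ‖iterDeriv T D p k (q - p)‖ < m (T^[k] p)} := by
    simpa using h
  obtain ⟨r, hr, hball⟩ := Metric.isOpen_iff.1 hopen _ hmem
  refine ⟨r, hr, fun q hq => ?_⟩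
  have hq' := hball (show q ∈ Metric.ball (p + w) r by rwa [mem_ball_iff_norm])
  rw [key n q (by simpa using hq'), key n (p + w) (by simpa using h), add_assoc, ← map_add]
  congr 2
  abel

lemma IsConeSystem.exists_leaf {T : ℝ × ℝ → ℝ × ℝ} {D : ℝ × ℝ → (ℝ × ℝ →ₗ[ℝ] ℝ × ℝ)}
    {Γ : Set (ℝ × ℝ)} {K : ℝ × ℝ → ℝ × ℝ → Prop} {e N : ℝ × ℝ → ℝ × ℝ → ℝ} {B : Set (ℝ × ℝ)}
    {C : ℝ} {m : ℝ × ℝ → ℝ} {p : ℝ × ℝ} (h : IsConeSystem T D Γ K e N B C)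
    (hm : ∀ p, AffineOnBall T p (D p) (m p)) (hp : ∀ n, T^[n] p ∈ Γ)
    (hmar : ∃ c > 0, ∀ n : ℕ, c / ((n : ℝ) + 1) ^ 2 ≤ m (T^[n] p))
    (hgap : ∃ M, ∀ n ≥ M, ∃ j, j ≤ n ∧ 7 * (n + 1) ≤ 8 * j ∧ T^[j] p ∈ B) :
    ∃ v, IsLeaf T p v ∧ K p v ∧ 0 < e p v ∧ K (T p) (D p v) ∧ 0 < e (T p) (D p v) := by
  obtain ⟨M, hM⟩ := id hgap
  obtain ⟨j, -, hj1, hj2⟩ := hM (M + 1) M.le_succ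
  obtain ⟨j, rfl⟩ : ∃ i, j = i + 1 := ⟨j - 1, by omega⟩
  have hj3 : 1 ≤ j := by omega
  obtain ⟨v, hv0, hv⟩ := h.exists_direction hp
  obtain ⟨C', hC'⟩ := h.exists_norm_le hp hv (h.energy_pos hp hv hv0 (Nat.zero_le j) hj2) hgap
  obtain ⟨c, hc, hmar⟩ := hmar
  have hC0 : 0 ≤ C' := by simpa using (norm_nonneg _).trans (hC' 0)
  obtain ⟨l, hl, hlC⟩ : ∃ l > 0, l * C' < c :=
    ⟨c / (C' + 1), by positivity, by rw [div_mul_eq_mul_div, div_lt_iff₀ (by positivity)]; nlinarith⟩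
  have hlv : ∀ n, K (T^[n] p) (iterDeriv T D p n (l • v)) := fun n => by
    rw [map_smul]; exact h.smul _ (hv n)
  refine ⟨l • v, ⟨smul_ne_zero hl.ne' hv0, iterDeriv T D p, l * C', h.det_iterDeriv hp,
    fun n => ?_, fun n t ht => ?_⟩, hlv 0,
    h.energy_pos hp hlv (smul_ne_zero hl.ne' hv0) (Nat.zero_le j) hj2, hlv 1,
    h.energy_pos hp hlv (smul_ne_zero hl.ne' hv0) hj3 hj2⟩
  · rw [map_smul, norm_smul, Real.norm_of_nonneg hl.le, mul_div_assoc]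
    refine mul_le_mul_of_nonneg_left ((hC' n).trans ?_) hl.le
    gcongr
    exact le_self_pow₀ (by linarith [(n.cast_nonneg : (0 : ℝ) ≤ n)]) (by norm_num)
  · refine exists_affineOnBall_iterate hm n fun k _ => ?_
    refine lt_of_lt_of_le ?_ (hmar k)
    rw [map_smul, map_smul, norm_smul, norm_smul, Real.norm_of_nonneg hl.le]
    have h1 : ‖t‖ ≤ 1 := ht
    have h2 : C' / ((k : ℝ) + 1) ^ 5 ≤ C' / ((k : ℝ) + 1) ^ 2 := by
      gcongr
      · linarith [(k.cast_nonneg : (0 : ℝ) ≤ k)]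
      · norm_num
    calc _ ≤ 1 * (l * (C' / ((k : ℝ) + 1) ^ 2)) := by
          have := (hC' k).trans h2
          gcongr
      _ = l * C' / ((k : ℝ) + 1) ^ 2 := by ring
      _ < _ := by gcongr

/-- The half-turn around the center of the unit square. -/
def halfTurn (p : ℝ × ℝ) : ℝ × ℝ := (1 - p.1, 1 - p.2)

@[simp] lemma halfTurn_halfTurn (p) : halfTurn (halfTurn p) = p := by simp [halfTurn]

/-- The affine form `l` precomposed with the half-turn. -/
def halfTurnLine (l : ℤ × ℤ × ℤ) : ℤ × ℤ × ℤ := (-l.1, -l.2.1, l.1 + l.2.1 + l.2.2)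

lemma lineEval_halfTurnLine (l p) : lineEval (halfTurnLine l) p = lineEval l (halfTurn p) := by
  simp only [lineEval, halfTurnLine, halfTurn]; push_cast; ring

lemma mem_cell_map_halfTurnLine (L p) : p ∈ cell (L.map halfTurnLine) ↔ halfTurn p ∈ cell L := by
  simp only [cell, Set.mem_ofPred_eq, List.forall_mem_map, lineEval_halfTurnLine]

/-- Conjugation by the half-turn. -/
def IntAffine.halfTurnConj (A : IntAffine) : IntAffine :=
  ⟨A.a, A.b, A.c, A.d, 1 - A.a - A.b - A.e, 1 - A.c - A.d - A.f⟩

lemma IntAffine.halfTurnConj_act (A : IntAffine) (p) :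
    A.halfTurnConj.act p = halfTurn (A.act (halfTurn p)) := by
  ext <;> simp only [act, halfTurnConj, halfTurn] <;> push_cast <;> ring

/-- Conjugation of a table by the half-turn. -/
def PLTable.halfTurnConj (tb : PLTable) : PLTable :=
  List.map (fun a => (a.1.map halfTurnLine, a.2.halfTurnConj)) tb

/-- The identity outside the unit square. -/
def outerTable : PLTable :=
  [([(-1, 0, 0)], ⟨1, 0, 0, 1, 0, 0⟩), ([(0, -1, 0)], ⟨1, 0, 0, 1, 0, 0⟩),
   ([(1, 0, -1)], ⟨1, 0, 0, 1, 0, 0⟩), ([(0, 1, -1)], ⟨1, 0, 0, 1, 0, 0⟩)]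

/-- The table of a third of a turn around the triangle `0 ≤ y ≤ x ≤ 1`. -/
def triTable : PLTable :=
  [([(0, 4, -1), (-4, 0, 3), (4, -4, -1)], ⟨0, -1, 1, -1, 1, 0⟩),
   ([(0, 1, 0), (-1, -1, 1), (1, -2, 0), (0, -4, 1), (-1, -2, 1)], ⟨1, 1, 0, 1, 0, 0⟩),
   ([(0, 1, 0), (-1, -1, 1), (1, -2, 0), (0, -4, 1), (1, 2, -1)], ⟨0, -1, 1, 3, 1, -1⟩),
   ([(-1, 0, 1), (1, 1, -1), (2, -1, -1), (4, 0, -3), (3, -1, -2)], ⟨1, 0, -1, 1, 0, 1⟩),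
   ([(-1, 0, 1), (1, 1, -1), (2, -1, -1), (4, 0, -3), (-3, 1, 2)], ⟨4, -1, 5, -1, -2, -3⟩),
   ([(1, -1, 0), (-1, 2, 0), (-2, 1, 1), (-4, 4, 1), (-2, 3, 0)], ⟨0, 1, -1, 2, 0, 0⟩),
   ([(1, -1, 0), (-1, 2, 0), (-2, 1, 1), (-4, 4, 1), (2, -3, 0)], ⟨4, -5, 1, -1, 0, 0⟩)]

/-- The table of a third of a turn around both triangles cut by the diagonal. -/
def triangleTable : PLTable := outerTable ++ (triTable ++ triTable.halfTurnConj)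

lemma forall_mem_triTable {P : List (ℤ × ℤ × ℤ) × IntAffine → Prop}
    (h : P ([(0, 4, -1), (-4, 0, 3), (4, -4, -1)], ⟨0, -1, 1, -1, 1, 0⟩) ∧
      P ([(0, 1, 0), (-1, -1, 1), (1, -2, 0), (0, -4, 1), (-1, -2, 1)], ⟨1, 1, 0, 1, 0, 0⟩) ∧
      P ([(0, 1, 0), (-1, -1, 1), (1, -2, 0), (0, -4, 1), (1, 2, -1)], ⟨0, -1, 1, 3, 1, -1⟩) ∧
      P ([(-1, 0, 1), (1, 1, -1), (2, -1, -1), (4, 0, -3), (3, -1, -2)], ⟨1, 0, -1, 1, 0, 1⟩) ∧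
      P ([(-1, 0, 1), (1, 1, -1), (2, -1, -1), (4, 0, -3), (-3, 1, 2)], ⟨4, -1, 5, -1, -2, -3⟩) ∧
      P ([(1, -1, 0), (-1, 2, 0), (-2, 1, 1), (-4, 4, 1), (-2, 3, 0)], ⟨0, 1, -1, 2, 0, 0⟩) ∧
      P ([(1, -1, 0), (-1, 2, 0), (-2, 1, 1), (-4, 4, 1), (2, -3, 0)], ⟨4, -5, 1, -1, 0, 0⟩)) :
    ∀ a ∈ triTable, P a := by
  simpa [triTable] using h

lemma triTable_region : ∀ a ∈ triTable, ∀ p ∈ cell a.1, 0 ≤ p.2 ∧ p.2 ≤ p.1 ∧ p.1 ≤ 1 := by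
  refine forall_mem_triTable ?_
  simp only [mem_cell_cons, mem_cell_nil, and_true, lineEval]
  push_cast
  and_intros <;> (rintro p h; and_intros <;> linarith)

lemma triTable_boundary : ∀ a ∈ triTable, ∀ p ∈ cell a.1, (p.2 ≤ 0 ∨ 1 ≤ p.1 ∨ p.1 ≤ p.2) →
    a.2.act p = p := by
  refine forall_mem_triTable ?_
  simp only [mem_cell_cons, mem_cell_nil, and_true, lineEval, IntAffine.act]
  push_cast
  and_intros <;> (rintro p h (h1 | h1 | h1) <;> ext <;> simp only <;> linarith)

lemma triTable_compat : triTable.Pairwise PLTable.Compat := by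
  simp only [triTable, List.pairwise_cons, List.mem_cons, List.not_mem_nil, or_false,
    forall_eq_or_imp, forall_eq, PLTable.Compat, mem_cell_cons, mem_cell_nil, and_true, lineEval,
    IntAffine.act, List.Pairwise.nil, Prod.mk.injEq, IsEmpty.forall_iff, implies_true, and_imp]
  push_cast
  repeat' refine And.intro ?_ ?_
  all_goals first
    | trivial
    | (intros; refine ⟨?_, ?_⟩ <;> first | trivial | linarith)
    | (intros; linarith)

lemma triTable_cover {p : ℝ × ℝ} (h : 0 ≤ p.2) (h' : p.2 ≤ p.1) (h1 : p.1 ≤ 1) :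
    ∃ a ∈ triTable, p ∈ cell a.1 := by
  simp only [triTable, List.exists_mem_cons_iff, List.not_mem_nil, mem_cell_cons, mem_cell_nil,
    lineEval, false_and, exists_false, or_false, and_true]
  push_cast
  by_cases hc : 1 ≤ 4 * p.2 ∧ 4 * p.1 ≤ 3 ∧ 1 ≤ 4 * (p.1 - p.2)
  · left; obtain ⟨h2, h3, h4⟩ := hc; and_intros <;> linarith
  right
  simp only [not_and_or, not_le] at hc
  by_cases hb : p.2 ≤ 1 - p.1 ∧ p.2 ≤ p.1 - p.2
  · have : 4 * p.2 ≤ 1 := by rcases hc with hc | hc | hc <;> linarith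
    rcases le_total (p.1 + 2 * p.2) 1 with hg | hg
    · left; and_intros <;> linarith
    · right; left; and_intros <;> linarith
  right; right
  by_cases hr : 1 - p.1 ≤ p.2 ∧ 1 - p.1 ≤ p.1 - p.2
  · have : 3 ≤ 4 * p.1 := by rcases hc with hc | hc | hc <;> linarith
    rcases le_total 2 (3 * p.1 - p.2) with hg | hg
    · left; and_intros <;> linarith
    · right; left; and_intros <;> linarith
  right; right
  have hd : p.1 - p.2 ≤ p.2 ∧ p.1 - p.2 ≤ 1 - p.1 := by
    simp only [not_and_or, not_le] at hb hr
    constructor <;> rcases hb with hb | hb <;> rcases hr with hr | hr <;> linarith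
  have : 4 * p.1 - 4 * p.2 ≤ 1 := by rcases hc with hc | hc | hc <;> linarith
  rcases le_total (2 * p.1) (3 * p.2) with hg | hg
  · left; and_intros <;> linarith
  · right; and_intros <;> linarith

lemma mem_outerTable {a} (h : a ∈ outerTable) {p} (hp : p ∈ cell a.1) :
    a.2 = ⟨1, 0, 0, 1, 0, 0⟩ ∧ (p.1 ≤ 0 ∨ p.2 ≤ 0 ∨ 1 ≤ p.1 ∨ 1 ≤ p.2) := by
  simp only [outerTable, List.mem_cons, List.not_mem_nil, or_false] at h
  rcases h with rfl | rfl | rfl | rfl <;>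
    simp only [mem_cell_cons, mem_cell_nil, and_true, lineEval] at hp <;> push_cast at hp <;>
    refine ⟨rfl, ?_⟩
  · left; linarith
  · right; left; linarith
  · right; right; left; linarith
  · right; right; right; linarith

lemma exists_mem_outerTable {p : ℝ × ℝ} (hp : p.1 ≤ 0 ∨ p.2 ≤ 0 ∨ 1 ≤ p.1 ∨ 1 ≤ p.2) :
    ∃ a ∈ outerTable, p ∈ cell a.1 := by
  simp only [outerTable, List.exists_mem_cons_iff, List.not_mem_nil, mem_cell_cons, mem_cell_nil,
    lineEval, false_and, exists_false, or_false, and_true]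
  push_cast
  rcases hp with h | h | h | h
  · left; linarith
  · right; left; linarith
  · right; right; left; linarith
  · right; right; right; linarith

lemma one_act (p : ℝ × ℝ) : IntAffine.act ⟨1, 0, 0, 1, 0, 0⟩ p = p := by
  ext <;> simp [IntAffine.act]

lemma pairwise_compat_outerTable_append {tb : PLTable} (h : tb.Pairwise PLTable.Compat)
    (hb : ∀ a ∈ tb, ∀ p ∈ cell a.1, (p.1 ≤ 0 ∨ p.2 ≤ 0 ∨ 1 ≤ p.1 ∨ 1 ≤ p.2) → a.2.act p = p) :
    (outerTable ++ tb).Pairwise PLTable.Compat := by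
  refine List.pairwise_append.2 ⟨?_, h, fun a ha b hb' p hpa hpb => ?_⟩
  · refine List.Pairwise.imp_of_mem (R := fun _ _ => True) ?_ (List.pairwise_of_forall fun _ _ => trivial)
    intro a b ha hb _ p hpa hpb
    rw [(mem_outerTable ha hpa).1, (mem_outerTable hb hpb).1]
  · obtain ⟨h1, h2⟩ := mem_outerTable ha hpa
    rw [h1, one_act, hb b hb' p hpb h2]

lemma mem_halfTurnConj {tb : PLTable} {a} : a ∈ tb.halfTurnConj ↔
    ∃ b ∈ tb, (b.1.map halfTurnLine, b.2.halfTurnConj) = a := by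
  rw [PLTable.halfTurnConj, List.mem_map]

lemma triangleTable_compat : triangleTable.Pairwise PLTable.Compat := by
  refine pairwise_compat_outerTable_append (List.pairwise_append.2
    ⟨triTable_compat, ?_, fun a ha b hb p hpa hpb => ?_⟩) fun a ha p hp h => ?_
  · refine List.Pairwise.map _ (fun a b h p hpa hpb => ?_) triTable_compat
    rw [mem_cell_map_halfTurnLine] at hpa hpb
    rw [IntAffine.halfTurnConj_act, IntAffine.halfTurnConj_act, h _ hpa hpb]
  · obtain ⟨b', hb', rfl⟩ := mem_halfTurnConj.1 hb
    rw [mem_cell_map_halfTurnLine] at hpb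
    have h1 := triTable_region _ ha _ hpa
    have h2 := triTable_region _ hb' _ hpb
    simp only [halfTurn] at h2
    rw [IntAffine.halfTurnConj_act, triTable_boundary _ ha _ hpa (by right; right; linarith),
      triTable_boundary _ hb' _ hpb (by right; right; simp only [halfTurn]; linarith),
      halfTurn_halfTurn]
  · rcases List.mem_append.1 ha with ha | ha
    · refine triTable_boundary _ ha _ hp ?_
      have := triTable_region _ ha _ hp
      rcases h with h | h | h | h
      · left; linarith
      · left; linarith
      · right; left; linarith
      · right; left; linarith
    · obtain ⟨b, hb, rfl⟩ := mem_halfTurnConj.1 ha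
      rw [mem_cell_map_halfTurnLine] at hp
      have := triTable_region _ hb _ hp
      rw [IntAffine.halfTurnConj_act, triTable_boundary _ hb _ hp, halfTurn_halfTurn]
      simp only [halfTurn] at this ⊢
      rcases h with h | h | h | h
      · right; left; linarith
      · right; left; linarith
      · left; linarith
      · left; linarith

lemma triangleTable_cover (p : ℝ × ℝ) : ∃ a ∈ triangleTable, p ∈ cell a.1 := by
  by_cases hp : p.1 ≤ 0 ∨ p.2 ≤ 0 ∨ 1 ≤ p.1 ∨ 1 ≤ p.2
  · obtain ⟨a, ha, h⟩ := exists_mem_outerTable hp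
    exact ⟨a, List.mem_append_left _ ha, h⟩
  · push Not at hp
    rcases le_total p.2 p.1 with h | h
    · obtain ⟨a, ha, h⟩ := triTable_cover hp.2.1.le h hp.2.2.1.le
      exact ⟨a, List.mem_append_right _ (List.mem_append_left _ ha), h⟩
    · obtain ⟨a, ha, h⟩ := triTable_cover (p := halfTurn p) (by simp only [halfTurn]; linarith)
        (by simp only [halfTurn]; linarith) (by simp only [halfTurn]; linarith)
      refine ⟨_, List.mem_append_right _ (List.mem_append_right _ (mem_halfTurnConj.2 ⟨a, ha, rfl⟩)), ?_⟩
      rwa [mem_cell_map_halfTurnLine]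

lemma triangleTable_det : ∀ a ∈ triangleTable, |a.2.det| = 1 := by
  have : ∀ a ∈ triTable, |a.2.det| = 1 := forall_mem_triTable (by simp [IntAffine.det])
  intro a ha
  rcases List.mem_append.1 ha with ha | ha
  · simp only [outerTable, List.mem_cons, List.not_mem_nil, or_false] at ha
    rcases ha with rfl | rfl | rfl | rfl <;> simp [IntAffine.det]
  rcases List.mem_append.1 ha with ha | ha
  · exact this a ha
  · obtain ⟨b, hb, rfl⟩ := mem_halfTurnConj.1 ha
    exact this b hb

/-- A third of a turn around each of the two triangles cut by the diagonal. -/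
noncomputable def triangleStep : ℝ × ℝ → ℝ × ℝ := triangleTable.map

lemma isPL_triangleStep : IsPL triangleStep :=
  PLTable.isPL triangleTable_compat triangleTable_cover triangleTable_det

lemma triangleStep_of_outer {p : ℝ × ℝ} (hp : p.1 ≤ 0 ∨ p.2 ≤ 0 ∨ 1 ≤ p.1 ∨ 1 ≤ p.2) :
    triangleStep p = p := by
  obtain ⟨a, ha, h⟩ := exists_mem_outerTable hp
  rw [triangleStep, PLTable.map_eq triangleTable_compat (List.mem_append_left _ ha) h,
    (mem_outerTable ha h).1, one_act]

lemma triangleStep_eq {a} (ha : a ∈ triTable) {p} (hp : p ∈ cell a.1) :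
    triangleStep p = a.2.act p :=
  PLTable.map_eq triangleTable_compat (List.mem_append_right _ (List.mem_append_left _ ha)) hp

lemma triangleStep_eq' {a} (ha : a ∈ triTable) {p} (hp : halfTurn p ∈ cell a.1) :
    triangleStep p = halfTurn (a.2.act (halfTurn p)) := by
  rw [← IntAffine.halfTurnConj_act]
  refine PLTable.map_eq triangleTable_compat (L := a.1.map halfTurnLine) (List.mem_append_right _
    (List.mem_append_right _ (mem_halfTurnConj.2 ⟨a, ha, rfl⟩))) ?_
  rwa [mem_cell_map_halfTurnLine]

/-- A point of the plane lies outside the open square, in the lower triangle or in the upper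
triangle. -/
lemma triangle_cases (p : ℝ × ℝ) : (p.1 ≤ 0 ∨ p.2 ≤ 0 ∨ 1 ≤ p.1 ∨ 1 ≤ p.2) ∨
    (∃ a ∈ triTable, p ∈ cell a.1) ∨ ∃ a ∈ triTable, halfTurn p ∈ cell a.1 := by
  obtain ⟨a, ha, h⟩ := triangleTable_cover p
  rcases List.mem_append.1 ha with ha | ha
  · exact Or.inl (mem_outerTable ha h).2
  rcases List.mem_append.1 ha with ha | ha
  · exact Or.inr (Or.inl ⟨a, ha, h⟩)
  · obtain ⟨b, hb, rfl⟩ := mem_halfTurnConj.1 ha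
    exact Or.inr (Or.inr ⟨b, hb, (mem_cell_map_halfTurnLine _ _).1 h⟩)

lemma triangleStep_halfTurn (p) : triangleStep (halfTurn p) = halfTurn (triangleStep p) := by
  rcases triangle_cases p with h | ⟨a, ha, h⟩ | ⟨a, ha, h⟩
  · rw [triangleStep_of_outer h, triangleStep_of_outer]
    simp only [halfTurn]
    rcases h with h | h | h | h
    · right; right; left; linarith
    · right; right; right; linarith
    · left; linarith
    · right; left; linarith
  · rw [triangleStep_eq ha h, triangleStep_eq' ha (by simpa using h), halfTurn_halfTurn]
  · rw [triangleStep_eq ha h, triangleStep_eq' ha h, halfTurn_halfTurn]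

/-- The identity outside the square of side `1 / 2`. -/
def frameTable : PLTable :=
  [([(-4, 0, 1)], ⟨1, 0, 0, 1, 0, 0⟩),
   ([(0, -4, 1)], ⟨1, 0, 0, 1, 0, 0⟩),
   ([(4, 0, -3)], ⟨1, 0, 0, 1, 0, 0⟩),
   ([(0, 4, -3)], ⟨1, 0, 0, 1, 0, 0⟩)]

/-- The table of a partial turn around the square of side `1 / 2`. -/
def innerTable : PLTable :=
  [([(8, 0, -3), (-8, 0, 5), (0, 8, -3), (0, -8, 5)], ⟨-1, 0, 0, -1, 1, 1⟩),
   ([(0, 4, -1), (0, -8, 3), (1, -1, 0), (-1, -1, 1), (1, -5, 1)], ⟨1, -4, 0, 1, 1, 0⟩),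
   ([(0, 4, -1), (0, -8, 3), (1, -1, 0), (-1, -1, 1), (-1, 5, -1), (1, -7, 2)], ⟨0, 1, -1, 6, 0, -1⟩),
   ([(0, 4, -1), (0, -8, 3), (1, -1, 0), (-1, -1, 1), (-1, 7, -2)], ⟨-1, 8, 0, -1, -2, 1⟩),
   ([(-4, 0, 3), (8, 0, -5), (1, 1, -1), (1, -1, 0), (5, 1, -4)], ⟨1, 0, 4, 1, 0, -3⟩),
   ([(-4, 0, 3), (8, 0, -5), (1, 1, -1), (1, -1, 0), (-5, -1, 4), (7, 1, -5)], ⟨6, 1, -1, 0, -4, 1⟩),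
   ([(-4, 0, 3), (8, 0, -5), (1, 1, -1), (1, -1, 0), (-7, -1, 5)], ⟨-1, 0, -8, -1, 1, 6⟩),
   ([(0, -4, 3), (0, 8, -5), (-1, 1, 0), (1, 1, -1), (-1, 5, -3)], ⟨1, -4, 0, 1, 3, 0⟩),
   ([(0, -4, 3), (0, 8, -5), (-1, 1, 0), (1, 1, -1), (1, -5, 3), (-1, 7, -4)], ⟨0, 1, -1, 6, 0, -3⟩),
   ([(0, -4, 3), (0, 8, -5), (-1, 1, 0), (1, 1, -1), (1, -7, 4)], ⟨-1, 8, 0, -1, -4, 1⟩),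
   ([(4, 0, -1), (-8, 0, 3), (-1, -1, 1), (-1, 1, 0), (-5, -1, 2)], ⟨1, 0, 4, 1, 0, -1⟩),
   ([(4, 0, -1), (-8, 0, 3), (-1, -1, 1), (-1, 1, 0), (5, 1, -2), (-7, -1, 3)], ⟨6, 1, -1, 0, -2, 1⟩),
   ([(4, 0, -1), (-8, 0, 3), (-1, -1, 1), (-1, 1, 0), (7, 1, -3)], ⟨-1, 0, -8, -1, 1, 4⟩)]

/-- The table of a partial turn around the center of the unit square. -/
def squareTable : PLTable := frameTable ++ innerTable

lemma innerTable_boundary : ∀ a ∈ innerTable, ∀ p ∈ cell a.1,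
    (4 * p.1 ≤ 1 ∨ 4 * p.2 ≤ 1 ∨ 3 ≤ 4 * p.1 ∨ 3 ≤ 4 * p.2) → a.2.act p = p := by
  simp only [innerTable, List.forall_mem_cons, List.not_mem_nil, IsEmpty.forall_iff, implies_true,
    and_true, mem_cell_cons, mem_cell_nil, lineEval, IntAffine.act]
  push_cast
  and_intros <;> (rintro p h (h1 | h1 | h1 | h1) <;> ext <;> simp only <;> linarith)

lemma innerTable_compat : innerTable.Pairwise PLTable.Compat := by
  simp only [innerTable, List.pairwise_cons, List.mem_cons, List.not_mem_nil, or_false,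
    forall_eq_or_imp, forall_eq, PLTable.Compat, mem_cell_cons, mem_cell_nil, and_true, lineEval,
    IntAffine.act, List.Pairwise.nil, Prod.mk.injEq, IsEmpty.forall_iff, implies_true, and_imp]
  push_cast
  repeat' refine And.intro ?_ ?_
  all_goals first
    | trivial
    | (intros; refine ⟨?_, ?_⟩ <;> first | trivial | linarith)
    | (intros; linarith)

lemma innerTable_cover {p : ℝ × ℝ} (h1 : 1 ≤ 4 * p.1) (h2 : 4 * p.1 ≤ 3) (h3 : 1 ≤ 4 * p.2)
    (h4 : 4 * p.2 ≤ 3) : ∃ a ∈ innerTable, p ∈ cell a.1 := by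
  simp only [innerTable, List.exists_mem_cons_iff, List.not_mem_nil, mem_cell_cons, mem_cell_nil,
    lineEval, false_and, exists_false, or_false, and_true]
  push_cast
  by_cases hc : 3 ≤ 8 * p.1 ∧ 8 * p.1 ≤ 5 ∧ 3 ≤ 8 * p.2 ∧ 8 * p.2 ≤ 5
  · left; obtain ⟨h2, h3, h4⟩ := hc; and_intros <;> linarith
  right
  simp only [not_and_or, not_le] at hc
  rcases le_total p.2 p.1 with hd | hd <;> rcases le_total (p.1 + p.2) 1 with ha | ha
  · have : 8 * p.2 ≤ 3 := by rcases hc with hc | hc | hc | hc <;> linarith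
    rcases le_total (5 * p.2 - 1) p.1 with hb | hb
    · left; and_intros <;> linarith
    rcases le_total (7 * p.2 - 2) p.1 with hb' | hb'
    · right; left; and_intros <;> linarith
    · right; right; left; and_intros <;> linarith
  · have : 5 ≤ 8 * p.1 := by rcases hc with hc | hc | hc | hc <;> linarith
    iterate 3 right
    rcases le_total (4 - 5 * p.1) p.2 with hb | hb
    · left; and_intros <;> linarith
    rcases le_total (5 - 7 * p.1) p.2 with hb' | hb'
    · right; left; and_intros <;> linarith
    · right; right; left; and_intros <;> linarith
  · have : 8 * p.1 ≤ 3 := by rcases hc with hc | hc | hc | hc <;> linarith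
    iterate 9 right
    rcases le_total (p.2) (2 - 5 * p.1) with hb | hb
    · left; and_intros <;> linarith
    rcases le_total (p.2) (3 - 7 * p.1) with hb' | hb'
    · right; left; and_intros <;> linarith
    · right; right; and_intros <;> linarith
  · have : 5 ≤ 8 * p.2 := by rcases hc with hc | hc | hc | hc <;> linarith
    iterate 6 right
    rcases le_total p.1 (5 * p.2 - 3) with hb | hb
    · left; and_intros <;> linarith
    rcases le_total p.1 (7 * p.2 - 4) with hb' | hb'
    · right; left; and_intros <;> linarith
    · right; right; left; and_intros <;> linarith

lemma mem_frameTable {a} (h : a ∈ frameTable) {p} (hp : p ∈ cell a.1) :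
    a.2 = ⟨1, 0, 0, 1, 0, 0⟩ ∧ (4 * p.1 ≤ 1 ∨ 4 * p.2 ≤ 1 ∨ 3 ≤ 4 * p.1 ∨ 3 ≤ 4 * p.2) := by
  simp only [frameTable, List.mem_cons, List.not_mem_nil, or_false] at h
  rcases h with rfl | rfl | rfl | rfl <;>
    simp only [mem_cell_cons, mem_cell_nil, and_true, lineEval] at hp <;> push_cast at hp <;>
    refine ⟨rfl, ?_⟩
  · left; linarith
  · right; left; linarith
  · right; right; left; linarith
  · right; right; right; linarith

lemma exists_mem_frameTable {p : ℝ × ℝ}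
    (hp : 4 * p.1 ≤ 1 ∨ 4 * p.2 ≤ 1 ∨ 3 ≤ 4 * p.1 ∨ 3 ≤ 4 * p.2) :
    ∃ a ∈ frameTable, p ∈ cell a.1 := by
  simp only [frameTable, List.exists_mem_cons_iff, List.not_mem_nil, mem_cell_cons, mem_cell_nil,
    lineEval, false_and, exists_false, or_false, and_true]
  push_cast
  rcases hp with h | h | h | h
  · left; linarith
  · right; left; linarith
  · right; right; left; linarith
  · right; right; right; linarith

lemma squareTable_compat : squareTable.Pairwise PLTable.Compat := by
  refine List.pairwise_append.2 ⟨?_, innerTable_compat, fun a ha b hb p hpa hpb => ?_⟩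
  · refine List.Pairwise.imp_of_mem (R := fun _ _ => True) ?_ (List.pairwise_of_forall fun _ _ => trivial)
    intro a b ha hb _ p hpa hpb
    rw [(mem_frameTable ha hpa).1, (mem_frameTable hb hpb).1]
  · obtain ⟨h1, h2⟩ := mem_frameTable ha hpa
    rw [h1, one_act, innerTable_boundary b hb p hpb h2]

lemma squareTable_cover (p : ℝ × ℝ) : ∃ a ∈ squareTable, p ∈ cell a.1 := by
  by_cases hp : 4 * p.1 ≤ 1 ∨ 4 * p.2 ≤ 1 ∨ 3 ≤ 4 * p.1 ∨ 3 ≤ 4 * p.2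
  · obtain ⟨a, ha, h⟩ := exists_mem_frameTable hp
    exact ⟨a, List.mem_append_left _ ha, h⟩
  · push Not at hp
    obtain ⟨a, ha, h⟩ := innerTable_cover hp.1.le hp.2.2.1.le hp.2.1.le hp.2.2.2.le
    exact ⟨a, List.mem_append_right _ ha, h⟩

lemma squareTable_det : ∀ a ∈ squareTable, |a.2.det| = 1 := by
  simp [squareTable, frameTable, innerTable, IntAffine.det]

/-- A partial turn around the center of the unit square. -/
noncomputable def squareStep : ℝ × ℝ → ℝ × ℝ := squareTable.map

lemma isPL_squareStep : IsPL squareStep :=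
  PLTable.isPL squareTable_compat squareTable_cover squareTable_det

lemma squareStep_of_frame {p : ℝ × ℝ}
    (hp : 4 * p.1 ≤ 1 ∨ 4 * p.2 ≤ 1 ∨ 3 ≤ 4 * p.1 ∨ 3 ≤ 4 * p.2) : squareStep p = p := by
  obtain ⟨a, ha, h⟩ := exists_mem_frameTable hp
  rw [squareStep, PLTable.map_eq squareTable_compat (List.mem_append_left _ ha) h,
    (mem_frameTable ha h).1, one_act]

lemma squareStep_eq {a} (ha : a ∈ innerTable) {p} (hp : p ∈ cell a.1) :
    squareStep p = a.2.act p :=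
  PLTable.map_eq squareTable_compat (List.mem_append_right _ ha) hp

lemma square_cases (p : ℝ × ℝ) : (4 * p.1 ≤ 1 ∨ 4 * p.2 ≤ 1 ∨ 3 ≤ 4 * p.1 ∨ 3 ≤ 4 * p.2) ∨
    ∃ a ∈ innerTable, p ∈ cell a.1 := by
  obtain ⟨a, ha, h⟩ := squareTable_cover p
  rcases List.mem_append.1 ha with ha | ha
  · exact Or.inl (mem_frameTable ha h).2
  · exact Or.inr ⟨a, ha, h⟩

/-- The height above the boundary of the lower triangle, vanishing outside it. -/
noncomputable def lowerHeight (p : ℝ × ℝ) : ℝ := max 0 (min (p.1 - p.2) (min p.2 (1 - p.1)))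

/-- The signed height above the boundaries of the two triangles. -/
noncomputable def triHeight (p : ℝ × ℝ) : ℝ := lowerHeight p - lowerHeight (halfTurn p)

/-- The height above the boundary of the square. -/
noncomputable def sqHeight (p : ℝ × ℝ) : ℝ := min (min p.1 (1 - p.1)) (min p.2 (1 - p.2))

lemma continuous_halfTurn : Continuous halfTurn := by unfold halfTurn; fun_prop

lemma continuous_lowerHeight : Continuous lowerHeight := by unfold lowerHeight; fun_prop

lemma continuous_triHeight : Continuous triHeight :=
  continuous_lowerHeight.sub (continuous_lowerHeight.comp continuous_halfTurn)

lemma continuous_sqHeight : Continuous sqHeight := by unfold sqHeight; fun_prop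

lemma triHeight_halfTurn (p) : triHeight (halfTurn p) = -triHeight p := by
  simp [triHeight]

lemma halfTurn_swap (p : ℝ × ℝ) : halfTurn p.swap = (halfTurn p).swap := rfl

lemma sqHeight_halfTurn (p : ℝ × ℝ) : sqHeight (halfTurn p) = sqHeight p := by
  simp only [sqHeight, halfTurn, sub_sub_cancel]
  rw [min_comm p.1, min_comm p.2]

lemma lowerHeight_eq {p : ℝ × ℝ} {m : ℝ} (h0 : 0 ≤ m) (h1 : m ≤ p.1 - p.2) (h2 : m ≤ p.2)
    (h3 : m ≤ 1 - p.1) (h : p.1 - p.2 ≤ m ∨ p.2 ≤ m ∨ 1 - p.1 ≤ m) : lowerHeight p = m := by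
  have : min (p.1 - p.2) (min p.2 (1 - p.1)) = m := by
    refine le_antisymm ?_ (le_min h1 (le_min h2 h3))
    simpa [min_le_iff] using h
  rw [lowerHeight, this, max_eq_right h0]

lemma lowerHeight_eq_zero {p : ℝ × ℝ} (h : p.1 ≤ p.2) : lowerHeight p = 0 := by
  rw [lowerHeight, max_eq_left]
  exact (min_le_left _ _).trans (by linarith)

lemma lowerHeight_act : ∀ a ∈ triTable, ∀ p ∈ cell a.1,
    lowerHeight (a.2.act p) = lowerHeight p ∧ (a.2.act p).2 ≤ (a.2.act p).1 := by
  refine forall_mem_triTable ?_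
  simp only [mem_cell_cons, mem_cell_nil, and_true, lineEval, IntAffine.act]
  push_cast
  refine ⟨?_, ?_, ?_, ?_, ?_, ?_, ?_⟩ <;> rintro p h
  · refine ⟨?_, by linarith⟩
    simp only [lowerHeight]
    have : max 0 (min (1 - p.1) (min (p.1 - p.2) p.2)) =
        max 0 (min (p.1 - p.2) (min p.2 (1 - p.1))) := by rw [min_comm (1 - p.1), min_assoc]
    rw [← this]
    congr 2
    · ring
    · congr 1 <;> ring
  all_goals
    refine ⟨?_, by linarith⟩
  · rw [lowerHeight_eq (m := p.2), lowerHeight_eq (m := p.2)] <;> first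
      | linarith
      | exact Or.inr (Or.inl (by linarith))
  · rw [lowerHeight_eq (m := p.2), lowerHeight_eq (m := p.2)] <;> first
      | linarith
      | exact Or.inr (Or.inl (by linarith))
      | exact Or.inr (Or.inr (by linarith))
  · rw [lowerHeight_eq (m := 1 - p.1), lowerHeight_eq (m := 1 - p.1)] <;> first
      | linarith
      | exact Or.inr (Or.inr (by linarith))
  · rw [lowerHeight_eq (m := 1 - p.1), lowerHeight_eq (m := 1 - p.1)] <;> first
      | linarith
      | exact Or.inr (Or.inr (by linarith))
      | exact Or.inl (by linarith)
  · rw [lowerHeight_eq (m := p.1 - p.2), lowerHeight_eq (m := p.1 - p.2)] <;> first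
      | linarith
      | exact Or.inl (by linarith)
  · rw [lowerHeight_eq (m := p.1 - p.2), lowerHeight_eq (m := p.1 - p.2)] <;> first
      | linarith
      | exact Or.inl (by linarith)
      | exact Or.inr (Or.inl (by linarith))

lemma lowerHeight_triangleStep (p) : lowerHeight (triangleStep p) = lowerHeight p := by
  rcases triangle_cases p with h | ⟨a, ha, h⟩ | ⟨a, ha, h⟩
  · rw [triangleStep_of_outer h]
  · rw [triangleStep_eq ha h, (lowerHeight_act a ha p h).1]
  · rw [triangleStep_eq' ha h]
    have h1 := (lowerHeight_act a ha _ h).2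
    have h2 := triTable_region a ha _ h
    simp only [halfTurn] at h2
    rw [lowerHeight_eq_zero, lowerHeight_eq_zero]
    · linarith
    · simp only [halfTurn] at h1 ⊢; linarith

lemma triHeight_triangleStep (p) : triHeight (triangleStep p) = triHeight p := by
  rw [triHeight, triHeight, ← triangleStep_halfTurn, lowerHeight_triangleStep,
    lowerHeight_triangleStep]

lemma exists_mem_triTable_inverse : ∀ a ∈ triTable, ∀ p ∈ cell a.1, ∃ b ∈ triTable,
    halfTurn (a.2.act p).swap ∈ cell b.1 ∧
      b.2.act (halfTurn (a.2.act p).swap) = halfTurn p.swap := by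
  refine forall_mem_triTable ?_
  simp only [mem_cell_cons, mem_cell_nil, and_true, lineEval, IntAffine.act, triTable,
    List.exists_mem_cons_iff, List.not_mem_nil, false_and, exists_false, or_false, halfTurn,
    Prod.fst_swap, Prod.snd_swap, Prod.mk.injEq]
  push_cast
  refine ⟨?_, ?_, ?_, ?_, ?_, ?_, ?_⟩ <;> rintro p h
  · left; and_intros <;> linarith
  · iterate 3 right
    left; and_intros <;> linarith
  · iterate 2 right
    left; and_intros <;> linarith
  · iterate 1 right
    left; and_intros <;> linarith
  · iterate 6 right
    and_intros <;> linarith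
  · iterate 5 right
    left; and_intros <;> linarith
  · iterate 4 right
    left; and_intros <;> linarith

lemma triangleStep_swap_triangleStep (p : ℝ × ℝ) : triangleStep (triangleStep p).swap = p.swap := by
  have key : ∀ p : ℝ × ℝ, (∃ a ∈ triTable, p ∈ cell a.1) →
      triangleStep (halfTurn (triangleStep p).swap) = halfTurn p.swap := by
    rintro p ⟨a, ha, h⟩
    obtain ⟨b, hb, h1, h2⟩ := exists_mem_triTable_inverse a ha p h
    rw [triangleStep_eq ha h, triangleStep_eq hb h1, h2]
  rcases triangle_cases p with h | h | h
  · rw [triangleStep_of_outer h, triangleStep_of_outer]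
    simp only [Prod.fst_swap, Prod.snd_swap]
    tauto
  · rw [← halfTurn_halfTurn (triangleStep p).swap, triangleStep_halfTurn, key p h,
      halfTurn_halfTurn]
  · have := key _ h
    rwa [triangleStep_halfTurn p, ← halfTurn_swap, ← halfTurn_swap, halfTurn_halfTurn,
      halfTurn_halfTurn] at this

lemma sqHeight_eq {p : ℝ × ℝ} {m : ℝ} (h1 : m ≤ p.1) (h2 : m ≤ 1 - p.1) (h3 : m ≤ p.2)
    (h4 : m ≤ 1 - p.2) (h : (p.1 ≤ m ∨ 1 - p.1 ≤ m) ∨ p.2 ≤ m ∨ 1 - p.2 ≤ m) : sqHeight p = m := by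
  refine le_antisymm ?_ (le_min (le_min h1 h2) (le_min h3 h4))
  simpa [sqHeight, min_le_iff] using h

lemma sqHeight_act : ∀ a ∈ innerTable, ∀ p ∈ cell a.1, sqHeight (a.2.act p) = sqHeight p := by
  simp only [innerTable, List.forall_mem_cons, List.not_mem_nil, IsEmpty.forall_iff, implies_true,
    and_true, mem_cell_cons, mem_cell_nil, lineEval, IntAffine.act]
  push_cast
  refine ⟨?_, ?_, ?_, ?_, ?_, ?_, ?_, ?_, ?_, ?_, ?_, ?_, ?_⟩ <;> rintro p h
  · rw [← sqHeight_halfTurn p]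
    congr 1
    ext <;> simp only [halfTurn] <;> ring
  · rw [sqHeight_eq (m := p.2), sqHeight_eq (m := p.2)] <;> first
      | linarith
      | exact Or.inr (Or.inl (by linarith))
  · rw [sqHeight_eq (m := p.2), sqHeight_eq (m := p.2)] <;> first
      | linarith
      | exact Or.inr (Or.inl (by linarith))
      | exact Or.inl (Or.inl (by linarith))
  · rw [sqHeight_eq (m := p.2), sqHeight_eq (m := p.2)] <;> first
      | linarith
      | exact Or.inr (Or.inl (by linarith))
      | exact Or.inr (Or.inr (by linarith))
  · rw [sqHeight_eq (m := 1 - p.1), sqHeight_eq (m := 1 - p.1)] <;> first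
      | linarith
      | exact Or.inl (Or.inr (by linarith))
  · rw [sqHeight_eq (m := 1 - p.1), sqHeight_eq (m := 1 - p.1)] <;> first
      | linarith
      | exact Or.inl (Or.inr (by linarith))
      | exact Or.inr (Or.inl (by linarith))
  · rw [sqHeight_eq (m := 1 - p.1), sqHeight_eq (m := 1 - p.1)] <;> first
      | linarith
      | exact Or.inl (Or.inr (by linarith))
      | exact Or.inl (Or.inl (by linarith))
  · rw [sqHeight_eq (m := 1 - p.2), sqHeight_eq (m := 1 - p.2)] <;> first
      | linarith
      | exact Or.inr (Or.inr (by linarith))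
  · rw [sqHeight_eq (m := 1 - p.2), sqHeight_eq (m := 1 - p.2)] <;> first
      | linarith
      | exact Or.inr (Or.inr (by linarith))
      | exact Or.inl (Or.inr (by linarith))
  · rw [sqHeight_eq (m := 1 - p.2), sqHeight_eq (m := 1 - p.2)] <;> first
      | linarith
      | exact Or.inr (Or.inr (by linarith))
      | exact Or.inr (Or.inl (by linarith))
  · rw [sqHeight_eq (m := p.1), sqHeight_eq (m := p.1)] <;> first
      | linarith
      | exact Or.inl (Or.inl (by linarith))
  · rw [sqHeight_eq (m := p.1), sqHeight_eq (m := p.1)] <;> first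
      | linarith
      | exact Or.inl (Or.inl (by linarith))
      | exact Or.inr (Or.inr (by linarith))
  · rw [sqHeight_eq (m := p.1), sqHeight_eq (m := p.1)] <;> first
      | linarith
      | exact Or.inl (Or.inl (by linarith))
      | exact Or.inl (Or.inr (by linarith))

lemma sqHeight_squareStep (p) : sqHeight (squareStep p) = sqHeight p := by
  rcases square_cases p with h | ⟨a, ha, h⟩
  · rw [squareStep_of_frame h]
  · rw [squareStep_eq ha h, sqHeight_act a ha p h]

lemma exists_mem_innerTable_inverse : ∀ a ∈ innerTable, ∀ p ∈ cell a.1, ∃ b ∈ innerTable,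
    (a.2.act p).swap ∈ cell b.1 ∧ b.2.act (a.2.act p).swap = p.swap := by
  simp only [innerTable, List.forall_mem_cons, List.not_mem_nil, IsEmpty.forall_iff, implies_true,
    and_true, mem_cell_cons, mem_cell_nil, lineEval, IntAffine.act, List.exists_mem_cons_iff,
    false_and, exists_false, or_false, Prod.swap, Prod.mk.injEq]
  push_cast
  refine ⟨?_, ?_, ?_, ?_, ?_, ?_, ?_, ?_, ?_, ?_, ?_, ?_, ?_⟩ <;> rintro p h
  · left; and_intros <;> linarith
  · iterate 10 right
    left; and_intros <;> linarith
  · iterate 2 right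
    left; and_intros <;> linarith
  · iterate 6 right
    left; and_intros <;> linarith
  · iterate 7 right
    left; and_intros <;> linarith
  · iterate 11 right
    left; and_intros <;> linarith
  · iterate 3 right
    left; and_intros <;> linarith
  · iterate 4 right
    left; and_intros <;> linarith
  · iterate 8 right
    left; and_intros <;> linarith
  · iterate 12 right
    and_intros <;> linarith
  · iterate 1 right
    left; and_intros <;> linarith
  · iterate 5 right
    left; and_intros <;> linarith
  · iterate 9 right
    left; and_intros <;> linarith

lemma squareStep_swap_squareStep (p : ℝ × ℝ) : squareStep (squareStep p).swap = p.swap := by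
  rcases square_cases p with h | ⟨a, ha, h⟩
  · rw [squareStep_of_frame h, squareStep_of_frame]
    simp only [Prod.fst_swap, Prod.snd_swap]
    tauto
  · obtain ⟨b, hb, h1, h2⟩ := exists_mem_innerTable_inverse a ha p h
    rw [squareStep_eq ha h, squareStep_eq hb h1, h2]

lemma exists_add_mul_mem_Ioo {a P : ℝ} (hP : 0 < P) (h : Irrational (a / P)) (x : ℝ) {u v : ℝ}
    (huv : u < v) : ∃ k : ℕ, ∃ j : ℤ, 1 ≤ k ∧ x + k * a + j * P ∈ Set.Ioo u v := by
  have : Fact (0 < P) := ⟨hP⟩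
  have hd : DenseRange (fun k : ℕ => k • (a : AddCircle P)) :=
    denseRange_zsmul_iff_nsmul.1 (AddCircle.denseRange_zsmul_coe_iff.2 h)
  have ho : IsOpen ((fun z : AddCircle P => z + ((x + a : ℝ) : AddCircle P)) ⁻¹'
      (((↑) : ℝ → AddCircle P) '' Set.Ioo u v)) :=
    (QuotientAddGroup.isOpenMap_coe _ isOpen_Ioo).preimage (continuous_add_const _)
  obtain ⟨k, y, hy, hk⟩ := hd.exists_mem_open ho
    ⟨(((u + v) / 2 - (x + a) : ℝ) : AddCircle P), (u + v) / 2, ⟨by linarith, by linarith⟩, by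
      dsimp only
      rw [← AddCircle.coe_add]; congr 1; ring⟩
  simp only [← AddCircle.coe_nsmul, ← AddCircle.coe_add] at hk
  rw [QuotientAddGroup.eq_iff_sub_mem, AddSubgroup.mem_zmultiples_iff] at hk
  obtain ⟨j, hj⟩ := hk
  refine ⟨k + 1, j, by omega, ?_⟩
  convert hy using 1
  simp only [zsmul_eq_mul, nsmul_eq_mul] at hj
  push_cast
  linarith

lemma volume_line_eq_zero {a b c : ℝ} (h : a ≠ 0 ∨ b ≠ 0) :
    volume {p : ℝ × ℝ | a * p.1 + b * p.2 = c} = 0 := by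
  have hm : MeasurableSet {p : ℝ × ℝ | a * p.1 + b * p.2 = c} :=
    (isClosed_eq (by fun_prop) continuous_const).measurableSet
  rw [Measure.volume_eq_prod]
  rcases h with h | h
  · rw [Measure.prod_apply_symm hm]
    have : ∀ y, ((fun x => (x, y)) ⁻¹' {p : ℝ × ℝ | a * p.1 + b * p.2 = c}) = {(c - b * y) / a} := by
      intro y; ext x
      simp only [Set.mem_preimage, Set.mem_ofPred_eq, Set.mem_singleton_iff]
      rw [eq_div_iff h]; constructor <;> intro h <;> linarith
    simp [this]
  · rw [Measure.prod_apply hm]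
    have : ∀ x, (Prod.mk x ⁻¹' {p : ℝ × ℝ | a * p.1 + b * p.2 = c}) = {(c - a * x) / b} := by
      intro y; ext x
      simp only [Set.mem_preimage, Set.mem_ofPred_eq, Set.mem_singleton_iff]
      rw [eq_div_iff h]; constructor <;> intro h <;> linarith
    simp [this]

/-- Near each point of `P` the function `α` is almost everywhere strictly increasing to first
order, or almost everywhere strictly decreasing to first order. -/
def LocallySigned (α' : ℝ → ℝ) (P : Set ℝ) : Prop :=
  ∀ t₀ ∈ P, ∃ σ : ℝ, (σ = 1 ∨ σ = -1) ∧ ∃ r > 0, ∀ᵐ t, |t - t₀| < r → 0 < σ * α' t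

lemma LocallySigned.exists_sign {α' : ℝ → ℝ} {P : Set ℝ} (h : LocallySigned α' P) {a b : ℝ}
    (hP : Set.Icc a b ⊆ P) :
    ∃ σ : ℝ, (σ = 1 ∨ σ = -1) ∧ ∀ᵐ t, t ∈ Set.Icc a b → 0 < σ * α' t := by
  set U : ℝ → Set ℝ := fun σ => {t₀ | ∃ r > 0, ∀ᵐ t, |t - t₀| < r → 0 < σ * α' t} with hU
  have hopen : ∀ σ, IsOpen (U σ) := by
    intro σ
    rw [Metric.isOpen_iff]
    rintro t₀ ⟨r, hr, h⟩
    refine ⟨r / 2, by positivity, fun s hs => ⟨r / 2, by positivity, ?_⟩⟩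
    filter_upwards [h] with t ht hts
    refine ht ?_
    rw [Metric.mem_ball, Real.dist_eq] at hs
    calc |t - t₀| ≤ |t - s| + |s - t₀| := abs_sub_le _ _ _
      _ < r := by linarith
  have hdisj : U 1 ∩ U (-1) = ∅ := by
    rw [Set.eq_empty_iff_forall_notMem]
    rintro t₀ ⟨⟨r, hr, h⟩, s, hs, h'⟩
    have h0 : volume (Metric.ball t₀ (min r s)) = 0 := by
      refine measure_mono_null (fun t ht => ?_) (ae_iff.1 (h.and h'))
      rw [Metric.mem_ball, Real.dist_eq, lt_min_iff] at ht
      rintro ⟨h1, h2⟩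
      have := h1 ht.1
      have := h2 ht.2
      linarith
    exact (Metric.measure_ball_pos volume t₀ (lt_min hr hs)).ne' h0
  have hsub : Set.Icc a b ⊆ U 1 ∪ U (-1) := by
    intro t ht
    obtain ⟨σ, rfl | rfl, h⟩ := h t (hP ht)
    exacts [Or.inl h, Or.inr h]
  have key : ∃ σ : ℝ, (σ = 1 ∨ σ = -1) ∧ Set.Icc a b ⊆ U σ := by
    rcases isPreconnected_iff_subset_of_disjoint.1 isPreconnected_Icc _ _ (hopen 1) (hopen (-1))
      hsub (by rw [hdisj, Set.inter_empty]) with h | h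
    exacts [⟨1, Or.inl rfl, h⟩, ⟨-1, Or.inr rfl, h⟩]
  obtain ⟨σ, hσ, hs⟩ := key
  refine ⟨σ, hσ, ?_⟩
  rw [ae_iff]
  refine measure_null_of_locally_null _ fun t ht => ?_
  simp only [Set.mem_ofPred_eq, Classical.not_imp] at ht
  obtain ⟨r, hr, h⟩ := hs ht.1
  refine ⟨Metric.ball t r ∩ {t | ¬ (t ∈ Set.Icc a b → 0 < σ * α' t)},
    Filter.inter_mem (mem_nhdsWithin_of_mem_nhds (Metric.ball_mem_nhds _ hr)) self_mem_nhdsWithin,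
    measure_mono_null (fun s hs => ?_) (ae_iff.1 h)⟩
  obtain ⟨h1, h2⟩ := hs
  simp only [Set.mem_ofPred_eq, Classical.not_imp] at h2 ⊢
  rw [Metric.mem_ball, Real.dist_eq] at h1
  exact ⟨h1, h2.2⟩

lemma LipschitzWith.integral_deriv {α : ℝ → ℝ} {K : NNReal} (h : LipschitzWith K α) (a b : ℝ) :
    IntervalIntegrable (deriv α) volume a b ∧ ∫ t in a..b, deriv α t = α b - α a := by
  have := (h.lipschitzOnWith (s := Set.uIcc a b)).absolutelyContinuousOnInterval
  exact ⟨this.intervalIntegrable_deriv, this.integral_deriv_eq_sub⟩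

lemma two_mul_abs_sub_le_of_ae_deriv {α β : ℝ → ℝ} {K L : NNReal} (hα : LipschitzWith K α)
    (hβ : LipschitzWith L β) {a b σ : ℝ} (hσ : ∀ᵐ t, t ∈ Set.Icc a b → 0 < σ * deriv α t)
    (h1 : σ = 1 ∨ σ = -1) (hs : ∀ᵐ t, t ∈ Set.Icc a b → 2 * |deriv β t| ≤ |deriv α t|) {s t : ℝ}
    (has : a ≤ s) (hst : s ≤ t) (htb : t ≤ b) : 2 * |β t - β s| ≤ σ * (α t - α s) := by
  obtain ⟨i1, e1⟩ := hα.integral_deriv s t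
  obtain ⟨i2, e2⟩ := hβ.integral_deriv s t
  rw [← e1, ← e2]
  calc 2 * |∫ x in s..t, deriv β x| ≤ 2 * ∫ x in s..t, |deriv β x| := by
        gcongr; exact intervalIntegral.abs_integral_le_integral_abs hst
    _ = ∫ x in s..t, 2 * |deriv β x| := by rw [intervalIntegral.integral_const_mul]
    _ ≤ ∫ x in s..t, σ * deriv α x := by
        refine intervalIntegral.integral_mono_ae_restrict hst (i2.abs.const_mul 2)
          (i1.const_mul σ) ?_
        refine (ae_restrict_iff' measurableSet_Icc).2 ?_
        filter_upwards [hσ, hs] with x h2 h3 hx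
        have hx' : x ∈ Set.Icc a b := ⟨has.trans hx.1, hx.2.trans htb⟩
        refine (h3 hx').trans (le_of_eq ?_)
        have := h2 hx'
        rcases h1 with rfl | rfl
        · rw [abs_of_pos (by linarith)]; ring
        · rw [abs_of_neg (by linarith)]; ring
    _ = σ * ∫ x in s..t, deriv α x := by rw [intervalIntegral.integral_const_mul]

lemma mul_volume_le_of_ae_deriv {α : ℝ → ℝ} {K : NNReal} (hα : LipschitzWith K α) {a b σ M : ℝ}
    (hab : a ≤ b) (hσ : ∀ᵐ t, t ∈ Set.Icc a b → 0 < σ * deriv α t)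
    (h1 : σ = 1 ∨ σ = -1) :
    M * volume.real {t | t ∈ Set.Icc a b ∧ M ≤ |deriv α t|} ≤ σ * (α b - α a) := by
  obtain ⟨i1, e1⟩ := hα.integral_deriv a b
  have hm : MeasurableSet {t | M ≤ |deriv α t|} :=
    measurableSet_le measurable_const (measurable_deriv α).abs
  rw [← e1, ← intervalIntegral.integral_const_mul, intervalIntegral.integral_of_le hab,
    ← integral_Icc_eq_integral_Ioc]
  have : M * volume.real {t | t ∈ Set.Icc a b ∧ M ≤ |deriv α t|} =
      ∫ x in Set.Icc a b, {t | M ≤ |deriv α t|}.indicator (fun _ => M) x := by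
    rw [setIntegral_indicator hm, setIntegral_const, smul_eq_mul, mul_comm]
    rfl
  rw [this]
  refine integral_mono_ae ((integrable_const M).indicator hm) ?_ ?_
  · exact ((intervalIntegrable_iff_integrableOn_Icc_of_le hab).1 (i1.const_mul σ))
  · refine (ae_restrict_iff' measurableSet_Icc).2 ?_
    filter_upwards [hσ] with x h2 hx
    have := h2 hx
    by_cases hxM : x ∈ {t | M ≤ |deriv α t|}
    · rw [Set.indicator_of_mem hxM]
      refine (show M ≤ |deriv α x| from hxM).trans (le_of_eq ?_)
      rcases h1 with rfl | rfl
      · rw [abs_of_pos (by linarith)]; ring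
      · rw [abs_of_neg (by linarith)]; ring
    · rw [Set.indicator_of_notMem hxM]; exact this.le

/-- The parameters at which a path lies in a box of a chart with domain `P`. -/
def boxTimes (P : Set ℝ) (α β : ℝ → ℝ) (α₀ β₀ δ : ℝ) : Set ℝ :=
  {t | t ∈ P ∧ |α t - α₀| ≤ δ ∧ |β t - β₀| ≤ δ}

lemma exists_exit_right {α β : ℝ → ℝ} {K L : NNReal} (hα : LipschitzWith K α)
    (hβ : LipschitzWith L β) {P : Set ℝ} (hP : IsOpen P) (hloc : LocallySigned (deriv α) P)
    (hs : ∀ᵐ t, t ∈ P → 2 * |deriv β t| ≤ |deriv α t|) {α₀ β₀ δ M b : ℝ} (hδ : 0 < δ)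
    (hb : 0 < b) (hQ : IsClosed (boxTimes P α β α₀ β₀ δ ∩ Set.Icc 0 b))
    (h0 : 0 ∈ boxTimes P α β α₀ β₀ (δ / 4))
    (hbig : 3 * δ ≤ M * volume.real {t | t ∈ Set.Icc 0 b ∧ (t ∈ P → M ≤ |deriv α t|)}) :
    ∃ c, 0 ≤ c ∧ c ≤ b ∧ Set.Icc 0 c ⊆ boxTimes P α β α₀ β₀ δ ∧ |α c - α₀| = δ := by
  set Q := boxTimes P α β α₀ β₀ δ with hQdef
  have hQP : Q ⊆ P := fun t ht => ht.1
  obtain ⟨h0P, h0α, h0β⟩ := h0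
  set A : Set ℝ := {c | c ∈ Set.Icc 0 b ∧ Set.Icc 0 c ⊆ Q} with hA
  have h0A : (0 : ℝ) ∈ A := by
    refine ⟨⟨le_rfl, hb.le⟩, ?_⟩
    rw [Set.Icc_self, Set.singleton_subset_iff]
    exact ⟨h0P, by linarith, by linarith⟩
  have hbdd : BddAbove A := ⟨b, fun c hc => hc.1.2⟩
  set c := sSup A with hc
  have hc0 : 0 ≤ c := le_csSup hbdd h0A
  have hcb : c ≤ b := csSup_le ⟨0, h0A⟩ fun c hc => hc.1.2
  have hIco : Set.Ico 0 c ⊆ Q := by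
    intro t ht
    obtain ⟨d, hd, hd'⟩ := exists_lt_of_lt_csSup ⟨0, h0A⟩ ht.2
    exact hd.2 ⟨ht.1, hd'.le⟩
  have hIcc : Set.Icc 0 c ⊆ Q := by
    rcases hc0.eq_or_lt with h | h
    · rw [← h]; exact h0A.2
    · rw [← closure_Ico h.ne]
      exact (hQ.closure_subset_iff.2 fun t ht => ⟨hIco ht, ht.1, ht.2.le.trans hcb⟩).trans
        Set.inter_subset_left
  refine ⟨c, hc0, hcb, hIcc, ?_⟩
  obtain ⟨σ, h1, hσ⟩ := hloc.exists_sign (hIcc.trans hQP)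
  have hs' : ∀ᵐ t, t ∈ Set.Icc 0 c → 2 * |deriv β t| ≤ |deriv α t| := by
    filter_upwards [hs] with t ht h using ht (hQP (hIcc h))
  have hslope := two_mul_abs_sub_le_of_ae_deriv hα hβ hσ h1 hs' le_rfl hc0 le_rfl
  have hcQ : c ∈ Q := hIcc ⟨hc0, le_rfl⟩
  obtain ⟨hcP, hcα, hcβ⟩ := hcQ
  by_contra hne
  have hcα' : |α c - α₀| < δ := lt_of_le_of_ne hcα hne
  have hσle : σ * (α c - α 0) ≤ |α c - α₀| + δ / 4 := by
    have h2 := abs_le.1 h0α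
    have h3 := abs_le.1 (le_refl |α c - α₀|)
    rcases h1 with rfl | rfl <;> linarith
  have hcβ' : |β c - β₀| < δ := by
    have : |β c - β₀| ≤ |β c - β 0| + |β 0 - β₀| := abs_sub_le _ _ _
    linarith
  rcases hcb.eq_or_lt with h | h
  · have h2 := mul_volume_le_of_ae_deriv (M := M) hα (h ▸ hb.le) hσ h1
    have : {t | t ∈ Set.Icc 0 c ∧ M ≤ |deriv α t|} =
        {t | t ∈ Set.Icc 0 b ∧ (t ∈ P → M ≤ |deriv α t|)} := by
      rw [h] at hIcc ⊢
      ext t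
      exact ⟨fun ht => ⟨ht.1, fun _ => ht.2⟩, fun ht => ⟨ht.1, ht.2 (hQP (hIcc ht.1))⟩⟩
    rw [this] at h2
    linarith
  · have hnhds : Q ∈ nhds c := by
      filter_upwards [hP.mem_nhds hcP,
        (hα.continuous.continuousAt.sub continuousAt_const).abs.eventually_lt continuousAt_const
          hcα',
        (hβ.continuous.continuousAt.sub continuousAt_const).abs.eventually_lt continuousAt_const
          hcβ'] with t ht1 ht2 ht3
      exact ⟨ht1, ht2.le, ht3.le⟩
    obtain ⟨r, hr, hball⟩ := Metric.mem_nhds_iff.1 hnhds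
    have : min b (c + r / 2) ∈ A := by
      refine ⟨⟨le_min hb.le (by linarith), min_le_left _ _⟩, fun t ht => ?_⟩
      rcases le_total t c with htc | htc
      · exact hIcc ⟨ht.1, htc⟩
      · refine hball ?_
        have := ht.2.trans (min_le_right _ _)
        rw [Metric.mem_ball, Real.dist_eq, abs_lt]
        constructor <;> linarith
    have h2 := le_csSup hbdd this
    rw [← hc] at h2
    have : c < min b (c + r / 2) := lt_min h (by linarith)
    linarith

/-- A path that starts near the center of a box and moves fast in the first coordinate crosses the
box from one vertical side to the other. -/
lemma exists_crossing {α β : ℝ → ℝ} {K L : NNReal} (hα : LipschitzWith K α)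
    (hβ : LipschitzWith L β) {P : Set ℝ} (hP : IsOpen P) (hloc : LocallySigned (deriv α) P)
    (hs : ∀ᵐ t, t ∈ P → 2 * |deriv β t| ≤ |deriv α t|) {α₀ β₀ δ M b : ℝ} (hδ : 0 < δ)
    (hb : 0 < b) (hQ : IsClosed (boxTimes P α β α₀ β₀ δ ∩ Set.Icc (-b) b))
    (h0 : 0 ∈ boxTimes P α β α₀ β₀ (δ / 4))
    (hbig : 3 * δ ≤ M * volume.real {t | t ∈ Set.Icc 0 b ∧ (t ∈ P → M ≤ |deriv α t|)})
    (hbig' : 3 * δ ≤ M * volume.real {t | t ∈ Set.Icc (-b) 0 ∧ (t ∈ P → M ≤ |deriv α t|)}) :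
    ∃ c d σ, -b ≤ c ∧ c ≤ d ∧ d ≤ b ∧ Set.Icc c d ⊆ boxTimes P α β α₀ β₀ δ ∧
      (σ = 1 ∨ σ = -1) ∧ σ * (α c - α₀) = -δ ∧ σ * (α d - α₀) = δ ∧
      ∀ s t, c ≤ s → s ≤ t → t ≤ d → 2 * |β t - β s| ≤ σ * (α t - α s) := by
  obtain ⟨d, hd0, hdb, hdQ, hd⟩ := exists_exit_right hα hβ hP hloc hs hδ hb
    (by
      convert hQ.inter (isClosed_Icc (a := 0) (b := b)) using 1
      ext t
      simp only [Set.mem_inter_iff, Set.mem_Icc]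
      exact ⟨fun h => ⟨⟨h.1, by linarith, h.2.2⟩, h.2⟩, fun h => ⟨h.1.1, h.2⟩⟩) h0 hbig
  have hneg : LipschitzWith 1 (fun t : ℝ => -t) := LipschitzWith.id.neg
  have hmp : MeasurePreserving (fun t : ℝ => -t) := Measure.measurePreserving_neg volume
  obtain ⟨c, hc0, hcb, hcQ, hc⟩ := exists_exit_right (P := (fun t => -t) ⁻¹' P) (b := b) (M := M)
    (α₀ := α₀) (β₀ := β₀)
    (hα.comp hneg) (hβ.comp hneg) (hP.preimage continuous_neg) (by
      intro t₀ ht₀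
      obtain ⟨σ, h1, r, hr, h⟩ := hloc _ ht₀
      refine ⟨-σ, by rcases h1 with rfl | rfl <;> simp, r, hr, ?_⟩
      filter_upwards [hmp.quasiMeasurePreserving.ae h] with t ht htr
      have := ht (by rw [← abs_neg]; convert htr using 2; ring)
      have e : deriv (α ∘ fun t => -t) t = -deriv α (-t) := deriv_comp_neg α t
      rw [e]
      linarith) (by
      filter_upwards [hmp.quasiMeasurePreserving.ae hs] with t ht htP
      have e : deriv (α ∘ fun t => -t) t = -deriv α (-t) := deriv_comp_neg α t
      have e' : deriv (β ∘ fun t => -t) t = -deriv β (-t) := deriv_comp_neg β t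
      rw [e, e', abs_neg, abs_neg]
      exact ht htP) hδ hb (by
      convert (hQ.preimage continuous_neg).inter (isClosed_Icc (a := 0) (b := b)) using 1
      ext t
      simp only [Set.mem_inter_iff, Set.mem_Icc, Set.mem_preimage]
      exact ⟨fun h => ⟨⟨h.1, by linarith, by linarith⟩, h.2⟩, fun h => ⟨h.1.1, h.2⟩⟩)
      (by
        change -(0 : ℝ) ∈ boxTimes P α β α₀ β₀ (δ / 4)
        rwa [neg_zero]) (by
      refine hbig'.trans (le_of_eq ?_)
      congr 1
      rw [measureReal_def, measureReal_def, ← hmp.measure_preimage_equiv (f := MeasurableEquiv.neg ℝ)]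
      congr 2
      ext t
      have e : deriv (α ∘ fun t => -t) t = -deriv α (-t) := deriv_comp_neg α t
      have e' : MeasurableEquiv.neg ℝ t = -t := rfl
      simp only [e', Set.mem_preimage, Set.mem_ofPred_eq, Set.mem_Icc, e, abs_neg]
      constructor
      · rintro ⟨⟨h1, h2⟩, h3⟩; exact ⟨⟨by linarith, by linarith⟩, h3⟩
      · rintro ⟨⟨h1, h2⟩, h3⟩; exact ⟨⟨by linarith, by linarith⟩, h3⟩)
  have hsub : Set.Icc (-c) d ⊆ boxTimes P α β α₀ β₀ δ := by
    intro t ht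
    rcases le_total 0 t with h | h
    · exact hdQ ⟨h, ht.2⟩
    · have : -(-t) ∈ boxTimes P α β α₀ β₀ δ := @hcQ (-t) ⟨by linarith, by linarith [ht.1]⟩
      rwa [neg_neg] at this
  have hsubP : Set.Icc (-c) d ⊆ P := fun t ht => (hsub ht).1
  have hcd : -c ≤ d := by linarith
  obtain ⟨σ, h1, hσ⟩ := hloc.exists_sign hsubP
  have hs' : ∀ᵐ t, t ∈ Set.Icc (-c) d → 2 * |deriv β t| ≤ |deriv α t| := by
    filter_upwards [hs] with t ht h using ht (hsubP h)
  have hslope : ∀ s t, -c ≤ s → s ≤ t → t ≤ d → 2 * |β t - β s| ≤ σ * (α t - α s) :=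
    fun s t a b c => two_mul_abs_sub_le_of_ae_deriv hα hβ hσ h1 hs' a b c
  obtain ⟨-, h0α, -⟩ := h0
  have h2 := abs_le.1 h0α
  have m1 := (mul_nonneg zero_le_two (abs_nonneg _)).trans (hslope 0 d (by linarith) hd0 le_rfl)
  have m2 := (mul_nonneg zero_le_two (abs_nonneg _)).trans (hslope (-c) 0 le_rfl (by linarith) hd0)
  have hc' : |α (-c) - α₀| = δ := hc
  refine ⟨-c, d, σ, by linarith, hcd, hdb, hsub, h1, ?_, ?_, hslope⟩
  · rcases abs_eq hδ.le |>.1 hc' with h | h <;> rcases h1 with rfl | rfl <;> linarith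
  · rcases abs_eq hδ.le |>.1 hd with h | h <;> rcases h1 with rfl | rfl <;> linarith

/-- A path crossing a box from side to side meets a path crossing it from top to bottom. -/
lemma exists_meet {α β a b : ℝ → ℝ} (hα : Continuous α) (hβ : Continuous β) (ha : Continuous a)
    {α₀ β₀ δ c d σ c' d' σ' : ℝ} {P P' : Set ℝ} (hcd : c ≤ d) (hcd' : c' ≤ d')
    (hsub : Set.Icc c d ⊆ boxTimes P α β α₀ β₀ δ) (hsub' : Set.Icc c' d' ⊆ boxTimes P' a b β₀ α₀ δ)
    (hσ : σ = 1 ∨ σ = -1) (hσ' : σ' = 1 ∨ σ' = -1) (hc : σ * (α c - α₀) = -δ)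
    (hd : σ * (α d - α₀) = δ) (hc' : σ' * (a c' - β₀) = -δ) (hd' : σ' * (a d' - β₀) = δ)
    (hslope : ∀ s t, c' ≤ s → s ≤ t → t ≤ d' → 2 * |b t - b s| ≤ σ' * (a t - a s)) :
    ∃ t ∈ Set.Icc c d, ∃ s ∈ Set.Icc c' d', α t = b s ∧ β t = a s := by
  have hex : ∀ y, |y - β₀| ≤ δ → ∃ s ∈ Set.Icc c' d', a s = y := by
    intro y hy
    rw [abs_le] at hy
    rcases hσ' with rfl | rfl
    · exact intermediate_value_Icc hcd' ha.continuousOn ⟨by linarith, by linarith⟩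
    · exact intermediate_value_Icc' hcd' ha.continuousOn ⟨by linarith, by linarith⟩
  choose! s hs has using hex
  have hlip : ∀ y y', |y - β₀| ≤ δ → |y' - β₀| ≤ δ → |b (s y) - b (s y')| ≤ |y - y'| := by
    intro y y' hy hy'
    have key : ∀ u v, u ∈ Set.Icc c' d' → v ∈ Set.Icc c' d' → u ≤ v → |b v - b u| ≤ |a v - a u| := by
      intro u v hu hv huv
      have h1 := hslope u v hu.1 huv hv.2
      have h2 : σ' * (a v - a u) ≤ |a v - a u| := by
        rcases hσ' with rfl | rfl
        · rw [one_mul]; exact le_abs_self _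
        · rw [neg_one_mul]; exact neg_le_abs _
      have := abs_nonneg (b v - b u)
      linarith
    rw [← has y hy, ← has y' hy', has y hy, has y' hy']
    rcases le_total (s y') (s y) with h | h
    · have := key _ _ (hs y' hy') (hs y hy) h
      rwa [has y hy, has y' hy'] at this
    · have := key _ _ (hs y hy) (hs y' hy') h
      rwa [has y hy, has y' hy', abs_sub_comm, abs_sub_comm y'] at this
  have hB : ContinuousOn (fun y => b (s y)) {y | |y - β₀| ≤ δ} := by
    refine LipschitzOnWith.continuousOn (K := 1) (LipschitzOnWith.of_dist_le_mul ?_)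
    intro y hy y' hy'
    rw [Real.dist_eq, Real.dist_eq, NNReal.coe_one, one_mul]
    exact hlip y y' hy hy'
  have hcont : ContinuousOn (fun t => σ * (α t - b (s (β t)))) (Set.Icc c d) :=
    continuousOn_const.mul (hα.continuousOn.sub
      (hB.comp hβ.continuousOn fun t ht => (hsub ht).2.2))
  have hbound : ∀ t ∈ Set.Icc c d, |b (s (β t)) - α₀| ≤ δ :=
    fun t ht => (hsub' (hs _ (hsub ht).2.2)).2.2
  have h1 := abs_le.1 (hbound c ⟨le_rfl, hcd⟩)
  have h2 := abs_le.1 (hbound d ⟨hcd, le_rfl⟩)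
  obtain ⟨t, ht, h0⟩ := intermediate_value_Icc hcd hcont
    (show (0 : ℝ) ∈ _ from ⟨by rcases hσ with rfl | rfl <;> linarith, by
      rcases hσ with rfl | rfl <;> linarith⟩)
  have hsb := (hsub ht).2.2
  refine ⟨t, ht, s (β t), hs _ hsb, ?_, (has _ hsb).symm⟩
  dsimp only at h0
  rcases hσ with rfl | rfl <;> linarith

/-- All the affine forms involved in the two tables. -/
def allLines : List (ℤ × ℤ × ℤ) := triangleTable.lines ++ squareTable.lines

set_option maxRecDepth 10000 in
lemma allLines_bound : ∀ l ∈ allLines, |l.1| + |l.2.1| ≤ 16 := by decide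

set_option maxRecDepth 10000 in
lemma allLines_ne : ∀ l ∈ allLines, l.1 ≠ 0 ∨ l.2.1 ≠ 0 := by decide

lemma lineMargin_pos_iff {L : List (ℤ × ℤ × ℤ)} {p} :
    0 < lineMargin L p ↔ ∀ l ∈ L, lineEval l p ≠ 0 := by
  refine ⟨fun h l hl h0 => ?_, lineMargin_pos⟩
  have := lineMargin_le hl p
  rw [h0, abs_zero, zero_div] at this
  exact absurd h this.not_gt

lemma lineMargin_anti {L L' : List (ℤ × ℤ × ℤ)} (h : ∀ l ∈ L, l ∈ L') (p) :
    min 1 (lineMargin L' p) ≤ lineMargin L p := by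
  induction L with
  | nil => exact min_le_left _ _
  | cons l L ih =>
    exact le_min ((min_le_right _ _).trans (lineMargin_le (h l (by simp)) p))
      (ih fun l hl => h l (by simp [hl]))

lemma lineMargin_le_one (L : List (ℤ × ℤ × ℤ)) (p) : lineMargin L p ≤ 1 := by
  induction L with
  | nil => exact le_rfl
  | cons l L ih => exact (min_le_right _ _).trans ih

lemma lineMargin_le_lineMargin {L L' : List (ℤ × ℤ × ℤ)} (h : ∀ l ∈ L, l ∈ L') (p) :
    lineMargin L' p ≤ lineMargin L p :=
  (le_min (lineMargin_le_one _ _) le_rfl).trans (lineMargin_anti h p)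

lemma AffineOnBall.mono {f : ℝ × ℝ → ℝ × ℝ} {p A r s} (h : AffineOnBall f p A r) (hs : s ≤ r) :
    AffineOnBall f p A s := fun q hq => h q (hq.trans_le hs)

/-- The point lies on none of the lines of the two tables. -/
def IsGen (p : ℝ × ℝ) : Prop := 0 < lineMargin allLines p

lemma IsGen.ne {p} (h : IsGen p) {l} (hl : l ∈ allLines) : lineEval l p ≠ 0 :=
  lineMargin_pos_iff.1 h l hl

lemma PLTable.hasMargin {tb : PLTable} (h : ∀ l ∈ tb.lines, l ∈ allLines) :
    HasMargin tb.map (fun p => (tb.sel p).lin) (lineMargin allLines) :=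
  ⟨continuous_lineMargin _,
    fun p => (affineOnBall (fun l hl => allLines_bound l (h l hl)) p).mono
      (lineMargin_le_lineMargin h p), volume_lineMargin_lt allLines_ne⟩

lemma PLTable.exists_sel {tb : PLTable} {p} (h : ∃ a ∈ tb, p ∈ cell a.1) :
    ∃ a ∈ tb, p ∈ cell a.1 ∧ tb.sel p = a.2 := by
  induction tb with
  | nil => simp at h
  | cons a tb ih =>
    by_cases ha : p ∈ cell a.1
    · exact ⟨a, by simp, ha, by simp [sel, ha]⟩
    · obtain ⟨b, hb, hp⟩ := h
      rcases List.mem_cons.1 hb with rfl | hb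
      · exact absurd hp ha
      · obtain ⟨c, hc, h1, h2⟩ := ih ⟨b, hb, hp⟩
        exact ⟨c, by simp [hc], h1, by simp [sel, ha, h2]⟩

/-- The interior of a cell. -/
def openCell (L : List (ℤ × ℤ × ℤ)) : Set (ℝ × ℝ) := {p | ∀ l ∈ L, 0 < lineEval l p}

lemma mem_openCell_nil (p) : p ∈ openCell [] ↔ True := by simp [openCell]

lemma mem_openCell_cons (l L p) :
    p ∈ openCell (l :: L) ↔ 0 < lineEval l p ∧ p ∈ openCell L := by simp [openCell]

lemma openCell_subset (L) : openCell L ⊆ cell L := fun _ h l hl => (h l hl).le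

lemma IsGen.mem_openCell {p} (h : IsGen p) {tb : PLTable} (htb : ∀ l ∈ tb.lines, l ∈ allLines)
    {a} (ha : a ∈ tb) (hp : p ∈ cell a.1) : p ∈ openCell a.1 := fun l hl =>
  lt_of_le_of_ne (hp l hl) (h.ne (htb l (List.mem_flatMap.2 ⟨a, ha, hl⟩))).symm

lemma triangle_lines : ∀ l ∈ triangleTable.lines, l ∈ allLines := fun _ h =>
  List.mem_append_left _ h

lemma square_lines : ∀ l ∈ squareTable.lines, l ∈ allLines := fun _ h =>
  List.mem_append_right _ h

/-- The derivative of `triangleStep`. -/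
noncomputable def triangleDeriv (p : ℝ × ℝ) : ℝ × ℝ →ₗ[ℝ] ℝ × ℝ := (triangleTable.sel p).lin

/-- The derivative of `squareStep`. -/
noncomputable def squareDeriv (p : ℝ × ℝ) : ℝ × ℝ →ₗ[ℝ] ℝ × ℝ := (squareTable.sel p).lin

lemma hasMargin_triangleStep : HasMargin triangleStep triangleDeriv (lineMargin allLines) :=
  PLTable.hasMargin triangle_lines

lemma hasMargin_squareStep : HasMargin squareStep squareDeriv (lineMargin allLines) :=
  PLTable.hasMargin square_lines

lemma det_triangleDeriv (p) : |LinearMap.det (triangleDeriv p)| = 1 := by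
  obtain ⟨a, ha, -, h⟩ := PLTable.exists_sel (triangleTable_cover p)
  rw [triangleDeriv, h, IntAffine.lin_det]
  exact_mod_cast triangleTable_det a ha

lemma det_squareDeriv (p) : |LinearMap.det (squareDeriv p)| = 1 := by
  obtain ⟨a, ha, -, h⟩ := PLTable.exists_sel (squareTable_cover p)
  rw [squareDeriv, h, IntAffine.lin_det]
  exact_mod_cast squareTable_det a ha

lemma IsGen.exists_mem_triTable {p} (h : IsGen p) (hp : p ∈ openSquare) :
    ∃ a ∈ triTable, triangleDeriv p = a.2.lin ∧
      (p ∈ openCell a.1 ∧ triangleStep p = a.2.act p ∨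
        halfTurn p ∈ openCell a.1 ∧ halfTurn (triangleStep p) = a.2.act (halfTurn p)) := by
  obtain ⟨a, ha, hpa, hsel⟩ := PLTable.exists_sel (triangleTable_cover p)
  have hpo := h.mem_openCell triangle_lines ha hpa
  have ha' := ha
  rw [triangleTable, List.mem_append, List.mem_append] at ha'
  rcases ha' with ha' | ha' | ha'
  · obtain ⟨⟨h1, h2⟩, h3, h4⟩ := hp
    rcases (mem_outerTable ha' hpa).2 with h | h | h | h <;> linarith
  · exact ⟨a, ha', by rw [triangleDeriv, hsel], Or.inl ⟨hpo, triangleStep_eq ha' hpa⟩⟩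
  · obtain ⟨b, hb, rfl⟩ := mem_halfTurnConj.1 ha'
    refine ⟨b, hb, by rw [triangleDeriv, hsel]; rfl, Or.inr ⟨fun l hl => ?_, ?_⟩⟩
    · have := hpo (halfTurnLine l) (List.mem_map_of_mem hl)
      rwa [lineEval_halfTurnLine] at this
    · rw [mem_cell_map_halfTurnLine] at hpa
      rw [triangleStep_eq' hb hpa, halfTurn_halfTurn]

lemma IsGen.mem_innerTable {p} (h : IsGen p) (hp : 1 / 4 < sqHeight p) :
    ∃ a ∈ innerTable, squareDeriv p = a.2.lin ∧ p ∈ openCell a.1 ∧ squareStep p = a.2.act p := by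
  obtain ⟨a, ha, hpa, hsel⟩ := PLTable.exists_sel (squareTable_cover p)
  have hpo := h.mem_openCell square_lines ha hpa
  have ha' := ha
  rw [squareTable, List.mem_append] at ha'
  rcases ha' with ha' | ha'
  · simp only [sqHeight, lt_min_iff] at hp
    rcases (mem_frameTable ha' hpa).2 with h | h | h | h <;> linarith
  · exact ⟨a, ha', by rw [squareDeriv, hsel], hpo, squareStep_eq ha' hpa⟩

/-- Components of a vector along and across the level triangles of `lowerHeight`. -/
noncomputable def lowerFrame (p w : ℝ × ℝ) : ℝ × ℝ :=
  if p.2 < 1 - p.1 ∧ p.2 < p.1 - p.2 then (w.1 - 2 * w.2, w.2)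
  else if 1 - p.1 < p.1 - p.2 then (w.1 + w.2, -w.1) else (w.2 - 2 * w.1, w.1 - w.2)

lemma lowerFrame_bottom {p : ℝ × ℝ} (h1 : p.2 < 1 - p.1) (h2 : p.2 < p.1 - p.2) (w : ℝ × ℝ) :
    lowerFrame p w = (w.1 - 2 * w.2, w.2) := by rw [lowerFrame, if_pos ⟨h1, h2⟩]

lemma lowerFrame_right {p : ℝ × ℝ} (h1 : 1 - p.1 < p.2) (h2 : 1 - p.1 < p.1 - p.2) (w : ℝ × ℝ) :
    lowerFrame p w = (w.1 + w.2, -w.1) := by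
  rw [lowerFrame, if_neg fun h => h1.not_gt h.1, if_pos h2]

lemma lowerFrame_diag {p : ℝ × ℝ} (h1 : p.1 - p.2 < p.2) (h2 : p.1 - p.2 < 1 - p.1) (w : ℝ × ℝ) :
    lowerFrame p w = (w.2 - 2 * w.1, w.1 - w.2) := by
  rw [lowerFrame, if_neg fun h => h1.not_gt h.2, if_neg h2.not_gt]

lemma lowerHeight_lt {p : ℝ × ℝ} {c : ℝ} (hc : 0 < c) (h : p.1 - p.2 < c ∨ p.2 < c ∨ 1 - p.1 < c) :
    lowerHeight p < c := max_lt hc (by simpa [min_lt_iff] using h)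

lemma lt_lowerHeight {p : ℝ × ℝ} {c : ℝ} (h1 : c < p.1 - p.2) (h2 : c < p.2) (h3 : c < 1 - p.1) :
    c < lowerHeight p := lt_max_of_lt_right (lt_min h1 (lt_min h2 h3))

lemma lowerFrame_act : ∀ a ∈ triTable, ∀ p ∈ openCell a.1,
    (lowerHeight p < 1 / 4 ∧ ∃ κ : ℝ, 1 ≤ κ ∧ ∀ w, lowerFrame (a.2.act p) (a.2.lin w) =
      ((lowerFrame p w).1 + κ * (lowerFrame p w).2, (lowerFrame p w).2)) ∨
    (1 / 4 < lowerHeight p ∧ a.2 = ⟨0, -1, 1, -1, 1, 0⟩) := by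
  refine forall_mem_triTable ?_
  simp only [mem_openCell_cons, mem_openCell_nil, and_true, lineEval]
  push_cast
  refine ⟨?_, ?_, ?_, ?_, ?_, ?_, ?_⟩ <;> rintro p h
  · right
    apply lt_lowerHeight <;> linarith
  · left
    refine ⟨lowerHeight_lt (by norm_num) (Or.inr (Or.inl (by linarith))), 1, by norm_num, fun w => ?_⟩
    rw [lowerFrame_bottom, lowerFrame_bottom] <;>
      (try simp only [IntAffine.act, IntAffine.lin, LinearMap.coe_mk, AddHom.coe_mk, Prod.mk.injEq]) <;>
      push_cast <;> first | linarith | (constructor <;> linarith)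
  · left
    refine ⟨lowerHeight_lt (by norm_num) (Or.inr (Or.inl (by linarith))), 4, by norm_num, fun w => ?_⟩
    rw [lowerFrame_right, lowerFrame_bottom] <;>
      (try simp only [IntAffine.act, IntAffine.lin, LinearMap.coe_mk, AddHom.coe_mk, Prod.mk.injEq]) <;>
      push_cast <;> first | linarith | (constructor <;> linarith)
  · left
    refine ⟨lowerHeight_lt (by norm_num) (Or.inr (Or.inr (by linarith))), 1, by norm_num, fun w => ?_⟩
    rw [lowerFrame_right, lowerFrame_right] <;>
      (try simp only [IntAffine.act, IntAffine.lin, LinearMap.coe_mk, AddHom.coe_mk, Prod.mk.injEq]) <;>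
      push_cast <;> first | linarith | (constructor <;> linarith)
  · left
    refine ⟨lowerHeight_lt (by norm_num) (Or.inr (Or.inr (by linarith))), 4, by norm_num, fun w => ?_⟩
    rw [lowerFrame_diag, lowerFrame_right] <;>
      (try simp only [IntAffine.act, IntAffine.lin, LinearMap.coe_mk, AddHom.coe_mk, Prod.mk.injEq]) <;>
      push_cast <;> first | linarith | (constructor <;> linarith)
  · left
    refine ⟨lowerHeight_lt (by norm_num) (Or.inl (by linarith)), 1, by norm_num, fun w => ?_⟩
    rw [lowerFrame_diag, lowerFrame_diag] <;>
      (try simp only [IntAffine.act, IntAffine.lin, LinearMap.coe_mk, AddHom.coe_mk, Prod.mk.injEq]) <;>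
      push_cast <;> first | linarith | (constructor <;> linarith)
  · left
    refine ⟨lowerHeight_lt (by norm_num) (Or.inl (by linarith)), 4, by norm_num, fun w => ?_⟩
    rw [lowerFrame_bottom, lowerFrame_diag] <;>
      (try simp only [IntAffine.act, IntAffine.lin, LinearMap.coe_mk, AddHom.coe_mk, Prod.mk.injEq]) <;>
      push_cast <;> first | linarith | (constructor <;> linarith)

/-- Components of a vector along and across the level triangles of `triHeight`. -/
noncomputable def triFrame (p w : ℝ × ℝ) : ℝ × ℝ :=
  if p.2 < p.1 then lowerFrame p w else lowerFrame (halfTurn p) (-w)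

/-- Components of a vector along and across the level squares of `sqHeight`. -/
noncomputable def sqFrame (p w : ℝ × ℝ) : ℝ × ℝ :=
  if p.2 < p.1 then (if p.1 + p.2 < 1 then (w.1 - w.2, w.2) else (w.1 + w.2, -w.1))
  else (if p.1 + p.2 < 1 then (-w.1 - w.2, w.1) else (w.2 - w.1, -w.2))

lemma sqFrame_bottom {p : ℝ × ℝ} (h1 : p.2 < p.1) (h2 : p.1 + p.2 < 1) (w : ℝ × ℝ) :
    sqFrame p w = (w.1 - w.2, w.2) := by rw [sqFrame, if_pos h1, if_pos h2]

lemma sqFrame_right {p : ℝ × ℝ} (h1 : p.2 < p.1) (h2 : 1 < p.1 + p.2) (w : ℝ × ℝ) :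
    sqFrame p w = (w.1 + w.2, -w.1) := by rw [sqFrame, if_pos h1, if_neg h2.not_gt]

lemma sqFrame_left {p : ℝ × ℝ} (h1 : p.1 < p.2) (h2 : p.1 + p.2 < 1) (w : ℝ × ℝ) :
    sqFrame p w = (-w.1 - w.2, w.1) := by rw [sqFrame, if_neg h1.not_gt, if_pos h2]

lemma sqFrame_top {p : ℝ × ℝ} (h1 : p.1 < p.2) (h2 : 1 < p.1 + p.2) (w : ℝ × ℝ) :
    sqFrame p w = (w.2 - w.1, -w.2) := by rw [sqFrame, if_neg h1.not_gt, if_neg h2.not_gt]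

lemma sqHeight_lt {p : ℝ × ℝ} {c : ℝ} (h : p.1 < c ∨ 1 - p.1 < c ∨ p.2 < c ∨ 1 - p.2 < c) :
    sqHeight p < c := by simpa [sqHeight, min_lt_iff, or_assoc] using h

lemma sqFrame_act : ∀ a ∈ innerTable, ∀ p ∈ openCell a.1,
    (sqHeight p < 3 / 8 ∧ 1 / 4 < sqHeight p ∧ ∃ κ : ℝ, 4 ≤ κ ∧ ∀ w, sqFrame (a.2.act p) (a.2.lin w) =
      ((sqFrame p w).1 - κ * (sqFrame p w).2, (sqFrame p w).2)) ∨
    (3 / 8 < sqHeight p ∧ a.2 = ⟨-1, 0, 0, -1, 1, 1⟩) := by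
  simp only [innerTable, List.forall_mem_cons, List.not_mem_nil, IsEmpty.forall_iff, implies_true,
    and_true, mem_openCell_cons, mem_openCell_nil, lineEval]
  push_cast
  refine ⟨?_, ?_, ?_, ?_, ?_, ?_, ?_, ?_, ?_, ?_, ?_, ?_, ?_⟩ <;> rintro p h
  · right
    simp only [sqHeight, lt_min_iff]
    and_intros <;> linarith
  all_goals left
  all_goals refine ⟨?_, ?_, ?_⟩
  all_goals first
    | (simp only [sqHeight, lt_min_iff]; and_intros <;> linarith)
    | exact sqHeight_lt (Or.inl (by linarith))
    | exact sqHeight_lt (Or.inr (Or.inl (by linarith)))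
    | exact sqHeight_lt (Or.inr (Or.inr (Or.inl (by linarith))))
    | exact sqHeight_lt (Or.inr (Or.inr (Or.inr (by linarith))))
    | skip
  · refine ⟨4, by norm_num, fun w => ?_⟩
    rw [sqFrame_bottom, sqFrame_bottom] <;>
      (try simp only [IntAffine.act, IntAffine.lin, LinearMap.coe_mk, AddHom.coe_mk, Prod.mk.injEq]) <;>
      push_cast <;> first | linarith | (constructor <;> linarith)
  · refine ⟨6, by norm_num, fun w => ?_⟩
    rw [sqFrame_left, sqFrame_bottom] <;>
      (try simp only [IntAffine.act, IntAffine.lin, LinearMap.coe_mk, AddHom.coe_mk, Prod.mk.injEq]) <;>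
      push_cast <;> first | linarith | (constructor <;> linarith)
  · refine ⟨8, by norm_num, fun w => ?_⟩
    rw [sqFrame_top, sqFrame_bottom] <;>
      (try simp only [IntAffine.act, IntAffine.lin, LinearMap.coe_mk, AddHom.coe_mk, Prod.mk.injEq]) <;>
      push_cast <;> first | linarith | (constructor <;> linarith)
  · refine ⟨4, by norm_num, fun w => ?_⟩
    rw [sqFrame_right, sqFrame_right] <;>
      (try simp only [IntAffine.act, IntAffine.lin, LinearMap.coe_mk, AddHom.coe_mk, Prod.mk.injEq]) <;>
      push_cast <;> first | linarith | (constructor <;> linarith)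
  · refine ⟨6, by norm_num, fun w => ?_⟩
    rw [sqFrame_bottom, sqFrame_right] <;>
      (try simp only [IntAffine.act, IntAffine.lin, LinearMap.coe_mk, AddHom.coe_mk, Prod.mk.injEq]) <;>
      push_cast <;> first | linarith | (constructor <;> linarith)
  · refine ⟨8, by norm_num, fun w => ?_⟩
    rw [sqFrame_left, sqFrame_right] <;>
      (try simp only [IntAffine.act, IntAffine.lin, LinearMap.coe_mk, AddHom.coe_mk, Prod.mk.injEq]) <;>
      push_cast <;> first | linarith | (constructor <;> linarith)
  · refine ⟨4, by norm_num, fun w => ?_⟩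
    rw [sqFrame_top, sqFrame_top] <;>
      (try simp only [IntAffine.act, IntAffine.lin, LinearMap.coe_mk, AddHom.coe_mk, Prod.mk.injEq]) <;>
      push_cast <;> first | linarith | (constructor <;> linarith)
  · refine ⟨6, by norm_num, fun w => ?_⟩
    rw [sqFrame_right, sqFrame_top] <;>
      (try simp only [IntAffine.act, IntAffine.lin, LinearMap.coe_mk, AddHom.coe_mk, Prod.mk.injEq]) <;>
      push_cast <;> first | linarith | (constructor <;> linarith)
  · refine ⟨8, by norm_num, fun w => ?_⟩
    rw [sqFrame_bottom, sqFrame_top] <;>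
      (try simp only [IntAffine.act, IntAffine.lin, LinearMap.coe_mk, AddHom.coe_mk, Prod.mk.injEq]) <;>
      push_cast <;> first | linarith | (constructor <;> linarith)
  · refine ⟨4, by norm_num, fun w => ?_⟩
    rw [sqFrame_left, sqFrame_left] <;>
      (try simp only [IntAffine.act, IntAffine.lin, LinearMap.coe_mk, AddHom.coe_mk, Prod.mk.injEq]) <;>
      push_cast <;> first | linarith | (constructor <;> linarith)
  · refine ⟨6, by norm_num, fun w => ?_⟩
    rw [sqFrame_top, sqFrame_left] <;>
      (try simp only [IntAffine.act, IntAffine.lin, LinearMap.coe_mk, AddHom.coe_mk, Prod.mk.injEq]) <;>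
      push_cast <;> first | linarith | (constructor <;> linarith)
  · refine ⟨8, by norm_num, fun w => ?_⟩
    rw [sqFrame_right, sqFrame_left] <;>
      (try simp only [IntAffine.act, IntAffine.lin, LinearMap.coe_mk, AddHom.coe_mk, Prod.mk.injEq]) <;>
      push_cast <;> first | linarith | (constructor <;> linarith)

lemma triHeight_of_le {p : ℝ × ℝ} (h : p.2 ≤ p.1) : triHeight p = lowerHeight p := by
  rw [triHeight, lowerHeight_eq_zero (p := halfTurn p) (by simp only [halfTurn]; linarith), sub_zero]

lemma triHeight_of_ge {p : ℝ × ℝ} (h : p.1 ≤ p.2) : triHeight p = -lowerHeight (halfTurn p) := by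
  rw [triHeight, lowerHeight_eq_zero h, zero_sub]

lemma lowerHeight_nonneg (p) : 0 ≤ lowerHeight p := le_max_left _ _

lemma snd_lt_fst_of_lowerHeight_pos {p : ℝ × ℝ} (h : 0 < lowerHeight p) : p.2 < p.1 := by
  by_contra! h'
  rw [lowerHeight_eq_zero h'] at h
  exact lt_irrefl _ h

lemma lowerHeight_pos {p : ℝ × ℝ} (hp : p ∈ openSquare) (h : p.2 < p.1) : 0 < lowerHeight p := by
  obtain ⟨⟨h1, h2⟩, h3, h4⟩ := hp
  exact lt_lowerHeight (by linarith) h3 (by linarith)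

lemma halfTurn_mem_openSquare {p : ℝ × ℝ} : halfTurn p ∈ openSquare ↔ p ∈ openSquare := by
  simp only [openSquare, halfTurn, Set.mem_prod, Set.mem_Ioo]
  constructor <;> rintro ⟨⟨h1, h2⟩, h3, h4⟩ <;> exact ⟨⟨by linarith, by linarith⟩, by linarith, by linarith⟩

lemma swap_mem_openSquare {p : ℝ × ℝ} : p.swap ∈ openSquare ↔ p ∈ openSquare := by
  simp only [openSquare, Set.mem_prod, Prod.fst_swap, Prod.snd_swap, and_comm]

lemma not_mem_openSquare {p : ℝ × ℝ} :
    p ∉ openSquare ↔ p.1 ≤ 0 ∨ p.2 ≤ 0 ∨ 1 ≤ p.1 ∨ 1 ≤ p.2 := by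
  simp only [openSquare, Set.mem_prod, Set.mem_Ioo, not_and_or, not_lt]
  tauto

lemma triangleStep_leftInverse :
    Function.LeftInverse (fun p => (triangleStep p.swap).swap) triangleStep := fun p => by
  simp [triangleStep_swap_triangleStep]

lemma triangleStep_rightInverse :
    Function.RightInverse (fun p => (triangleStep p.swap).swap) triangleStep := fun p => by
  have := triangleStep_swap_triangleStep p.swap
  simpa using this

lemma squareStep_leftInverse :
    Function.LeftInverse (fun p => (squareStep p.swap).swap) squareStep := fun p => by
  simp [squareStep_swap_squareStep]

lemma squareStep_rightInverse :
    Function.RightInverse (fun p => (squareStep p.swap).swap) squareStep := fun p => by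
  have := squareStep_swap_squareStep p.swap
  simpa using this

lemma squareStep_of_notMem {p} (hp : p ∉ openSquare) : squareStep p = p :=
  squareStep_of_frame (by
    rcases not_mem_openSquare.1 hp with h | h | h | h
    · left; linarith
    · right; left; linarith
    · right; right; left; linarith
    · right; right; right; linarith)

lemma preimage_openSquare {f : ℝ × ℝ → ℝ × ℝ} (hf : Function.Injective f)
    (h : ∀ p, p ∉ openSquare → f p = p) : f ⁻¹' openSquare = openSquare := by
  ext p
  rw [Set.mem_preimage]
  by_cases hp : p ∈ openSquare
  · simp only [hp, iff_true]
    by_contra h'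
    have := hf (h _ h')
    rw [this] at h'
    exact h' hp
  · rw [h p hp]

lemma triangleStep_preimage : triangleStep ⁻¹' openSquare = openSquare :=
  preimage_openSquare triangleStep_leftInverse.injective fun _ hp =>
    triangleStep_of_outer (not_mem_openSquare.1 hp)

lemma squareStep_preimage : squareStep ⁻¹' openSquare = openSquare :=
  preimage_openSquare squareStep_leftInverse.injective fun _ => squareStep_of_notMem

lemma triangleStep_mem {p} : triangleStep p ∈ openSquare ↔ p ∈ openSquare := by
  rw [← Set.mem_preimage, triangleStep_preimage]

lemma squareStep_mem {p} : squareStep p ∈ openSquare ↔ p ∈ openSquare := by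
  rw [← Set.mem_preimage, squareStep_preimage]

lemma isPL_triangleStep_symm : IsPL fun p => (triangleStep p.swap).swap := by
  have hs : IsPL (Prod.swap : ℝ × ℝ → ℝ × ℝ) :=
    ⟨continuous_swap, {⟨0, 1, 1, 0, 0, 0⟩}, Set.finite_singleton _, by simp [IntAffine.det],
      fun p => ⟨_, rfl, by simp [IntAffine.act, Prod.swap]⟩⟩
  exact hs.comp (isPL_triangleStep.comp hs)

lemma triFrame_of_lt {p : ℝ × ℝ} (h : p.2 < p.1) (w) : triFrame p w = lowerFrame p w := if_pos h

lemma triFrame_of_gt {p : ℝ × ℝ} (h : p.1 < p.2) (w) :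
    triFrame p w = lowerFrame (halfTurn p) (-w) := if_neg h.not_gt

lemma IsGen.triFrame_triangleStep {p} (h : IsGen p) (hp : p ∈ openSquare) :
    (|triHeight p| < 1 / 4 ∧ ∃ κ : ℝ, 1 ≤ κ ∧ ∀ w, triFrame (triangleStep p) (triangleDeriv p w) =
      ((triFrame p w).1 + κ * (triFrame p w).2, (triFrame p w).2)) ∨
    (1 / 4 < |triHeight p| ∧ triangleDeriv p = IntAffine.lin ⟨0, -1, 1, -1, 1, 0⟩) := by
  obtain ⟨a, ha, hD, ⟨hpa, hf⟩ | ⟨hpa, hf⟩⟩ := h.exists_mem_triTable hp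
  · have h1 := triTable_region a ha p (openCell_subset _ hpa)
    have hne : p.1 ≠ p.2 := fun h0 => by
      have := h.ne (l := (1, -1, 0)) (by decide)
      simp [lineEval, h0] at this
    have hlt : p.2 < p.1 := lt_of_le_of_ne h1.2.1 hne.symm
    have h2 := lowerHeight_act a ha p (openCell_subset _ hpa)
    have h3 : (a.2.act p).2 < (a.2.act p).1 :=
      snd_lt_fst_of_lowerHeight_pos (h2.1 ▸ lowerHeight_pos hp hlt)
    rw [triHeight_of_le hlt.le, abs_of_nonneg (lowerHeight_nonneg _), hD, hf]
    rcases lowerFrame_act a ha p hpa with ⟨h4, κ, hκ, h5⟩ | ⟨h4, h5⟩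
    · refine Or.inl ⟨h4, κ, hκ, fun w => ?_⟩
      rw [triFrame_of_lt h3, triFrame_of_lt hlt, h5]
    · exact Or.inr ⟨h4, by rw [h5]⟩
  · have h1 := triTable_region a ha _ (openCell_subset _ hpa)
    have hne : p.1 ≠ p.2 := fun h0 => by
      have := h.ne (l := (1, -1, 0)) (by decide)
      simp [lineEval, h0] at this
    have hlt : p.1 < p.2 := lt_of_le_of_ne (by simp only [halfTurn] at h1; linarith) hne
    have hlt' : (halfTurn p).2 < (halfTurn p).1 := by simp only [halfTurn]; linarith
    have h2 := lowerHeight_act a ha _ (openCell_subset _ hpa)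
    have h3 : (a.2.act (halfTurn p)).2 < (a.2.act (halfTurn p)).1 :=
      snd_lt_fst_of_lowerHeight_pos (h2.1 ▸ lowerHeight_pos (halfTurn_mem_openSquare.2 hp) hlt')
    rw [← hf] at h3
    have h6 : (triangleStep p).1 < (triangleStep p).2 := by simp only [halfTurn] at h3; linarith
    rw [triHeight_of_ge hlt.le, abs_neg, abs_of_nonneg (lowerHeight_nonneg _), hD]
    rcases lowerFrame_act a ha _ hpa with ⟨h4, κ, hκ, h5⟩ | ⟨h4, h5⟩
    · refine Or.inl ⟨h4, κ, hκ, fun w => ?_⟩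
      rw [triFrame_of_gt h6, triFrame_of_gt hlt, ← map_neg, hf, h5]
    · exact Or.inr ⟨h4, by rw [h5]⟩

lemma IsGen.sqFrame_squareStep {p} (h : IsGen p) :
    ((1 / 4 < sqHeight p ∧ sqHeight p < 3 / 8) ∧ ∃ κ : ℝ, 4 ≤ κ ∧
      ∀ w, sqFrame (squareStep p) (squareDeriv p w) =
        ((sqFrame p w).1 - κ * (sqFrame p w).2, (sqFrame p w).2)) ∨
    (3 / 8 < sqHeight p ∧ squareDeriv p = IntAffine.lin ⟨-1, 0, 0, -1, 1, 1⟩) ∨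
    (sqHeight p ≤ 1 / 4 ∧ squareDeriv p = LinearMap.id) := by
  by_cases hp : 1 / 4 < sqHeight p
  · obtain ⟨a, ha, hD, hpa, hg⟩ := h.mem_innerTable hp
    rw [hD, hg]
    rcases sqFrame_act a ha p hpa with ⟨h1, -, h2⟩ | ⟨h1, h2⟩
    · exact Or.inl ⟨⟨hp, h1⟩, h2⟩
    · exact Or.inr (Or.inl ⟨h1, by rw [h2]⟩)
  · refine Or.inr (Or.inr ⟨not_lt.1 hp, ?_⟩)
    obtain ⟨a, ha, hpa, hsel⟩ := PLTable.exists_sel (squareTable_cover p)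
    have hpo := h.mem_openCell square_lines ha hpa
    rw [squareTable, List.mem_append] at ha
    rcases ha with ha | ha
    · rw [squareDeriv, hsel, (mem_frameTable ha hpa).1]
      ext <;> simp [IntAffine.lin]
    · rcases sqFrame_act a ha p hpo with ⟨-, h1, -⟩ | ⟨h1, -⟩ <;> linarith

/-- A full turn around the level triangles. -/
noncomputable def triTurn (p : ℝ × ℝ) : ℝ × ℝ := triangleStep (triangleStep (triangleStep p))

/-- A turn around the level squares. -/
noncomputable def sqTurn (p : ℝ × ℝ) : ℝ × ℝ := squareStep (squareStep p)

/-- The derivative of `triTurn`. -/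
noncomputable def triTurnDeriv (p : ℝ × ℝ) : ℝ × ℝ →ₗ[ℝ] ℝ × ℝ :=
  triangleDeriv (triangleStep (triangleStep p)) ∘ₗ triangleDeriv (triangleStep p) ∘ₗ triangleDeriv p

/-- The derivative of `sqTurn`. -/
noncomputable def sqTurnDeriv (p : ℝ × ℝ) : ℝ × ℝ →ₗ[ℝ] ℝ × ℝ :=
  squareDeriv (squareStep p) ∘ₗ squareDeriv p

/-- The region where `triTurn` is not the identity. -/
def triZone : Set (ℝ × ℝ) := {p | p ∈ openSquare ∧ |triHeight p| < 1 / 4}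

/-- The region where `sqTurn` is not the identity. -/
def sqZone : Set (ℝ × ℝ) := {p | 1 / 4 < sqHeight p ∧ sqHeight p < 3 / 8}

lemma triHeight_triTurn (p) : triHeight (triTurn p) = triHeight p := by
  simp only [triTurn, triHeight_triangleStep]

lemma sqHeight_sqTurn (p) : sqHeight (sqTurn p) = sqHeight p := by
  simp only [sqTurn, sqHeight_squareStep]

lemma triTurn_mem {p} : triTurn p ∈ openSquare ↔ p ∈ openSquare := by
  simp only [triTurn, triangleStep_mem]

lemma sqTurn_mem {p} : sqTurn p ∈ openSquare ↔ p ∈ openSquare := by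
  simp only [sqTurn, squareStep_mem]

lemma triTurn_mem_triZone {p} : triTurn p ∈ triZone ↔ p ∈ triZone := by
  simp only [triZone, Set.mem_ofPred_eq, triTurn_mem, triHeight_triTurn]

lemma sqTurn_mem_sqZone {p} : sqTurn p ∈ sqZone ↔ p ∈ sqZone := by
  simp only [sqZone, Set.mem_ofPred_eq, sqHeight_sqTurn]

lemma isOpen_openSquare : IsOpen openSquare := isOpen_Ioo.prod isOpen_Ioo

lemma isOpen_triZone : IsOpen triZone :=
  isOpen_openSquare.inter (isOpen_lt continuous_triHeight.abs continuous_const)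

lemma isOpen_sqZone : IsOpen sqZone :=
  (isOpen_lt continuous_const continuous_sqHeight).inter
    (isOpen_lt continuous_sqHeight continuous_const)

lemma sqZone_subset : sqZone ⊆ openSquare := fun p hp => by
  have h := hp.1
  simp only [sqHeight, lt_min_iff] at h
  exact ⟨⟨by linarith, by linarith⟩, by linarith, by linarith⟩

lemma triangleStep_of_le_lowerHeight {p : ℝ × ℝ} (h : 1 / 4 ≤ lowerHeight p) :
    triangleStep p = (1 - p.2, p.1 - p.2) := by
  have h1 : 1 / 4 ≤ min (p.1 - p.2) (min p.2 (1 - p.1)) := by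
    rcases le_max_iff.1 h with h | h
    · norm_num at h
    · exact h
  simp only [le_min_iff] at h1
  rw [triangleStep_eq (a := ([(0, 4, -1), (-4, 0, 3), (4, -4, -1)], ⟨0, -1, 1, -1, 1, 0⟩))
    (by simp [triTable])]
  · ext <;> simp [IntAffine.act] <;> ring
  · simp only [mem_cell_cons, mem_cell_nil, lineEval]
    push_cast
    refine ⟨?_, ?_, ?_, trivial⟩ <;> linarith

lemma triTurn_of_le_lowerHeight {p : ℝ × ℝ} (h : 1 / 4 ≤ lowerHeight p) : triTurn p = p := by
  have h1 := triangleStep_of_le_lowerHeight h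
  have h2 := triangleStep_of_le_lowerHeight (p := triangleStep p) (by rwa [lowerHeight_triangleStep])
  have h3 := triangleStep_of_le_lowerHeight (p := triangleStep (triangleStep p))
    (by rwa [lowerHeight_triangleStep, lowerHeight_triangleStep])
  rw [triTurn, h3, h2, h1]
  ext <;> simp

lemma triTurn_halfTurn (p) : triTurn (halfTurn p) = halfTurn (triTurn p) := by
  simp only [triTurn, triangleStep_halfTurn]

lemma triTurn_of_notMem {p} (hp : p ∉ triZone) : triTurn p = p := by
  by_cases h : p ∈ openSquare
  · have h1 : 1 / 4 ≤ |triHeight p| := by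
      by_contra! h'; exact hp ⟨h, h'⟩
    rcases le_total p.2 p.1 with h2 | h2
    · rw [triHeight_of_le h2, abs_of_nonneg (lowerHeight_nonneg _)] at h1
      exact triTurn_of_le_lowerHeight h1
    · rw [triHeight_of_ge h2, abs_neg, abs_of_nonneg (lowerHeight_nonneg _)] at h1
      have := triTurn_of_le_lowerHeight h1
      rw [triTurn_halfTurn] at this
      rw [← halfTurn_halfTurn (triTurn p), this, halfTurn_halfTurn]
  · have := triangleStep_of_outer (not_mem_openSquare.1 h)
    rw [triTurn, this, this, this]

lemma squareStep_of_le_sqHeight {p : ℝ × ℝ} (h : 3 / 8 ≤ sqHeight p) :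
    squareStep p = halfTurn p := by
  simp only [sqHeight, le_min_iff] at h
  rw [squareStep_eq (a := ([(8, 0, -3), (-8, 0, 5), (0, 8, -3), (0, -8, 5)], ⟨-1, 0, 0, -1, 1, 1⟩))
    (by simp [innerTable])]
  · ext <;> simp [IntAffine.act, halfTurn] <;> ring
  · simp only [mem_cell_cons, mem_cell_nil, lineEval]
    push_cast
    refine ⟨?_, ?_, ?_, ?_, trivial⟩ <;> linarith

lemma sqTurn_of_notMem {p} (hp : p ∉ sqZone) : sqTurn p = p := by
  by_cases h : 1 / 4 < sqHeight p
  · have h1 : 3 / 8 ≤ sqHeight p := by by_contra! h'; exact hp ⟨h, h'⟩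
    rw [sqTurn, squareStep_of_le_sqHeight (by rwa [sqHeight_squareStep]),
      squareStep_of_le_sqHeight h1, halfTurn_halfTurn]
  · have h1 : squareStep p = p := by
      refine squareStep_of_frame ?_
      simp only [sqHeight, lt_min_iff] at h
      by_contra! h2
      exact h ⟨⟨by linarith, by linarith⟩, by linarith, by linarith⟩
    rw [sqTurn, h1, h1]

lemma det_triTurnDeriv (p) : |LinearMap.det (triTurnDeriv p)| = 1 := by
  simp [triTurnDeriv, LinearMap.det_comp, abs_mul, det_triangleDeriv]

lemma det_sqTurnDeriv (p) : |LinearMap.det (sqTurnDeriv p)| = 1 := by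
  simp [sqTurnDeriv, LinearMap.det_comp, abs_mul, det_squareDeriv]

/-- The orbit of the point under the steps of `triTurn` avoids all the lines. -/
def TriGen (p : ℝ × ℝ) : Prop :=
  IsGen p ∧ IsGen (triangleStep p) ∧ IsGen (triangleStep (triangleStep p))

/-- The orbit of the point under the steps of `sqTurn` avoids all the lines. -/
def SqGen (p : ℝ × ℝ) : Prop := IsGen p ∧ IsGen (squareStep p)

lemma TriGen.triFrame_triTurn {p} (h : TriGen p) (hp : p ∈ triZone) :
    ∃ κ : ℝ, 3 ≤ κ ∧ ∀ w, triFrame (triTurn p) (triTurnDeriv p w) =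
      ((triFrame p w).1 + κ * (triFrame p w).2, (triFrame p w).2) := by
  obtain ⟨h1, h2, h3⟩ := h
  obtain ⟨hp, hφ⟩ := hp
  have key : ∀ {q}, IsGen q → q ∈ openSquare → |triHeight q| < 1 / 4 → ∃ κ : ℝ, 1 ≤ κ ∧
      ∀ w, triFrame (triangleStep q) (triangleDeriv q w) =
      ((triFrame q w).1 + κ * (triFrame q w).2, (triFrame q w).2) := fun hq hq' hφ =>
    (hq.triFrame_triangleStep hq').elim (fun h => h.2) fun h => absurd hφ h.1.not_gt
  obtain ⟨a, ha, hA⟩ := key h1 hp hφ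
  obtain ⟨b, hb, hB⟩ := key h2 (triangleStep_mem.2 hp) (by rwa [triHeight_triangleStep])
  obtain ⟨c, hc, hC⟩ := key h3 (triangleStep_mem.2 (triangleStep_mem.2 hp))
    (by rwa [triHeight_triangleStep, triHeight_triangleStep])
  refine ⟨a + b + c, by linarith, fun w => ?_⟩
  rw [triTurn, triTurnDeriv, LinearMap.comp_apply, LinearMap.comp_apply, hC, hB, hA]
  ext <;> simp only; ring

lemma TriGen.triTurnDeriv_eq {p} (h : TriGen p) (hp : p ∈ openSquare) (hp' : p ∉ triZone) :
    triTurnDeriv p = LinearMap.id := by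
  obtain ⟨h1, h2, h3⟩ := h
  have hφ : ¬ |triHeight p| < 1 / 4 := fun h => hp' ⟨hp, h⟩
  have key : ∀ {q}, IsGen q → q ∈ openSquare → ¬ |triHeight q| < 1 / 4 →
      triangleDeriv q = IntAffine.lin ⟨0, -1, 1, -1, 1, 0⟩ := fun hq hq' hφ =>
    (hq.triFrame_triangleStep hq').elim (fun h => absurd h.1 hφ) fun h => h.2
  rw [triTurnDeriv, key h1 hp hφ, key h2 (triangleStep_mem.2 hp) (by rwa [triHeight_triangleStep]),
    key h3 (triangleStep_mem.2 (triangleStep_mem.2 hp))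
    (by rwa [triHeight_triangleStep, triHeight_triangleStep])]
  ext <;> simp [IntAffine.lin]

lemma SqGen.sqFrame_sqTurn {p} (h : SqGen p) (hp : p ∈ sqZone) :
    ∃ κ : ℝ, 8 ≤ κ ∧ ∀ w, sqFrame (sqTurn p) (sqTurnDeriv p w) =
      ((sqFrame p w).1 - κ * (sqFrame p w).2, (sqFrame p w).2) := by
  obtain ⟨h1, h2⟩ := h
  have key : ∀ {q}, IsGen q → q ∈ sqZone → ∃ κ : ℝ, 4 ≤ κ ∧
      ∀ w, sqFrame (squareStep q) (squareDeriv q w) =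
      ((sqFrame q w).1 - κ * (sqFrame q w).2, (sqFrame q w).2) := fun hq hq' => by
    rcases hq.sqFrame_squareStep with h | h | h
    · exact h.2
    · exact absurd hq'.2 h.1.not_gt
    · exact absurd hq'.1 h.1.not_gt
  obtain ⟨a, ha, hA⟩ := key h1 hp
  obtain ⟨b, hb, hB⟩ := key h2 (by simpa only [sqZone, Set.mem_ofPred_eq, sqHeight_squareStep] using hp)
  refine ⟨a + b, by linarith, fun w => ?_⟩
  rw [sqTurn, sqTurnDeriv, LinearMap.comp_apply, hB, hA]
  ext <;> simp only; ring

lemma SqGen.sqTurnDeriv_eq {p} (h : SqGen p) (hp : p ∉ sqZone) : sqTurnDeriv p = LinearMap.id := by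
  obtain ⟨h1, h2⟩ := h
  rcases h1.sqFrame_squareStep with h | h | h
  · exact absurd h.1 hp
  · rcases h2.sqFrame_squareStep with h' | h' | h'
    · rw [sqHeight_squareStep] at h'; exact absurd h'.1 hp
    · rw [sqTurnDeriv, h.2, h'.2]
      ext <;> simp [IntAffine.lin]
    · rw [sqHeight_squareStep] at h'; linarith
  · rcases h2.sqFrame_squareStep with h' | h' | h'
    · rw [sqHeight_squareStep] at h'; exact absurd h'.1 hp
    · rw [sqHeight_squareStep] at h'; linarith
    · rw [sqTurnDeriv, h.2, h'.2, LinearMap.id_comp]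

/-- A piecewise affine area-preserving self-map of the plane which preserves the unit square. -/
structure IsSquareMap (f : ℝ × ℝ → ℝ × ℝ) : Prop where
  isPL : IsPL f
  measurePreserving : MeasurePreserving f volume volume
  preimage : f ⁻¹' openSquare = openSquare

namespace IsSquareMap

variable {f g : ℝ × ℝ → ℝ × ℝ}

lemma comp (hg : IsSquareMap g) (hf : IsSquareMap f) : IsSquareMap (g ∘ f) :=
  ⟨hg.isPL.comp hf.isPL, hg.measurePreserving.comp hf.measurePreserving, by
    rw [Set.preimage_comp, hg.preimage, hf.preimage]⟩

lemma measurePreserving_restrict (hf : IsSquareMap f) :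
    MeasurePreserving f (volume.restrict openSquare) (volume.restrict openSquare) := by
  have := hf.measurePreserving.restrict_preimage measurableSet_openSquare
  rwa [hf.preimage] at this

lemma exists_hasMargin_comp (hf : IsSquareMap f) {D D' m m'} (hgm : HasMargin g D' m')
    (hfm : HasMargin f D m) : ∃ M, HasMargin (g ∘ f) (fun p => D' (f p) ∘ₗ D p) M ∧
      ∀ p, 0 < M p → 0 < m p ∧ 0 < m' (f p) := by
  obtain ⟨K, hK1, hK⟩ := hf.isPL.exists_lipschitz
  have hK0 : (0 : ℝ) < K := zero_lt_one.trans_le (by exact_mod_cast hK1)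
  refine ⟨_, hgm.comp hfm hK hK1 hf.measurePreserving hf.preimage, fun p hp => ?_⟩
  exact ⟨hp.trans_le (min_le_left _ _), by
    simpa [div_pos_iff_of_pos_right hK0] using hp.trans_le (min_le_right _ _)⟩

end IsSquareMap

/-- The reflection in the diagonal, as a linear map. -/
def swapLin : ℝ × ℝ →ₗ[ℝ] ℝ × ℝ := (LinearMap.snd ℝ ℝ ℝ).prod (LinearMap.fst ℝ ℝ ℝ)

lemma swapLin_apply (p) : swapLin p = p.swap := rfl

lemma det_swapLin : |LinearMap.det swapLin| = 1 := by
  have : swapLin = IntAffine.lin ⟨0, 1, 1, 0, 0, 0⟩ := by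
    ext <;> simp [swapLin, IntAffine.lin]
  rw [this, IntAffine.lin_det]; simp [IntAffine.det]

lemma isPL_swap : IsPL (Prod.swap : ℝ × ℝ → ℝ × ℝ) :=
  ⟨continuous_swap, {⟨0, 1, 1, 0, 0, 0⟩}, Set.finite_singleton _, by simp [IntAffine.det],
    fun p => ⟨_, rfl, by simp [IntAffine.act, Prod.swap]⟩⟩

lemma isSquareMap_swap : IsSquareMap (Prod.swap : ℝ × ℝ → ℝ × ℝ) :=
  ⟨isPL_swap, isPL_swap.measurePreserving continuous_swap Prod.swap_swap Prod.swap_swap,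
    Set.ext fun _ => swap_mem_openSquare⟩

lemma hasMargin_swap : HasMargin Prod.swap (fun _ => swapLin) (fun _ => 1) := by
  refine ⟨continuous_const, fun p q _ => ?_, volume_lineMargin_lt (L := []) (by simp)⟩
  rw [swapLin_apply]; simp

lemma isSquareMap_triangleStep : IsSquareMap triangleStep :=
  ⟨isPL_triangleStep, isPL_triangleStep.measurePreserving isPL_triangleStep_symm.1
    triangleStep_leftInverse triangleStep_rightInverse, triangleStep_preimage⟩

lemma isSquareMap_squareStep : IsSquareMap squareStep :=
  ⟨isPL_squareStep, isPL_squareStep.measurePreserving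
    (isPL_swap.comp (isPL_squareStep.comp isPL_swap)).1
    squareStep_leftInverse squareStep_rightInverse, squareStep_preimage⟩

lemma isSquareMap_triTurn : IsSquareMap triTurn :=
  isSquareMap_triangleStep.comp (isSquareMap_triangleStep.comp isSquareMap_triangleStep)

lemma isSquareMap_sqTurn : IsSquareMap sqTurn := isSquareMap_squareStep.comp isSquareMap_squareStep

lemma triTurn_swap_triTurn (p) : triTurn (triTurn p).swap = p.swap := by
  simp only [triTurn, triangleStep_swap_triangleStep]

lemma sqTurn_swap_sqTurn (p) : sqTurn (sqTurn p).swap = p.swap := by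
  simp only [sqTurn, squareStep_swap_squareStep]

/-- The ergodic homeomorphism, on the plane. -/
noncomputable def stepMap (p : ℝ × ℝ) : ℝ × ℝ := sqTurn (triTurn p)

/-- The inverse of `stepMap`. -/
noncomputable def stepInv (p : ℝ × ℝ) : ℝ × ℝ := (triTurn (sqTurn p.swap)).swap

lemma stepInv_stepMap : Function.LeftInverse stepInv stepMap := fun p => by
  rw [stepInv, stepMap, sqTurn_swap_sqTurn, triTurn_swap_triTurn, Prod.swap_swap]

lemma stepMap_stepInv : Function.RightInverse stepInv stepMap := fun p => by
  rw [stepInv, stepMap, triTurn_swap_triTurn, sqTurn_swap_sqTurn, Prod.swap_swap]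

/-- The derivative of `stepMap`. -/
noncomputable def stepDeriv (p : ℝ × ℝ) : ℝ × ℝ →ₗ[ℝ] ℝ × ℝ :=
  sqTurnDeriv (triTurn p) ∘ₗ triTurnDeriv p

/-- The derivative of `stepInv`. -/
noncomputable def stepInvDeriv (p : ℝ × ℝ) : ℝ × ℝ →ₗ[ℝ] ℝ × ℝ :=
  swapLin ∘ₗ triTurnDeriv (sqTurn p.swap) ∘ₗ sqTurnDeriv p.swap ∘ₗ swapLin

lemma isSquareMap_stepMap : IsSquareMap stepMap := isSquareMap_sqTurn.comp isSquareMap_triTurn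

lemma isSquareMap_stepInv : IsSquareMap stepInv :=
  isSquareMap_swap.comp (isSquareMap_triTurn.comp (isSquareMap_sqTurn.comp isSquareMap_swap))

lemma exists_hasMargin_triTurn : ∃ M, HasMargin triTurn triTurnDeriv M ∧ ∀ p, 0 < M p → TriGen p := by
  obtain ⟨m, hm, h⟩ := isSquareMap_triangleStep.exists_hasMargin_comp hasMargin_triangleStep
    hasMargin_triangleStep
  obtain ⟨M, hM, h'⟩ := (isSquareMap_triangleStep.comp
    isSquareMap_triangleStep).exists_hasMargin_comp hasMargin_triangleStep hm
  exact ⟨M, hM, fun p hp => ⟨(h p (h' p hp).1).1, (h p (h' p hp).1).2, (h' p hp).2⟩⟩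

lemma exists_hasMargin_sqTurn : ∃ M, HasMargin sqTurn sqTurnDeriv M ∧ ∀ p, 0 < M p → SqGen p :=
  isSquareMap_squareStep.exists_hasMargin_comp hasMargin_squareStep hasMargin_squareStep

lemma exists_hasMargin_stepMap : ∃ M, HasMargin stepMap stepDeriv M ∧
    ∀ p, 0 < M p → (TriGen p ∧ SqGen (triTurn p)) ∧
      ∃ r > 0, AffineOnBall triTurn p (triTurnDeriv p) r := by
  obtain ⟨m, hm, h⟩ := exists_hasMargin_triTurn
  obtain ⟨m', hm', h'⟩ := exists_hasMargin_sqTurn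
  obtain ⟨M, hM, h2⟩ := isSquareMap_triTurn.exists_hasMargin_comp hm' hm
  exact ⟨M, hM, fun p hp => ⟨⟨h p (h2 p hp).1, h' _ (h2 p hp).2⟩, m p, (h2 p hp).1, hm.2.1 p⟩⟩

lemma exists_hasMargin_stepInv : ∃ M, HasMargin stepInv stepInvDeriv M := by
  obtain ⟨m, hm, -⟩ := exists_hasMargin_triTurn
  obtain ⟨m', hm', -⟩ := exists_hasMargin_sqTurn
  obtain ⟨M1, hM1, -⟩ := isSquareMap_swap.exists_hasMargin_comp hm' hasMargin_swap
  obtain ⟨M2, hM2, -⟩ := (isSquareMap_sqTurn.comp isSquareMap_swap).exists_hasMargin_comp hm hM1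
  obtain ⟨M3, hM3, -⟩ := (isSquareMap_triTurn.comp
    (isSquareMap_sqTurn.comp isSquareMap_swap)).exists_hasMargin_comp hasMargin_swap hM2
  exact ⟨M3, hM3⟩

/-- A radius of affinity for `stepMap`. -/
noncomputable def stepMargin : ℝ × ℝ → ℝ := exists_hasMargin_stepMap.choose

/-- A radius of affinity for `stepInv`. -/
noncomputable def stepInvMargin : ℝ × ℝ → ℝ := exists_hasMargin_stepInv.choose

lemma hasMargin_stepMap : HasMargin stepMap stepDeriv stepMargin :=
  exists_hasMargin_stepMap.choose_spec.1

lemma hasMargin_stepInv : HasMargin stepInv stepInvDeriv stepInvMargin :=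
  exists_hasMargin_stepInv.choose_spec

lemma triGen_of_stepMargin_pos {p} (h : 0 < stepMargin p) : TriGen p :=
  (exists_hasMargin_stepMap.choose_spec.2 p h).1.1

lemma sqGen_of_stepMargin_pos {p} (h : 0 < stepMargin p) : SqGen (triTurn p) :=
  (exists_hasMargin_stepMap.choose_spec.2 p h).1.2

lemma exists_affineOnBall_triTurn {p} (h : 0 < stepMargin p) :
    ∃ r > 0, AffineOnBall triTurn p (triTurnDeriv p) r :=
  (exists_hasMargin_stepMap.choose_spec.2 p h).2

lemma det_stepInvDeriv (p) : |LinearMap.det (stepInvDeriv p)| = 1 := by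
  simp [stepInvDeriv, LinearMap.det_comp, abs_mul, det_triTurnDeriv, det_sqTurnDeriv, det_swapLin]

lemma HasMargin.ae_pos {f D m} (h : HasMargin f D m) :
    ∀ᵐ p ∂(volume.restrict openSquare), 0 < m p := by
  obtain ⟨-, -, C, hC⟩ := h
  rw [ae_restrict_iff' measurableSet_openSquare]
  have h0 : volume {p ∈ openSquare | m p ≤ 0} = 0 := by
    have h2 : Filter.Tendsto (fun ε : ℝ => ENNReal.ofReal (C * ε)) (nhdsWithin 0 (Set.Ioi 0))
        (nhds 0) := by
      have : Filter.Tendsto (fun ε : ℝ => ENNReal.ofReal (C * ε)) (nhds 0)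
          (nhds (ENNReal.ofReal (C * 0))) := (ENNReal.continuous_ofReal.comp (by fun_prop)).tendsto _
      simp only [mul_zero, ENNReal.ofReal_zero] at this
      exact this.mono_left nhdsWithin_le_nhds
    refine le_antisymm (ge_of_tendsto h2 ?_) (by simp)
    filter_upwards [self_mem_nhdsWithin] with ε hε
    refine (measure_mono ?_).trans (hC ε hε)
    exact fun p hp => ⟨hp.1, hp.2.trans_lt hε⟩
  refine measure_mono_null (fun p hp => ?_) h0
  simp only [Set.mem_compl_iff, Set.mem_ofPred_eq, Classical.not_imp, not_lt] at hp
  exact hp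

/-- The points at which all the derivatives are defined. -/
def goodSet : Set (ℝ × ℝ) :=
  {y | y ∈ openSquare ∧ 0 < stepMargin y ∧ 0 < stepMargin (stepInv y) ∧ 0 < stepInvMargin y}

lemma ae_mem_goodSet : ∀ᵐ p ∂(volume.restrict openSquare), p ∈ goodSet := by
  filter_upwards [ae_restrict_mem measurableSet_openSquare, hasMargin_stepMap.ae_pos,
    isSquareMap_stepInv.measurePreserving_restrict.quasiMeasurePreserving.ae
      hasMargin_stepMap.ae_pos, hasMargin_stepInv.ae_pos] with p h1 h2 h3 h4
  exact ⟨h1, h2, h3, h4⟩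

lemma stepDeriv_stepInvDeriv {y} (hy : y ∈ goodSet) (w) :
    stepDeriv (stepInv y) (stepInvDeriv y w) = w := by
  obtain ⟨-, -, h1, h2⟩ := hy
  obtain ⟨K, hK1, hK⟩ := isSquareMap_stepInv.isPL.exists_lipschitz
  have hK0 : (0 : ℝ) < K := zero_lt_one.trans_le (by exact_mod_cast hK1)
  have h3 := AffineOnBall.comp (hasMargin_stepMap.2.1 (stepInv y)) (hasMargin_stepInv.2.1 y) hK hK1
  have h4 : AffineOnBall (stepMap ∘ stepInv) y LinearMap.id 1 := fun q _ => by
    simp only [Function.comp, stepMap_stepInv _]; simp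
  have := AffineOnBall.unique (lt_min h2 (by positivity)) one_pos h3 h4
  simpa using LinearMap.congr_fun this w

lemma IsGen.mem_zone {p} (h : IsGen p) (hp : p ∈ openSquare) : p ∈ triZone ∨ p ∈ sqZone := by
  rcases h.triFrame_triangleStep hp with h1 | h1
  · exact Or.inl ⟨hp, h1.1⟩
  right
  have h2 := h1.1
  rcases le_total p.2 p.1 with h3 | h3
  · rw [triHeight_of_le h3, abs_of_nonneg (lowerHeight_nonneg _), lowerHeight, lt_max_iff] at h2
    norm_num at h2
    constructor
    · simp only [sqHeight, lt_min_iff]; and_intros <;> linarith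
    · apply sqHeight_lt
      by_contra! h4
      linarith
  · rw [triHeight_of_ge h3, abs_neg, abs_of_nonneg (lowerHeight_nonneg _), lowerHeight,
      lt_max_iff] at h2
    norm_num [halfTurn] at h2
    constructor
    · simp only [sqHeight, lt_min_iff]; and_intros <;> linarith
    · apply sqHeight_lt
      by_contra! h4
      linarith

/-- The cone preserved by turns around the triangles. -/
def TriCone (a : ℝ × ℝ) : Prop := a.2 ^ 2 ≤ a.1 * a.2

/-- The cone preserved by turns around the squares. -/
def SqCone (b : ℝ × ℝ) : Prop := b.1 * b.2 ≤ -4 * b.2 ^ 2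

/-- On the common zone, the two frames are related in one of two ways. -/
def FrameRel (a b : ℝ × ℝ) : Prop :=
  (a.1 = b.2 - a.2 ∧ b.1 = -2 * b.2 - a.2) ∨ (a.1 = -b.2 - 2 * a.2 ∧ b.1 = a.2)

lemma ring_bounds {p} (h : p ∈ triZone) (h' : p ∈ sqZone) :
    (1 / 4 < p.1 ∧ p.1 < 3 / 4 ∧ 1 / 4 < p.2 ∧ p.2 < 3 / 4) ∧ p.1 - p.2 < 1 / 4 ∧
      p.2 - p.1 < 1 / 4 ∧ triHeight p = p.1 - p.2 ∧ p.1 + p.2 ≠ 1 := by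
  obtain ⟨h1, h2⟩ := h'
  have h3 := h.2
  simp only [sqHeight, lt_min_iff] at h1
  have key : ∀ q : ℝ × ℝ, q.2 ≤ q.1 → 1 / 4 < q.2 → q.1 < 3 / 4 → lowerHeight q < 1 / 4 →
      q.1 - q.2 < 1 / 4 ∧ lowerHeight q = q.1 - q.2 := by
    intro q hq1 hq2 hq3 hq
    have : q.1 - q.2 < 1 / 4 := by
      by_contra! h0
      exact hq.not_ge (le_max_of_le_right (le_min h0 (le_min hq2.le (by linarith))))
    exact ⟨this, lowerHeight_eq (by linarith) le_rfl (by linarith) (by linarith)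
      (Or.inl le_rfl)⟩
  have h4 : p.1 - p.2 < 1 / 4 ∧ p.2 - p.1 < 1 / 4 ∧ triHeight p = p.1 - p.2 := by
    rcases le_total p.2 p.1 with h5 | h5
    · rw [triHeight_of_le h5] at h3 ⊢
      rw [abs_of_nonneg (lowerHeight_nonneg _)] at h3
      obtain ⟨h6, h7⟩ := key p h5 (by linarith) (by linarith) h3
      exact ⟨h6, by linarith, h7⟩
    · rw [triHeight_of_ge h5] at h3 ⊢
      rw [abs_neg, abs_of_nonneg (lowerHeight_nonneg _)] at h3
      obtain ⟨h6, h7⟩ := key (halfTurn p) (by simp only [halfTurn]; linarith)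
        (by simp only [halfTurn]; linarith) (by simp only [halfTurn]; linarith) h3
      simp only [halfTurn] at h6 h7 ⊢
      exact ⟨by linarith, by linarith, by rw [h7]; ring⟩
  refine ⟨⟨by linarith, by linarith, by linarith, by linarith⟩, h4.1, h4.2.1, h4.2.2, fun h0 => ?_⟩
  refine h2.not_ge ?_
  simp only [sqHeight, le_min_iff]
  and_intros <;> linarith

lemma frameRel {p} (h : p ∈ triZone) (h' : p ∈ sqZone) (w) :
    FrameRel (triFrame p w) (sqFrame p w) := by
  obtain ⟨⟨h1, h2, h3, h4⟩, h5, h6, -, h7⟩ := ring_bounds h h'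
  rcases lt_or_ge p.2 p.1 with h8 | h8
  · rw [triFrame_of_lt h8, lowerFrame_diag (by linarith) (by linarith)]
    rcases lt_or_gt_of_ne h7 with h9 | h9
    · rw [sqFrame_bottom h8 h9]
      right; constructor <;> ring
    · rw [sqFrame_right h8 h9]
      left; constructor <;> simp only <;> ring
  · rw [triFrame, if_neg h8.not_gt, lowerFrame_diag (by simp only [halfTurn]; linarith)
      (by simp only [halfTurn]; linarith)]
    rcases lt_or_gt_of_ne h7 with h9 | h9
    · rw [sqFrame, if_neg h8.not_gt, if_pos h9]
      left; constructor <;> simp <;> ring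
    · rw [sqFrame, if_neg h8.not_gt, if_neg h9.not_gt]
      right; constructor <;> simp <;> ring

lemma TriCone.two_mul_le {a b : ℝ × ℝ} (h : TriCone a) (hr : FrameRel a b) :
    2 * |a.2| ≤ |b.2| ∧ b.1 * b.2 ≤ 0 := by
  rw [TriCone] at h
  have h2 : 2 * a.2 ^ 2 ≤ |a.2| * |b.2| ∧ b.1 * b.2 ≤ 0 := by
    rcases hr with ⟨h1, h2⟩ | ⟨h1, h2⟩ <;> rw [h1] at h <;> rw [h2, ← abs_mul]
    · exact ⟨(by nlinarith [sq_nonneg a.2, sq_nonneg b.2] : _ ≤ a.2 * b.2).trans (le_abs_self _),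
        by nlinarith [sq_nonneg a.2, sq_nonneg b.2]⟩
    · exact ⟨(by nlinarith : _ ≤ -(a.2 * b.2)).trans (neg_le_abs _), by nlinarith⟩
  refine ⟨?_, h2.2⟩
  rcases eq_or_ne a.2 0 with h0 | h0
  · simp [h0]
  · rw [← sq_abs] at h2
    have := abs_pos.2 h0
    nlinarith

lemma SqCone.two_mul_le {a b : ℝ × ℝ} (h : SqCone b) (hr : FrameRel a b) :
    2 * |b.2| ≤ |a.2| ∧ -2 * a.2 ^ 2 ≤ a.1 * a.2 := by
  rw [SqCone] at h
  have h2 : 2 * b.2 ^ 2 ≤ |a.2| * |b.2| ∧ -2 * a.2 ^ 2 ≤ a.1 * a.2 := by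
    rcases hr with ⟨h1, h2⟩ | ⟨h1, h2⟩ <;> rw [h2] at h <;> rw [h1, ← abs_mul]
    · exact ⟨(by nlinarith [sq_nonneg a.2, sq_nonneg b.2] : _ ≤ a.2 * b.2).trans (le_abs_self _),
        by nlinarith [sq_nonneg a.2, sq_nonneg b.2]⟩
    · exact ⟨(by nlinarith : _ ≤ -(a.2 * b.2)).trans (neg_le_abs _), by nlinarith⟩
  refine ⟨?_, h2.2⟩
  rcases eq_or_ne b.2 0 with h0 | h0
  · simp [h0]
  · rw [← sq_abs] at h2
    have := abs_pos.2 h0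
    nlinarith

lemma TriCone.abs_le {a : ℝ × ℝ} (h : TriCone a) {κ : ℝ} (hκ : 0 ≤ κ) : |a.1| ≤ |a.1 + κ * a.2| := by
  rw [TriCone] at h
  rw [← sq_le_sq]
  nlinarith [mul_nonneg hκ ((sq_nonneg _).trans h), mul_nonneg (mul_nonneg hκ hκ) (sq_nonneg a.2)]

lemma SqCone.abs_le {b : ℝ × ℝ} (h : SqCone b) {κ : ℝ} (hκ : 0 ≤ κ) : |b.1| ≤ |b.1 - κ * b.2| := by
  rw [SqCone] at h
  rw [← sq_le_sq]
  nlinarith [mul_nonneg hκ (sq_nonneg b.2), mul_nonneg (mul_nonneg hκ hκ) (sq_nonneg b.2),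
    mul_nonneg hκ (show 0 ≤ -(b.1 * b.2) by nlinarith [sq_nonneg b.2])]

lemma triCone_add {a : ℝ × ℝ} (h : -2 * a.2 ^ 2 ≤ a.1 * a.2) {κ : ℝ} (hκ : 3 ≤ κ) :
    TriCone (a.1 + κ * a.2, a.2) := by
  simp only [TriCone]; nlinarith [sq_nonneg a.2]

lemma sqCone_sub {b : ℝ × ℝ} (h : b.1 * b.2 ≤ 0) {κ : ℝ} (hκ : 8 ≤ κ) :
    SqCone (b.1 - κ * b.2, b.2) := by
  simp only [SqCone]; nlinarith [sq_nonneg b.2]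

lemma TriCone.weak {a : ℝ × ℝ} (h : TriCone a) : -2 * a.2 ^ 2 ≤ a.1 * a.2 := by
  rw [TriCone] at h; nlinarith [sq_nonneg a.2]

lemma SqCone.weak {b : ℝ × ℝ} (h : SqCone b) : b.1 * b.2 ≤ 0 := by
  rw [SqCone] at h; nlinarith [sq_nonneg b.2]

lemma FrameRel.abs_fst_le {a b : ℝ × ℝ} (h : FrameRel a b) :
    |a.1| ≤ |b.2| + 2 * |a.2| ∧ |b.1| ≤ 2 * |b.2| + |a.2| := by
  have h1 := neg_abs_le a.2
  have h2 := le_abs_self a.2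
  have h3 := neg_abs_le b.2
  have h4 := le_abs_self b.2
  rcases h with ⟨h5, h6⟩ | ⟨h5, h6⟩ <;> rw [h5, h6] <;> refine ⟨?_, ?_⟩ <;>
    refine abs_le.2 ⟨?_, ?_⟩ <;> linarith

lemma norm_le_lowerFrame (p w : ℝ × ℝ) : ‖w‖ ≤ 3 * (|(lowerFrame p w).1| + |(lowerFrame p w).2|) := by
  refine norm_prod_le_iff.2 ?_
  simp only [Real.norm_eq_abs]
  rw [lowerFrame]
  have h1 : ∀ x y : ℝ, x ≤ |x| ∧ -|x| ≤ x ∧ y ≤ |y| ∧ -|y| ≤ y := fun x y =>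
    ⟨le_abs_self _, neg_abs_le _, le_abs_self _, neg_abs_le _⟩
  split_ifs
  · have := h1 (w.1 - 2 * w.2) w.2
    constructor <;> exact abs_le.2 ⟨by linarith, by linarith⟩
  · have := h1 (w.1 + w.2) (-w.1)
    constructor <;> exact abs_le.2 ⟨by linarith, by linarith⟩
  · have := h1 (w.2 - 2 * w.1) (w.1 - w.2)
    constructor <;> exact abs_le.2 ⟨by linarith, by linarith⟩

lemma norm_le_triFrame (p w : ℝ × ℝ) : ‖w‖ ≤ 3 * (|(triFrame p w).1| + |(triFrame p w).2|) := by
  rw [triFrame]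
  split_ifs
  · exact norm_le_lowerFrame _ _
  · rw [← norm_neg]; exact norm_le_lowerFrame _ _

lemma norm_le_sqFrame (p w : ℝ × ℝ) : ‖w‖ ≤ 3 * (|(sqFrame p w).1| + |(sqFrame p w).2|) := by
  refine norm_prod_le_iff.2 ?_
  simp only [Real.norm_eq_abs]
  rw [sqFrame]
  have h1 : ∀ x y : ℝ, x ≤ |x| ∧ -|x| ≤ x ∧ y ≤ |y| ∧ -|y| ≤ y := fun x y =>
    ⟨le_abs_self _, neg_abs_le _, le_abs_self _, neg_abs_le _⟩
  split_ifs
  · have := h1 (w.1 - w.2) w.2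
    constructor <;> exact abs_le.2 ⟨by linarith, by linarith⟩
  · have := h1 (w.1 + w.2) (-w.1)
    constructor <;> exact abs_le.2 ⟨by linarith, by linarith⟩
  · have := h1 (-w.1 - w.2) w.1
    constructor <;> exact abs_le.2 ⟨by linarith, by linarith⟩
  · have := h1 (w.2 - w.1) (-w.2)
    constructor <;> exact abs_le.2 ⟨by linarith, by linarith⟩

lemma lowerFrame_smul (p) (r : ℝ) (w) : lowerFrame p (r • w) = r • lowerFrame p w := by
  simp only [lowerFrame]
  split_ifs <;> ext <;> simp <;> ring

lemma triFrame_smul (p) (r : ℝ) (w) : triFrame p (r • w) = r • triFrame p w := by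
  simp only [triFrame]
  split_ifs
  · exact lowerFrame_smul _ _ _
  · rw [← smul_neg]; exact lowerFrame_smul _ _ _

lemma sqFrame_smul (p) (r : ℝ) (w) : sqFrame p (r • w) = r • sqFrame p w := by
  simp only [sqFrame]
  split_ifs <;> ext <;> simp <;> ring

lemma continuous_lowerFrame (p) : Continuous (lowerFrame p) := by
  unfold lowerFrame; split_ifs <;> fun_prop

lemma continuous_triFrame (p) : Continuous (triFrame p) := by
  unfold triFrame
  split_ifs
  · exact continuous_lowerFrame p
  · exact (continuous_lowerFrame _).comp continuous_neg

lemma continuous_sqFrame (p) : Continuous (sqFrame p) := by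
  unfold sqFrame; split_ifs <;> fun_prop

lemma exists_triFrame_snd (p) : ∃ w, w ≠ 0 ∧ (triFrame p w).2 = 0 := by
  unfold triFrame lowerFrame
  split_ifs
  exacts [⟨(1, 0), by simp, by simp⟩, ⟨(0, 1), by simp, by simp⟩, ⟨(1, 1), by simp, by simp⟩,
    ⟨(1, 0), by simp, by simp⟩, ⟨(0, 1), by simp, by simp⟩, ⟨(1, 1), by simp, by simp⟩]

lemma exists_sqFrame_snd (p) : ∃ w, w ≠ 0 ∧ (sqFrame p w).2 = 0 := by
  unfold sqFrame
  split_ifs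
  exacts [⟨(1, 0), by simp, by simp⟩, ⟨(0, 1), by simp, by simp⟩, ⟨(0, 1), by simp, by simp⟩,
    ⟨(1, 0), by simp, by simp⟩]

open Classical in
/-- The cone before a triangle turn. -/
def preCone (p w : ℝ × ℝ) : Prop :=
  if p ∈ sqZone then SqCone (sqFrame p w) else TriCone (triFrame p w)

open Classical in
/-- The cone after a triangle turn. -/
def postCone (p w : ℝ × ℝ) : Prop :=
  if p ∈ triZone then TriCone (triFrame p w) else SqCone (sqFrame p w)

open Classical in
/-- The energy before a triangle turn. -/
noncomputable def preEnergy (p w : ℝ × ℝ) : ℝ :=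
  if p ∈ triZone then |(triFrame p w).2| else |(sqFrame p w).2|

open Classical in
/-- The energy after a triangle turn. -/
noncomputable def postEnergy (p w : ℝ × ℝ) : ℝ :=
  if p ∈ sqZone then |(sqFrame p w).2| else |(triFrame p w).2|

open Classical in
/-- A measure of the size of the vectors in `preCone`. -/
noncomputable def preSize (p w : ℝ × ℝ) : ℝ :=
  if p ∈ triZone then
    if p ∈ sqZone then |(triFrame p w).2| else |(triFrame p w).1| + |(triFrame p w).2|
  else |(sqFrame p w).1| + |(sqFrame p w).2|

/-- The points whose orbit changes zone during the next step. -/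
def visitSet : Set (ℝ × ℝ) :=
  {p | (p ∈ triZone ∧ triTurn p ∈ sqZone) ∨ (p ∉ triZone ∧ stepMap p ∈ triZone)}

section Cones

variable {p w : ℝ × ℝ}

lemma preCone.weak_tri (h : preCone p w) (hp : p ∈ triZone) :
    -2 * (triFrame p w).2 ^ 2 ≤ (triFrame p w).1 * (triFrame p w).2 := by
  rw [preCone] at h
  split_ifs at h with h1
  · exact (h.two_mul_le (frameRel hp h1 w)).2
  · exact h.weak

lemma postCone.weak_sq (h : postCone p w) (hp : p ∈ sqZone) :
    (sqFrame p w).1 * (sqFrame p w).2 ≤ 0 := by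
  rw [postCone] at h
  split_ifs at h with h1
  · exact (h.two_mul_le (frameRel h1 hp w)).2
  · exact h.weak

lemma preCone.postCone_triTurn (h : preCone p w) (hp : p ∈ openSquare) (hg : TriGen p) :
    postCone (triTurn p) (triTurnDeriv p w) := by
  by_cases h1 : p ∈ triZone
  · obtain ⟨κ, hκ, h2⟩ := hg.triFrame_triTurn h1
    rw [postCone, if_pos (triTurn_mem_triZone.2 h1), h2]
    exact triCone_add (h.weak_tri h1) hκ
  · have h2 := (hg.1.mem_zone hp).resolve_left h1
    rw [preCone, if_pos h2] at h
    rwa [hg.triTurnDeriv_eq hp h1, triTurn_of_notMem h1, LinearMap.id_apply, postCone,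
      if_neg h1]

lemma postCone.preCone_sqTurn (h : postCone p w) (hp : p ∈ openSquare) (hg : SqGen p) :
    preCone (sqTurn p) (sqTurnDeriv p w) := by
  by_cases h1 : p ∈ sqZone
  · obtain ⟨κ, hκ, h2⟩ := hg.sqFrame_sqTurn h1
    rw [preCone, if_pos (sqTurn_mem_sqZone.2 h1), h2]
    exact sqCone_sub (h.weak_sq h1) hκ
  · have h2 := (hg.1.mem_zone hp).resolve_right h1
    rw [postCone, if_pos h2] at h
    rwa [hg.sqTurnDeriv_eq h1, sqTurn_of_notMem h1, LinearMap.id_apply, preCone, if_neg h1]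

lemma postCone.energy_le (h : postCone p w) (hp : p ∈ triZone) :
    |(triFrame p w).2| ≤ postEnergy p w ∧ (p ∈ sqZone → 2 * |(triFrame p w).2| ≤ postEnergy p w) := by
  rw [postCone, if_pos hp] at h
  rw [postEnergy]
  have := abs_nonneg (triFrame p w).2
  split_ifs with h1
  · have := (h.two_mul_le (frameRel hp h1 w)).1
    exact ⟨by linarith, fun _ => this⟩
  · exact ⟨le_rfl, fun h2 => absurd h2 h1⟩

lemma preCone.energy_le (h : preCone p w) (hp : p ∈ sqZone) :
    |(sqFrame p w).2| ≤ preEnergy p w ∧ (p ∈ triZone → 2 * |(sqFrame p w).2| ≤ preEnergy p w) := by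
  rw [preCone, if_pos hp] at h
  rw [preEnergy]
  have := abs_nonneg (sqFrame p w).2
  split_ifs with h1
  · have := (h.two_mul_le (frameRel h1 hp w)).1
    exact ⟨by linarith, fun _ => this⟩
  · exact ⟨le_rfl, fun h2 => absurd h2 h1⟩

lemma preCone.triTurn_energy (h : preCone p w) (hp : p ∈ openSquare) (hg : TriGen p) :
    preEnergy p w ≤ postEnergy (triTurn p) (triTurnDeriv p w) ∧
      (p ∈ triZone → triTurn p ∈ sqZone →
        2 * preEnergy p w ≤ postEnergy (triTurn p) (triTurnDeriv p w)) := by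
  by_cases h1 : p ∈ triZone
  · obtain ⟨κ, hκ, h2⟩ := hg.triFrame_triTurn h1
    have h3 := (h.postCone_triTurn hp hg).energy_le (triTurn_mem_triZone.2 h1)
    rw [h2] at h3
    rw [preEnergy, if_pos h1]
    exact ⟨h3.1, fun _ => h3.2⟩
  · have h2 := (hg.1.mem_zone hp).resolve_left h1
    rw [hg.triTurnDeriv_eq hp h1, triTurn_of_notMem h1, LinearMap.id_apply, postEnergy, preEnergy,
      if_neg h1, if_pos h2]
    exact ⟨le_rfl, fun h3 => absurd h3 h1⟩

lemma postCone.sqTurn_energy (h : postCone p w) (hp : p ∈ openSquare) (hg : SqGen p) :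
    postEnergy p w ≤ preEnergy (sqTurn p) (sqTurnDeriv p w) ∧
      (p ∈ sqZone → sqTurn p ∈ triZone →
        2 * postEnergy p w ≤ preEnergy (sqTurn p) (sqTurnDeriv p w)) := by
  by_cases h1 : p ∈ sqZone
  · obtain ⟨κ, hκ, h2⟩ := hg.sqFrame_sqTurn h1
    have h3 := (h.preCone_sqTurn hp hg).energy_le (sqTurn_mem_sqZone.2 h1)
    rw [h2] at h3
    rw [postEnergy, if_pos h1]
    exact ⟨h3.1, fun _ => h3.2⟩
  · have h2 := (hg.1.mem_zone hp).resolve_right h1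
    rw [hg.sqTurnDeriv_eq h1, sqTurn_of_notMem h1, LinearMap.id_apply, postEnergy, preEnergy,
      if_neg h1, if_pos h2]
    exact ⟨le_rfl, fun h3 => absurd h3 h1⟩

lemma preCone.preCone_stepMap (h : preCone p w) (hp : p ∈ openSquare) (hg : 0 < stepMargin p) :
    preCone (stepMap p) (stepDeriv p w) :=
  (h.postCone_triTurn hp (triGen_of_stepMargin_pos hg)).preCone_sqTurn (triTurn_mem.2 hp) (sqGen_of_stepMargin_pos hg)

lemma preCone.stepMap_energy (h : preCone p w) (hp : p ∈ openSquare) (hg : 0 < stepMargin p) :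
    preEnergy p w ≤ preEnergy (stepMap p) (stepDeriv p w) ∧
      (p ∈ visitSet → 2 * preEnergy p w ≤ preEnergy (stepMap p) (stepDeriv p w)) := by
  have h1 := triGen_of_stepMargin_pos hg
  have h2 := h.triTurn_energy hp h1
  have h3 := (h.postCone_triTurn hp h1).sqTurn_energy (triTurn_mem.2 hp) (sqGen_of_stepMargin_pos hg)
  refine ⟨h2.1.trans h3.1, ?_⟩
  rintro (h4 | h4)
  · exact (h2.2 h4.1 h4.2).trans h3.1
  · have h5 := h3.2 (by
      rw [triTurn_of_notMem h4.1]
      exact (h1.1.mem_zone hp).resolve_left h4.1) h4.2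
    linarith [h2.1, show _ ≤ preEnergy (stepMap p) (stepDeriv p w) from h5]

lemma preCone.stepMap_size (h : preCone p w) (hp : p ∈ openSquare) (hg : 0 < stepMargin p)
    (hB : p ∉ visitSet) : preSize p w ≤ preSize (stepMap p) (stepDeriv p w) := by
  have h1 := triGen_of_stepMargin_pos hg
  have h2 := sqGen_of_stepMargin_pos hg
  simp only [visitSet, Set.mem_ofPred_eq, not_or, not_and] at hB
  by_cases h3 : p ∈ triZone
  · obtain ⟨κ, hκ, h5⟩ := h1.triFrame_triTurn h3
    have h4 := hB.1 h3
    have h6 := triTurn_mem_triZone.2 h3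
    rw [stepDeriv, h2.sqTurnDeriv_eq h4, stepMap, sqTurn_of_notMem h4, LinearMap.comp_apply,
      LinearMap.id_apply]
    simp only [preSize, if_pos h3, if_pos h6, if_neg h4, h5]
    split_ifs with h7
    · linarith [abs_nonneg ((triFrame p w).1 + κ * (triFrame p w).2)]
    · rw [preCone, if_neg h7] at h
      linarith [h.abs_le (by linarith : 0 ≤ κ)]
  · have h4 := hB.2 h3
    have h5 := (h1.1.mem_zone hp).resolve_left h3
    rw [triTurn_of_notMem h3] at h2
    obtain ⟨κ, hκ, h6⟩ := h2.sqFrame_sqTurn h5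
    rw [preSize, if_neg h3, preSize, if_neg h4]
    rw [stepMap, stepDeriv, h1.triTurnDeriv_eq hp h3, triTurn_of_notMem h3, LinearMap.comp_apply,
      LinearMap.id_apply, h6]
    rw [preCone, if_pos h5] at h
    linarith [h.abs_le (by linarith : 0 ≤ κ)]

lemma preCone.stepMap_size_visit (h : preCone p w) (hp : p ∈ openSquare) (hg : 0 < stepMargin p)
    (hB : p ∈ visitSet) : preSize p w ≤ 3 * preEnergy (stepMap p) (stepDeriv p w) := by
  have h1 := triGen_of_stepMargin_pos hg
  have h2 := sqGen_of_stepMargin_pos hg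
  rcases hB with ⟨h3, h4⟩ | ⟨h3, h4⟩
  · have h5 := h.postCone_triTurn hp h1
    refine le_trans ?_ (mul_le_mul_of_nonneg_left (h5.sqTurn_energy (triTurn_mem.2 hp) h2).1 zero_le_three)
    obtain ⟨κ, hκ, h6⟩ := h1.triFrame_triTurn h3
    have h7 := triTurn_mem_triZone.2 h3
    have h8 := frameRel h7 h4 (triTurnDeriv p w)
    rw [postEnergy, if_pos h4]
    rw [postCone, if_pos h7] at h5
    have h9 := (h5.two_mul_le h8).1
    have h10 := h8.abs_fst_le.1
    have h11 : preSize p w ≤ |(triFrame (triTurn p) (triTurnDeriv p w)).1| +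
        |(triFrame (triTurn p) (triTurnDeriv p w)).2| := by
      rw [preSize, if_pos h3, h6]
      split_ifs with h12
      · linarith [abs_nonneg ((triFrame p w).1 + κ * (triFrame p w).2)]
      · rw [preCone, if_neg h12] at h
        linarith [h.abs_le (by linarith : 0 ≤ κ)]
    linarith [abs_nonneg (sqFrame (triTurn p) (triTurnDeriv p w)).2]
  · have h5 := (h1.1.mem_zone hp).resolve_left h3
    have h6 := h.preCone_stepMap hp hg
    have h7 : stepMap p ∈ sqZone := by
      rw [stepMap, triTurn_of_notMem h3]
      exact sqTurn_mem_sqZone.2 h5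
    have h8 := frameRel h4 h7 (stepDeriv p w)
    rw [preCone, if_pos h7] at h6
    have h9 := (h6.two_mul_le h8).1
    have h10 := h8.abs_fst_le.2
    rw [preEnergy, if_pos h4, preSize, if_neg h3]
    have h11 : |(sqFrame p w).1| + |(sqFrame p w).2| ≤
        |(sqFrame (stepMap p) (stepDeriv p w)).1| +
          |(sqFrame (stepMap p) (stepDeriv p w)).2| := by
      rw [triTurn_of_notMem h3] at h2
      obtain ⟨κ, hκ, h12⟩ := h2.sqFrame_sqTurn h5
      rw [stepMap, stepDeriv, h1.triTurnDeriv_eq hp h3, triTurn_of_notMem h3,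
        LinearMap.comp_apply, LinearMap.id_apply, h12]
      rw [preCone, if_pos h5] at h
      linarith [h.abs_le (by linarith : 0 ≤ κ)]
    linarith [abs_nonneg (triFrame (stepMap p) (stepDeriv p w)).2]

lemma preCone_smul (r : ℝ) (h : preCone p w) : preCone p (r • w) := by
  rw [preCone] at h ⊢
  split_ifs at h ⊢
  · simp only [sqFrame_smul, SqCone, Prod.smul_fst, Prod.smul_snd, smul_eq_mul] at h ⊢
    nlinarith [mul_le_mul_of_nonneg_left h (sq_nonneg r)]
  · simp only [triFrame_smul, TriCone, Prod.smul_fst, Prod.smul_snd, smul_eq_mul] at h ⊢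
    nlinarith [mul_le_mul_of_nonneg_left h (sq_nonneg r)]

lemma isConeSystem_stepInv :
    IsConeSystem stepInv stepInvDeriv goodSet preCone preEnergy preSize visitSet 12 := by
  have hmem : ∀ y ∈ goodSet, stepInv y ∈ openSquare := fun y hy => by
    have := isSquareMap_stepInv.preimage.ge hy.1
    exact this
  have hS := fun y (_ : y ∈ goodSet) => stepMap_stepInv y
  refine ⟨by norm_num, fun y _ => det_stepInvDeriv y, fun p => ?_, preCone_smul, fun p => ?_, ?_, ?_,
    ?_, ?_, ?_, ?_⟩
  · unfold preCone
    split_ifs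
    · have := continuous_sqFrame p
      exact isClosed_le (by fun_prop) (by fun_prop)
    · have := continuous_triFrame p
      exact isClosed_le (by fun_prop) (by fun_prop)
  · unfold preCone
    split_ifs
    · obtain ⟨w, hw, h⟩ := exists_sqFrame_snd p
      exact ⟨w, hw, by simp [SqCone, h]⟩
    · obtain ⟨w, hw, h⟩ := exists_triFrame_snd p
      exact ⟨w, hw, by simp [TriCone, h]⟩
  · intro p w h
    rw [preCone] at h
    rw [preSize]
    have h1 := norm_le_triFrame p w
    have h2 := norm_le_sqFrame p w
    have h3 := norm_nonneg w
    split_ifs at h ⊢ with h4 h5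
    · have h6 := frameRel h4 h5 w
      have := (h.two_mul_le h6).1
      have := h6.abs_fst_le.1
      have := abs_nonneg (triFrame p w).2
      linarith
    all_goals linarith
  · intro y hy w h
    have := h.preCone_stepMap (hmem y hy) hy.2.2.1
    rwa [stepDeriv_stepInvDeriv hy, stepMap_stepInv y] at this
  · intro y hy w h
    have := (h.stepMap_energy (hmem y hy) hy.2.2.1).1
    rwa [stepDeriv_stepInvDeriv hy, stepMap_stepInv y] at this
  · intro y hy w h hB
    have := (h.stepMap_energy (hmem y hy) hy.2.2.1).2 hB
    rwa [stepDeriv_stepInvDeriv hy, stepMap_stepInv y] at this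
  · intro y hy w h hB
    have := h.stepMap_size (hmem y hy) hy.2.2.1 hB
    rwa [stepDeriv_stepInvDeriv hy, stepMap_stepInv y] at this
  · intro y hy w h hB
    have h1 := h.stepMap_size_visit (hmem y hy) hy.2.2.1 hB
    rw [stepDeriv_stepInvDeriv hy, stepMap_stepInv y] at h1
    have : 0 ≤ preEnergy y w := by unfold preEnergy; split_ifs <;> exact abs_nonneg _
    linarith

end Cones

lemma exists_iterate_mem_Ioo {X : Type*} {F : X → X} {R : ℝ → X → Prop} {a P : ℝ} (hP : 0 < P)
    (h : Irrational (a / P)) (hstep : ∀ l p, R l p → ∃ j : ℤ, R (l + a + j * P) (F p))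
    (hR : ∀ l p, R l p → 0 ≤ l ∧ l ≤ P) {u v : ℝ} (hu : 0 ≤ u) (hv : v ≤ P) (huv : u < v) {l p}
    (hl : R l p) : ∃ k, 1 ≤ k ∧ ∃ l' ∈ Set.Ioo u v, R l' (F^[k] p) := by
  obtain ⟨k, j, hk, hj⟩ := exists_add_mul_mem_Ioo hP h l huv
  have key : ∀ k : ℕ, ∃ j : ℤ, R (l + k * a + j * P) (F^[k] p) := by
    intro k
    induction k with
    | zero => exact ⟨0, by simpa using hl⟩
    | succ k ih =>
      obtain ⟨j, hj⟩ := ih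
      obtain ⟨i, hi⟩ := hstep _ _ hj
      rw [Function.iterate_succ_apply']
      refine ⟨j + i, ?_⟩
      convert hi using 1
      push_cast
      ring
  obtain ⟨i, hi⟩ := key k
  refine ⟨k, hk, _, hj, ?_⟩
  have h1 := hR _ _ hi
  obtain ⟨h2, h3⟩ := hj
  have h4 : i = j := by
    have h5 : ((i - j : ℤ) : ℝ) * P < 1 * P := by push_cast; nlinarith
    have h6 : (-1 : ℝ) * P < ((i - j : ℤ) : ℝ) * P := by push_cast; nlinarith
    have h7 := lt_of_mul_lt_mul_right h5 hP.le
    have h8 := lt_of_mul_lt_mul_right h6 hP.le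
    have h9 : i - j < 1 := by exact_mod_cast h7
    have h10 : -1 < i - j := by exact_mod_cast h8
    omega
  rwa [h4] at hi

/-- `p` lies at arclength `l` on the boundary of the triangle at height `h`. -/
def OnTriangle (h l : ℝ) (p : ℝ × ℝ) : Prop :=
  (p = (l + 2 * h, h) ∧ 0 ≤ l ∧ l ≤ 1 - 3 * h) ∨
  (p = (1 - h, l + 4 * h - 1) ∧ 1 - 3 * h ≤ l ∧ l ≤ 2 * (1 - 3 * h)) ∨
  (p = (3 - 7 * h - l, 3 - 8 * h - l) ∧ 2 * (1 - 3 * h) ≤ l ∧ l ≤ 3 * (1 - 3 * h))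

/-- `p` lies at arclength `l` on the boundary of the square at height `h`. -/
def OnSquare (h l : ℝ) (p : ℝ × ℝ) : Prop :=
  (p = (h + l, h) ∧ 0 ≤ l ∧ l ≤ 1 - 2 * h) ∨
  (p = (1 - h, l + 3 * h - 1) ∧ 1 - 2 * h ≤ l ∧ l ≤ 2 * (1 - 2 * h)) ∨
  (p = (3 - 5 * h - l, 1 - h) ∧ 2 * (1 - 2 * h) ≤ l ∧ l ≤ 3 * (1 - 2 * h)) ∨
  (p = (h, 4 - 7 * h - l) ∧ 3 * (1 - 2 * h) ≤ l ∧ l ≤ 4 * (1 - 2 * h))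

lemma OnTriangle.triangleStep {h l p} (hl : OnTriangle h l p) (h0 : 0 < h) (h1 : h < 1 / 4) :
    ∃ j : ℤ, OnTriangle h (l + h + j * (3 * (1 - 3 * h))) (triangleStep p) := by
  rcases hl with ⟨rfl, h2, h3⟩ | ⟨rfl, h2, h3⟩ | ⟨rfl, h2, h3⟩
  · rcases le_total (l + h) (1 - 3 * h) with h4 | h4
    · rw [triangleStep_eq (a := ([(0, 1, 0), (-1, -1, 1), (1, -2, 0), (0, -4, 1), (-1, -2, 1)],
        ⟨1, 1, 0, 1, 0, 0⟩)) (by simp [triTable]) (by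
          simp only [mem_cell_cons, mem_cell_nil, lineEval, and_true]; push_cast
          and_intros <;> linarith)]
      refine ⟨0, Or.inl ⟨?_, by push_cast; linarith, by push_cast; linarith⟩⟩
      simp only [IntAffine.act]; push_cast; ext <;> simp only <;> ring
    · rw [triangleStep_eq (a := ([(0, 1, 0), (-1, -1, 1), (1, -2, 0), (0, -4, 1), (1, 2, -1)],
        ⟨0, -1, 1, 3, 1, -1⟩)) (by simp [triTable]) (by
          simp only [mem_cell_cons, mem_cell_nil, lineEval, and_true]; push_cast
          and_intros <;> linarith)]
      refine ⟨0, Or.inr (Or.inl ⟨?_, by push_cast; linarith, by push_cast; linarith⟩)⟩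
      simp only [IntAffine.act]; push_cast; ext <;> simp only <;> ring
  · rcases le_total (l + h) (2 * (1 - 3 * h)) with h4 | h4
    · rw [triangleStep_eq (a := ([(-1, 0, 1), (1, 1, -1), (2, -1, -1), (4, 0, -3), (3, -1, -2)],
        ⟨1, 0, -1, 1, 0, 1⟩)) (by simp [triTable]) (by
          simp only [mem_cell_cons, mem_cell_nil, lineEval, and_true]; push_cast
          and_intros <;> linarith)]
      refine ⟨0, Or.inr (Or.inl ⟨?_, by push_cast; linarith, by push_cast; linarith⟩)⟩
      simp only [IntAffine.act]; push_cast; ext <;> simp only <;> ring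
    · rw [triangleStep_eq (a := ([(-1, 0, 1), (1, 1, -1), (2, -1, -1), (4, 0, -3), (-3, 1, 2)],
        ⟨4, -1, 5, -1, -2, -3⟩)) (by simp [triTable]) (by
          simp only [mem_cell_cons, mem_cell_nil, lineEval, and_true]; push_cast
          and_intros <;> linarith)]
      refine ⟨0, Or.inr (Or.inr ⟨?_, by push_cast; linarith, by push_cast; linarith⟩)⟩
      simp only [IntAffine.act]; push_cast; ext <;> simp only <;> ring
  · rcases le_total (l + h) (3 * (1 - 3 * h)) with h4 | h4
    · rw [triangleStep_eq (a := ([(1, -1, 0), (-1, 2, 0), (-2, 1, 1), (-4, 4, 1), (-2, 3, 0)],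
        ⟨0, 1, -1, 2, 0, 0⟩)) (by simp [triTable]) (by
          simp only [mem_cell_cons, mem_cell_nil, lineEval, and_true]; push_cast
          and_intros <;> linarith)]
      refine ⟨0, Or.inr (Or.inr ⟨?_, by push_cast; linarith, by push_cast; linarith⟩)⟩
      simp only [IntAffine.act]; push_cast; ext <;> simp only <;> ring
    · rw [triangleStep_eq (a := ([(1, -1, 0), (-1, 2, 0), (-2, 1, 1), (-4, 4, 1), (2, -3, 0)],
        ⟨4, -5, 1, -1, 0, 0⟩)) (by simp [triTable]) (by
          simp only [mem_cell_cons, mem_cell_nil, lineEval, and_true]; push_cast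
          and_intros <;> linarith)]
      refine ⟨-1, Or.inl ⟨?_, by push_cast; linarith, by push_cast; linarith⟩⟩
      simp only [IntAffine.act]; push_cast; ext <;> simp only <;> ring

lemma OnSquare.squareStep {h l p} (hl : OnSquare h l p) (h0 : 1 / 4 < h) (h1 : h < 3 / 8) :
    ∃ j : ℤ, OnSquare h (l + (1 - 4 * h) + j * (4 * (1 - 2 * h))) (squareStep p) := by
  rcases hl with ⟨rfl, h2, h3⟩ | ⟨rfl, h2, h3⟩ | ⟨rfl, h2, h3⟩ | ⟨rfl, h2, h3⟩
  · rcases le_total (4 * h - 1) l with h4 | h4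
    · rw [squareStep_eq (a := ([(0, 4, -1), (0, -8, 3), (1, -1, 0), (-1, -1, 1), (1, -5, 1)],
        ⟨1, -4, 0, 1, 1, 0⟩)) (by simp [innerTable]) (by
          simp only [mem_cell_cons, mem_cell_nil, lineEval, and_true]; push_cast
          and_intros <;> linarith)]
      refine ⟨0, Or.inl ⟨?_, by push_cast; linarith, by push_cast; linarith⟩⟩
      simp only [IntAffine.act]; push_cast; ext <;> simp only <;> ring
    rcases le_total (6 * h - 2) l with h5 | h5
    · rw [squareStep_eq (a := ([(0, 4, -1), (0, -8, 3), (1, -1, 0), (-1, -1, 1), (-1, 5, -1),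
        (1, -7, 2)], ⟨0, 1, -1, 6, 0, -1⟩)) (by simp [innerTable]) (by
          simp only [mem_cell_cons, mem_cell_nil, lineEval, and_true]; push_cast
          and_intros <;> linarith)]
      refine ⟨1, Or.inr (Or.inr (Or.inr ⟨?_, by push_cast; linarith, by push_cast; linarith⟩))⟩
      simp only [IntAffine.act]; push_cast; ext <;> simp only <;> ring
    · rw [squareStep_eq (a := ([(0, 4, -1), (0, -8, 3), (1, -1, 0), (-1, -1, 1), (-1, 7, -2)],
        ⟨-1, 8, 0, -1, -2, 1⟩)) (by simp [innerTable]) (by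
          simp only [mem_cell_cons, mem_cell_nil, lineEval, and_true]; push_cast
          and_intros <;> linarith)]
      refine ⟨1, Or.inr (Or.inr (Or.inl ⟨?_, by push_cast; linarith, by push_cast; linarith⟩))⟩
      simp only [IntAffine.act]; push_cast; ext <;> simp only <;> ring
  · rcases le_total (4 * h - 1) (l - (1 - 2 * h)) with h4 | h4
    · rw [squareStep_eq (a := ([(-4, 0, 3), (8, 0, -5), (1, 1, -1), (1, -1, 0), (5, 1, -4)],
        ⟨1, 0, 4, 1, 0, -3⟩)) (by simp [innerTable]) (by
          simp only [mem_cell_cons, mem_cell_nil, lineEval, and_true]; push_cast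
          and_intros <;> linarith)]
      refine ⟨0, Or.inr (Or.inl ⟨?_, by push_cast; linarith, by push_cast; linarith⟩)⟩
      simp only [IntAffine.act]; push_cast; ext <;> simp only <;> ring
    rcases le_total (6 * h - 2) (l - (1 - 2 * h)) with h5 | h5
    · rw [squareStep_eq (a := ([(-4, 0, 3), (8, 0, -5), (1, 1, -1), (1, -1, 0), (-5, -1, 4),
        (7, 1, -5)], ⟨6, 1, -1, 0, -4, 1⟩)) (by simp [innerTable]) (by
          simp only [mem_cell_cons, mem_cell_nil, lineEval, and_true]; push_cast
          and_intros <;> linarith)]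
      refine ⟨0, Or.inl ⟨?_, by push_cast; linarith, by push_cast; linarith⟩⟩
      simp only [IntAffine.act]; push_cast; ext <;> simp only <;> ring
    · rw [squareStep_eq (a := ([(-4, 0, 3), (8, 0, -5), (1, 1, -1), (1, -1, 0), (-7, -1, 5)],
        ⟨-1, 0, -8, -1, 1, 6⟩)) (by simp [innerTable]) (by
          simp only [mem_cell_cons, mem_cell_nil, lineEval, and_true]; push_cast
          and_intros <;> linarith)]
      refine ⟨1, Or.inr (Or.inr (Or.inr ⟨?_, by push_cast; linarith, by push_cast; linarith⟩))⟩
      simp only [IntAffine.act]; push_cast; ext <;> simp only <;> ring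
  · rcases le_total (4 * h - 1) (l - 2 * (1 - 2 * h)) with h4 | h4
    · rw [squareStep_eq (a := ([(0, -4, 3), (0, 8, -5), (-1, 1, 0), (1, 1, -1), (-1, 5, -3)],
        ⟨1, -4, 0, 1, 3, 0⟩)) (by simp [innerTable]) (by
          simp only [mem_cell_cons, mem_cell_nil, lineEval, and_true]; push_cast
          and_intros <;> linarith)]
      refine ⟨0, Or.inr (Or.inr (Or.inl ⟨?_, by push_cast; linarith, by push_cast; linarith⟩))⟩
      simp only [IntAffine.act]; push_cast; ext <;> simp only <;> ring
    rcases le_total (6 * h - 2) (l - 2 * (1 - 2 * h)) with h5 | h5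
    · rw [squareStep_eq (a := ([(0, -4, 3), (0, 8, -5), (-1, 1, 0), (1, 1, -1), (1, -5, 3),
        (-1, 7, -4)], ⟨0, 1, -1, 6, 0, -3⟩)) (by simp [innerTable]) (by
          simp only [mem_cell_cons, mem_cell_nil, lineEval, and_true]; push_cast
          and_intros <;> linarith)]
      refine ⟨0, Or.inr (Or.inl ⟨?_, by push_cast; linarith, by push_cast; linarith⟩)⟩
      simp only [IntAffine.act]; push_cast; ext <;> simp only <;> ring
    · rw [squareStep_eq (a := ([(0, -4, 3), (0, 8, -5), (-1, 1, 0), (1, 1, -1), (1, -7, 4)],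
        ⟨-1, 8, 0, -1, -4, 1⟩)) (by simp [innerTable]) (by
          simp only [mem_cell_cons, mem_cell_nil, lineEval, and_true]; push_cast
          and_intros <;> linarith)]
      refine ⟨0, Or.inl ⟨?_, by push_cast; linarith, by push_cast; linarith⟩⟩
      simp only [IntAffine.act]; push_cast; ext <;> simp only <;> ring
  · rcases le_total (4 * h - 1) (l - 3 * (1 - 2 * h)) with h4 | h4
    · rw [squareStep_eq (a := ([(4, 0, -1), (-8, 0, 3), (-1, -1, 1), (-1, 1, 0), (-5, -1, 2)],
        ⟨1, 0, 4, 1, 0, -1⟩)) (by simp [innerTable]) (by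
          simp only [mem_cell_cons, mem_cell_nil, lineEval, and_true]; push_cast
          and_intros <;> linarith)]
      refine ⟨0, Or.inr (Or.inr (Or.inr ⟨?_, by push_cast; linarith, by push_cast; linarith⟩))⟩
      simp only [IntAffine.act]; push_cast; ext <;> simp only <;> ring
    rcases le_total (6 * h - 2) (l - 3 * (1 - 2 * h)) with h5 | h5
    · rw [squareStep_eq (a := ([(4, 0, -1), (-8, 0, 3), (-1, -1, 1), (-1, 1, 0), (5, 1, -2),
        (-7, -1, 3)], ⟨6, 1, -1, 0, -2, 1⟩)) (by simp [innerTable]) (by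
          simp only [mem_cell_cons, mem_cell_nil, lineEval, and_true]; push_cast
          and_intros <;> linarith)]
      refine ⟨0, Or.inr (Or.inr (Or.inl ⟨?_, by push_cast; linarith, by push_cast; linarith⟩))⟩
      simp only [IntAffine.act]; push_cast; ext <;> simp only <;> ring
    · rw [squareStep_eq (a := ([(4, 0, -1), (-8, 0, 3), (-1, -1, 1), (-1, 1, 0), (7, 1, -3)],
        ⟨-1, 0, -8, -1, 1, 4⟩)) (by simp [innerTable]) (by
          simp only [mem_cell_cons, mem_cell_nil, lineEval, and_true]; push_cast
          and_intros <;> linarith)]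
      refine ⟨0, Or.inr (Or.inl ⟨?_, by push_cast; linarith, by push_cast; linarith⟩)⟩
      simp only [IntAffine.act]; push_cast; ext <;> simp only <;> ring

lemma exists_onTriangle {p : ℝ × ℝ} (h : 0 < lowerHeight p) : ∃ l, OnTriangle (lowerHeight p) l p := by
  have h1 : lowerHeight p = min (p.1 - p.2) (min p.2 (1 - p.1)) := by
    rw [lowerHeight] at h ⊢
    exact max_eq_right ((lt_max_iff.1 h).resolve_left (lt_irrefl _)).le
  have h2 : lowerHeight p ≤ p.1 - p.2 ∧ lowerHeight p ≤ p.2 ∧ lowerHeight p ≤ 1 - p.1 := by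
    rw [h1]; simp
  obtain ⟨h3, h4, h5⟩ := h2
  have h6 : p.1 - p.2 = lowerHeight p ∨ p.2 = lowerHeight p ∨ 1 - p.1 = lowerHeight p := by
    rw [h1]
    rcases min_choice (p.1 - p.2) (min p.2 (1 - p.1)) with h | h <;>
      rcases min_choice p.2 (1 - p.1) with h' | h' <;> rw [h] <;> simp [h']
  clear h1
  generalize lowerHeight p = m at *
  rcases h6 with h6 | h6 | h6
  · exact ⟨3 - 7 * m - p.1, Or.inr (Or.inr ⟨by ext <;> simp only <;> linarith, by linarith,
      by linarith⟩)⟩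
  · exact ⟨p.1 - 2 * m, Or.inl ⟨by ext <;> simp only <;> linarith, by linarith, by linarith⟩⟩
  · exact ⟨p.2 - 4 * m + 1, Or.inr (Or.inl ⟨by ext <;> simp only <;> linarith, by linarith,
      by linarith⟩)⟩

lemma exists_onSquare (p : ℝ × ℝ) : ∃ l, OnSquare (sqHeight p) l p := by
  have h2 : sqHeight p ≤ p.1 ∧ sqHeight p ≤ 1 - p.1 ∧ sqHeight p ≤ p.2 ∧ sqHeight p ≤ 1 - p.2 := by
    simp [sqHeight]
  obtain ⟨h3, h4, h5, h6⟩ := h2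
  have h6 : p.1 = sqHeight p ∨ 1 - p.1 = sqHeight p ∨ p.2 = sqHeight p ∨ 1 - p.2 = sqHeight p := by
    rw [sqHeight]
    rcases min_choice (min p.1 (1 - p.1)) (min p.2 (1 - p.2)) with h | h <;> rw [h]
    · rcases min_choice p.1 (1 - p.1) with h' | h' <;> simp [h']
    · rcases min_choice p.2 (1 - p.2) with h' | h' <;> simp [h']
  generalize sqHeight p = m at *
  rcases h6 with h6 | h6 | h6 | h6
  · exact ⟨4 - 7 * m - p.2, Or.inr (Or.inr (Or.inr ⟨by ext <;> simp only <;> linarith, by linarith,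
      by linarith⟩))⟩
  · exact ⟨p.2 - 3 * m + 1, Or.inr (Or.inl ⟨by ext <;> simp only <;> linarith, by linarith,
      by linarith⟩)⟩
  · exact ⟨p.1 - m, Or.inl ⟨by ext <;> simp only <;> linarith, by linarith, by linarith⟩⟩
  · exact ⟨3 - 5 * m - p.1, Or.inr (Or.inr (Or.inl ⟨by ext <;> simp only <;> linarith, by linarith,
      by linarith⟩))⟩

lemma OnTriangle.triTurn {h l p} (hl : OnTriangle h l p) (h0 : 0 < h) (h1 : h < 1 / 4) :
    ∃ j : ℤ, OnTriangle h (l + 3 * h + j * (3 * (1 - 3 * h))) (triTurn p) := by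
  obtain ⟨i, h2⟩ := hl.triangleStep h0 h1
  obtain ⟨j, h3⟩ := h2.triangleStep h0 h1
  obtain ⟨k, h4⟩ := h3.triangleStep h0 h1
  refine ⟨i + j + k, ?_⟩
  rw [_root_.triTurn]
  convert h4 using 1
  push_cast
  ring

lemma OnSquare.sqTurn {h l p} (hl : OnSquare h l p) (h0 : 1 / 4 < h) (h1 : h < 3 / 8) :
    ∃ j : ℤ, OnSquare h (l + 2 * (1 - 4 * h) + j * (4 * (1 - 2 * h))) (sqTurn p) := by
  obtain ⟨i, h2⟩ := hl.squareStep h0 h1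
  obtain ⟨j, h3⟩ := h2.squareStep h0 h1
  refine ⟨i + j, ?_⟩
  rw [_root_.sqTurn]
  convert h3 using 1
  push_cast
  ring

lemma exists_triTurn_mem_sqZone_of_lt {p : ℝ × ℝ} (h0 : 0 < lowerHeight p)
    (h1 : lowerHeight p < 1 / 4)
    (hi : Irrational (3 * lowerHeight p / (3 * (1 - 3 * lowerHeight p)))) :
    ∃ k, 1 ≤ k ∧ triTurn^[k] p ∈ sqZone := by
  obtain ⟨l, hl⟩ := exists_onTriangle h0
  generalize lowerHeight p = m at *
  obtain ⟨k, hk, l', ⟨h2, h3⟩, h4⟩ := exists_iterate_mem_Ioo (R := OnTriangle m) (by linarith) hi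
    (fun l p h => h.triTurn h0 h1) (fun l p h => by rcases h with h | h | h <;> constructor <;> linarith)
    (u := 2 * (1 - 3 * m) + (1 / 4 - m)) (v := 2 * (1 - 3 * m) + (3 / 8 - m)) (by linarith)
    (by linarith) (by linarith) hl
  refine ⟨k, hk, ?_⟩
  rcases h4 with ⟨-, h5, h6⟩ | ⟨-, h5, h6⟩ | ⟨h4, -, -⟩
  · linarith
  · linarith
  · rw [h4]
    constructor
    · simp only [sqHeight, lt_min_iff]
      and_intros <;> linarith
    · apply sqHeight_lt
      right; left; linarith

lemma exists_sqTurn_mem_triZone {p : ℝ × ℝ} (hp : p ∈ sqZone)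
    (hi : Irrational (2 * (1 - 4 * sqHeight p) / (4 * (1 - 2 * sqHeight p)))) :
    ∃ k, 1 ≤ k ∧ sqTurn^[k] p ∈ triZone := by
  obtain ⟨l, hl⟩ := exists_onSquare p
  obtain ⟨h0, h1⟩ := hp
  generalize sqHeight p = m at *
  obtain ⟨k, hk, l', ⟨h2, h3⟩, h4⟩ := exists_iterate_mem_Ioo (R := OnSquare m) (by linarith) hi
    (fun l p h => h.sqTurn h0 h1)
    (fun l p h => by rcases h with h | h | h | h <;> constructor <;> linarith)
    (u := (1 - 2 * m) + (3 / 4 - 2 * m)) (v := 2 * (1 - 2 * m)) (by linarith)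
    (by linarith) (by linarith) hl
  refine ⟨k, hk, ?_⟩
  rcases h4 with ⟨-, h5, h6⟩ | ⟨h4, -, -⟩ | ⟨-, h5, h6⟩ | ⟨-, h5, h6⟩
  · linarith
  · rw [h4]
    refine ⟨⟨⟨?_, ?_⟩, ?_, ?_⟩, ?_⟩
    iterate 4 simp only; linarith
    rw [triHeight_of_le (by simp only; linarith),
      lowerHeight_eq (m := 2 - 4 * m - l') (by linarith) (by simp only; linarith)
        (by simp only; linarith) (by simp only; linarith) (Or.inl (by simp only; linarith)),
      abs_of_pos (by linarith)]
    linarith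
  · linarith
  · linarith

lemma iterate_triTurn_halfTurn (n : ℕ) (p) : triTurn^[n] (halfTurn p) = halfTurn (triTurn^[n] p) :=
  (Function.Semiconj.iterate_right (f := halfTurn) (fun p => (triTurn_halfTurn p).symm) n p).symm

lemma halfTurn_mem_sqZone {p} : halfTurn p ∈ sqZone ↔ p ∈ sqZone := by
  simp only [sqZone, Set.mem_ofPred_eq, sqHeight_halfTurn]

lemma exists_triTurn_mem_sqZone {p : ℝ × ℝ} (hp : p ∈ triZone)
    (hi : Irrational (3 * |triHeight p| / (3 * (1 - 3 * |triHeight p|)))) :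
    ∃ k, 1 ≤ k ∧ triTurn^[k] p ∈ sqZone := by
  have h0 : |triHeight p| ≠ 0 := by
    intro h
    rw [h] at hi
    simp at hi
  have h1 := hp.2
  rcases le_total p.2 p.1 with h | h
  · rw [triHeight_of_le h, abs_of_nonneg (lowerHeight_nonneg _)] at hi h1 h0
    exact exists_triTurn_mem_sqZone_of_lt ((lowerHeight_nonneg _).lt_of_ne' h0) h1 hi
  · rw [triHeight_of_ge h, abs_neg, abs_of_nonneg (lowerHeight_nonneg _)] at hi h1 h0
    obtain ⟨k, hk, h2⟩ :=
      exists_triTurn_mem_sqZone_of_lt ((lowerHeight_nonneg _).lt_of_ne' h0) h1 hi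
    rw [iterate_triTurn_halfTurn, halfTurn_mem_sqZone] at h2
    exact ⟨k, hk, h2⟩

lemma volume_abs_triHeight_eq (c : ℝ) : volume {p ∈ openSquare | |triHeight p| = c} = 0 := by
  have h : {p ∈ openSquare | |triHeight p| = c} ⊆ {p : ℝ × ℝ | 1 * p.1 + (-1) * p.2 = c} ∪
      {p | 1 * p.1 + (-1) * p.2 = -c} ∪ {p | 1 * p.1 + 0 * p.2 = c} ∪ {p | 1 * p.1 + 0 * p.2 = 1 - c} ∪
      {p | 0 * p.1 + 1 * p.2 = c} ∪ {p | 0 * p.1 + 1 * p.2 = 1 - c} := by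
    have key : ∀ p ∈ openSquare, p.2 ≤ p.1 → p.1 - p.2 = lowerHeight p ∨ p.2 = lowerHeight p ∨
        1 - p.1 = lowerHeight p := by
      rintro p ⟨⟨h1, h2⟩, h3, h4⟩ h5
      rw [lowerHeight, max_eq_right (le_min (by linarith) (le_min h3.le (by linarith)))]
      rcases min_choice (p.1 - p.2) (min p.2 (1 - p.1)) with h | h <;>
        rcases min_choice p.2 (1 - p.1) with h' | h' <;> rw [h] <;> simp [h']
    rintro p ⟨hp, h1⟩
    simp only [Set.mem_union, Set.mem_ofPred_eq]
    rcases le_total p.2 p.1 with h | h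
    · rw [triHeight_of_le h, abs_of_nonneg (lowerHeight_nonneg _)] at h1
      have h2 := key p hp h
      rw [h1] at h2
      rcases h2 with h2 | h2 | h2
      · left; left; left; left; left; linarith
      · left; right; linarith
      · left; left; right; linarith
    · rw [triHeight_of_ge h, abs_neg, abs_of_nonneg (lowerHeight_nonneg _)] at h1
      have h2 := key (halfTurn p) (halfTurn_mem_openSquare.2 hp) (by simp only [halfTurn]; linarith)
      rw [h1] at h2
      simp only [halfTurn] at h2
      rcases h2 with h2 | h2 | h2
      · left; left; left; left; right; linarith
      · right; linarith
      · left; left; left; right; linarith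
  refine measure_mono_null h ?_
  simp only [measure_union_null_iff]
  and_intros <;> exact volume_line_eq_zero (by norm_num)

lemma volume_sqHeight_eq (c : ℝ) : volume {p | sqHeight p = c} = 0 := by
  have h : {p | sqHeight p = c} ⊆ {p | 1 * p.1 + 0 * p.2 = c} ∪ {p | 1 * p.1 + 0 * p.2 = 1 - c} ∪
      {p | 0 * p.1 + 1 * p.2 = c} ∪ {p | 0 * p.1 + 1 * p.2 = 1 - c} := by
    intro p hp
    simp only [Set.mem_union, Set.mem_ofPred_eq, sqHeight] at hp ⊢
    rcases min_choice (min p.1 (1 - p.1)) (min p.2 (1 - p.2)) with h | h <;> rw [h] at hp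
    · rcases min_choice p.1 (1 - p.1) with h' | h' <;> rw [h'] at hp
      · left; left; left; linarith
      · left; left; right; linarith
    · rcases min_choice p.2 (1 - p.2) with h' | h' <;> rw [h'] at hp
      · left; right; linarith
      · right; linarith
  refine measure_mono_null h ?_
  simp only [measure_union_null_iff]
  and_intros <;> exact volume_line_eq_zero (by norm_num)

lemma ae_irrational_triHeight : ∀ᵐ p ∂(volume.restrict openSquare), |triHeight p| < 1 / 4 →
    Irrational (3 * |triHeight p| / (3 * (1 - 3 * |triHeight p|))) := by
  rw [ae_restrict_iff' measurableSet_openSquare]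
  have : ∀ᵐ p : ℝ × ℝ, ∀ r : ℚ, ¬(p ∈ openSquare ∧ |triHeight p| = r / (1 + 3 * r)) := by
    rw [ae_all_iff]
    exact fun r => measure_eq_zero_iff_ae_notMem.1 (volume_abs_triHeight_eq _)
  filter_upwards [this] with p h1 hp h2
  rintro ⟨r, hr⟩
  refine h1 r ⟨hp, ?_⟩
  generalize |triHeight p| = h at *
  have h3 : 1 - 3 * h ≠ 0 := by intro h4; linarith
  have h4 : 1 + 3 * (r : ℝ) = 1 / (1 - 3 * h) := by rw [hr]; field_simp; ring
  have h5 : 1 - h * 3 ≠ 0 := by rwa [mul_comm]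
  rw [h4, hr]; field_simp

lemma ae_irrational_sqHeight : ∀ᵐ p : ℝ × ℝ, p ∈ sqZone →
    Irrational (2 * (1 - 4 * sqHeight p) / (4 * (1 - 2 * sqHeight p))) := by
  have : ∀ᵐ p : ℝ × ℝ, ∀ r : ℚ, ¬(sqHeight p = (1 - 2 * r) / (4 - 4 * r)) := by
    rw [ae_all_iff]
    exact fun r => measure_eq_zero_iff_ae_notMem.1 (volume_sqHeight_eq _)
  filter_upwards [this] with p h1 ⟨h2, h3⟩
  rintro ⟨r, hr⟩
  refine h1 r ?_
  generalize sqHeight p = h at *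
  have h3 : 1 - 2 * h ≠ 0 := by intro h4; linarith
  have h4 : 1 - 2 * (r : ℝ) = 2 * h / (1 - 2 * h) := by rw [hr]; field_simp; ring
  have h5 : 4 - 4 * (r : ℝ) = 2 / (1 - 2 * h) := by rw [hr]; field_simp; ring
  have h6 : 1 - h * 2 ≠ 0 := by rwa [mul_comm]
  rw [h4, h5]; field_simp

lemma ae_mem_zone : ∀ᵐ p ∂(volume.restrict openSquare), p ∈ triZone ∨ p ∈ sqZone := by
  filter_upwards [ae_mem_goodSet] with p hp
  exact (triGen_of_stepMargin_pos hp.2.1).1.mem_zone hp.1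

lemma ae_exists_visit_of_mem_triZone : ∀ᵐ p ∂(volume.restrict openSquare), p ∈ triZone →
    ∃ n, stepMap^[n] p ∈ triZone ∧ triTurn (stepMap^[n] p) ∈ sqZone := by
  filter_upwards [ae_irrational_triHeight] with p h hp
  have h1 := exists_triTurn_mem_sqZone hp (h hp.2)
  classical
  have hk := Nat.find_spec h1
  have hmin := fun m => Nat.find_min h1 (m := m)
  generalize Nat.find h1 = k at hk hmin
  obtain ⟨k, rfl⟩ := Nat.exists_eq_add_of_le' hk.1
  have key : ∀ j ≤ k, stepMap^[j] p = triTurn^[j] p := by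
    intro j hj
    induction j with
    | zero => rfl
    | succ j ih =>
      rw [Function.iterate_succ_apply', Function.iterate_succ_apply', ih (by omega), stepMap]
      refine sqTurn_of_notMem fun h2 => hmin (j + 1) (by omega) ⟨by omega, ?_⟩
      rwa [Function.iterate_succ_apply']
  have hz : ∀ j, triTurn^[j] p ∈ triZone := by
    intro j
    induction j with
    | zero => exact hp
    | succ j ih => rw [Function.iterate_succ_apply']; exact triTurn_mem_triZone.2 ih
  refine ⟨k, ?_⟩
  rw [key k le_rfl, ← Function.iterate_succ_apply' triTurn]
  exact ⟨hz k, hk.2⟩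

lemma ae_exists_visit_of_notMem_triZone : ∀ᵐ p ∂(volume.restrict openSquare), p ∉ triZone →
    ∃ n, stepMap^[n] p ∉ triZone ∧ stepMap^[n + 1] p ∈ triZone ∩ sqZone := by
  filter_upwards [ae_restrict_of_ae ae_irrational_sqHeight, ae_mem_zone] with p h hz hp
  have hp' := hz.resolve_left hp
  have h1 := exists_sqTurn_mem_triZone hp' (h hp')
  classical
  have hk := Nat.find_spec h1
  have hmin := fun m => Nat.find_min h1 (m := m)
  generalize Nat.find h1 = k at hk hmin
  obtain ⟨k, rfl⟩ := Nat.exists_eq_add_of_le' hk.1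
  have h2 : ∀ j ≤ k, sqTurn^[j] p ∉ triZone := by
    intro j hj h2
    rcases Nat.eq_zero_or_pos j with rfl | h3
    · exact hp h2
    · exact hmin j (by omega) ⟨h3, h2⟩
  have key : ∀ j ≤ k + 1, stepMap^[j] p = sqTurn^[j] p := by
    intro j hj
    induction j with
    | zero => rfl
    | succ j ih =>
      rw [Function.iterate_succ_apply', Function.iterate_succ_apply', ih (by omega), stepMap,
        triTurn_of_notMem (h2 j (by omega))]
  have hz : ∀ j, sqTurn^[j] p ∈ sqZone := by
    intro j
    induction j with
    | zero => exact hp'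
    | succ j ih => rw [Function.iterate_succ_apply']; exact sqTurn_mem_sqZone.2 ih
  refine ⟨k, ?_⟩
  rw [key k (by omega), key (k + 1) le_rfl]
  exact ⟨h2 k le_rfl, hk.2, hz _⟩

lemma ae_exists_mem_visitSet :
    ∀ᵐ p ∂(volume.restrict openSquare), ∃ n, stepMap^[n] p ∈ visitSet := by
  filter_upwards [ae_exists_visit_of_mem_triZone, ae_exists_visit_of_notMem_triZone] with p h1 h2
  by_cases h : p ∈ triZone
  · obtain ⟨n, h3⟩ := h1 h
    exact ⟨n, Or.inl h3⟩
  · obtain ⟨n, h3, h4, -⟩ := h2 h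
    refine ⟨n, Or.inr ⟨h3, ?_⟩⟩
    rwa [Function.iterate_succ_apply'] at h4

lemma ae_exists_mem_zones :
    ∀ᵐ p ∂(volume.restrict openSquare), ∃ n, stepMap^[n] p ∈ triZone ∩ sqZone := by
  have hS := isSquareMap_stepMap.measurePreserving_restrict
  filter_upwards [ae_forall_iterate hS ae_exists_visit_of_mem_triZone,
    ae_forall_iterate hS ae_exists_visit_of_notMem_triZone] with p h1 h2
  have h3 : ∀ m, stepMap^[m] p ∉ triZone → ∃ n, stepMap^[n] p ∈ triZone ∩ sqZone := by
    intro m hm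
    obtain ⟨n, -, h⟩ := h2 m hm
    rw [← Function.iterate_add_apply] at h
    exact ⟨_, h⟩
  by_cases h : p ∈ triZone
  · obtain ⟨n, h4, h5⟩ := h1 0 h
    by_cases h6 : stepMap^[n + 1] p ∈ triZone
    · refine ⟨_, h6, ?_⟩
      rw [Function.iterate_succ_apply']
      exact sqTurn_mem_sqZone.2 h5
    · exact h3 _ h6
  · exact h3 0 h

lemma measurableSet_visitSet : MeasurableSet visitSet := by
  have h1 := isOpen_triZone.measurableSet
  have h2 := isOpen_sqZone.measurableSet
  have h3 := isSquareMap_triTurn.measurePreserving.measurable h2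
  have h4 := isSquareMap_stepMap.measurePreserving.measurable h1
  exact (h1.inter h3).union (h1.compl.inter h4)

lemma ae_exists_leaf : ∀ᵐ p ∂(volume.restrict openSquare), ∃ v, IsLeaf stepInv p v ∧ preCone p v ∧
    0 < preEnergy p v ∧ (p ∈ sqZone → (sqFrame p v).2 ≠ 0) := by
  have hS := isSquareMap_stepMap.measurePreserving_restrict
  have hT := isSquareMap_stepInv.measurePreserving_restrict
  have : IsFiniteMeasure (volume.restrict openSquare) := ⟨by
    rw [Measure.restrict_apply_univ, volume_openSquare]; exact ENNReal.one_lt_top⟩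
  filter_upwards [ae_exists_margin hasMargin_stepInv hT, ae_forall_iterate hT ae_mem_goodSet,
    ae_visit_gap hS hT stepMap_stepInv stepInv_stepMap measurableSet_visitSet
      ae_exists_mem_visitSet] with p h1 h2 h3
  obtain ⟨v, hv, hK, he, hK', he'⟩ :=
    isConeSystem_stepInv.exists_leaf hasMargin_stepInv.2.1 h2 h1 h3
  refine ⟨v, hv, hK, he, fun hp => ?_⟩
  have hg : 0 < stepMargin (stepInv p) := (h2 0).2.2.1
  have hq : stepInv p ∈ openSquare := (h2 1).1
  have h4 := (hK'.triTurn_energy hq (triGen_of_stepMargin_pos hg)).1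
  have h5 : sqTurn (triTurn (stepInv p)) = p := stepMap_stepInv p
  have h6 : triTurn (stepInv p) ∈ sqZone := sqTurn_mem_sqZone.1 (by rwa [h5])
  obtain ⟨κ, -, h7⟩ := (sqGen_of_stepMargin_pos hg).sqFrame_sqTurn h6
  have h8 := h7 (triTurnDeriv (stepInv p) (stepInvDeriv p v))
  have h9 : sqTurnDeriv (triTurn (stepInv p)) (triTurnDeriv (stepInv p) (stepInvDeriv p v)) = v :=
    stepDeriv_stepInvDeriv (h2 0) v
  rw [h5, h9] at h8
  rw [postEnergy, if_pos h6] at h4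
  rw [h8]
  exact abs_pos.1 (he'.trans_le h4)

lemma eventually_lt_iff {X : Type*} [TopologicalSpace X] {f g : X → ℝ} (hf : Continuous f)
    (hg : Continuous g) {x : X} (h : f x ≠ g x) : ∀ᶠ y in nhds x, (f y < g y ↔ f x < g x) := by
  rcases h.lt_or_gt with h | h
  · filter_upwards [hf.continuousAt.eventually_lt hg.continuousAt h] with y hy
    exact iff_of_true hy h
  · filter_upwards [hg.continuousAt.eventually_lt hf.continuousAt h] with y hy
    exact iff_of_false hy.not_gt h.not_gt

lemma IsGen.eventually_frame {p : ℝ × ℝ} (h : IsGen p) (hp : p ∈ openSquare) :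
    ∀ᶠ q in nhds p, q ∈ openSquare ∧ (q.2 < q.1 ↔ p.2 < p.1) ∧ (q ∈ triZone ↔ p ∈ triZone) ∧
      (q ∈ sqZone ↔ p ∈ sqZone) ∧ triFrame q = triFrame p ∧ sqFrame q = sqFrame p := by
  have hφ : |triHeight p| ≠ 1 / 4 := by
    rcases h.triFrame_triangleStep hp with h | h
    · exact h.1.ne
    · exact h.1.ne'
  have h1 := fun {l} hl => h.ne (l := l) hl
  have hd := h1 (l := (1, -1, 0)) (by decide)
  have ha := h1 (l := (1, 1, -1)) (by decide)
  have hb := h1 (l := (1, -2, 0)) (by decide)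
  have hc := h1 (l := (2, -1, -1)) (by decide)
  have hb' := h1 (l := (1, -2, 1)) (by decide)
  have hc' := h1 (l := (2, -1, 0)) (by decide)
  simp only [lineEval] at hd ha hb hc hb' hc'
  push_cast at hd ha hb hc hb' hc'
  have hh : sqHeight p ≠ 1 / 4 := by
    have e1 := h1 (l := (4, 0, -1)) (by decide)
    have e2 := h1 (l := (0, 4, -1)) (by decide)
    have e3 := h1 (l := (-4, 0, 3)) (by decide)
    have e4 := h1 (l := (0, -4, 3)) (by decide)
    simp only [lineEval] at e1 e2 e3 e4
    push_cast at e1 e2 e3 e4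
    intro h0
    rw [sqHeight] at h0
    rcases min_choice (min p.1 (1 - p.1)) (min p.2 (1 - p.2)) with h2 | h2
    · rcases min_choice p.1 (1 - p.1) with h3 | h3
      · exact e1 (by linarith)
      · exact e3 (by linarith)
    · rcases min_choice p.2 (1 - p.2) with h3 | h3
      · exact e2 (by linarith)
      · exact e4 (by linarith)
  have hh' : sqHeight p ≠ 3 / 8 := by
    rcases h.sqFrame_squareStep with h | h | h
    · exact h.1.2.ne
    · exact h.1.ne'
    · exact fun h0 => by linarith [h.1]
  have key : ∀ f g : ℝ × ℝ → ℝ, Continuous f → Continuous g → f p ≠ g p →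
      ∀ᶠ q in nhds p, (f q < g q ↔ f p < g p) := fun f g hf hg => eventually_lt_iff hf hg
  filter_upwards [isOpen_openSquare.mem_nhds hp,
    eventually_lt_iff continuous_triHeight.abs continuous_const hφ,
    eventually_lt_iff continuous_const continuous_sqHeight hh.symm,
    eventually_lt_iff continuous_sqHeight continuous_const hh',
    eventually_lt_iff continuous_snd continuous_fst (x := p) fun h0 => hd (by linarith),
    key (fun q => q.1 + q.2) (fun _ => 1) (by fun_prop) (by fun_prop) fun h0 => ha (by linarith),
    key (fun q => q.2) (fun q => 1 - q.1) (by fun_prop) (by fun_prop) fun h0 => ha (by linarith),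
    key (fun q => 1 - q.2) (fun q => q.1) (by fun_prop) (by fun_prop) fun h0 => ha (by linarith),
    key (fun q => q.2) (fun q => q.1 - q.2) (by fun_prop) (by fun_prop) fun h0 => hb (by linarith),
    key (fun q => 1 - q.1) (fun q => q.1 - q.2) (by fun_prop) (by fun_prop)
      fun h0 => hc (by linarith),
    key (fun q => 1 - q.2) (fun q => q.2 - q.1) (by fun_prop) (by fun_prop)
      fun h0 => hb' (by linarith),
    key (fun q => q.1) (fun q => q.2 - q.1) (by fun_prop) (by fun_prop)
      fun h0 => hc' (by linarith)] with q g1 g2 g3 g4 g5 g6 k1 k2 g7 g8 g9 g10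
  refine ⟨g1, g5, and_congr (iff_of_true g1 hp) g2, and_congr g3 g4, ?_, ?_⟩
  · ext1 w
    simp only [triFrame, lowerFrame, halfTurn, sub_sub_cancel, sub_sub_sub_cancel_left, g5, k1, k2,
      g7, g8, g9, g10]
  · ext1 w
    simp only [sqFrame, g5, g6]

open Filter

/-- The function is eventually positive or eventually negative. -/
def Signed (ℓ : Filter ℝ) (f : ℝ → ℝ) : Prop :=
  ∃ σ : ℝ, (σ = 1 ∨ σ = -1) ∧ ∀ᶠ t in ℓ, 0 < σ * f t

lemma sign_transfer {σ δ s x y : ℝ} (hσ : σ = 1 ∨ σ = -1) (hδ : δ = 1 ∨ δ = -1)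
    (hs : 0 < δ * s) (hx : 0 < σ * x) (h : |x| ≤ |y|) (h0 : 0 ≤ s * (x * y)) :
    0 < δ * σ * y := by
  have hx0 : x ≠ 0 := by rintro rfl; simp at hx
  have hy0 : y ≠ 0 := abs_pos.1 ((abs_pos.2 hx0).trans_le h)
  have hδ2 : δ * δ = 1 := by rcases hδ with rfl | rfl <;> norm_num
  have hσ2 : σ * σ = 1 := by rcases hσ with rfl | rfl <;> norm_num
  have h1 : δ * s * (σ * x) * (δ * σ * y) = δ * δ * (σ * σ) * (s * (x * y)) := by ring
  have h2 : 0 ≤ δ * s * (σ * x) * (δ * σ * y) := by rw [h1, hδ2, hσ2]; linarith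
  refine lt_of_le_of_ne (nonneg_of_mul_nonneg_right h2 (mul_pos hs hx)) (Ne.symm ?_)
  refine mul_ne_zero (mul_ne_zero ?_ ?_) hy0
  · rintro rfl; simp at hδ2
  · rintro rfl; simp at hσ2

lemma exists_sign {x : ℝ} (h : x ≠ 0) : ∃ δ : ℝ, (δ = 1 ∨ δ = -1) ∧ 0 < δ * x := by
  rcases h.lt_or_gt with h | h
  · exact ⟨-1, Or.inr rfl, by linarith⟩
  · exact ⟨1, Or.inl rfl, by linarith⟩

/-- A turn `f` in the zone `A` does not create folds. -/
lemma signed_turn {ℓ : Filter ℝ} {f : ℝ × ℝ → ℝ × ℝ} {D : ℝ × ℝ → ℝ × ℝ → ℝ × ℝ}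
    {A B : Set (ℝ × ℝ)} {a b : ℝ × ℝ → ℝ × ℝ → ℝ} {c w : ℝ → ℝ × ℝ} {z : ℝ × ℝ}
    (hf : Continuous f) (hA : IsOpen A) (hB : IsOpen B) (hc : Tendsto c ℓ (nhds z))
    (hfA : ∀ p, f p ∈ A ↔ p ∈ A) (hfix : ∀ p, p ∉ A → f p = p)
    (hD : ∀ᶠ t in ℓ, c t ∉ A → D (c t) (w t) = w t)
    (ha : ∀ᶠ t in ℓ, c t ∈ A → a (f (c t)) (D (c t) (w t)) = a (c t) (w t))
    (h1 : ∀ᶠ t in ℓ, c t ∈ A → c t ∈ B → |b (c t) (w t)| ≤ |a (c t) (w t)| ∧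
      0 ≤ ((c t).1 + (c t).2 - 1) * (a (c t) (w t) * b (c t) (w t)))
    (h2 : ∀ᶠ t in ℓ, f (c t) ∈ A → f (c t) ∈ B →
      |a (f (c t)) (D (c t) (w t))| ≤ |b (f (c t)) (D (c t) (w t))| ∧
      0 ≤ ((f (c t)).1 + (f (c t)).2 - 1) *
        (a (f (c t)) (D (c t) (w t)) * b (f (c t)) (D (c t) (w t))))
    (hs : ∀ p ∈ A, p ∈ B → p.1 + p.2 ≠ 1)
    (hs' : z ∈ B → z ∉ A → (∀ᶠ p in nhds z, p ∉ A) ∨ z.1 + z.2 ≠ 1)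
    (hza : z ∈ A → Signed ℓ fun t => a (c t) (w t))
    (hzb : z ∈ B → Signed ℓ fun t => b (c t) (w t)) :
    (f z ∈ A → Signed ℓ fun t => a (f (c t)) (D (c t) (w t))) ∧
      (f z ∈ B → Signed ℓ fun t => b (f (c t)) (D (c t) (w t))) := by
  have hfc : Tendsto (fun t => f (c t)) ℓ (nhds (f z)) := (hf.tendsto z).comp hc
  have hA' : f z ∈ A → Signed ℓ fun t => a (f (c t)) (D (c t) (w t)) := by
    intro h
    obtain ⟨σ, hσ, h3⟩ := hza ((hfA _).1 h)
    refine ⟨σ, hσ, ?_⟩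
    filter_upwards [h3, ha, hc.eventually (hA.mem_nhds ((hfA _).1 h))] with t h4 h5 h6
    rwa [h5 h6]
  have hsum : ∀ {g : ℝ → ℝ × ℝ} {y : ℝ × ℝ} {δ : ℝ}, Tendsto g ℓ (nhds y) →
      0 < δ * (y.1 + y.2 - 1) → ∀ᶠ t in ℓ, 0 < δ * ((g t).1 + (g t).2 - 1) := by
    intro g y δ hg hy
    have hcont : Continuous fun q : ℝ × ℝ => δ * (q.1 + q.2 - 1) := by fun_prop
    exact hg.eventually (continuousAt_const.eventually_lt hcont.continuousAt hy)
  refine ⟨hA', fun h => ?_⟩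
  by_cases hzA : z ∈ A
  · obtain ⟨σ, hσ, h3⟩ := hA' ((hfA _).2 hzA)
    obtain ⟨δ, hδ, h4⟩ := exists_sign (sub_ne_zero.2 (hs _ ((hfA _).2 hzA) h))
    refine ⟨δ * σ, by rcases hσ with rfl | rfl <;> rcases hδ with rfl | rfl <;> norm_num, ?_⟩
    filter_upwards [h3, h2, hfc.eventually (hA.mem_nhds ((hfA _).2 hzA)),
      hfc.eventually (hB.mem_nhds h), hsum hfc h4] with t k1 k2 k3 k4 k5
    obtain ⟨k6, k7⟩ := k2 k3 k4
    exact sign_transfer hσ hδ k5 k1 k6 k7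
  · have hfz := hfix z hzA
    rw [hfz] at h hfc
    obtain ⟨σ, hσ, h3⟩ := hzb h
    refine ⟨σ, hσ, ?_⟩
    rcases hs' h hzA with h4 | h4
    · filter_upwards [h3, hc.eventually h4, hD] with t k1 k2 k3
      rwa [k3 k2, hfix _ k2]
    · obtain ⟨δ, hδ, h4⟩ := exists_sign (sub_ne_zero.2 h4)
      filter_upwards [h3, hD, ha, h1, h2, hc.eventually (hB.mem_nhds h),
        hfc.eventually (hB.mem_nhds h), hsum hc h4, hsum hfc h4] with t k1 k2 k3 k4 k5 k6 k7 k8 k9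
      by_cases hcA : c t ∈ A
      · obtain ⟨e1, e2⟩ := k4 hcA k6
        obtain ⟨e3, e4⟩ := k5 ((hfA _).2 hcA) k7
        rw [mul_comm (a _ _)] at e2
        have e5 := sign_transfer hσ hδ k8 k1 e1 e2
        rw [← k3 hcA] at e5
        have e6 := sign_transfer (σ := δ * σ)
          (by rcases hσ with rfl | rfl <;> rcases hδ with rfl | rfl <;> norm_num) hδ k9 e5 e3 e4
        have hδ2 : δ * δ = 1 := by rcases hδ with rfl | rfl <;> norm_num
        rwa [← mul_assoc, hδ2, one_mul] at e6
      · rwa [k2 hcA, hfix _ hcA]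

/-- The derivative of `triHeight`. -/
noncomputable def triSlope (p w : ℝ × ℝ) : ℝ :=
  if p.2 < p.1 then (triFrame p w).2 else -(triFrame p w).2

/-- The derivative of `sqHeight`. -/
noncomputable def sqSlope (p w : ℝ × ℝ) : ℝ := (sqFrame p w).2

section Signs

variable {p w : ℝ × ℝ}

lemma abs_triSlope : |triSlope p w| = |(triFrame p w).2| := by
  rw [triSlope]; split_ifs; rfl; rw [abs_neg]

lemma snd_lt_fst_iff (hp : p ∈ openSquare) : p.2 < p.1 ↔ 0 < triHeight p := by
  constructor
  · intro h
    rw [triHeight_of_le h.le]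
    exact lowerHeight_pos hp h
  · intro h
    by_contra! h'
    rw [triHeight_of_ge h'] at h
    linarith [lowerHeight_nonneg (halfTurn p)]

lemma TriGen.triSlope_triTurn (h : TriGen p) (hp : p ∈ triZone) :
    triSlope (triTurn p) (triTurnDeriv p w) = triSlope p w := by
  obtain ⟨κ, -, h1⟩ := h.triFrame_triTurn hp
  have h2 : (triTurn p).2 < (triTurn p).1 ↔ p.2 < p.1 := by
    rw [snd_lt_fst_iff hp.1, snd_lt_fst_iff (triTurn_mem.2 hp.1), triHeight_triTurn]
  simp only [triSlope, h1, h2]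

lemma SqGen.sqSlope_sqTurn (h : SqGen p) (hp : p ∈ sqZone) :
    sqSlope (sqTurn p) (sqTurnDeriv p w) = sqSlope p w := by
  obtain ⟨κ, -, h1⟩ := h.sqFrame_sqTurn hp
  simp only [sqSlope, h1]

lemma slope_formulas (h : p ∈ triZone) (h' : p ∈ sqZone) (w : ℝ × ℝ) :
    triSlope p w = w.1 - w.2 ∧ triFrame p w = (if p.2 < p.1 then (w.2 - 2 * w.1, w.1 - w.2)
      else (2 * w.1 - w.2, w.2 - w.1)) := by
  obtain ⟨⟨h1, h2, h3, h4⟩, h5, h6, -⟩ := ring_bounds h h'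
  rw [triSlope, triFrame]
  split_ifs with hlt
  · rw [lowerFrame_diag (by linarith) (by linarith)]
    exact ⟨rfl, rfl⟩
  · rw [lowerFrame_diag (by simp only [halfTurn]; linarith) (by simp only [halfTurn]; linarith)]
    constructor
    · simp only [Prod.fst_neg, Prod.snd_neg]; ring
    · ext <;> simp only [Prod.fst_neg, Prod.snd_neg] <;> ring

lemma slope_sign (h : p ∈ triZone) (h' : p ∈ sqZone)
    (hw : TriCone (triFrame p w) ∨ SqCone (sqFrame p w)) :
    0 ≤ (p.1 + p.2 - 1) * (triSlope p w * sqSlope p w) := by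
  obtain ⟨h1, h2⟩ := slope_formulas h h' w
  rw [h1, sqSlope]
  rw [h2, sqFrame] at hw
  rw [sqFrame]
  have key : ∀ x : ℝ, (0 ≤ p.1 + p.2 - 1 → 0 ≤ x) → (p.1 + p.2 - 1 ≤ 0 → x ≤ 0) →
      0 ≤ (p.1 + p.2 - 1) * x := fun x k1 k2 => by
    rcases le_total 0 (p.1 + p.2 - 1) with k | k
    · exact mul_nonneg k (k1 k)
    · exact mul_nonneg_of_nonpos_of_nonpos k (k2 k)
  have hsum := (ring_bounds h h').2.2.2.2
  have hlt := lt_or_gt_of_ne hsum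
  split_ifs at hw ⊢ <;> apply key <;> intro k <;>
    first
    | (exfalso; rcases hlt with hlt | hlt <;> linarith)
    | (simp only [TriCone, SqCone] at hw
       rcases hw with hw | hw <;>
       nlinarith [sq_nonneg (w.1 - w.2), sq_nonneg w.1, sq_nonneg w.2])

lemma sum_ne_one (h1 : 1 / 4 ≤ sqHeight p) (h2 : sqHeight p ≤ 3 / 8) (h3 : |triHeight p| ≤ 1 / 4)
    (h4 : (1 / 4 < sqHeight p ∧ sqHeight p < 3 / 8) ∨ |triHeight p| < 1 / 4) : p.1 + p.2 ≠ 1 := by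
  intro h0
  have hy : p.2 = 1 - p.1 := by linarith
  have key : ∀ x : ℝ, 1 / 2 ≤ x → 1 / 4 ≤ 1 - x → 1 - x ≤ 3 / 8 →
      lowerHeight (x, 1 - x) ≤ 1 / 4 → (1 / 4 < 1 - x ∧ 1 - x < 3 / 8) ∨
      lowerHeight (x, 1 - x) < 1 / 4 → False := by
    intro x hx k1 k2 k3 k4
    have k5 : min (x - (1 - x)) (1 - x) ≤ lowerHeight (x, 1 - x) := by
      simp only [lowerHeight, min_self]; exact le_max_right _ _
    rcases min_choice (x - (1 - x)) (1 - x) with k6 | k6 <;> rw [k6] at k5 <;>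
      rcases k4 with ⟨k4, k7⟩ | k4 <;> linarith
  rw [sqHeight, hy, sub_sub_cancel, min_comm (1 - p.1) p.1, min_self] at h1 h2 h4
  rcases le_total (1 / 2) p.1 with hx | hx
  · rw [triHeight_of_le (by linarith), abs_of_nonneg (lowerHeight_nonneg _),
      show p = (p.1, 1 - p.1) from Prod.ext rfl hy] at h3 h4
    rw [min_eq_right (by linarith)] at h1 h2 h4
    exact key _ hx h1 h2 h3 h4
  · rw [triHeight_of_ge (by linarith), abs_neg, abs_of_nonneg (lowerHeight_nonneg _),
      show halfTurn p = (1 - p.1, 1 - (1 - p.1)) by simp [halfTurn, hy]] at h3 h4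
    rw [min_eq_left (by linarith)] at h1 h2 h4
    rw [show p.1 = 1 - (1 - p.1) by ring] at h1 h2 h4
    exact key _ (by linarith) h1 h2 (by simpa using h3) (by simpa using h4)

lemma signed_triTurn {ℓ : Filter ℝ} {c w : ℝ → ℝ × ℝ} {z : ℝ × ℝ} (hz : z ∈ openSquare)
    (hc : Tendsto c ℓ (nhds z)) (hmem : ∀ᶠ t in ℓ, c t ∈ openSquare ∧ TriGen (c t) ∧
      preCone (c t) (w t))
    (hza : z ∈ triZone → Signed ℓ fun t => triSlope (c t) (w t))
    (hzb : z ∈ sqZone → Signed ℓ fun t => sqSlope (c t) (w t)) :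
    (triTurn z ∈ triZone → Signed ℓ fun t => triSlope (triTurn (c t)) (triTurnDeriv (c t) (w t))) ∧
    (triTurn z ∈ sqZone → Signed ℓ fun t => sqSlope (triTurn (c t)) (triTurnDeriv (c t) (w t))) := by
  refine signed_turn (D := fun p => triTurnDeriv p) (a := triSlope) (b := sqSlope)
    isSquareMap_triTurn.isPL.1 isOpen_triZone isOpen_sqZone hc
    (fun p => triTurn_mem_triZone) (fun p => triTurn_of_notMem) ?_ ?_ ?_ ?_
    (fun p h h' => (ring_bounds h h').2.2.2.2) ?_ hza hzb
  · filter_upwards [hmem] with t h h'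
    rw [h.2.1.triTurnDeriv_eq h.1 h', LinearMap.id_apply]
  · filter_upwards [hmem] with t h h' using h.2.1.triSlope_triTurn h'
  · filter_upwards [hmem] with t h h1 h2
    have h3 := h.2.2
    rw [preCone, if_pos h2] at h3
    refine ⟨?_, slope_sign h1 h2 (Or.inr h3)⟩
    rw [abs_triSlope, sqSlope]
    linarith [(h3.two_mul_le (frameRel h1 h2 _)).1, abs_nonneg (sqFrame (c t) (w t)).2]
  · filter_upwards [hmem] with t h h1 h2
    have h3 := h.2.2.postCone_triTurn h.1 h.2.1
    rw [postCone, if_pos h1] at h3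
    refine ⟨?_, slope_sign h1 h2 (Or.inl h3)⟩
    have := (h3.two_mul_le (frameRel h1 h2 _)).1
    rw [abs_triSlope, sqSlope]
    linarith [abs_nonneg (triFrame (triTurn (c t)) (triTurnDeriv (c t) (w t))).2]
  · intro h1 h2
    have h3 : 1 / 4 ≤ |triHeight z| := by
      by_contra! h3; exact h2 ⟨hz, h3⟩
    rcases h3.lt_or_eq with h3 | h3
    · left
      filter_upwards [continuousAt_const.eventually_lt continuous_triHeight.abs.continuousAt h3]
        with p hp h4 using hp.not_gt h4.2
    · exact Or.inr (sum_ne_one h1.1.le h1.2.le h3.ge (Or.inl h1))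

lemma signed_sqTurn {ℓ : Filter ℝ} {c w : ℝ → ℝ × ℝ} {z : ℝ × ℝ}
    (hc : Tendsto c ℓ (nhds z)) (hmem : ∀ᶠ t in ℓ, c t ∈ openSquare ∧ SqGen (c t) ∧
      postCone (c t) (w t))
    (hza : z ∈ triZone → Signed ℓ fun t => triSlope (c t) (w t))
    (hzb : z ∈ sqZone → Signed ℓ fun t => sqSlope (c t) (w t)) :
    (sqTurn z ∈ triZone → Signed ℓ fun t => triSlope (sqTurn (c t)) (sqTurnDeriv (c t) (w t))) ∧
    (sqTurn z ∈ sqZone → Signed ℓ fun t => sqSlope (sqTurn (c t)) (sqTurnDeriv (c t) (w t))) := by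
  refine And.symm (signed_turn (D := fun p => sqTurnDeriv p) (a := sqSlope) (b := triSlope)
    isSquareMap_sqTurn.isPL.1 isOpen_sqZone isOpen_triZone hc
    (fun p => sqTurn_mem_sqZone) (fun p => sqTurn_of_notMem) ?_ ?_ ?_ ?_
    (fun p h h' => (ring_bounds h' h).2.2.2.2) ?_ hzb hza)
  · filter_upwards [hmem] with t h h'
    rw [h.2.1.sqTurnDeriv_eq h', LinearMap.id_apply]
  · filter_upwards [hmem] with t h h' using h.2.1.sqSlope_sqTurn h'
  · filter_upwards [hmem] with t h h2 h1
    have h3 := h.2.2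
    rw [postCone, if_pos h1] at h3
    refine ⟨?_, mul_comm (triSlope _ _) _ ▸ slope_sign h1 h2 (Or.inl h3)⟩
    rw [abs_triSlope, sqSlope]
    linarith [(h3.two_mul_le (frameRel h1 h2 _)).1, abs_nonneg (triFrame (c t) (w t)).2]
  · filter_upwards [hmem] with t h h2 h1
    have h3 := h.2.2.preCone_sqTurn h.1 h.2.1
    rw [preCone, if_pos h2] at h3
    refine ⟨?_, mul_comm (triSlope _ _) _ ▸ slope_sign h1 h2 (Or.inr h3)⟩
    have := (h3.two_mul_le (frameRel h1 h2 _)).1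
    rw [abs_triSlope, sqSlope]
    linarith [abs_nonneg (sqFrame (sqTurn (c t)) (sqTurnDeriv (c t) (w t))).2]
  · intro h1 h2
    rcases lt_or_ge (sqHeight z) (1 / 4) with h3 | h3
    · left
      filter_upwards [continuous_sqHeight.continuousAt.eventually_lt continuousAt_const h3]
        with p hp h4 using hp.not_gt h4.1
    rcases lt_or_ge (3 / 8) (sqHeight z) with h4 | h4
    · left
      filter_upwards [continuousAt_const.eventually_lt continuous_sqHeight.continuousAt h4]
        with p hp h4 using hp.not_gt h4.2
    exact Or.inr (sum_ne_one h3 h4 h1.2.le (Or.inr h1.2))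

end Signs

/-- Points whose forward orbit avoids the singularities and expands infinitely often. -/
def typicalSet : Set (ℝ × ℝ) :=
  {q | (∀ k, stepMap^[k] q ∈ openSquare ∧ 0 < stepMargin (stepMap^[k] q)) ∧
    ∀ N, ∃ n, N ≤ n ∧ stepMap^[n] q ∈ visitSet}

lemma ae_mem_typicalSet : ∀ᵐ p ∂(volume.restrict openSquare), p ∈ typicalSet := by
  have hS := isSquareMap_stepMap.measurePreserving_restrict
  filter_upwards [ae_forall_iterate hS ae_mem_goodSet,
    ae_forall_exists_visit hS ae_exists_mem_visitSet] with p h1 h2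
  exact ⟨fun k => ⟨(h1 k).1, (h1 k).2.1⟩, h2⟩

section typical

variable {q w : ℝ × ℝ}

lemma preCone_iterDeriv (hq : q ∈ typicalSet) (hw : preCone q w) (n : ℕ) :
    preCone (stepMap^[n] q) (iterDeriv stepMap stepDeriv q n w) := by
  induction n with
  | zero => exact hw
  | succ n ih =>
    rw [Function.iterate_succ_apply']
    exact ih.preCone_stepMap (hq.1 n).1 (hq.1 n).2

lemma tendsto_preEnergy (hq : q ∈ typicalSet) (hw : preCone q w) (he : 0 < preEnergy q w) :
    Tendsto (fun n => preEnergy (stepMap^[n] q) (iterDeriv stepMap stepDeriv q n w)) atTop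
      atTop := by
  set e : ℕ → ℝ := fun n => preEnergy (stepMap^[n] q) (iterDeriv stepMap stepDeriv q n w) with hedef
  have hstep : ∀ n, e n ≤ e (n + 1) ∧ (stepMap^[n] q ∈ visitSet → 2 * e n ≤ e (n + 1)) := by
    intro n
    simp only [hedef, Function.iterate_succ_apply']
    exact (preCone_iterDeriv hq hw n).stepMap_energy (hq.1 n).1 (hq.1 n).2
  have hmono : Monotone e := monotone_nat_of_le_succ fun n => (hstep n).1
  have h0 : 0 < e 0 := he
  have key : ∀ k : ℕ, ∃ n, 2 ^ k * e 0 ≤ e n := by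
    intro k
    induction k with
    | zero => exact ⟨0, by simp⟩
    | succ k ih =>
      obtain ⟨n, hn⟩ := ih
      obtain ⟨m, hm, hv⟩ := hq.2 n
      refine ⟨m + 1, ?_⟩
      have := (hstep m).2 hv
      have := hmono hm
      rw [pow_succ]
      linarith
  refine tendsto_atTop_atTop_of_monotone hmono fun b => ?_
  obtain ⟨k, hk⟩ := pow_unbounded_of_one_lt (b / e 0) (one_lt_two (α := ℝ))
  obtain ⟨n, hn⟩ := key k
  exact ⟨n, ((div_lt_iff₀ h0).1 hk).le.trans hn⟩

lemma AffineOnBall.hasDerivAt {f : ℝ × ℝ → ℝ × ℝ} {c : ℝ → ℝ × ℝ} {A r} {t : ℝ}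
    (h : AffineOnBall f (c t) A r) (hr : 0 < r) (hc : HasDerivAt c w t) :
    HasDerivAt (fun s => f (c s)) (A w) t := by
  have h1 : HasDerivAt (fun s => f (c t) + A (c s - c t)) (A w) t := by
    have := (LinearMap.toContinuousLinearMap A).hasFDerivAt.comp_hasDerivAt t (hc.sub_const (c t))
    exact this.const_add _
  refine h1.congr_of_eventuallyEq ?_
  filter_upwards [hc.continuousAt.eventually (Metric.ball_mem_nhds (c t) hr)] with s hs
  exact h _ (by rwa [← dist_eq_norm])

lemma hasDerivAt_line (p v : ℝ × ℝ) (t : ℝ) : HasDerivAt (fun s : ℝ => p + s • v) v t := by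
  simpa using ((hasDerivAt_id t).smul_const v).const_add p

lemma hasDerivAt_iterate {p v : ℝ × ℝ} {t : ℝ} (hq : p + t • v ∈ typicalSet) (n : ℕ) :
    HasDerivAt (fun s : ℝ => stepMap^[n] (p + s • v))
      (iterDeriv stepMap stepDeriv (p + t • v) n v) t := by
  induction n with
  | zero => exact hasDerivAt_line p v t
  | succ n ih =>
    simp only [Function.iterate_succ_apply']
    exact (hasMargin_stepMap.2.1 (stepMap^[n] (p + t • v))).hasDerivAt
      (c := fun s : ℝ => stepMap^[n] (p + s • v)) (hq.1 n).2 ih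

lemma hasDerivAt_triTurn {c : ℝ → ℝ × ℝ} {t : ℝ} (hg : 0 < stepMargin (c t))
    (hc : HasDerivAt c w t) : HasDerivAt (fun s => triTurn (c s)) (triTurnDeriv (c t) w) t := by
  obtain ⟨r, hr, h⟩ := exists_affineOnBall_triTurn hg
  exact h.hasDerivAt hr hc

end typical

/-- A segment in a contracting leaf of the inverse map which is expanded by `stepMap` and on which
the frames are constant. -/
structure IsCurve (p v : ℝ × ℝ) : Prop where
  leaf : IsLeaf stepInv p v
  cone : preCone p v
  pos : 0 < preEnergy p v
  ne_zero : p ∈ sqZone → (sqFrame p v).2 ≠ 0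
  frame : ∀ t : ℝ, |t| ≤ 1 → p + t • v ∈ openSquare ∧ ((p + t • v).2 < (p + t • v).1 ↔ p.2 < p.1) ∧
    (p + t • v ∈ triZone ↔ p ∈ triZone) ∧ (p + t • v ∈ sqZone ↔ p ∈ sqZone) ∧
    triFrame (p + t • v) = triFrame p ∧ sqFrame (p + t • v) = sqFrame p
  typical : ∀ᵐ t : ℝ, |t| ≤ 1 / 2 → p + t • v ∈ typicalSet

lemma IsLeaf.ae_mem {T : ℝ × ℝ → ℝ × ℝ} {P : ℝ × ℝ → Prop}
    (hP : ∀ᵐ p ∂(volume.restrict openSquare), P p) : ∀ᵐ p, ∀ v, IsLeaf T p v →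
      (∀ t : ℝ, |t| ≤ 1 → p + t • v ∈ openSquare) →
      ∀ᵐ t : ℝ, |t| ≤ 1 / 2 → P (p + t • v) := by
  rw [ae_restrict_iff' measurableSet_openSquare] at hP
  filter_upwards [(isSegmentFamily_isLeaf T).ae_null (ae_iff.1 hP)] with p hp v hv hsq
  refine measure_mono_null (fun t ht => ?_) (hp v hv)
  simp only [Set.mem_compl_iff, Set.mem_ofPred_eq, Classical.not_imp] at ht ⊢
  exact ⟨ht.1, hsq t (by linarith [ht.1]), ht.2⟩

lemma ae_exists_isCurve : ∀ᵐ p ∂(volume.restrict openSquare), ∃ v, IsCurve p v := by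
  filter_upwards [ae_restrict_mem measurableSet_openSquare, ae_mem_typicalSet, ae_exists_leaf,
    ae_restrict_of_ae (IsLeaf.ae_mem (T := stepInv) ae_mem_typicalSet)] with p hp htyp ⟨v, hv, hK, he, h0⟩ hN
  have hgen : IsGen p := (triGen_of_stepMargin_pos (htyp.1 0).2).1
  obtain ⟨r, hr, hball⟩ := Metric.eventually_nhds_iff_ball.1 (hgen.eventually_frame hp)
  obtain ⟨l, hl, hl1, hlr⟩ : ∃ l : ℝ, 0 < l ∧ l ≤ 1 ∧ l * ‖v‖ < r := by
    refine ⟨min 1 (r / (‖v‖ + 1)), by positivity, min_le_left _ _, ?_⟩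
    have h1 : min 1 (r / (‖v‖ + 1)) * (‖v‖ + 1) ≤ r := by
      calc _ ≤ r / (‖v‖ + 1) * (‖v‖ + 1) := by gcongr; exact min_le_right _ _
        _ = r := div_mul_cancel₀ _ (by positivity)
    have : 0 < min 1 (r / (‖v‖ + 1)) := by positivity
    linarith
  have hframe : ∀ t : ℝ, |t| ≤ 1 → p + t • l • v ∈ Metric.ball p r := by
    intro t ht
    rw [mem_ball_iff_norm, add_sub_cancel_left, norm_smul, norm_smul, Real.norm_eq_abs,
      Real.norm_of_nonneg hl.le]
    have : |t| * (l * ‖v‖) ≤ 1 * (l * ‖v‖) := by gcongr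
    linarith
  have hleaf : IsLeaf stepInv p (l • v) := by
    have := (isSegmentFamily_isLeaf stepInv).sub (t := 0) hv hl (by simpa using hl1)
    simpa using this
  refine ⟨l • v, hleaf, preCone_smul l hK, ?_, fun h => ?_, fun t ht => hball _ (hframe t ht),
    hN _ hleaf fun t ht => (hball _ (hframe t ht)).1⟩
  · rw [preEnergy] at he ⊢
    split_ifs at he ⊢
    · rw [triFrame_smul, Prod.smul_snd, smul_eq_mul, abs_mul]; positivity
    · rw [sqFrame_smul, Prod.smul_snd, smul_eq_mul, abs_mul]; positivity
  · rw [sqFrame_smul, Prod.smul_snd, smul_eq_mul]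
    exact mul_ne_zero hl.ne' (h0 h)

lemma signed_of_eventually_eq {ℓ : Filter ℝ} {f : ℝ → ℝ} {x : ℝ} (hx : x ≠ 0)
    (h : ∀ᶠ t in ℓ, f t = x) : Signed ℓ f := by
  obtain ⟨σ, hσ, h1⟩ := exists_sign hx
  exact ⟨σ, hσ, h.mono fun t ht => by rwa [ht]⟩

lemma Signed.congr {ℓ : Filter ℝ} {f g : ℝ → ℝ} (hf : Signed ℓ f) (h : ∀ᶠ t in ℓ, f t = g t) :
    Signed ℓ g := by
  obtain ⟨σ, hσ, h1⟩ := hf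
  exact ⟨σ, hσ, by filter_upwards [h, h1] with t h2 h3; rwa [← h2]⟩

namespace IsCurve

variable {p v : ℝ × ℝ}

lemma triSlope_eq (h : IsCurve p v) {t : ℝ} (ht : |t| ≤ 1) (w) :
    triSlope (p + t • v) w = triSlope p w := by
  obtain ⟨-, h1, -, -, h2, -⟩ := h.frame t ht
  simp only [triSlope, h1, h2]

lemma sqSlope_eq (h : IsCurve p v) {t : ℝ} (ht : |t| ≤ 1) (w) :
    sqSlope (p + t • v) w = sqSlope p w := by
  rw [sqSlope, (h.frame t ht).2.2.2.2.2, sqSlope]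

lemma preCone_add (h : IsCurve p v) {t : ℝ} (ht : |t| ≤ 1) : preCone (p + t • v) v := by
  obtain ⟨-, -, -, h1, h2, h3⟩ := h.frame t ht
  have := h.cone
  rw [preCone] at this ⊢
  rw [h2, h3]
  split_ifs at this ⊢ <;> first | exact this | (exfalso; tauto)

lemma preEnergy_add (h : IsCurve p v) {t : ℝ} (ht : |t| ≤ 1) : 0 < preEnergy (p + t • v) v := by
  obtain ⟨-, -, h1, -, h2, h3⟩ := h.frame t ht
  have := h.pos
  rw [preEnergy] at this ⊢
  rw [h2, h3]
  split_ifs at this ⊢ <;> first | exact this | (exfalso; tauto)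

lemma eventually_typical (h : IsCurve p v) {t₀ : ℝ} (ht₀ : |t₀| < 1 / 2) :
    ∀ᶠ t in nhds t₀ ⊓ ae volume, |t| ≤ 1 ∧ p + t • v ∈ typicalSet := by
  have h1 : ∀ᶠ t in nhds t₀ ⊓ ae volume, |t| < 1 / 2 := Filter.Eventually.filter_mono inf_le_left
    (continuous_abs.continuousAt.eventually_lt continuousAt_const ht₀)
  filter_upwards [h1, Filter.Eventually.filter_mono inf_le_right h.typical] with t h2 h3
  exact ⟨by linarith, h3 h2.le⟩

lemma mem_openSquare (h : IsCurve p v) {t : ℝ} (ht : |t| ≤ 1) (n : ℕ) :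
    stepMap^[n] (p + t • v) ∈ openSquare := by
  induction n with
  | zero => exact (h.frame t ht).1
  | succ n ih =>
    rw [Function.iterate_succ_apply']
    exact sqTurn_mem.2 (triTurn_mem.2 ih)

lemma continuous_iterate (p v : ℝ × ℝ) (n : ℕ) :
    Continuous fun t : ℝ => stepMap^[n] (p + t • v) :=
  (isSquareMap_stepMap.isPL.1.iterate n).comp (by fun_prop)

lemma signed (h : IsCurve p v) {t₀ : ℝ} (ht₀ : |t₀| < 1 / 2) (n : ℕ) :
    (stepMap^[n] (p + t₀ • v) ∈ triZone → Signed (nhds t₀ ⊓ ae volume) fun t =>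
      triSlope (stepMap^[n] (p + t • v)) (iterDeriv stepMap stepDeriv (p + t • v) n v)) ∧
    (stepMap^[n] (p + t₀ • v) ∈ sqZone → Signed (nhds t₀ ⊓ ae volume) fun t =>
      sqSlope (stepMap^[n] (p + t • v)) (iterDeriv stepMap stepDeriv (p + t • v) n v)) ∧
    (triTurn (stepMap^[n] (p + t₀ • v)) ∈ triZone → Signed (nhds t₀ ⊓ ae volume) fun t =>
      triSlope (triTurn (stepMap^[n] (p + t • v))) (triTurnDeriv (stepMap^[n] (p + t • v))
        (iterDeriv stepMap stepDeriv (p + t • v) n v))) ∧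
    (triTurn (stepMap^[n] (p + t₀ • v)) ∈ sqZone → Signed (nhds t₀ ⊓ ae volume) fun t =>
      sqSlope (triTurn (stepMap^[n] (p + t • v))) (triTurnDeriv (stepMap^[n] (p + t • v))
        (iterDeriv stepMap stepDeriv (p + t • v) n v))) := by
  have ht₀' : |t₀| ≤ 1 := by linarith
  have hev := h.eventually_typical ht₀
  have hc : ∀ n, Tendsto (fun t : ℝ => stepMap^[n] (p + t • v)) (nhds t₀ ⊓ ae volume)
      (nhds (stepMap^[n] (p + t₀ • v))) := fun n =>
    ((continuous_iterate p v n).tendsto t₀).mono_left inf_le_left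
  have hF := fun n => signed_triTurn (w := fun t => iterDeriv stepMap stepDeriv (p + t • v) n v)
    (h.mem_openSquare ht₀' n) (hc n) (by
      filter_upwards [hev] with t ⟨ht, hq⟩
      exact ⟨(hq.1 n).1, triGen_of_stepMargin_pos (hq.1 n).2,
        preCone_iterDeriv hq (h.preCone_add ht) n⟩)
  induction n with
  | zero =>
    have h1 : p + t₀ • v ∈ triZone → Signed (nhds t₀ ⊓ ae volume) fun t =>
        triSlope (p + t • v) v := fun hz => by
      refine signed_of_eventually_eq (x := triSlope p v) ?_ (hev.mono fun t ht => h.triSlope_eq ht.1 v)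
      have := h.pos
      rw [preEnergy, if_pos ((h.frame t₀ ht₀').2.2.1.1 hz), ← abs_triSlope] at this
      exact abs_pos.1 this
    have h2 : p + t₀ • v ∈ sqZone → Signed (nhds t₀ ⊓ ae volume) fun t =>
        sqSlope (p + t • v) v := fun hz =>
      signed_of_eventually_eq (x := sqSlope p v) (h.ne_zero ((h.frame t₀ ht₀').2.2.2.1.1 hz))
        (hev.mono fun t ht => h.sqSlope_eq ht.1 v)
    exact ⟨h1, h2, hF 0 h1 h2⟩
  | succ n ih =>
    have hG := signed_sqTurn (((isSquareMap_triTurn.isPL.1.tendsto _).comp (hc n))) (by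
      filter_upwards [hev] with t ⟨ht, hq⟩
      exact ⟨triTurn_mem.2 (hq.1 n).1, sqGen_of_stepMargin_pos (hq.1 n).2,
        (preCone_iterDeriv hq (h.preCone_add ht) n).postCone_triTurn (hq.1 n).1
          (triGen_of_stepMargin_pos (hq.1 n).2)⟩) ih.2.2.1 ih.2.2.2
    have h1 : stepMap^[n + 1] (p + t₀ • v) ∈ triZone → Signed (nhds t₀ ⊓ ae volume) fun t =>
        triSlope (stepMap^[n + 1] (p + t • v))
          (iterDeriv stepMap stepDeriv (p + t • v) (n + 1) v) := by
      simp only [Function.iterate_succ_apply']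
      exact hG.1
    have h2 : stepMap^[n + 1] (p + t₀ • v) ∈ sqZone → Signed (nhds t₀ ⊓ ae volume) fun t =>
        sqSlope (stepMap^[n + 1] (p + t • v))
          (iterDeriv stepMap stepDeriv (p + t • v) (n + 1) v) := by
      simp only [Function.iterate_succ_apply']
      exact hG.2
    exact ⟨h1, h2, hF (n + 1) h1 h2⟩

end IsCurve

lemma LocallySigned.of_signed {α' : ℝ → ℝ} {P : Set ℝ}
    (h : ∀ t₀ ∈ P, Signed (nhds t₀ ⊓ ae volume) α') : LocallySigned α' P := by
  intro t₀ ht₀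
  obtain ⟨σ, hσ, h1⟩ := h t₀ ht₀
  obtain ⟨U, hU, V, hV, hUV⟩ := Filter.mem_inf_iff_superset.1 h1
  obtain ⟨r, hr, hball⟩ := Metric.mem_nhds_iff.1 hU
  refine ⟨σ, hσ, r, hr, ?_⟩
  filter_upwards [hV] with t ht htr
  exact hUV ⟨hball (by rwa [Metric.mem_ball, Real.dist_eq]), ht⟩

/-- The set on which a sequence of functions that tends to infinity stays large has almost full
measure. -/
lemma eventually_half_le_volume {e : ℕ → ℝ → ℝ} {a b : ℝ} (hab : a < b)
    (he : ∀ᵐ t, t ∈ Set.Icc a b → Tendsto (fun n => e n t) atTop atTop) (M : ℝ) :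
    ∃ N, (b - a) / 2 ≤ volume.real {t | t ∈ Set.Icc a b ∧ ∀ n ≥ N, M ≤ e n t} := by
  set A : ℕ → Set ℝ := fun N => {t | t ∈ Set.Icc a b ∧ ∀ n ≥ N, M ≤ e n t} with hA
  have hmono : Monotone A := fun m n hmn t ht => ⟨ht.1, fun k hk => ht.2 k (hmn.trans hk)⟩
  have hfull : ENNReal.ofReal (b - a) ≤ volume (⋃ N, A N) := by
    rw [← Real.volume_Icc]
    refine measure_mono_ae ?_
    filter_upwards [he] with t ht ht'
    obtain ⟨N, hN⟩ := eventually_atTop.1 ((ht ht').eventually_ge_atTop M)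
    exact Set.mem_iUnion.2 ⟨N, ht', hN⟩
  have hlt : ENNReal.ofReal ((b - a) / 2) < volume (⋃ N, A N) :=
    ((ENNReal.ofReal_lt_ofReal_iff (by linarith)).2 (by linarith)).trans_le hfull
  obtain ⟨N, hN⟩ := ((tendsto_measure_iUnion_atTop hmono).eventually (lt_mem_nhds hlt)).exists
  refine ⟨N, ?_⟩
  rw [measureReal_def]
  refine (ENNReal.ofReal_le_iff_le_toReal ?_).1 hN.le
  exact ((measure_mono fun t ht => ht.1).trans_lt (measure_Icc_lt_top (a := a) (b := b))).ne

lemma eventually_exists_crossing {α β e : ℕ → ℝ → ℝ} {P : ℕ → Set ℝ} {α₀ β₀ δ : ℝ}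
    (hα : ∀ n, ∃ K, LipschitzWith K (α n)) (hβ : ∀ n, ∃ K, LipschitzWith K (β n))
    (hP : ∀ n, IsOpen (P n)) (hbox : ∀ n t, |t| < 1 / 2 → |α n t - α₀| ≤ δ → |β n t - β₀| ≤ δ → t ∈ P n)
    (hloc : ∀ n, LocallySigned (deriv (α n)) (P n))
    (hs : ∀ n, ∀ᵐ t, t ∈ P n → 2 * |deriv (β n) t| ≤ |deriv (α n) t| ∧ e n t ≤ |deriv (α n) t|)
    (he : ∀ᵐ t, |t| < 1 / 2 → Tendsto (fun n => e n t) atTop atTop) (hδ : 0 < δ) :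
    ∃ N, ∀ n ≥ N, 0 ∈ boxTimes (P n) (α n) (β n) α₀ β₀ (δ / 4) →
      ∃ c d σ, -(1 / 4) ≤ c ∧ c ≤ d ∧ d ≤ 1 / 4 ∧ Set.Icc c d ⊆ boxTimes (P n) (α n) (β n) α₀ β₀ δ ∧
      (σ = 1 ∨ σ = -1) ∧ σ * (α n c - α₀) = -δ ∧ σ * (α n d - α₀) = δ ∧
      ∀ s t, c ≤ s → s ≤ t → t ≤ d → 2 * |β n t - β n s| ≤ σ * (α n t - α n s) := by
  have key : ∀ a b : ℝ, -(1 / 4) ≤ a → b ≤ 1 / 4 → b - a = 1 / 4 → ∃ N, ∀ n ≥ N,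
      3 * δ ≤ 24 * δ * volume.real {t | t ∈ Set.Icc a b ∧ (t ∈ P n → 24 * δ ≤ |deriv (α n) t|)} := by
    intro a b ha hb hab
    obtain ⟨N, hN⟩ := eventually_half_le_volume (a := a) (b := b) (by linarith) (by
      filter_upwards [he] with t ht h
      exact ht (abs_lt.2 ⟨by linarith [h.1], by linarith [h.2]⟩)) (24 * δ)
    refine ⟨N, fun n hn => ?_⟩
    have h1 : volume.real {t | t ∈ Set.Icc a b ∧ ∀ n ≥ N, 24 * δ ≤ e n t} ≤
        volume.real {t | t ∈ Set.Icc a b ∧ (t ∈ P n → 24 * δ ≤ |deriv (α n) t|)} := by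
      rw [measureReal_def, measureReal_def]
      refine ENNReal.toReal_mono ?_ (measure_mono_ae ?_)
      · exact ((measure_mono fun t ht => ht.1).trans_lt (measure_Icc_lt_top (a := a) (b := b))).ne
      · filter_upwards [hs n] with t ht h
        exact ⟨h.1, fun htP => (h.2 n hn).trans (ht htP).2⟩
    nlinarith
  obtain ⟨N, hN⟩ := key 0 (1 / 4) (by norm_num) (by norm_num) (by norm_num)
  obtain ⟨N', hN'⟩ := key (-(1 / 4)) 0 (by norm_num) (by norm_num) (by norm_num)
  refine ⟨max N N', fun n hn h0 => ?_⟩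
  obtain ⟨K, hK⟩ := hα n
  obtain ⟨L, hL⟩ := hβ n
  refine exists_crossing hK hL (hP n) (hloc n) ?_ hδ (by norm_num) ?_ h0
    (hN n ((le_max_left _ _).trans hn)) (hN' n ((le_max_right _ _).trans hn))
  · filter_upwards [hs n] with t ht h using (ht h).1
  · have : boxTimes (P n) (α n) (β n) α₀ β₀ δ ∩ Set.Icc (-(1 / 4)) (1 / 4) =
        {t | |α n t - α₀| ≤ δ} ∩ {t | |β n t - β₀| ≤ δ} ∩ Set.Icc (-(1 / 4)) (1 / 4) := by
      ext t
      constructor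
      · rintro ⟨⟨h1, h2, h3⟩, h4⟩
        exact ⟨⟨h2, h3⟩, h4⟩
      · rintro ⟨⟨h2, h3⟩, h4⟩
        exact ⟨⟨hbox n t (abs_lt.2 ⟨by linarith [h4.1], by linarith [h4.2]⟩) h2 h3, h2, h3⟩, h4⟩
    rw [this]
    have h1 := hK.continuous
    have h2 := hL.continuous
    exact ((isClosed_le (by fun_prop) continuous_const).inter
      (isClosed_le (by fun_prop) continuous_const)).inter isClosed_Icc

/-- The distance to the upper and right sides of the square. -/
noncomputable def sideHeight (z : ℝ × ℝ) : ℝ := 1 - max z.1 z.2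

/-- A chart domain for the coordinates `z.1 - z.2` and `sideHeight`. -/
def chartDomain : Set (ℝ × ℝ) :=
  {z | |z.1 - z.2| < 1 / 4 ∧ 1 / 4 < sideHeight z ∧ sideHeight z < 3 / 8}

lemma lipschitzWith_sideHeight : LipschitzWith 1 sideHeight := by
  refine LipschitzWith.of_dist_le_mul fun x y => ?_
  rw [NNReal.coe_one, one_mul, Real.dist_eq, sideHeight, sideHeight, sub_sub_sub_cancel_left,
    Prod.dist_eq, Real.dist_eq, Real.dist_eq, abs_sub_comm x.1, abs_sub_comm x.2]
  exact abs_max_sub_max_le_max _ _ _ _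

lemma isOpen_chartDomain : IsOpen chartDomain := by
  have := lipschitzWith_sideHeight.continuous
  exact (isOpen_lt (f := fun z : ℝ × ℝ => |z.1 - z.2|) (by fun_prop) continuous_const).inter
    ((isOpen_lt continuous_const this).inter (isOpen_lt this continuous_const))

lemma sideHeight_swap (z : ℝ × ℝ) : sideHeight z.swap = sideHeight z := by
  rw [sideHeight, sideHeight, max_comm]; rfl

lemma mem_chartDomain_iff {z : ℝ × ℝ} :
    z ∈ chartDomain ↔ z ∈ triZone ∧ z ∈ sqZone ∧ 1 < z.1 + z.2 := by
  constructor
  · rintro ⟨h1, h2, h3⟩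
    have h4 : sqHeight z = sideHeight z := by
      rw [sideHeight] at *
      rw [abs_lt] at h1
      rw [sqHeight]
      rcases max_cases z.1 z.2 with ⟨h, h'⟩ | ⟨h, h'⟩ <;> rw [h] at h2 h3 ⊢
      · rw [min_eq_right (by linarith : 1 - z.1 ≤ z.1),
          min_eq_left (le_min (by linarith) (by linarith))]
      · rw [min_eq_right (by linarith : 1 - z.2 ≤ z.2),
          min_eq_right (le_min (by linarith) (by linarith))]
    have h5 : (1 / 4 < z.1 ∧ z.1 < 3 / 4) ∧ (1 / 4 < z.2 ∧ z.2 < 3 / 4) ∧ 1 < z.1 + z.2 := by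
      rw [sideHeight] at h2 h3
      rw [abs_lt] at h1
      rcases max_cases z.1 z.2 with ⟨h, h'⟩ | ⟨h, h'⟩ <;> rw [h] at h2 h3 <;>
        and_intros <;> linarith
    obtain ⟨⟨a1, a2⟩, ⟨a3, a4⟩, a5⟩ := h5
    have h6 : z ∈ sqZone := ⟨by linarith, by linarith⟩
    refine ⟨⟨sqZone_subset h6, ?_⟩, h6, a5⟩
    have key : ∀ q : ℝ × ℝ, q.1 - q.2 < 1 / 4 → lowerHeight q < 1 / 4 := by
      intro q hq
      exact max_lt (by norm_num) ((min_le_left _ _).trans_lt hq)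
    rw [abs_lt] at h1 ⊢
    rcases le_total z.2 z.1 with h | h
    · rw [triHeight_of_le h]
      exact ⟨by linarith [lowerHeight_nonneg z], key z h1.2⟩
    · rw [triHeight_of_ge h]
      have := key (halfTurn z) (by simp only [halfTurn]; linarith)
      exact ⟨by linarith, by linarith [lowerHeight_nonneg (halfTurn z)]⟩
  · rintro ⟨h1, h2, h3⟩
    obtain ⟨⟨a1, a2, a3, a4⟩, a5, a6, -⟩ := ring_bounds h1 h2
    have h4 := h2.2
    refine ⟨abs_lt.2 ⟨by linarith, a5⟩, ?_, ?_⟩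
    · rw [sideHeight]
      have := max_lt a2 a4
      linarith
    · rw [sideHeight]
      simp only [sqHeight, min_lt_iff] at h4
      rcases max_cases z.1 z.2 with ⟨h, h'⟩ | ⟨h, h'⟩ <;> rw [h] <;>
        rcases h4 with (h4 | h4) | (h4 | h4) <;> linarith

lemma chart_ext {z z' : ℝ × ℝ} (h : z.1 - z.2 = z'.1 - z'.2) (h' : sideHeight z = sideHeight z') :
    z = z' := by
  rw [sideHeight, sideHeight] at h'
  have : z.1 = z'.1 := by
    rcases max_cases z.1 z.2 with ⟨h1, h2⟩ | ⟨h1, h2⟩ <;>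
      rcases max_cases z'.1 z'.2 with ⟨h3, h4⟩ | ⟨h3, h4⟩ <;> rw [h1, h3] at h' <;> linarith
  exact Prod.ext this (by linarith)

lemma HasDerivAt.fst_and_snd {c : ℝ → ℝ × ℝ} {w : ℝ × ℝ} {t : ℝ} (hc : HasDerivAt c w t) :
    HasDerivAt (fun s => (c s).1) w.1 t ∧ HasDerivAt (fun s => (c s).2) w.2 t :=
  ⟨(ContinuousLinearMap.fst ℝ ℝ ℝ).hasFDerivAt.comp_hasDerivAt t hc,
    (ContinuousLinearMap.snd ℝ ℝ ℝ).hasFDerivAt.comp_hasDerivAt t hc⟩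

lemma hasDerivAt_fst_sub_snd {c : ℝ → ℝ × ℝ} {w : ℝ × ℝ} {t : ℝ} (hc : HasDerivAt c w t)
    (hz : c t ∈ chartDomain) :
    HasDerivAt (fun s => (c s).1 - (c s).2) (triSlope (c t) w) t := by
  obtain ⟨h1, h2, -⟩ := mem_chartDomain_iff.1 hz
  rw [(slope_formulas h1 h2 w).1]
  exact hc.fst_and_snd.1.sub hc.fst_and_snd.2

lemma hasDerivAt_sideHeight {c : ℝ → ℝ × ℝ} {w : ℝ × ℝ} {t : ℝ} (hc : HasDerivAt c w t)
    (hz : c t ∈ chartDomain) (hg : IsGen (c t)) :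
    HasDerivAt (fun s => sideHeight (c s)) (sqSlope (c t) w) t := by
  obtain ⟨-, -, h3⟩ := mem_chartDomain_iff.1 hz
  have hne : (c t).1 ≠ (c t).2 := fun h0 => by
    have h1 := hg.ne (l := (1, -1, 0)) (by decide)
    simp only [lineEval] at h1
    push_cast at h1
    exact h1 (by linarith)
  rw [sqSlope]
  obtain ⟨d1, d2⟩ := hc.fst_and_snd
  have c1 := d1.continuousAt
  have c2 := d2.continuousAt
  rcases hne.lt_or_gt with h | h
  · rw [sqFrame_top h h3]
    refine (d2.const_sub 1).congr_of_eventuallyEq ?_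
    filter_upwards [c1.eventually_lt c2 h] with s hs
    rw [sideHeight, max_eq_right hs.le]
  · rw [sqFrame_right h h3]
    refine (d1.const_sub 1).congr_of_eventuallyEq ?_
    filter_upwards [c2.eventually_lt c1 h] with s hs
    rw [sideHeight, max_eq_left hs.le]

lemma exists_lipschitz_iterate (p v : ℝ × ℝ) (n : ℕ) :
    ∃ K, LipschitzWith K fun t : ℝ => stepMap^[n] (p + t • v) := by
  obtain ⟨K, -, hK⟩ := isSquareMap_stepMap.isPL.exists_lipschitz
  have : LipschitzWith ‖v‖₊ fun t : ℝ => p + t • v := by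
    refine LipschitzWith.of_dist_le_mul fun t s => ?_
    rw [dist_add_left, dist_eq_norm, ← sub_smul, norm_smul, coe_nnnorm, dist_eq_norm, mul_comm]
  exact ⟨_, (hK.iterate n).comp this⟩

lemma LipschitzWith.fst_sub_snd {c : ℝ → ℝ × ℝ} {K : NNReal} (hc : LipschitzWith K c) :
    LipschitzWith (K + K) fun t => (c t).1 - (c t).2 := by
  have h1 : LipschitzWith (1 * K) fun t => (c t).1 := LipschitzWith.prod_fst.comp hc
  have h2 : LipschitzWith (1 * K) fun t => (c t).2 := LipschitzWith.prod_snd.comp hc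
  rw [one_mul] at h1 h2
  exact h1.sub h2

namespace IsCurve

variable {p v q u : ℝ × ℝ} {a₀ b₀ δ : ℝ}

/-- The image of the curve, for large times, crosses boxes horizontally. -/
lemma eventually_crossing (h : IsCurve p v) (hδ : 0 < δ) (ha : |a₀| + δ < 1 / 4)
    (hb : 1 / 4 < b₀ - δ) (hb' : b₀ + δ < 3 / 8) : ∃ N, ∀ n ≥ N,
      0 ∈ boxTimes {t | |t| < 1 / 2 ∧ stepMap^[n] (p + t • v) ∈ chartDomain}
        (fun t => (stepMap^[n] (p + t • v)).1 - (stepMap^[n] (p + t • v)).2)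
        (fun t => sideHeight (stepMap^[n] (p + t • v))) a₀ b₀ (δ / 4) →
      ∃ c d σ, -(1 / 4) ≤ c ∧ c ≤ d ∧ d ≤ 1 / 4 ∧
      Set.Icc c d ⊆ boxTimes {t | |t| < 1 / 2 ∧ stepMap^[n] (p + t • v) ∈ chartDomain}
        (fun t => (stepMap^[n] (p + t • v)).1 - (stepMap^[n] (p + t • v)).2)
        (fun t => sideHeight (stepMap^[n] (p + t • v))) a₀ b₀ δ ∧
      (σ = 1 ∨ σ = -1) ∧
      σ * ((stepMap^[n] (p + c • v)).1 - (stepMap^[n] (p + c • v)).2 - a₀) = -δ ∧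
      σ * ((stepMap^[n] (p + d • v)).1 - (stepMap^[n] (p + d • v)).2 - a₀) = δ := by
  have hder : ∀ n, ∀ᵐ t : ℝ, t ∈ {t : ℝ | |t| < 1 / 2 ∧ stepMap^[n] (p + t • v) ∈ chartDomain} →
      deriv (fun t : ℝ => (stepMap^[n] (p + t • v)).1 - (stepMap^[n] (p + t • v)).2) t =
        triSlope (stepMap^[n] (p + t • v)) (iterDeriv stepMap stepDeriv (p + t • v) n v) ∧
      deriv (fun t : ℝ => sideHeight (stepMap^[n] (p + t • v))) t =
        sqSlope (stepMap^[n] (p + t • v)) (iterDeriv stepMap stepDeriv (p + t • v) n v) ∧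
      p + t • v ∈ typicalSet := by
    intro n
    filter_upwards [h.typical] with t ht ⟨h1, h2⟩
    have hq := ht h1.le
    have hd := hasDerivAt_iterate hq n
    exact ⟨(hasDerivAt_fst_sub_snd hd h2).deriv, (hasDerivAt_sideHeight hd h2
      (triGen_of_stepMargin_pos (hq.1 n).2).1).deriv, hq⟩
  have hP : ∀ n, IsOpen {t : ℝ | |t| < 1 / 2 ∧ stepMap^[n] (p + t • v) ∈ chartDomain} := fun n =>
    (isOpen_lt continuous_abs continuous_const).inter
      (isOpen_chartDomain.preimage (continuous_iterate p v n))
  obtain ⟨N, hN⟩ := eventually_exists_crossing (α₀ := a₀) (β₀ := b₀)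
    (α := fun n t => (stepMap^[n] (p + t • v)).1 - (stepMap^[n] (p + t • v)).2)
    (β := fun n t => sideHeight (stepMap^[n] (p + t • v)))
    (e := fun n t => preEnergy (stepMap^[n] (p + t • v))
      (iterDeriv stepMap stepDeriv (p + t • v) n v))
    (P := fun n => {t : ℝ | |t| < 1 / 2 ∧ stepMap^[n] (p + t • v) ∈ chartDomain})
    (fun n => by
      obtain ⟨K, hK⟩ := exists_lipschitz_iterate p v n
      exact ⟨_, hK.fst_sub_snd⟩)
    (fun n => by
      obtain ⟨K, hK⟩ := exists_lipschitz_iterate p v n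
      exact ⟨_, lipschitzWith_sideHeight.comp hK⟩) hP
    (fun n t ht h1 h2 => by
      rw [abs_le] at h1 h2
      obtain ⟨h3, h4⟩ := abs_le.1 (le_refl |a₀|)
      exact ⟨ht, abs_lt.2 ⟨by linarith, by linarith⟩, by linarith, by linarith⟩)
    (fun n => LocallySigned.of_signed fun t₀ ht₀ =>
      ((h.signed ht₀.1 n).1 (mem_chartDomain_iff.1 ht₀.2).1).congr (by
        filter_upwards [Filter.Eventually.filter_mono inf_le_right (hder n),
          Filter.Eventually.filter_mono inf_le_left ((hP n).mem_nhds ht₀)] with t h1 h2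
        exact (h1 h2).1.symm))
    (fun n => by
      filter_upwards [hder n] with t ht hz
      obtain ⟨h1, h2, hq⟩ := ht hz
      rw [h1, h2]
      obtain ⟨h3, h4, -⟩ := mem_chartDomain_iff.1 hz.2
      have h5 := preCone_iterDeriv hq (h.preCone_add (by linarith [hz.1])) n
      have h6 := (h5.energy_le h4).2 h3
      rw [abs_triSlope, sqSlope]
      rw [preEnergy, if_pos h3] at h6 ⊢
      exact ⟨h6, le_rfl⟩)
    (by
      filter_upwards [h.typical] with t ht h1
      exact tendsto_preEnergy (ht h1.le) (h.preCone_add (by linarith))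
        (h.preEnergy_add (by linarith))) hδ
  refine ⟨N, fun n hn h0 => ?_⟩
  obtain ⟨c, d, σ, h1, h2, h3, h4, h5, h6, h7, -⟩ := hN n hn h0
  exact ⟨c, d, σ, h1, h2, h3, h4, h5, h6, h7⟩

/-- The reflected image of the curve, for large times, crosses boxes vertically. -/
lemma eventually_crossing_swap (h : IsCurve p v) (hδ : 0 < δ) (ha : |a₀| + δ < 1 / 4)
    (hb : 1 / 4 < b₀ - δ) (hb' : b₀ + δ < 3 / 8) : ∃ N, ∀ n ≥ N,
      0 ∈ boxTimes {t | |t| < 1 / 2 ∧ triTurn (stepMap^[n] (p + t • v)) ∈ chartDomain}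
        (fun t => sideHeight (triTurn (stepMap^[n] (p + t • v))))
        (fun t => -((triTurn (stepMap^[n] (p + t • v))).1 - (triTurn (stepMap^[n] (p + t • v))).2))
        b₀ a₀ (δ / 4) →
      ∃ c d σ, -(1 / 4) ≤ c ∧ c ≤ d ∧ d ≤ 1 / 4 ∧
      Set.Icc c d ⊆ boxTimes {t | |t| < 1 / 2 ∧ triTurn (stepMap^[n] (p + t • v)) ∈ chartDomain}
        (fun t => sideHeight (triTurn (stepMap^[n] (p + t • v))))
        (fun t => -((triTurn (stepMap^[n] (p + t • v))).1 - (triTurn (stepMap^[n] (p + t • v))).2))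
        b₀ a₀ δ ∧
      (σ = 1 ∨ σ = -1) ∧
      σ * (sideHeight (triTurn (stepMap^[n] (p + c • v))) - b₀) = -δ ∧
      σ * (sideHeight (triTurn (stepMap^[n] (p + d • v))) - b₀) = δ ∧
      ∀ s t, c ≤ s → s ≤ t → t ≤ d →
        2 * |-((triTurn (stepMap^[n] (p + t • v))).1 - (triTurn (stepMap^[n] (p + t • v))).2) -
          -((triTurn (stepMap^[n] (p + s • v))).1 - (triTurn (stepMap^[n] (p + s • v))).2)| ≤
        σ * (sideHeight (triTurn (stepMap^[n] (p + t • v))) -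
          sideHeight (triTurn (stepMap^[n] (p + s • v)))) := by
  have hder : ∀ n, ∀ᵐ t : ℝ,
      t ∈ {t : ℝ | |t| < 1 / 2 ∧ triTurn (stepMap^[n] (p + t • v)) ∈ chartDomain} →
      deriv (fun t : ℝ => -((triTurn (stepMap^[n] (p + t • v))).1 -
        (triTurn (stepMap^[n] (p + t • v))).2)) t = -triSlope (triTurn (stepMap^[n] (p + t • v)))
          (triTurnDeriv (stepMap^[n] (p + t • v)) (iterDeriv stepMap stepDeriv (p + t • v) n v)) ∧
      deriv (fun t : ℝ => sideHeight (triTurn (stepMap^[n] (p + t • v)))) t =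
        sqSlope (triTurn (stepMap^[n] (p + t • v)))
          (triTurnDeriv (stepMap^[n] (p + t • v)) (iterDeriv stepMap stepDeriv (p + t • v) n v)) ∧
      p + t • v ∈ typicalSet := by
    intro n
    filter_upwards [h.typical] with t ht ⟨h1, h2⟩
    have hq := ht h1.le
    have hd := hasDerivAt_triTurn (c := fun t : ℝ => stepMap^[n] (p + t • v)) (hq.1 n).2
      (hasDerivAt_iterate hq n)
    exact ⟨(hasDerivAt_fst_sub_snd hd h2).neg.deriv, (hasDerivAt_sideHeight hd h2
      (sqGen_of_stepMargin_pos (hq.1 n).2).1).deriv, hq⟩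
  have hP : ∀ n, IsOpen {t : ℝ | |t| < 1 / 2 ∧
      triTurn (stepMap^[n] (p + t • v)) ∈ chartDomain} := fun n =>
    (isOpen_lt continuous_abs continuous_const).inter
      (isOpen_chartDomain.preimage (isSquareMap_triTurn.isPL.1.comp (continuous_iterate p v n)))
  have hlip : ∀ n, ∃ K, LipschitzWith K fun t : ℝ => triTurn (stepMap^[n] (p + t • v)) := by
    intro n
    obtain ⟨K, hK⟩ := exists_lipschitz_iterate p v n
    obtain ⟨L, -, hL⟩ := isSquareMap_triTurn.isPL.exists_lipschitz
    exact ⟨_, hL.comp hK⟩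
  exact eventually_exists_crossing (α₀ := b₀) (β₀ := a₀)
    (α := fun n t => sideHeight (triTurn (stepMap^[n] (p + t • v))))
    (β := fun n t => -((triTurn (stepMap^[n] (p + t • v))).1 -
      (triTurn (stepMap^[n] (p + t • v))).2))
    (e := fun n t => preEnergy (stepMap^[n] (p + t • v))
      (iterDeriv stepMap stepDeriv (p + t • v) n v))
    (P := fun n => {t : ℝ | |t| < 1 / 2 ∧ triTurn (stepMap^[n] (p + t • v)) ∈ chartDomain})
    (fun n => by
      obtain ⟨K, hK⟩ := hlip n
      exact ⟨_, lipschitzWith_sideHeight.comp hK⟩)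
    (fun n => by
      obtain ⟨K, hK⟩ := hlip n
      exact ⟨_, hK.fst_sub_snd.neg⟩) hP
    (fun n t ht h1 h2 => by
      rw [abs_le] at h1 h2
      obtain ⟨h3, h4⟩ := abs_le.1 (le_refl |a₀|)
      exact ⟨ht, abs_lt.2 ⟨by linarith, by linarith⟩, by linarith, by linarith⟩)
    (fun n => LocallySigned.of_signed fun t₀ ht₀ =>
      ((h.signed ht₀.1 n).2.2.2 (mem_chartDomain_iff.1 ht₀.2).2.1).congr (by
        filter_upwards [Filter.Eventually.filter_mono inf_le_right (hder n),
          Filter.Eventually.filter_mono inf_le_left ((hP n).mem_nhds ht₀)] with t h1 h2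
        exact (h1 h2).2.1.symm))
    (fun n => by
      filter_upwards [hder n] with t ht hz
      obtain ⟨h1, h2, hq⟩ := ht hz
      rw [h1, h2]
      obtain ⟨h3, h4, -⟩ := mem_chartDomain_iff.1 hz.2
      have h5 := preCone_iterDeriv hq (h.preCone_add (by linarith [hz.1])) n
      have h6 := triGen_of_stepMargin_pos (hq.1 n).2
      have h7 := ((h5.postCone_triTurn (hq.1 n).1 h6).energy_le h3).2 h4
      have h8 := (h5.triTurn_energy (hq.1 n).1 h6).1
      rw [abs_neg, abs_triSlope, sqSlope]
      rw [postEnergy, if_pos h4] at h7 h8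
      exact ⟨h7, h8⟩)
    (by
      filter_upwards [h.typical] with t ht h1
      exact tendsto_preEnergy (ht h1.le) (h.preCone_add (by linarith))
        (h.preEnergy_add (by linarith))) hδ

/-- Long images of two curves, one of them reflected, meet if they come close to the center of the
same box. -/
lemma exists_eq_swap (h : IsCurve p v) (h' : IsCurve q u) (hδ : 0 < δ) (ha : |a₀| + δ < 1 / 4)
    (hb : 1 / 4 < b₀ - δ) (hb' : b₀ + δ < 3 / 8) : ∃ N, ∀ n ≥ N, ∀ m ≥ N,
      |(stepMap^[n] p).1 - (stepMap^[n] p).2 - a₀| ≤ δ / 4 →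
      |sideHeight (stepMap^[n] p) - b₀| ≤ δ / 4 →
      |(triTurn (stepMap^[m] q)).swap.1 - (triTurn (stepMap^[m] q)).swap.2 - a₀| ≤ δ / 4 →
      |sideHeight (triTurn (stepMap^[m] q)).swap - b₀| ≤ δ / 4 →
      ∃ t s : ℝ, |t| ≤ 1 / 2 ∧ |s| ≤ 1 / 2 ∧
        stepMap^[n] (p + t • v) = (triTurn (stepMap^[m] (q + s • u))).swap := by
  obtain ⟨N, hN⟩ := h.eventually_crossing hδ ha hb hb'
  obtain ⟨N', hN'⟩ := h'.eventually_crossing_swap hδ ha hb hb'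
  have hmem : ∀ z : ℝ × ℝ, |z.1 - z.2 - a₀| ≤ δ / 4 → |sideHeight z - b₀| ≤ δ / 4 →
      z ∈ chartDomain := by
    intro z h1 h2
    rw [abs_le] at h1 h2
    obtain ⟨h3, h4⟩ := abs_le.1 (le_refl |a₀|)
    exact ⟨abs_lt.2 ⟨by linarith, by linarith⟩, by linarith, by linarith⟩
  refine ⟨max N N', fun n hn m hm h1 h2 h3 h4 => ?_⟩
  rw [sideHeight_swap] at h4
  obtain ⟨c, d, σ, k1, k2, k3, k4, k5, k6, k7⟩ := hN n ((le_max_left _ _).trans hn) (by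
    simp only [boxTimes, Set.mem_ofPred_eq, zero_smul, add_zero, abs_zero]
    exact ⟨⟨by norm_num, hmem _ h1 h2⟩, h1, h2⟩)
  obtain ⟨c', d', σ', l1, l2, l3, l4, l5, l6, l7, l8⟩ := hN' m ((le_max_right _ _).trans hm) (by
    simp only [boxTimes, Set.mem_ofPred_eq, zero_smul, add_zero, abs_zero, neg_sub]
    refine ⟨⟨by norm_num, ?_⟩, h4, h3⟩
    obtain ⟨g1, g2⟩ := hmem _ h3 ((sideHeight_swap _).symm ▸ h4)
    rw [sideHeight_swap] at g2
    exact ⟨by rw [abs_sub_comm]; exact g1, g2⟩)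
  have hc1 := continuous_iterate p v n
  have hc2 : Continuous fun s : ℝ => triTurn (stepMap^[m] (q + s • u)) :=
    isSquareMap_triTurn.isPL.1.comp (continuous_iterate q u m)
  have hc3 := lipschitzWith_sideHeight.continuous
  obtain ⟨t, ht, s, hs, e1, e2⟩ := exists_meet (by fun_prop) (hc3.comp hc1) (hc3.comp hc2) k2 l2 k4 l4 k5 l5
    k6 k7 l6 l7 l8
  refine ⟨t, s, abs_le.2 ⟨by linarith [ht.1], by linarith [ht.2]⟩,
    abs_le.2 ⟨by linarith [hs.1], by linarith [hs.2]⟩, chart_ext ?_ ?_⟩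
  · simp only [neg_sub] at e1
    exact e1
  · rw [sideHeight_swap]
    exact e2

end IsCurve

/-- An involution which conjugates `stepMap` to its inverse. -/
noncomputable def reversor (p : ℝ × ℝ) : ℝ × ℝ := (triTurn p).swap

lemma reversor_reversor (p) : reversor (reversor p) = p := by
  rw [reversor, reversor, triTurn_swap_triTurn, Prod.swap_swap]

lemma isSquareMap_reversor : IsSquareMap reversor := isSquareMap_swap.comp isSquareMap_triTurn

lemma reversor_stepInv (p) : reversor (stepInv p) = stepMap (reversor p) := by
  have h : ∀ q, reversor (stepMap q) = stepInv (reversor q) := fun q => by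
    rw [reversor, reversor, stepMap, stepInv, Prod.swap_swap]
  rw [← stepMap_stepInv (reversor (stepInv p)), ← h, stepMap_stepInv]

lemma reversor_iterate (m : ℕ) (p) : stepMap^[m] (reversor (stepMap^[m] p)) = reversor p := by
  induction m generalizing p with
  | zero => rfl
  | succ m ih =>
    rw [Function.iterate_succ_apply, Function.iterate_succ_apply', ← reversor_stepInv,
      stepInv_stepMap, ih]

lemma preimage_stepInv {E : Set (ℝ × ℝ)} (h : stepMap ⁻¹' E = E) : stepInv ⁻¹' E = E := by
  conv_lhs => rw [← h, ← Set.preimage_comp, stepMap_stepInv.comp_eq_id, Set.preimage_id]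

lemma mem_iterate_iff {E : Set (ℝ × ℝ)} (h : stepMap ⁻¹' E = E) (n : ℕ) (p) :
    stepMap^[n] p ∈ E ↔ p ∈ E := by
  induction n generalizing p with
  | zero => rfl
  | succ n ih => rw [Function.iterate_succ_apply, ih, ← Set.mem_preimage, h]

instance : IsFiniteMeasure ((volume : Measure (ℝ × ℝ)).restrict openSquare) :=
  ⟨by rw [Measure.restrict_apply_univ, volume_openSquare]; exact ENNReal.one_lt_top⟩

/-- Curves through typical points do not see the difference between an invariant set and its
reflection once they meet. -/
lemma ae_ae_mem_iff {E : Set (ℝ × ℝ)} (hE : MeasurableSet E) (hinv : stepMap ⁻¹' E = E) :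
    ∀ᵐ p ∂(volume.restrict openSquare), ∀ᵐ q ∂(volume.restrict openSquare), ∃ v u,
      IsCurve p v ∧ IsCurve q u ∧ ∀ n m : ℕ, ∀ t s : ℝ, |t| ≤ 1 / 2 → |s| ≤ 1 / 2 →
        stepMap^[n] (p + t • v) = reversor (stepMap^[m] (q + s • u)) →
        (p ∈ E ↔ reversor q ∈ E) := by
  have hT := isSquareMap_stepInv.measurePreserving_restrict
  have hR := isSquareMap_reversor.measurePreserving_restrict
  have hinv' : stepInv ⁻¹' (reversor ⁻¹' E) = reversor ⁻¹' E := by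
    ext p
    rw [Set.mem_preimage, Set.mem_preimage, reversor_stepInv, ← Set.mem_preimage, hinv,
      Set.mem_preimage]
  obtain ⟨H, hH, hHE⟩ := exists_hopf_set hT hE (preimage_stepInv hinv)
  obtain ⟨H', hH', hHE'⟩ := exists_hopf_set hT
    (hE.preimage isSquareMap_reversor.isPL.1.measurable) hinv'
  have hP : ∀ᵐ p ∂(volume.restrict openSquare),
      p ∈ H ∧ ∀ k, reversor (stepMap^[k] p) ∈ H' := by
    filter_upwards [hH, ae_forall_iterate isSquareMap_stepMap.measurePreserving_restrict
      (hR.quasiMeasurePreserving.ae hH')] with p h1 h2 using ⟨h1, h2⟩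
  filter_upwards [hH, ae_exists_isCurve, ae_restrict_of_ae (IsLeaf.ae_mem (T := stepInv) hP)]
    with p hp ⟨v, hv⟩ hpv
  have hbad := hpv v hv.leaf fun t ht => (hv.frame t ht).1
  set D : Set ℝ := {t | ¬ (|t| ≤ 1 / 2 →
    (p + t • v) ∈ H ∧ ∀ k, reversor (stepMap^[k] (p + t • v)) ∈ H')}
  have hD : μH[1] D = 0 := by rw [hausdorffMeasure_real]; exact ae_iff.1 hbad
  have hZ : μH[1] (⋃ k : ℕ, (fun t : ℝ => reversor (stepMap^[k] (p + t • v))) '' D) = 0 := by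
    rw [measure_iUnion_null_iff]
    intro k
    obtain ⟨K, hK⟩ := exists_lipschitz_iterate p v k
    obtain ⟨L, -, hL⟩ := isSquareMap_reversor.isPL.exists_lipschitz
    have := ((hL.comp hK).lipschitzOnWith (s := D)).hausdorffMeasure_image_le zero_le_one
    rw [hD, mul_zero] at this
    exact le_antisymm this bot_le
  filter_upwards [hH', ae_exists_isCurve,
    ae_restrict_of_ae ((isSegmentFamily_isLeaf stepInv).ae_not_hit hZ)] with q hq ⟨u, hu⟩ hqu
  refine ⟨v, u, hv, hu, fun n m t s ht hs h => ?_⟩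
  have e : q + s • u = reversor (stepMap^[m + n] (p + t • v)) := by
    rw [Function.iterate_add_apply, h, reversor_iterate, reversor_reversor]
  have htD : t ∉ D := fun h' => hqu u hu.leaf s hs (Set.mem_iUnion.2 ⟨m + n, t, h', e.symm⟩)
  simp only [D, Set.mem_ofPred_eq, not_not] at htD
  obtain ⟨g1, g2⟩ := htD ht
  obtain ⟨C, hC⟩ := hv.leaf.exists_dist_le
  obtain ⟨C', hC'⟩ := hu.leaf.exists_dist_le
  have e1 : p ∈ E ↔ p + t • v ∈ E := hHE p hp _ g1
    ⟨C, fun k => by simpa using hC 0 t (by norm_num) (by linarith) k⟩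
  have e2 : q ∈ reversor ⁻¹' E ↔ q + s • u ∈ reversor ⁻¹' E := hHE' q hq _ (e ▸ g2 _)
    ⟨C', fun k => by simpa using hC' 0 s (by norm_num) (by linarith) k⟩
  rw [e1, ← mem_iterate_iff hinv n, h, ← mem_iterate_iff hinv m, reversor_iterate]
  exact e2.symm

/-- The box of half side `δ` around the point of `chartDomain` with coordinates `a`, `b`. -/
def chartBox (a b δ : ℝ) : Set (ℝ × ℝ) := {z | |z.1 - z.2 - a| ≤ δ ∧ |sideHeight z - b| ≤ δ}

lemma measurableSet_chartBox (a b δ : ℝ) : MeasurableSet (chartBox a b δ) := by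
  have := lipschitzWith_sideHeight.continuous
  exact ((isClosed_le (f := fun z : ℝ × ℝ => |z.1 - z.2 - a|) (by fun_prop) continuous_const).inter
    (isClosed_le (f := fun z : ℝ × ℝ => |sideHeight z - b|) (by fun_prop)
      continuous_const)).measurableSet

/-- An invariant set is trivial in small boxes. -/
lemma restrict_chartBox_trivial {E : Set (ℝ × ℝ)} (hE : MeasurableSet E)
    (hinv : stepMap ⁻¹' E = E) {a b δ : ℝ} (hδ : 0 < δ) (ha : |a| + δ < 1 / 4)
    (hb : 1 / 4 < b - δ) (hb' : b + δ < 3 / 8) :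
    volume.restrict openSquare (chartBox a b (δ / 4) ∩ E) = 0 ∨
      volume.restrict openSquare (chartBox a b (δ / 4) \ E) = 0 := by
  by_contra! hcon
  obtain ⟨h1, h2⟩ := hcon
  have hS := isSquareMap_stepMap.measurePreserving_restrict.conservative
  have hR := isSquareMap_reversor.measurePreserving_restrict
  have hU := measurableSet_chartBox a b (δ / 4)
  rw [← hR.measure_preimage (hU.diff hE).nullMeasurableSet] at h2
  rw [← frequently_ae_mem_iff] at h1 h2
  obtain ⟨p, hp, hpq, hpr⟩ := (h1.and_eventually ((ae_ae_mem_iff hE hinv).and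
    (hS.ae_mem_imp_frequently_image_mem (hU.inter hE).nullMeasurableSet))).exists
  obtain ⟨q, hq, ⟨v, u, hv, hu, hvu⟩, hqr⟩ := (h2.and_eventually (hpq.and
    (hS.ae_mem_imp_frequently_image_mem (hR.measurable (hU.diff hE)).nullMeasurableSet))).exists
  obtain ⟨N, hN⟩ := hv.exists_eq_swap hu hδ ha hb hb'
  obtain ⟨n, hn, hnp⟩ := (frequently_atTop.1 (hpr hp)) N
  obtain ⟨m, hm, hmq⟩ := (frequently_atTop.1 (hqr hq)) N
  obtain ⟨t, s, ht, hs, h⟩ := hN n hn m hm hnp.1.1 hnp.1.2 hmq.1.1 hmq.1.2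
  exact hq.2 ((hvu n m t s ht hs h).1 hp.2)

lemma exists_mem_innerTable_halfTurn : ∀ a ∈ innerTable, ∀ p ∈ cell a.1, ∃ b ∈ innerTable,
    halfTurn p ∈ cell b.1 ∧ b.2.act (halfTurn p) = halfTurn (a.2.act p) := by
  simp only [innerTable, List.forall_mem_cons, List.not_mem_nil, IsEmpty.forall_iff, implies_true,
    and_true, mem_cell_cons, mem_cell_nil, lineEval, IntAffine.act, List.exists_mem_cons_iff,
    false_and, exists_false, or_false, halfTurn, Prod.mk.injEq]
  push_cast
  refine ⟨?_, ?_, ?_, ?_, ?_, ?_, ?_, ?_, ?_, ?_, ?_, ?_, ?_⟩ <;> rintro p h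
  · left; and_intros <;> linarith
  · iterate 7 right
    left; and_intros <;> linarith
  · iterate 8 right
    left; and_intros <;> linarith
  · iterate 9 right
    left; and_intros <;> linarith
  · iterate 10 right
    left; and_intros <;> linarith
  · iterate 11 right
    left; and_intros <;> linarith
  · iterate 12 right
    and_intros <;> linarith
  · iterate 1 right
    left; and_intros <;> linarith
  · iterate 2 right
    left; and_intros <;> linarith
  · iterate 3 right
    left; and_intros <;> linarith
  · iterate 4 right
    left; and_intros <;> linarith
  · iterate 5 right
    left; and_intros <;> linarith
  · iterate 6 right
    left; and_intros <;> linarith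

lemma squareStep_halfTurn (p : ℝ × ℝ) : squareStep (halfTurn p) = halfTurn (squareStep p) := by
  rcases square_cases p with h | ⟨a, ha, h⟩
  · rw [squareStep_of_frame h, squareStep_of_frame]
    simp only [halfTurn]
    rcases h with h | h | h | h
    · right; right; left; linarith
    · right; right; right; linarith
    · left; linarith
    · right; left; linarith
  · obtain ⟨b, hb, h1, h2⟩ := exists_mem_innerTable_halfTurn a ha p h
    rw [squareStep_eq ha h, squareStep_eq hb h1, h2]

lemma stepMap_halfTurn (p : ℝ × ℝ) : stepMap (halfTurn p) = halfTurn (stepMap p) := by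
  simp only [stepMap, triTurn_halfTurn, sqTurn, squareStep_halfTurn]

lemma stepMap_two_thirds : stepMap (2 / 3, 2 / 3) = halfTurn (2 / 3, 2 / 3) := by
  have h1 : triangleStep (2 / 3, 2 / 3) = (2 / 3, 2 / 3) := by
    rw [triangleStep_eq (a := ([(1, -1, 0), (-1, 2, 0), (-2, 1, 1), (-4, 4, 1), (-2, 3, 0)],
      ⟨0, 1, -1, 2, 0, 0⟩)) (by simp [triTable])]
    · simp only [IntAffine.act]; norm_num
    · simp only [mem_cell_cons, mem_cell_nil, lineEval, and_true]; push_cast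
      and_intros <;> norm_num
  have h2 : squareStep (2 / 3, 2 / 3) = (2 / 3, 1 / 3) := by
    rw [squareStep_eq (a := ([(-4, 0, 3), (8, 0, -5), (1, 1, -1), (1, -1, 0), (5, 1, -4)],
      ⟨1, 0, 4, 1, 0, -3⟩)) (by simp [innerTable])]
    · simp only [IntAffine.act]; norm_num
    · simp only [mem_cell_cons, mem_cell_nil, lineEval, and_true]; push_cast
      and_intros <;> norm_num
  have h3 : squareStep (2 / 3, 1 / 3) = (1 / 3, 1 / 3) := by
    rw [squareStep_eq (a := ([(0, 4, -1), (0, -8, 3), (1, -1, 0), (-1, -1, 1), (1, -5, 1)],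
      ⟨1, -4, 0, 1, 1, 0⟩)) (by simp [innerTable])]
    · simp only [IntAffine.act]; norm_num
    · simp only [mem_cell_cons, mem_cell_nil, lineEval, and_true]; push_cast
      and_intros <;> norm_num
  rw [stepMap, triTurn, h1, h1, h1, sqTurn, h2, h3, halfTurn]
  norm_num

open scoped Topology

lemma isPreconnected_chartDomain : IsPreconnected chartDomain := by
  have h : IsPreconnected (Set.Ioo (-(1 / 4) : ℝ) (1 / 4) ×ˢ Set.Ioo (1 / 4 : ℝ) (3 / 8)) :=
    isPreconnected_Ioo.prod isPreconnected_Ioo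
  have hc : Continuous fun c : ℝ × ℝ => ((1 - c.2 - max (-c.1) 0, 1 - c.2 - max c.1 0) : ℝ × ℝ) := by
    fun_prop
  convert h.image _ hc.continuousOn
  ext z
  simp only [chartDomain, sideHeight, Set.mem_ofPred_eq, Set.mem_image, Set.mem_prod, Set.mem_Ioo,
    Prod.exists, abs_lt]
  constructor
  · rintro ⟨h1, h2⟩
    refine ⟨z.1 - z.2, 1 - max z.1 z.2, ⟨h1, h2⟩, Prod.ext ?_ ?_⟩
    all_goals
      rcases le_total z.1 z.2 with h | h
      · simp only [max_eq_right h, max_eq_left (show 0 ≤ -(z.1 - z.2) by linarith),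
          max_eq_right (show z.1 - z.2 ≤ 0 by linarith)]
        ring
      · simp only [max_eq_left h, max_eq_right (show -(z.1 - z.2) ≤ 0 by linarith),
          max_eq_left (show 0 ≤ z.1 - z.2 by linarith)]
        ring
  · rintro ⟨a, b, ⟨⟨h1, h2⟩, h3, h4⟩, rfl⟩
    rcases le_total a 0 with h | h
    · simp only [max_eq_right h, max_eq_left (show 0 ≤ -a by linarith)]
      rw [max_eq_right (by linarith)]
      and_intros <;> linarith
    · simp only [max_eq_left h, max_eq_right (show -a ≤ 0 by linarith)]
      rw [max_eq_left (by linarith)]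
      and_intros <;> linarith

/-- A set which is locally null or conull in a connected open set is null or conull there. -/
lemma IsPreconnected.measure_trivial {X : Type*} [TopologicalSpace X] [SecondCountableTopology X]
    [MeasurableSpace X] {μ : Measure X} [μ.IsOpenPosMeasure] {U E : Set X} (hU : IsPreconnected U)
    (h : ∀ z ∈ U, ∃ W ∈ 𝓝 z, μ (W ∩ E) = 0 ∨ μ (W \ E) = 0) : μ (U ∩ E) = 0 ∨ μ (U \ E) = 0 := by
  have hop : ∀ F : Set X, IsOpen {z | ∃ W ∈ 𝓝 z, μ (W ∩ F) = 0} := by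
    intro F
    rw [isOpen_iff_mem_nhds]
    rintro z ⟨W, hW, h0⟩
    filter_upwards [eventually_mem_nhds_iff.2 hW] with y hy using ⟨W, hy, h0⟩
  have hnull : ∀ F : Set X, U ⊆ {z | ∃ W ∈ 𝓝 z, μ (W ∩ F) = 0} → μ (U ∩ F) = 0 := by
    intro F hF
    refine measure_null_of_locally_null _ fun z hz => ?_
    obtain ⟨W, hW, h0⟩ := hF hz.1
    exact ⟨W ∩ F, Filter.inter_mem (mem_nhdsWithin_of_mem_nhds hW)
      (mem_of_superset self_mem_nhdsWithin Set.inter_subset_right), h0⟩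
  have hdisj : Disjoint {z | ∃ W ∈ 𝓝 z, μ (W ∩ E) = 0} {z | ∃ W ∈ 𝓝 z, μ (W ∩ Eᶜ) = 0} := by
    rw [Set.disjoint_left]
    rintro z ⟨W, hW, h0⟩ ⟨W', hW', h0'⟩
    refine (Measure.measure_pos_of_mem_nhds μ (Filter.inter_mem hW hW')).ne' (measure_mono_null ?_
      (measure_union_null h0 h0'))
    rintro y ⟨h1, h2⟩
    by_cases hy : y ∈ E
    · exact Or.inl ⟨h1, hy⟩
    · exact Or.inr ⟨h2, hy⟩
  refine (hU.subset_or_subset (hop E) (hop Eᶜ) hdisj fun z hz => ?_).imp (hnull E) (hnull Eᶜ)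
  obtain ⟨W, hW, h0 | h0⟩ := h z hz
  · exact Or.inl ⟨W, hW, h0⟩
  · exact Or.inr ⟨W, hW, h0⟩

lemma chartDomain_subset : chartDomain ⊆ openSquare := fun _ hz =>
  sqZone_subset (mem_chartDomain_iff.1 hz).2.1

lemma chartDomain_trivial {E : Set (ℝ × ℝ)} (hE : MeasurableSet E) (hinv : stepMap ⁻¹' E = E) :
    volume (chartDomain ∩ E) = 0 ∨ volume (chartDomain \ E) = 0 := by
  refine isPreconnected_chartDomain.measure_trivial fun z hz => ?_
  obtain ⟨h1, h2, h3⟩ := hz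
  obtain ⟨δ, hδ, k1, k2, k3⟩ : ∃ δ > 0, |z.1 - z.2| + δ < 1 / 4 ∧ 1 / 4 < sideHeight z - δ ∧
      sideHeight z + δ < 3 / 8 := by
    refine ⟨min (1 / 4 - |z.1 - z.2|) (min (sideHeight z - 1 / 4) (3 / 8 - sideHeight z)) / 2,
      half_pos (lt_min (by linarith) (lt_min (by linarith) (by linarith))), ?_⟩
    have m1 := min_le_left (1 / 4 - |z.1 - z.2|) (min (sideHeight z - 1 / 4) (3 / 8 - sideHeight z))
    have m2 := (min_le_right (1 / 4 - |z.1 - z.2|) _).trans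
      (min_le_left (sideHeight z - 1 / 4) (3 / 8 - sideHeight z))
    have m3 := (min_le_right (1 / 4 - |z.1 - z.2|) _).trans
      (min_le_right (sideHeight z - 1 / 4) (3 / 8 - sideHeight z))
    and_intros <;> linarith
  have hc := lipschitzWith_sideHeight.continuous
  have hW : chartBox (z.1 - z.2) (sideHeight z) (δ / 4) ∈ 𝓝 z := by
    have e1 : ∀ᶠ y in 𝓝 z, |y.1 - y.2 - (z.1 - z.2)| < δ / 4 :=
      (show Continuous fun y : ℝ × ℝ => |y.1 - y.2 - (z.1 - z.2)| by fun_prop).continuousAt.eventually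
        (gt_mem_nhds (by simpa using hδ))
    have e2 : ∀ᶠ y in 𝓝 z, |sideHeight y - sideHeight z| < δ / 4 :=
      (show Continuous fun y => |sideHeight y - sideHeight z| by fun_prop).continuousAt.eventually
        (gt_mem_nhds (by simpa using hδ))
    filter_upwards [e1, e2] with y hy hy' using ⟨hy.le, hy'.le⟩
  have hsub : chartBox (z.1 - z.2) (sideHeight z) (δ / 4) ⊆ openSquare := by
    rintro y ⟨h4, h5⟩
    refine chartDomain_subset ?_
    rw [abs_le] at h4 h5
    obtain ⟨h6, h7⟩ := abs_le.1 (le_refl |z.1 - z.2|)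
    exact ⟨abs_lt.2 ⟨by linarith, by linarith⟩, by linarith, by linarith⟩
  refine ⟨_, hW, ?_⟩
  have := restrict_chartBox_trivial hE hinv hδ k1 k2 k3
  rwa [Measure.restrict_eq_self _ (Set.inter_subset_left.trans hsub),
    Measure.restrict_eq_self _ (Set.sdiff_subset.trans hsub)] at this

lemma measurePreserving_halfTurn : MeasurePreserving halfTurn volume volume := by
  exact Measure.measurePreserving_sub_left (volume : Measure (ℝ × ℝ)) (1, 1)

lemma halfTurn_mem_triZone {p} : halfTurn p ∈ triZone ↔ p ∈ triZone := by
  simp only [triZone, Set.mem_ofPred_eq, halfTurn_mem_openSquare, triHeight_halfTurn, abs_neg]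

/-- An invariant set which is null in `chartDomain` is null. -/
lemma openSquare_null {E : Set (ℝ × ℝ)} (hE : MeasurableSet E) (hinv : stepMap ⁻¹' E = E)
    (h0 : volume (chartDomain ∩ E) = 0) : volume (openSquare ∩ E) = 0 := by
  have hinv' : stepMap ⁻¹' (halfTurn ⁻¹' E) = halfTurn ⁻¹' E := by
    ext p
    rw [Set.mem_preimage, Set.mem_preimage, ← stepMap_halfTurn, ← Set.mem_preimage, hinv,
      Set.mem_preimage]
  have hS := isSquareMap_stepMap.measurePreserving
  have h1 : volume (chartDomain ∩ halfTurn ⁻¹' E) = 0 := by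
    refine (chartDomain_trivial (hE.preimage continuous_halfTurn.measurable) hinv').resolve_right
      fun h => ?_
    have hV : IsOpen (chartDomain ∩ stepMap ⁻¹' (halfTurn ⁻¹' chartDomain)) :=
      isOpen_chartDomain.inter ((isOpen_chartDomain.preimage continuous_halfTurn).preimage
        isSquareMap_stepMap.isPL.1)
    have h2 : ((2 / 3, 2 / 3) : ℝ × ℝ) ∈ chartDomain := by
      simp only [chartDomain, sideHeight, Set.mem_ofPred_eq, max_self]
      norm_num
    refine (hV.measure_pos volume ⟨(2 / 3, 2 / 3), h2, ?_⟩).ne' (measure_mono_null ?_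
      (measure_union_null h0 ((hS.quasiMeasurePreserving.preimage_null
        (measurePreserving_halfTurn.quasiMeasurePreserving.preimage_null h)))))
    · rwa [Set.mem_preimage, Set.mem_preimage, stepMap_two_thirds, halfTurn_halfTurn]
    · rintro z ⟨h3, h4⟩
      by_cases hz : z ∈ E
      · exact Or.inl ⟨h3, hz⟩
      · refine Or.inr ⟨h4, fun h5 => hz ?_⟩
        rw [Set.mem_preimage, halfTurn_halfTurn, ← Set.mem_preimage, hinv] at h5
        exact h5
  have h2 : volume {p : ℝ × ℝ | (1 : ℝ) * p.1 + 1 * p.2 = 1} = 0 :=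
    volume_line_eq_zero (Or.inl one_ne_zero)
  have h3 := measurePreserving_halfTurn.quasiMeasurePreserving.preimage_null h1
  have h4 : ∀ᵐ p ∂(volume.restrict openSquare), p ∉ E := by
    filter_upwards [ae_exists_mem_zones,
      ae_forall_iterate isSquareMap_stepMap.measurePreserving_restrict
        (ae_restrict_of_ae (measure_eq_zero_iff_ae_notMem.1 h0)),
      ae_forall_iterate isSquareMap_stepMap.measurePreserving_restrict
        (ae_restrict_of_ae (measure_eq_zero_iff_ae_notMem.1 h2)),
      ae_forall_iterate isSquareMap_stepMap.measurePreserving_restrict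
        (ae_restrict_of_ae (measure_eq_zero_iff_ae_notMem.1 h3))] with p ⟨n, hn⟩ k1 k2 k3 hp
    rw [← mem_iterate_iff hinv n] at hp
    rcases lt_trichotomy 1 ((stepMap^[n] p).1 + (stepMap^[n] p).2) with h | h | h
    · exact k1 n ⟨mem_chartDomain_iff.2 ⟨hn.1, hn.2, h⟩, hp⟩
    · exact k2 n (by simp [← h])
    · refine k3 n ⟨mem_chartDomain_iff.2 ⟨halfTurn_mem_triZone.2 hn.1,
        halfTurn_mem_sqZone.2 hn.2, ?_⟩, by simpa using hp⟩
      simp only [halfTurn]; linarith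
  rw [ae_restrict_iff' measurableSet_openSquare] at h4
  refine measure_mono_null ?_ (ae_iff.1 h4)
  rintro z ⟨h5, h6⟩ h7
  exact h7 h5 h6

/-- The map `stepMap` is ergodic on the square. -/
lemma openSquare_trivial {E : Set (ℝ × ℝ)} (hE : MeasurableSet E) (hinv : stepMap ⁻¹' E = E) :
    volume (openSquare ∩ E) = 0 ∨ volume (openSquare \ E) = 0 :=
  (chartDomain_trivial hE hinv).imp (openSquare_null hE hinv) fun h =>
    openSquare_null hE.compl (show stepMap ⁻¹' Eᶜ = Eᶜ by rw [Set.preimage_compl, hinv]) h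

lemma stepMap_of_notMem {p : ℝ × ℝ} (hp : p ∉ openSquare) : stepMap p = p := by
  rw [stepMap, triTurn_of_notMem fun h => hp h.1, sqTurn_of_notMem fun h => hp (sqZone_subset h)]

lemma stepInv_of_notMem {p : ℝ × ℝ} (hp : p ∉ openSquare) : stepInv p = p := by
  conv_lhs => rw [← stepMap_of_notMem hp, stepInv_stepMap]

/-- The map in two variables given by a map of the plane. -/
noncomputable def pairMap (f : ℝ × ℝ → ℝ × ℝ) (x : Fin 2 → ℝ) : Fin 2 → ℝ :=
  ![(f (x 0, x 1)).1, (f (x 0, x 1)).2]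

lemma mem_unitCube_two {x : Fin 2 → ℝ} :
    x ∈ unitCube 2 ↔ (0 ≤ x 0 ∧ x 0 ≤ 1) ∧ 0 ≤ x 1 ∧ x 1 ≤ 1 := by
  rw [unitCube, Set.mem_univ_pi, Fin.forall_fin_two]
  rfl

lemma pairMap_mem_unitCube {f : ℝ × ℝ → ℝ × ℝ} (hf : IsSquareMap f)
    (h : ∀ p, p ∉ openSquare → f p = p) {x : Fin 2 → ℝ} :
    pairMap f x ∈ unitCube 2 ↔ x ∈ unitCube 2 := by
  by_cases hx : (x 0, x 1) ∈ openSquare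
  · have hfx : f (x 0, x 1) ∈ openSquare := by rwa [← Set.mem_preimage, hf.preimage]
    obtain ⟨⟨h1, h2⟩, h3, h4⟩ := hx
    obtain ⟨⟨k1, k2⟩, k3, k4⟩ := hfx
    rw [mem_unitCube_two, mem_unitCube_two]
    exact iff_of_true ⟨⟨k1.le, k2.le⟩, k3.le, k4.le⟩ ⟨⟨h1.le, h2.le⟩, h3.le, h4.le⟩
  · rw [mem_unitCube_two, mem_unitCube_two, pairMap, h _ hx]
    rfl

lemma isMcNaughtonMap_pairMap {f : ℝ × ℝ → ℝ × ℝ} (hf : IsSquareMap f)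
    (h : ∀ p, p ∉ openSquare → f p = p) : IsMcNaughtonMap (pairMap f) := by
  obtain ⟨hc, s, hs, -, hA⟩ := hf.isPL
  have hc' : Continuous (pairMap f) := by
    refine continuous_pi fun i => ?_
    fin_cases i
    · exact (hc.comp (by fun_prop : Continuous fun x : Fin 2 → ℝ => (x 0, x 1))).fst
    · exact (hc.comp (by fun_prop : Continuous fun x : Fin 2 → ℝ => (x 0, x 1))).snd
  obtain ⟨n, e, he⟩ := hs.fin_param
  intro i
  refine ⟨((continuous_apply i).comp hc').continuousOn, fun x hx => ?_, n,
    fun j => ![![(e j).a, (e j).b], ![(e j).c, (e j).d]] i, fun j => ![(e j).e, (e j).f] i,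
    fun x _ => ?_⟩
  · exact (pairMap_mem_unitCube hf h).2 hx i (Set.mem_univ i)
  · obtain ⟨A, hAs, hx⟩ := hA (x 0, x 1)
    rw [← he.2] at hAs
    obtain ⟨j, rfl⟩ := hAs
    refine ⟨j, ?_⟩
    simp only [pairMap, hx, Fin.sum_univ_two, IntAffine.act]
    fin_cases i <;> simp

lemma notMem_openSquare_of_mem_frontier {x : Fin 2 → ℝ} (hx : x ∈ frontier (unitCube 2)) :
    (x 0, x 1) ∉ openSquare := by
  rintro ⟨h1, h2⟩
  refine hx.2 ?_
  rw [unitCube, interior_pi_set Set.finite_univ, Set.mem_univ_pi]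
  intro i
  rw [interior_Icc]
  fin_cases i
  · exact h1
  · exact h2

lemma measurePreserving_pairMap {f : ℝ × ℝ → ℝ × ℝ} (hf : IsSquareMap f) :
    MeasurePreserving (pairMap f) volume volume := by
  have e := volume_preserving_finTwoArrow ℝ
  exact (e.symm _).comp (hf.measurePreserving.comp e)

lemma volume_pair_frontier : volume {x : Fin 2 → ℝ | x ∈ unitCube 2 ∧ (x 0, x 1) ∉ openSquare} = 0 := by
  have e := volume_preserving_finTwoArrow ℝ
  have h1 : ∀ c : ℝ, volume {p : ℝ × ℝ | (1 : ℝ) * p.1 + 0 * p.2 = c} = 0 := fun c =>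
    volume_line_eq_zero (Or.inl one_ne_zero)
  have h2 : ∀ c : ℝ, volume {p : ℝ × ℝ | (0 : ℝ) * p.1 + 1 * p.2 = c} = 0 := fun c =>
    volume_line_eq_zero (Or.inr one_ne_zero)
  refine measure_mono_null ?_ (e.quasiMeasurePreserving.preimage_null
    (measure_union_null (measure_union_null (h1 0) (h1 1)) (measure_union_null (h2 0) (h2 1))))
  rintro x ⟨hx, h⟩
  obtain ⟨⟨k1, k2⟩, k3, k4⟩ := mem_unitCube_two.1 hx
  simp only [Set.mem_preimage, Set.mem_union, Set.mem_ofPred_eq, one_mul, zero_mul, add_zero,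
    zero_add]
  change ((x 0 = 0 ∨ x 0 = 1) ∨ x 1 = 0 ∨ x 1 = 1)
  by_contra! hne
  exact h ⟨⟨k1.lt_of_ne hne.1.1.symm, k2.lt_of_ne hne.1.2⟩,
    k3.lt_of_ne hne.2.1.symm, k4.lt_of_ne hne.2.2⟩

lemma pairMap_trivial {E : Set (Fin 2 → ℝ)} (hE : MeasurableSet E) (hsub : E ⊆ unitCube 2)
    (hinv : pairMap stepMap ⁻¹' E ∩ unitCube 2 = E) :
    volume E = 0 ∨ volume (unitCube 2 \ E) = 0 := by
  have e := volume_preserving_finTwoArrow ℝ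
  set φ := (MeasurableEquiv.finTwoArrow (α := ℝ)).symm with hφ
  have hφe : ∀ x : Fin 2 → ℝ, φ (x 0, x 1) = x := fun x =>
    (MeasurableEquiv.finTwoArrow (α := ℝ)).symm_apply_apply x
  have hS : ∀ p, φ (stepMap p) = pairMap stepMap (φ p) := fun p => rfl
  have hpre : pairMap stepMap ⁻¹' E = E := by
    conv_rhs => rw [← hinv]
    refine (Set.inter_eq_left.2 fun x hx => ?_).symm
    exact (pairMap_mem_unitCube isSquareMap_stepMap fun _ => stepMap_of_notMem).1 (hsub hx)
  have hinv' : stepMap ⁻¹' (φ ⁻¹' E) = φ ⁻¹' E := by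
    ext p
    rw [Set.mem_preimage, Set.mem_preimage, hS, ← Set.mem_preimage, hpre, Set.mem_preimage]
  refine (openSquare_trivial (φ.measurable hE) hinv').imp (fun h => ?_) fun h => ?_
  all_goals
    refine measure_mono_null (fun x hx => ?_) (measure_union_null volume_pair_frontier
      (e.quasiMeasurePreserving.preimage_null h))
    by_cases hxs : (x 0, x 1) ∈ openSquare
  · exact Or.inr ⟨hxs, by rw [Set.mem_preimage]; exact (hφe x).symm ▸ hx⟩
  · exact Or.inl ⟨hsub hx, hxs⟩
  · exact Or.inr ⟨hxs, fun h' => hx.2 (by rw [← hφe x]; exact h')⟩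
  · exact Or.inl ⟨hx.1, hxs⟩

/-- There is a McNaughton homeomorphism of the unit square which fixes the
boundary pointwise, preserves Lebesgue measure, and is ergodic with respect to
Lebesgue measure. -/
theorem exists_ergodic_mcnaughton_homeo_square :
    ∃ S : (Fin 2 → ℝ) → (Fin 2 → ℝ), IsMcNaughtonHomeo S ∧
      (∀ x ∈ frontier (unitCube 2), S x = x) ∧
      (∀ E : Set (Fin 2 → ℝ), MeasurableSet E → E ⊆ unitCube 2 →
        volume (S ⁻¹' E ∩ unitCube 2) = volume E) ∧
      (∀ E : Set (Fin 2 → ℝ), MeasurableSet E → E ⊆ unitCube 2 →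
        S ⁻¹' E ∩ unitCube 2 = E →
        volume E = 0 ∨ volume (unitCube 2 \ E) = 0) := by
  have hS : ∀ p, p ∉ openSquare → stepMap p = p := fun _ => stepMap_of_notMem
  refine ⟨pairMap stepMap, ⟨isMcNaughtonMap_pairMap isSquareMap_stepMap hS, pairMap stepInv,
    isMcNaughtonMap_pairMap isSquareMap_stepInv fun _ => stepInv_of_notMem, fun x _ => ?_,
    fun x _ => ?_⟩, fun x hx => ?_, fun E hE hsub => ?_, fun E hE hsub => pairMap_trivial hE hsub⟩
  · have : (pairMap stepMap x 0, pairMap stepMap x 1) = stepMap (x 0, x 1) := rfl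
    rw [pairMap, this, stepInv_stepMap]
    ext i; fin_cases i <;> rfl
  · have : (pairMap stepInv x 0, pairMap stepInv x 1) = stepInv (x 0, x 1) := rfl
    rw [pairMap, this, stepMap_stepInv]
    ext i; fin_cases i <;> rfl
  · rw [pairMap, stepMap_of_notMem (notMem_openSquare_of_mem_frontier hx)]
    ext i; fin_cases i <;> rfl
  · have : pairMap stepMap ⁻¹' E ⊆ unitCube 2 := fun x hx =>
      (pairMap_mem_unitCube isSquareMap_stepMap hS).1 (hsub hx)
    rw [Set.inter_eq_left.2 this]
    exact (measurePreserving_pairMap isSquareMap_stepMap).measure_preimage hE.nullMeasurableSet
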